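/- (Walker's conjecture on cobasin boundaries.) Let f : S² → S² be an orientation-preserving homeomorphism, and let K ⊆ S² be a continuum such that S²∖K has exactly two connected components U₁ and U₂, both f-invariant, with ∂U₁ = ∂U₂ = K (K irreducibly separates into these two domains). Suppose the prime ends dynamics on one side is conjugate to an irrational rotation by α: there exist an extension F₁ of f|_{U₁} to c_E(U₁,S²), a homeomorphism φ : b_E(U₁,S²) → ℝ/ℤ, and an irrational α ∈ ℝ/ℤ with φ(F₁(p)) = φ(p) + α for all p ∈ b_E(U₁,S²). Then the prime ends rotation number from the other side also equals α: for every extension F₂ of f|_{U₂} to c_E(U₂,S²) there exist a homeomorphism ψ : b_E(U₂,S²) → ℝ/ℤ and a lift G of ψ ∘ F₂|_{b_E(U₂,S²)} ∘ ψ⁻¹ whose translation number is congruent to α modulo ℤ. -/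

import Mathlib

open Set Topology Filter

noncomputable section

universe u

variable {X : Type u} [TopologicalSpace X]

/-- A homeomorphism is *orientation preserving* if it is isotopic to the identity. -/
def IsOrientationPreserving (f : X ≃ₜ X) : Prop :=
  ∃ H : unitInterval × X → X,
    Continuous H ∧ (∀ x, H (0, x) = x) ∧ (∀ x, H (1, x) = f x) ∧
      ∀ t : unitInterval, IsHomeomorph fun x => H (t, x)

/-- `D` is a connected component of `A`. -/
def IsCompOf (A D : Set X) : Prop := ∃ x ∈ A, D = connectedComponentIn A x

/-- `A` has exactly two connected components, the distinct sets `D₁` and `D₂`. -/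
def HasTwoComps (A D₁ D₂ : Set X) : Prop :=
  IsCompOf A D₁ ∧ IsCompOf A D₂ ∧ D₁ ≠ D₂ ∧
    ∀ x ∈ A, connectedComponentIn A x = D₁ ∨ connectedComponentIn A x = D₂

/-- A *cross-cut* of the open set `U`: the image of an arc `g` on `(0,1)`, where `g` is
continuous and injective on `[0,1]`'s interior, runs inside `U`, has endpoints on `∂U`, and
separates `U` into exactly two components, each with a boundary point on `∂U` away from the
closed arc. -/
def IsCrossCut (U γ : Set X) : Prop :=
  ∃ g : ℝ → X,
    ContinuousOn g (Icc 0 1) ∧ InjOn g (Ioo 0 1) ∧ (∀ t ∈ Ioo (0:ℝ) 1, g t ∈ U) ∧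
      g 0 ∈ frontier U ∧ g 1 ∈ frontier U ∧ γ = g '' Ioo 0 1 ∧
      ∃ D₁ D₂ : Set X, HasTwoComps (U \ γ) D₁ D₂ ∧
        (frontier D₁ ∩ (frontier U \ g '' Icc 0 1)).Nonempty ∧
        (frontier D₂ ∩ (frontier U \ g '' Icc 0 1)).Nonempty

/-- A *cross-section* of `U`: a connected component of `U ∖ γ` for a cross-cut `γ`. -/
def IsCrossSection (U D : Set X) : Prop := ∃ γ : Set X, IsCrossCut U γ ∧ IsCompOf (U \ γ) D

/-- The image of a set under the `k`-th integer iterate of a homeomorphism. -/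
def iterZ (f : X ≃ₜ X) (k : ℤ) (A : Set X) : Set X := ⇑(f.toEquiv ^ k) '' A

/-- A cross-section of `U` which is wandering for `f^n`. -/
def IsWanderingSection (f : X ≃ₜ X) (U : Set X) (n : ℕ) (D : Set X) : Prop :=
  IsCrossSection U D ∧ ∀ k : ℤ, k ≠ 0 → iterZ f ((n : ℤ) * k) D ∩ D = ∅

/-- `f` is ∂-nonwandering in `U`. -/
def BdNonwandering (f : X ≃ₜ X) (U : Set X) : Prop :=
  ∀ n : ℕ, 1 ≤ n → ∃ K : Set X, IsCompact K ∧ K ⊆ U ∧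
    ∀ D : Set X, IsWanderingSection f U n D →
      (∃ k : ℤ, 0 < k ∧ (iterZ f ((n : ℤ) * k) D ∩ K).Nonempty) ∧
      (∃ k : ℤ, k < 0 ∧ (iterZ f ((n : ℤ) * k) D ∩ K).Nonempty)

/-- The boundary of `D` inside `U` (for `D` open in `U`). -/
def bdIn (U D : Set X) : Set X := (closure D \ D) ∩ U

/-- A chain of cross-sections of `U`. -/
def IsPEChain (U : Set X) (D : ℕ → Set X) : Prop :=
  (∀ i, IsCrossSection U (D i)) ∧ (∀ i j : ℕ, j ≤ i → D i ⊆ D j) ∧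
    ∀ i j : ℕ, i ≠ j → closure (bdIn U (D i)) ∩ closure (bdIn U (D j)) = ∅

/-- The chain `D` divides the cross-section `E`. -/
def ChainDividesSection (D : ℕ → Set X) (E : Set X) : Prop := ∃ N : ℕ, ∀ i, N ≤ i → D i ⊆ E

/-- The chain `D` divides the chain `D'`. -/
def ChainDivides (D D' : ℕ → Set X) : Prop := ∀ n : ℕ, ∃ m : ℕ, D m ⊆ D' n

/-- A prime chain: a chain dividing every chain that divides it. -/
def IsPrimeChain (U : Set X) (D : ℕ → Set X) : Prop :=
  IsPEChain U D ∧ ∀ D' : ℕ → Set X, IsPEChain U D' → ChainDivides D' D → ChainDivides D D'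

/-- The type of prime chains of `U`. -/
def PrimeChain (U : Set X) : Type u := {D : ℕ → Set X // IsPrimeChain U D}

/-- A prime end of `U`: an equivalence class of prime chains. -/
def PrimeEnd (U : Set X) : Type u :=
  Quot fun C C' : PrimeChain U => ChainDivides C.1 C'.1 ∧ ChainDivides C'.1 C.1

/-- The prime end `p` divides the cross-section `E`. -/
def PrimeEndDivides {U : Set X} (p : PrimeEnd U) (E : Set X) : Prop :=
  ∃ C : PrimeChain U, Quot.mk _ C = p ∧ ChainDividesSection C.1 E

/-- The prime ends compactification of `U` (as a set: `U ⊔ (prime ends)`). -/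
def PrimeEndComp (U : Set X) : Type u := ↥U ⊕ PrimeEnd U

/-- A point of `U`, as an element of the prime ends compactification. -/
def pePt (U : Set X) (x : ↥U) : PrimeEndComp U := Sum.inl x

/-- A prime end, as an element of the prime ends compactification. -/
def peEnd (U : Set X) (p : PrimeEnd U) : PrimeEndComp U := Sum.inr p

/-- The copy of a subset `V ⊆ U` inside the prime ends compactification. -/
def peOpen (U V : Set X) : Set (PrimeEndComp U) := {z | ∃ x : ↥U, z = pePt U x ∧ (x : X) ∈ V}

/-- The basic set `E ∪ i_E(E)` of the prime ends compactification, for a cross-section `E`. -/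
def peSection (U E : Set X) : Set (PrimeEndComp U) :=
  peOpen U E ∪ {z | ∃ p : PrimeEnd U, z = peEnd U p ∧ PrimeEndDivides p E}

/-- The topology of the prime ends compactification. -/
instance primeEndCompTopology (U : Set X) : TopologicalSpace (PrimeEndComp U) :=
  TopologicalSpace.generateFrom
    ({s | ∃ V : Set X, IsOpen V ∧ V ⊆ U ∧ s = peOpen U V} ∪
      {s | ∃ E : Set X, IsCrossSection U E ∧ s = peSection U E})

/-- The circle of prime ends, as a subset of the prime ends compactification. -/
def PrimeEndCircle (U : Set X) : Set (PrimeEndComp U) := Set.range (peEnd U)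

/-- `F` is an extension of `f|_U` to the prime ends compactification of `U`. -/
def IsPEExtension (f : X ≃ₜ X) (U : Set X) (F : PrimeEndComp U ≃ₜ PrimeEndComp U) : Prop :=
  ∀ (x : X) (hx : x ∈ U) (hfx : f x ∈ U), F (pePt U ⟨x, hx⟩) = pePt U ⟨f x, hfx⟩

/-- An end-cut of `U`: an injective arc in `U` defined on `[0,1)` converging in the ambient
space as `t → 1⁻`. -/
def IsEndCut (U : Set X) (γ : ℝ → X) : Prop :=
  ContinuousOn γ (Ico 0 1) ∧ InjOn γ (Ico 0 1) ∧ (∀ t ∈ Ico (0:ℝ) 1, γ t ∈ U) ∧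
    ∃ z : X, Tendsto γ (𝓝[<] (1:ℝ)) (𝓝 z)

/-- `z` is an accessible point of `∂U`. -/
def IsAccessiblePoint (U : Set X) (z : X) : Prop :=
  ∃ γ : ℝ → X, IsEndCut U γ ∧ Tendsto γ (𝓝[<] (1:ℝ)) (𝓝 z)

/-- `p` is an accessible prime end of `U`. -/
def IsAccessiblePrimeEnd (U : Set X) (p : PrimeEnd U) : Prop :=
  ∃ (γ : ℝ → X) (hγ : ∀ t ∈ Ico (0:ℝ) 1, γ t ∈ U), IsEndCut U γ ∧
    Tendsto (fun t : ↥(Ico (0:ℝ) 1) => pePt U ⟨γ ↑t, hγ ↑t t.2⟩)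
      (comap Subtype.val (𝓝[<] (1:ℝ))) (𝓝 (peEnd U p))

/-- A translation arc for `f` based at `x`: a simple arc from `x` to `f x` meeting its image
only as allowed. -/
def IsTranslationArc (f : X ≃ₜ X) (γ : Set X) (x : X) : Prop :=
  f x ≠ x ∧
    ∃ g : ℝ → X, ContinuousOn g (Icc 0 1) ∧ InjOn g (Icc 0 1) ∧
      g 0 = x ∧ g 1 = f x ∧ γ = g '' Icc 0 1 ∧
      ((⇑f '' γ) ∩ γ = {f x} ∨ ((⇑f '' γ) ∩ γ = {x, f x} ∧ f (f x) = x))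

/-- An `N`-translation arc for `f` based at `x` (for `N = 1` this is just a translation arc). -/
def IsNTranslationArc (f : X ≃ₜ X) (N : ℕ) (γ : Set X) (x : X) : Prop :=
  IsTranslationArc f γ x ∧
    (2 ≤ N →
      (∀ k : ℕ, 2 ≤ k → k ≤ N - 1 → (⇑f)^[k] '' γ ∩ γ = ∅) ∧
        ((⇑f)^[N] '' γ ∩ γ = ∅ ∨ ((⇑f)^[N] '' γ ∩ γ = {x} ∧ (⇑f)^[N + 1] x = x)))

/-- An ∞-translation arc: an `N`-translation arc for every `N ≥ 1`. -/
def IsInfTranslationArc (f : X ≃ₜ X) (γ : Set X) (x : X) : Prop :=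
  ∀ N : ℕ, 1 ≤ N → IsNTranslationArc f N γ x

/-- A nonwandering homeomorphism. -/
def IsNonwanderingMap (f : X → X) : Prop :=
  ∀ V : Set X, IsOpen V → V.Nonempty → ∃ n : ℕ, 1 ≤ n ∧ (f^[n] '' V ∩ V).Nonempty

/-- A loop contained in `A` which is not null-homotopic in `V`. -/
def IsEssentialLoopIn (V A : Set X) : Prop :=
  ∃ (z : ↥V) (δ : Path z z), (∀ t : unitInterval, (↑(δ t) : X) ∈ A) ∧
    ¬ δ.Homotopic (Path.refl z)

/-- An annular continuum: a continuum with an open annular neighborhood `V` such that `V ∖ K`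
has exactly two components, each essential in `V`. -/
def IsAnnularContinuum (K : Set X) : Prop :=
  IsCompact K ∧ IsConnected K ∧ K.Nontrivial ∧
    ∃ V : Set X, IsOpen V ∧ K ⊆ V ∧
      Nonempty (↥V ≃ₜ AddCircle (1 : ℝ) × ↥(Ioo (0 : ℝ) 1)) ∧
      ∃ D₁ D₂ : Set X, HasTwoComps (V \ K) D₁ D₂ ∧
        IsEssentialLoopIn V D₁ ∧ IsEssentialLoopIn V D₂

/-- A set contractible in the ambient surface: it has an open neighborhood homeomorphic to the
plane. -/
def ContractibleInSurface (K : Set X) : Prop :=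
  ∃ W : Set X, IsOpen W ∧ K ⊆ W ∧ Nonempty (↥W ≃ₜ (ℝ × ℝ))

/-- `α ∈ ℝ/ℤ` is rational. -/
def IsRationalAC (α : AddCircle (1 : ℝ)) : Prop := ∃ r : ℚ, α = ((r : ℝ) : AddCircle (1 : ℝ))

/-- The constant `q(α,g)`: the smallest positive integer `q` with `‖qα‖ = 0` if `α` is
rational, and `(2g+1)‖qα‖ < ‖α‖` if `α` is irrational. -/
def qConst (α : AddCircle (1 : ℝ)) (g : ℕ) : ℕ :=
  sInf {q : ℕ | 0 < q ∧
    ((IsRationalAC α ∧ ‖q • α‖ = 0) ∨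
      (¬IsRationalAC α ∧ ((2 * g + 1 : ℕ) : ℝ) * ‖q • α‖ < ‖α‖))}


/-- The two-dimensional sphere. -/
abbrev SphereTwo : Type := ↥(Metric.sphere (0 : EuclideanSpace ℝ (Fin 3)) 1)

open Metric Complex MeasureTheory
open scoped ENNReal Real ComplexConjugate

local notation "𝔻" => ball (0 : ℂ) 1
local notation "𝔻bar" => closedBall (0 : ℂ) 1
local notation "𝕊" => sphere (0 : ℂ) 1
local notation "𝕋" => AddCircle (1 : ℝ)

variable {c v w z ζ η : ℂ} {R a b s t : ℝ} {A A₁ A₂ B F Fb φ ψ : ℂ → ℂ} {E K S V W : Set ℂ}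

lemma IsCompOf.isPreconnected {A D : Set X} (h : IsCompOf A D) :
    IsPreconnected D := by
  obtain ⟨x, -, rfl⟩ := h; exact isPreconnected_connectedComponentIn

lemma IsCompOf.subset {A D : Set X} (h : IsCompOf A D) : D ⊆ A := by
  obtain ⟨x, -, rfl⟩ := h; exact connectedComponentIn_subset _ _

lemma IsCompOf.nonempty {A D : Set X} (h : IsCompOf A D) : D.Nonempty := by
  obtain ⟨x, hx, rfl⟩ := h; exact ⟨x, mem_connectedComponentIn hx⟩

lemma IsCompOf.subset_of_preconnected {A D C : Set X} (h : IsCompOf A D)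
    (hC : IsPreconnected C) (hCA : C ⊆ A) (hne : (C ∩ D).Nonempty) : C ⊆ D := by
  obtain ⟨x, hx, rfl⟩ := h
  have ⟨y, hy, hyD⟩ := hne
  rw [connectedComponentIn_eq hyD]
  exact hC.subset_connectedComponentIn hy hCA

lemma IsCompOf.closure_inter_subset {A D : Set X} (h : IsCompOf A D) :
    closure D ∩ A ⊆ D := by
  rintro x ⟨hx, hxA⟩
  have h1 := h.isPreconnected.subset_closure (subset_insert x D) (insert_subset hx subset_closure)
  have ⟨y, hy⟩ := h.nonempty
  exact h.subset_of_preconnected h1 (insert_subset hxA h.subset) ⟨y, mem_insert_of_mem _ hy, hy⟩ (mem_insert _ _)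

lemma IsCompOf.isOpen [LocallyConnectedSpace X] {A D : Set X}
    (h : IsCompOf A D) (hA : IsOpen A) : IsOpen D := by
  obtain ⟨x, -, rfl⟩ := h; exact hA.connectedComponentIn

lemma hasTwoComps_of_open {D₁ D₂ : Set X} (h₁ : IsOpen D₁) (h₂ : IsOpen D₂)
    (hd : Disjoint D₁ D₂) (hp₁ : IsPreconnected D₁) (hp₂ : IsPreconnected D₂) (hn₁ : D₁.Nonempty)
    (hn₂ : D₂.Nonempty) : HasTwoComps (D₁ ∪ D₂) D₁ D₂ := by
  have key : ∀ {D₁ D₂ : Set X}, IsOpen D₁ → IsOpen D₂ → Disjoint D₁ D₂ → IsPreconnected D₁ → ∀ x ∈ D₁,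
      connectedComponentIn (D₁ ∪ D₂) x = D₁ := by
    intro D₁ D₂ h₁ h₂ hd hp x hx
    refine Subset.antisymm ?_ (hp.subset_connectedComponentIn hx subset_union_left)
    exact isPreconnected_connectedComponentIn.subset_left_of_subset_union h₁ h₂ hd
      (connectedComponentIn_subset _ _) ⟨x, mem_connectedComponentIn (Or.inl hx), hx⟩
  have k2 : ∀ x ∈ D₂, connectedComponentIn (D₁ ∪ D₂) x = D₂ := by grind
  have ⟨x, hx⟩ := hn₁
  have ⟨y, hy⟩ := hn₂
  refine ⟨⟨x, Or.inl hx, (key h₁ h₂ hd hp₁ x hx).symm⟩, ⟨y, Or.inr hy, (k2 y hy).symm⟩, ?_, ?_⟩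
  · rintro rfl; exact disjoint_left.1 hd hx hx
  · rintro z (hz | hz)
    · exact Or.inl (key h₁ h₂ hd hp₁ z hz)
    · exact Or.inr (k2 z hz)

lemma HasTwoComps.eq_or {A D₁ D₂ D : Set X} (h : HasTwoComps A D₁ D₂)
    (hD : IsCompOf A D) : D = D₁ ∨ D = D₂ := by
  obtain ⟨x, hx, rfl⟩ := hD; exact h.2.2.2 x hx

lemma ChainDivides.trans {X : Type*} {A B C : ℕ → Set X} (h₁ : ChainDivides A B) (h₂ : ChainDivides B C) :
    ChainDivides A C := fun n => by
  have ⟨m, hm⟩ := h₂ n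
  have ⟨k, hk⟩ := h₁ m
  exact ⟨k, hk.trans hm⟩

lemma ChainDivides.rfl' {X : Type*} {A : ℕ → Set X} : ChainDivides A A := fun n => ⟨n, Subset.rfl⟩

lemma PrimeEnd.mk_eq_iff {U : Set X} {C C' : PrimeChain U} :
    (Quot.mk _ C : PrimeEnd U) = Quot.mk _ C' ↔ ChainDivides C.1 C'.1 ∧ ChainDivides C'.1 C.1 := by
  constructor
  · intro h
    have h1 := Quot.eqvGen_exact h
    rwa [Equivalence.eqvGen_iff] at h1
    exact ⟨fun _ => ⟨ChainDivides.rfl', ChainDivides.rfl'⟩, fun h => ⟨h.2, h.1⟩,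
      fun h h' => ⟨h.1.trans h'.1, h'.2.trans h.2⟩⟩
  · exact fun h => Quot.sound h

lemma IsPEChain.nonempty {U : Set X} {D : ℕ → Set X} (h : IsPEChain U D) (n : ℕ) :
    (D n).Nonempty := by
  have ⟨γ, _, hD⟩ := h.1 n; exact hD.nonempty

lemma isOpen_peOpen {U V : Set X} (hV : IsOpen V) (hVU : V ⊆ U) :
    IsOpen (peOpen U V) := TopologicalSpace.isOpen_generateFrom_of_mem (Or.inl ⟨V, hV, hVU, rfl⟩)

lemma isOpen_peSection {U E : Set X} (hE : IsCrossSection U E) :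
    IsOpen (peSection U E) := TopologicalSpace.isOpen_generateFrom_of_mem (Or.inr ⟨E, hE, rfl⟩)

lemma disjoint_peSection {U E E' : Set X} (h : Disjoint E E') :
    Disjoint (peSection U E) (peSection U E') := by
  refine disjoint_left.2 ?_
  rintro _ (⟨x, rfl, hx⟩ | ⟨p, rfl, C, rfl, N, hN⟩) (⟨x', e, hx'⟩ | ⟨p', e, C', hC', N', hN'⟩)
  · obtain rfl := Sum.inl.inj e; exact disjoint_left.1 h hx hx'
  · cases e
  · cases e
  · obtain rfl := Sum.inr.inj e
    have ⟨m, hm⟩ := (PrimeEnd.mk_eq_iff.1 hC').2 N'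
    have ⟨x, hx⟩ := C.2.1.nonempty (max m N)
    exact disjoint_left.1 h (hN _ (le_max_right _ _) hx) (hN' N' le_rfl (hm (C.2.1.2.1 _ _ (le_max_left m N) hx)))

lemma disjoint_peOpen_peSection {U V E : Set X} (h : Disjoint V E) :
    Disjoint (peOpen U V) (peSection U E) := by
  refine disjoint_left.2 ?_
  rintro _ ⟨x, rfl, hx⟩ (⟨x', e, hx'⟩ | ⟨p', e, -⟩)
  · obtain rfl := Sum.inl.inj e; exact disjoint_left.1 h hx hx'
  · cases e

lemma montel_ultrafilter (l : Ultrafilter ℕ) (hW : IsOpen W) {f : ℕ → ℂ → ℂ} {C : ℝ}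
    (hd : ∀ᶠ n in (l : Filter ℕ), DifferentiableOn ℂ (f n) W)
    (hb : ∀ᶠ n in (l : Filter ℕ), ∀ z ∈ W, ‖f n z‖ ≤ C) {g : ℂ → ℂ}
    (hg : ∀ z, g z = limUnder (l : Filter ℕ) (fun n => f n z)) :
    TendstoLocallyUniformlyOn f g l W ∧ DifferentiableOn ℂ g W := by
  have hlim : ∀ z ∈ W, Tendsto (fun n => f n z) l (𝓝 (g z)) := by
    intro z hz
    rw [hg]
    apply tendsto_nhds_limUnder
    have hc : IsCompact (closedBall (0 : ℂ) C) := isCompact_closedBall _ _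
    have := hc.ultrafilter_le_nhds (l.map fun n => f n z) (by
      rw [Filter.le_principal_iff]
      change _ ∈ (l : Filter ℕ).map _
      rw [Filter.mem_map]
      filter_upwards [hb] with n hn
      simpa using hn z hz)
    have ⟨x, _, hx⟩ := this
    exact ⟨x, hx⟩
  have hC : ∀ z ∈ W, ‖g z‖ ≤ C := fun z hz => by
    refine le_of_tendsto (hlim z hz).norm ?_
    filter_upwards [hb] with n hn using hn z hz
  have hloc : TendstoLocallyUniformlyOn f g l W := by
    rw [Metric.tendstoLocallyUniformlyOn_iff]
    intro ε hε z hz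
    have ⟨R, hR, hRW⟩ := Metric.isOpen_iff.1 hW z hz
    have hC0 := (norm_nonneg _).trans (hC z hz)
    set K := (2 * C + 1) / R with hK
    have key : ∀ᶠ n in (l : Filter ℕ), ∀ w ∈ ball z R, dist (f n w) (f n z) ≤ K * dist w z := by
      filter_upwards [hd, hb] with n hn hbn w hw
      refine dist_le_div_mul_dist_of_mapsTo_ball (hn.mono hRW) ?_ hw
      intro u hu
      rw [mem_closedBall, dist_eq_norm]
      have := norm_sub_le (f n u) (f n z)
      have := hbn u (hRW hu)
      have := hbn z hz
      linarith
    have keyg : ∀ w ∈ ball z R, dist (g w) (g z) ≤ K * dist w z := by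
      intro w hw
      refine le_of_tendsto ((hlim w (hRW hw)).dist (hlim z hz)) ?_
      filter_upwards [key] with n hn using hn w hw
    refine ⟨ball z (min R (ε / 3 / K)), mem_nhdsWithin_of_mem_nhds (ball_mem_nhds _ (by positivity)), ?_⟩
    filter_upwards [key, (Metric.tendsto_nhds.1 (hlim z hz)) (ε / 3) (by positivity)] with n hn hn2 w hw
    have hw1 := ball_subset_ball (min_le_left _ _) hw
    have hw2 : K * dist w z < ε / 3 := by
      have : dist w z < ε / 3 / K := lt_of_lt_of_le hw (min_le_right _ _)
      rwa [lt_div_iff₀' (by positivity)] at this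
    have h1 := hn w hw1
    have h2 := keyg w hw1
    have h3 := dist_triangle (g w) (g z) (f n w)
    have h4 := dist_triangle (g z) (f n z) (f n w)
    rw [dist_comm (f n w)] at h1
    rw [dist_comm (f n z)] at hn2
    linarith
  exact ⟨hloc, hloc.differentiableOn hd hW⟩

/-- Differentiable branches of a square root of `z - c`, for `c` in a closed connected set touching
the circle. -/
lemma exists_sqrt_away (hE : IsPreconnected E) (hEs : (E ∩ 𝕊).Nonempty)
    {ε : ℝ} (hε : 0 < ε) (hW : W ⊆ 𝔻) (hWE : ∀ z ∈ W, ∀ e ∈ E, ε ≤ dist z e) (hc : c ∈ E) :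
    ∃ s : ℂ → ℂ, DifferentiableOn ℂ s W ∧ ∀ z ∈ W, s z ^ 2 = z - c := by
  have ⟨a, haE, has⟩ := hEs
  have hne : ∀ z ∈ W, ∀ e ∈ E, z - e ≠ 0 := fun z hz e he h => by
    have := hWE z hz e he
    rw [dist_eq_norm, h, norm_zero] at this
    linarith
  have hsq : ∀ w : ℂ, (w ^ (1 / 2 : ℂ)) ^ 2 = w := fun w => by rw [← Complex.cpow_nat_mul]; norm_num
  have hP := hE.induction₂' (fun x y => ∃ s : ℂ → ℂ, DifferentiableOn ℂ s W ∧
      ∀ z ∈ W, s z ^ 2 = (z - x) / (z - y)) (fun x hx => ?_) ?_ hc haE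
  · have ⟨s, hs, hs2⟩ := hP
    refine ⟨fun z => s z * ((-a) ^ (1 / 2 : ℂ) * (1 - z / a) ^ (1 / 2 : ℂ)), ?_, fun z hz => ?_⟩
    · refine hs.mul (DifferentiableOn.const_mul ?_ _)
      refine DifferentiableOn.cpow_const (by fun_prop) fun z hz => ?_
      rw [mem_slitPlane_iff]; left
      have hz1 : ‖z / a‖ < 1 := by
        rw [norm_div, mem_sphere_zero_iff_norm.1 has, div_one]
        simpa using hW hz
      have := (abs_re_le_norm (z / a)).trans_lt hz1
      rw [abs_lt] at this
      simp only [sub_re, one_re]; linarith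
    · have ha0 : a ≠ 0 := by rintro rfl; simp at has
      rw [mul_pow, mul_pow, hs2 z hz, hsq, hsq]
      have := hne z hz a haE
      field_simp
      ring
  · have : ∀ᶠ y in 𝓝[E] x, dist x y < ε := mem_nhdsWithin_of_mem_nhds (by
        filter_upwards [ball_mem_nhds x hε] with y hy using by rwa [dist_comm])
    filter_upwards [this, self_mem_nhdsWithin] with y hy hyE
    have gen : ∀ u ∈ E, ∀ v ∈ E, dist u v < ε → ∃ s : ℂ → ℂ, DifferentiableOn ℂ s W ∧
        ∀ z ∈ W, s z ^ 2 = (z - u) / (z - v) := by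
      intro u hu v hv huv
      refine ⟨fun z => ((z - u) / (z - v)) ^ (1 / 2 : ℂ), ?_, fun z hz => hsq _⟩
      refine DifferentiableOn.cpow_const ?_ fun z hz => ?_
      · exact DifferentiableOn.div (by fun_prop) (by fun_prop) fun z hz => hne z hz v hv
      · have h1 : (z - u) / (z - v) = 1 + (v - u) / (z - v) := by
          have := hne z hz v hv
          field_simp; ring
        rw [h1, mem_slitPlane_iff]; left
        have h2 : ‖(v - u) / (z - v)‖ < 1 := by
          rw [norm_div, div_lt_one (norm_pos_iff.2 (hne z hz v hv)), ← dist_eq_norm, ← dist_eq_norm, dist_comm v u]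
          exact huv.trans_le (hWE z hz v hv)
        have := (abs_re_le_norm ((v - u) / (z - v))).trans_lt h2
        rw [abs_lt] at this
        simp only [add_re, one_re]; linarith
    exact ⟨gen x hx y hyE hy, gen y hyE x hx (by rwa [dist_comm])⟩
  · rintro x y w hx hy hw ⟨s, hs, hs2⟩ ⟨t, ht, ht2⟩
    refine ⟨fun z => s z * t z, hs.mul ht, fun z hz => ?_⟩
    grind

lemma exists_sqrt_sub (hE : IsPreconnected E) (hEc : IsClosed E) (hEs : (E ∩ 𝕊).Nonempty) (hVo : IsOpen V) (hV : V ⊆ 𝔻)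
    (hVE : Disjoint V E) (hc : c ∈ E) :
    ∃ s : ℂ → ℂ, DifferentiableOn ℂ s V ∧ ∀ z ∈ V, s z ^ 2 = z - c := by
  have hW := fun m : ℕ => exists_sqrt_away (W := {z | z ∈ 𝔻 ∧ ∀ e ∈ E, 1 / ((m : ℝ) + 1) ≤ dist z e})
    hE hEs (ε := 1 / ((m : ℝ) + 1)) (by positivity) (fun z hz => hz.1) (fun z hz => hz.2) hc
  choose t ht ht2 using hW
  let l : Ultrafilter ℕ := Filter.hyperfilter ℕ
  let s : ℂ → ℂ := fun z => limUnder (l : Filter ℕ) fun n => t n z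
  have key : ∀ z₀ ∈ V, ∃ σ : ℂ → ℂ, DifferentiableAt ℂ σ z₀ ∧ ∃ N ∈ 𝓝 z₀, ∀ z ∈ N, s z = σ z ∧ σ z ^ 2 = z - c := by
    intro z₀ hz₀
    have ⟨R, hR, hRV⟩ := Metric.isOpen_iff.1 hVo z₀ hz₀
    have hev : ∀ᶠ m : ℕ in atTop, 1 / ((m : ℝ) + 1) ≤ R / 2 :=
      (tendsto_one_div_add_atTop_nhds_zero_nat).eventually (ge_mem_nhds (by positivity))
    have hsub : ∀ m : ℕ, 1 / ((m : ℝ) + 1) ≤ R / 2 →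
        ball z₀ (R / 2) ⊆ {z | z ∈ 𝔻 ∧ ∀ e ∈ E, 1 / ((m : ℝ) + 1) ≤ dist z e} := by
      intro m hm z hz
      refine ⟨hV (hRV (ball_subset_ball (by linarith) hz)), fun e he => hm.trans ?_⟩
      by_contra hlt
      push Not at hlt
      refine hVE.le_bot ⟨hRV ?_, he⟩
      rw [mem_ball] at hz ⊢
      have := dist_triangle e z z₀
      rw [dist_comm e z] at this
      linarith
    have ⟨m₀, hm₀⟩ := hev.exists
    set σ := t m₀ with hσ
    have hσ2 : ∀ z ∈ ball z₀ (R / 2), σ z ^ 2 = z - c := fun z hz => ht2 m₀ z (hsub m₀ hm₀ hz)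
    have hσd := (ht m₀).mono (hsub m₀ hm₀)
    have hσ0 : ∀ z ∈ ball z₀ (R / 2), σ z ≠ 0 := fun z hz h => by
      have := hσ2 z hz
      rw [h] at this
      exact hVE.le_bot ⟨hRV (ball_subset_ball (by linarith) hz), (by grind : z = c) ▸ hc⟩
    have hpm : ∀ m : ℕ, 1 / ((m : ℝ) + 1) ≤ R / 2 →
        EqOn (t m) σ (ball z₀ (R / 2)) ∨ EqOn (t m) (-σ) (ball z₀ (R / 2)) := by
      intro m hm
      refine IsPreconnected.eq_or_eq_neg_of_sq_eq (convex_ball _ _).isPreconnected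
        (((ht m).mono (hsub m hm)).continuousOn) hσd.continuousOn (fun z hz => ?_) (fun {z} hz => hσ0 z hz)
      simp only [Pi.pow_apply]
      rw [hσ2 z hz, ht2 m z (hsub m hm hz)]
    have hcase : (∀ᶠ m in (l : Filter ℕ), EqOn (t m) σ (ball z₀ (R / 2))) ∨
        (∀ᶠ m in (l : Filter ℕ), EqOn (t m) (-σ) (ball z₀ (R / 2))) := by
      rw [← Ultrafilter.eventually_or]
      filter_upwards [Nat.hyperfilter_le_atTop hev] with m hm using hpm m hm
    have hball : ball z₀ (R / 2) ∈ 𝓝 z₀ := ball_mem_nhds _ (by positivity)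
    have hda := (hσd z₀ (mem_ball_self (by positivity))).differentiableAt hball
    rcases hcase with h | h
    · refine ⟨σ, hda, _, hball, fun z hz => ⟨?_, hσ2 z hz⟩⟩
      refine Tendsto.limUnder_eq (tendsto_const_nhds.congr' ?_)
      filter_upwards [h] with m hm using (hm hz).symm
    · refine ⟨-σ, hda.neg, _, hball, fun z hz => ⟨?_, by simpa using hσ2 z hz⟩⟩
      refine Tendsto.limUnder_eq (tendsto_const_nhds.congr' ?_)
      filter_upwards [h] with m hm using (hm hz).symm
  refine ⟨s, fun z hz => ?_, fun z hz => ?_⟩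
  · have ⟨σ, hσ, N, hN, h⟩ := key z hz
    refine (hσ.congr_of_eventuallyEq ?_).differentiableWithinAt
    filter_upwards [hN] with w hw using (h w hw).1
  · have ⟨σ, hσ, N, hN, h⟩ := key z hz
    have ⟨h1, h2⟩ := h z (mem_of_mem_nhds hN)
    rw [h1, h2]

/-- The Möbius automorphism of the unit disc sending `c` to `0`. -/
def moeb (c z : ℂ) : ℂ := (z - c) / (1 - conj c * z)

lemma moeb_den (hc : ‖c‖ < 1) (hz : ‖z‖ ≤ 1) : 1 - conj c * z ≠ 0 := by
  intro h
  have h1 : ‖conj c * z‖ = 1 := by rw [← sub_eq_zero.1 h, norm_one]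
  rw [norm_mul, norm_conj] at h1
  nlinarith [norm_nonneg c, norm_nonneg z]

lemma moeb_normSq (hc : ‖c‖ < 1) (hz : ‖z‖ ≤ 1) :
    1 - ‖moeb c z‖ ^ 2 = (1 - ‖c‖ ^ 2) * (1 - ‖z‖ ^ 2) / ‖1 - conj c * z‖ ^ 2 := by
  have h := norm_pos_iff.2 (moeb_den hc hz)
  rw [moeb, norm_div, div_pow, eq_div_iff (by positivity), sub_mul, div_mul_cancel₀ _ (by positivity)]
  simp only [← Complex.normSq_eq_norm_sq, Complex.normSq_apply, sub_re, sub_im, one_re, one_im, mul_re,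
    mul_im, conj_re, conj_im]
  ring

lemma moeb_norm_le (hc : ‖c‖ < 1) (hz : ‖z‖ ≤ 1) : ‖moeb c z‖ ≤ 1 := by
  have h := moeb_normSq hc hz
  have : 0 ≤ (1 - ‖c‖ ^ 2) * (1 - ‖z‖ ^ 2) / ‖1 - conj c * z‖ ^ 2 := by
    have := norm_nonneg c
    have := norm_nonneg z
    have : 0 ≤ 1 - ‖c‖ ^ 2 := by nlinarith
    have : 0 ≤ 1 - ‖z‖ ^ 2 := by nlinarith
    positivity
  nlinarith [norm_nonneg (moeb c z)]

lemma moeb_norm_lt (hc : ‖c‖ < 1) (hz : ‖z‖ < 1) : ‖moeb c z‖ < 1 := by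
  have h := moeb_normSq hc hz.le
  have hd := norm_pos_iff.2 (moeb_den hc hz.le)
  have : 0 < (1 - ‖c‖ ^ 2) * (1 - ‖z‖ ^ 2) / ‖1 - conj c * z‖ ^ 2 := by
    have := norm_nonneg c
    have := norm_nonneg z
    have : 0 < 1 - ‖c‖ ^ 2 := by nlinarith
    have : 0 < 1 - ‖z‖ ^ 2 := by nlinarith
    positivity
  nlinarith [norm_nonneg (moeb c z)]

lemma moeb_neg_moeb (hc : ‖c‖ < 1) (hz : ‖z‖ ≤ 1) : moeb (-c) (moeb c z) = z := by
  have h := moeb_den hc hz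
  rw [moeb, div_eq_iff (moeb_den (by simpa) (moeb_norm_le hc hz)), moeb, map_neg]
  set d := 1 - conj c * z with hd
  have e : conj c * z = 1 - d := by rw [hd]; ring
  field_simp
  linear_combination (-z - c + (z - c)) * e - (z - c) * e + hd * (0:ℂ)

lemma hasDerivAt_moeb (hc : ‖c‖ < 1) (hz : ‖z‖ ≤ 1) :
    HasDerivAt (moeb c) ((1 - ‖c‖ ^ 2 : ℝ) / (1 - conj c * z) ^ 2) z := by
  refine (((hasDerivAt_id z).sub_const c).fun_div (((hasDerivAt_id z).const_mul (conj c)).const_sub 1) (moeb_den hc hz)).congr_deriv ?_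
  congr 1
  push_cast
  rw [(mul_conj' c).symm]
  simp; ring

lemma moeb_deriv_ne (hc : ‖c‖ < 1) (hz : ‖z‖ ≤ 1) : deriv (moeb c) z ≠ 0 := by
  rw [(hasDerivAt_moeb hc hz).deriv]
  refine div_ne_zero ?_ (pow_ne_zero _ (moeb_den hc hz))
  have := norm_nonneg c
  exact_mod_cast (by nlinarith : 0 < 1 - ‖c‖ ^ 2).ne'

lemma moeb_continuousOn (hc : ‖c‖ < 1) : ContinuousOn (moeb c) (𝔻bar) :=
  fun z hz => (hasDerivAt_moeb hc (by simpa using hz)).continuousAt.continuousWithinAt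

lemma moeb_injOn (hc : ‖c‖ < 1) : InjOn (moeb c) (𝔻bar) :=
  fun z hz w hw h => by rw [← moeb_neg_moeb hc (z := z) (by simpa using hz), h, moeb_neg_moeb hc (by simpa using hw)]

lemma moeb_image_compl (hc : ‖c‖ < 1) (hS : S ⊆ 𝔻bar) :
    𝔻bar \ (moeb c '' S) = moeb c '' (𝔻bar \ S) := by
  have : moeb c '' 𝔻bar = 𝔻bar := by
    apply Subset.antisymm
    · rintro _ ⟨z, hz, rfl⟩
      simpa using moeb_norm_le hc (by simpa using hz)
    · intro z hz
      refine ⟨moeb (-c) z, ?_, ?_⟩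
      · simpa using moeb_norm_le (c := -c) (by simpa) (by simpa using hz)
      · simpa using moeb_neg_moeb (c := -c) (by simpa) (by simpa using hz)
  rw [(moeb_injOn hc).image_sdiff_subset hS, this]

lemma isOpen_image_of_deriv {f : ℂ → ℂ} (hV : IsOpen V) (hW : IsOpen W) (hWV : W ⊆ V)
    (hf : DifferentiableOn ℂ f V) (hd : ∀ z ∈ V, deriv f z ≠ 0) : IsOpen (f '' W) := by
  rw [isOpen_iff_mem_nhds]
  rintro _ ⟨z, hz, rfl⟩
  rw [← (hf.analyticAt (hV.mem_nhds (hWV hz))).hasStrictDerivAt.map_nhds_eq (hd z (hWV hz))]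
  exact image_mem_map (hW.mem_nhds hz)

lemma hasDerivAt_inverse_on {f g : ℂ → ℂ} (hV : IsOpen V)
    (hf : DifferentiableOn ℂ f V) (hd : ∀ z ∈ V, deriv f z ≠ 0) (hg : ∀ z ∈ V, g (f z) = z) :
    ∀ z ∈ V, HasDerivAt g (deriv f z)⁻¹ (f z) := by
  intro z hz
  refine ((hf.analyticAt (hV.mem_nhds hz)).hasStrictDerivAt.to_local_left_inverse (hd z hz) ?_).hasDerivAt
  filter_upwards [hV.mem_nhds hz] with w hw using hg w hw

/-- Competitors in the extremal problem producing the Riemann map. -/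
structure RMClass (V : Set ℂ) (φ : ℂ → ℂ) : Prop where
  diff : DifferentiableOn ℂ φ V
  inj : InjOn φ V
  maps : MapsTo φ V 𝔻
  zero : φ 0 = 0
  der : ∀ z ∈ V, deriv φ z ≠ 0
  conn : IsPreconnected (𝔻bar \ φ '' V)

lemma RMClass.scale (hR : 0 < R) (hVR : V ⊆ ball 0 R)
    (hVc : IsPreconnected Vᶜ) : RMClass V (fun z => z / R) := by
  have hR' : (R : ℂ) ≠ 0 := by exact_mod_cast hR.ne'
  refine ⟨by fun_prop, fun z _ w _ h => ?_, fun z hz => ?_, by simp, fun z _ => ?_, ?_⟩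
  · simpa [div_left_inj' hR'] using h
  · have := hVR hz
    rw [mem_ball_zero_iff] at this ⊢
    rw [norm_div, norm_real, Real.norm_of_nonneg hR.le, div_lt_one hR]; exact this
  · simp [hR']
  · have : 𝔻bar \ (fun z : ℂ => z / R) '' V =
        (fun z : ℂ => z / (max R ‖z‖ : ℝ)) '' Vᶜ := by
      ext z
      constructor
      · rintro ⟨h1, h2⟩
        refine ⟨R * z, fun h => h2 ⟨_, h, by field_simp⟩, ?_⟩
        have : ‖(R : ℂ) * z‖ ≤ R := by
          rw [norm_mul, norm_real, Real.norm_of_nonneg hR.le]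
          have : ‖z‖ ≤ 1 := by simpa using h1
          nlinarith
        simp only
        rw [max_eq_left this]
        field_simp
      · rintro ⟨w, hw, rfl⟩
        have hm : 0 < max R ‖w‖ := lt_max_of_lt_left hR
        have hn : ‖w / (max R ‖w‖ : ℝ)‖ = ‖w‖ / max R ‖w‖ := by rw [norm_div, norm_real, Real.norm_of_nonneg hm.le]
        refine ⟨?_, ?_⟩
        · rw [mem_closedBall_zero_iff, hn, div_le_one hm]; exact le_max_right _ _
        · rintro ⟨v, hv, hvw⟩
          simp only at hvw
          rcases le_total ‖w‖ R with h | h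
          · rw [max_eq_left h, div_left_inj' hR'] at hvw
            exact hw (hvw ▸ hv)
          · have h1 : ‖v / R‖ = 1 := by grind
            rw [norm_div, norm_real, Real.norm_of_nonneg hR.le, div_eq_one_iff_eq hR.ne'] at h1
            have := hVR hv
            rw [mem_ball_zero_iff] at this
            linarith
    rw [this]
    refine hVc.image _ (Continuous.continuousOn ?_)
    refine Continuous.div continuous_id (by fun_prop) fun z => ?_
    exact_mod_cast (lt_max_of_lt_left hR).ne'

lemma isPreconnected_sq_preimage (hE : IsPreconnected E) (h0 : (0 : ℂ) ∈ E)
    (hEc : IsClosed E) : IsPreconnected {z : ℂ | z ^ 2 ∈ E} := by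
  set A := {z : ℂ | z ^ 2 ∈ E} with hA
  have hAc : IsClosed A := hEc.preimage (by fun_prop)
  have hopen := (Complex.isOpenQuotientMap_pow 2).isOpenMap
  have hclosed : IsClosedMap (fun z : ℂ => z ^ 2) := by
    refine IsProperMap.isClosedMap (isProperMap_iff_tendsto_cocompact.2 ⟨by fun_prop, ?_⟩)
    rw [← Metric.cobounded_eq_cocompact, tendsto_norm_atTop_iff_cobounded.symm]
    simp only [norm_pow]
    exact (tendsto_pow_atTop two_ne_zero).comp tendsto_norm_cobounded_atTop
  have key : ∀ u v : Set ℂ, IsOpen u → IsOpen v → A ⊆ u ∪ v → (0 : ℂ) ∈ u → (A ∩ v).Nonempty →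
      (A ∩ (u ∩ v)).Nonempty := by
    intro u v hu hv huv h0u ⟨q, hqA, hqv⟩
    by_contra hne
    obtain ⟨y, hyE, ⟨p, hpv, rfl⟩, hyW⟩ := hE _ _ (hopen v hv) ((hclosed _ (hAc.sdiff hu)).isOpen_compl) (fun y hy => by
      by_cases h : y ∈ (fun z : ℂ => z ^ 2) '' (A \ u)
      · obtain ⟨p, ⟨hp, hpu⟩, rfl⟩ := h
        exact Or.inl ⟨p, (huv hp).resolve_left hpu, rfl⟩
      · exact Or.inr h) ⟨_, hqA, q, hqv, rfl⟩ ⟨0, h0, by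
        rintro ⟨p, ⟨-, hpu⟩, hp⟩
        simp only at hp
        rw [pow_eq_zero_iff two_ne_zero] at hp
        exact hpu (hp ▸ h0u)⟩
    exact hyW ⟨p, ⟨hyE, fun hpu => hne ⟨p, hyE, hpu, hpv⟩⟩, rfl⟩
  intro u v hu hv huv hAu hAv
  rcases huv (by simpa [hA] using h0 : (0 : ℂ) ∈ A) with h | h
  · exact key u v hu hv huv h hAv
  · rw [inter_comm u v]
    exact key v u hv hu (by rwa [union_comm]) h hAu

lemma isPreconnected_compl_sqrt (hV : IsOpen V) (hVb : V ⊆ 𝔻) (hVp : IsPreconnected V) (hVne : V.Nonempty)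
    (h0 : (0 : ℂ) ∉ V) (hE : IsPreconnected (𝔻bar \ V)) {s : ℂ → ℂ}
    (hs : DifferentiableOn ℂ s V) (hs2 : ∀ z ∈ V, s z ^ 2 = z) (hsd : ∀ z ∈ V, deriv s z ≠ 0) :
    IsPreconnected (𝔻bar \ s '' V) := by
  set A := {z : ℂ | z ^ 2 ∈ 𝔻bar \ V} with hA
  have hAp := isPreconnected_sq_preimage hE ⟨by simp, h0⟩ (isClosed_closedBall.sdiff hV)
  set B := (fun z => - s z) '' V with hB
  have hsV := isOpen_image_of_deriv hV hV Subset.rfl hs hsd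
  have hdisj : Disjoint (s '' V) B := by grind
  have hsq1 : ∀ z : ℂ, z ^ 2 ∈ 𝔻bar ↔ z ∈ 𝔻bar := fun z => by
    simp only [mem_closedBall_zero_iff, norm_pow]
    exact pow_le_one_iff_of_nonneg (norm_nonneg _) two_ne_zero
  have hBb : B ⊆ 𝔻bar := by
    rintro _ ⟨x, hx, rfl⟩
    rw [← hsq1]
    simp only [neg_sq]
    rw [hs2 x hx]
    exact ball_subset_closedBall (hVb hx)
  have hunion : 𝔻bar \ s '' V = A ∪ B := by
    ext z
    constructor
    · rintro ⟨h1, h2⟩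
      by_cases hz : z ^ 2 ∈ V
      · right
        refine ⟨z ^ 2, hz, ?_⟩
        rcases sq_eq_sq_iff_eq_or_eq_neg.1 (hs2 _ hz) with h | h
        · exact absurd ⟨_, hz, h⟩ h2
        · simp [h]
      · left
        exact ⟨(hsq1 z).2 h1, hz⟩
    · rintro (h | h)
      · refine ⟨(hsq1 z).1 h.1, ?_⟩
        rintro ⟨w, hw, rfl⟩
        exact h.2 (by rw [hs2 w hw]; exact hw)
      · exact ⟨hBb h, fun h' => Set.disjoint_left.1 hdisj h' h⟩
  have hBo : IsOpen B := by
    rw [(by grind : B = Neg.neg ⁻¹' (s '' V))]; exact hsV.preimage continuous_neg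
  obtain ⟨x, hx⟩ : (frontier B).Nonempty := by
    rw [nonempty_frontier_iff]
    refine ⟨hVne.image _, fun h => ?_⟩
    have : (2 : ℂ) ∈ 𝔻bar := hBb (h ▸ mem_univ _)
    rw [mem_closedBall_zero_iff] at this
    norm_num at this
  have hxc := frontier_subset_closure hx
  have hxA : x ∈ A := by
    have : x ∈ A ∪ B := by
      rw [← hunion]
      exact ⟨closure_minimal hBb isClosed_closedBall hxc, fun h => (hdisj.closure_right hsV).le_bot ⟨h, hxc⟩⟩
    exact this.resolve_right (fun h => by rw [frontier, hBo.interior_eq] at hx; exact hx.2 h)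
  rw [hunion]
  have := hAp.union x hxA (mem_insert x B) ((hVp.image _ hs.neg.continuousOn).subset_closure (subset_insert _ _) (insert_subset hxc subset_closure))
  rwa [(by grind : A ∪ insert x B = A ∪ B)] at this

lemma RMClass.koebe (hV : IsOpen V) (hVp : IsPreconnected V) (h0 : (0 : ℂ) ∈ V) (hφ : RMClass V φ) (hc : ‖c‖ < 1) (hcV : c ∉ φ '' V) :
    ∃ φ', RMClass V φ' ∧ ‖deriv φ' 0‖ = ‖deriv φ 0‖ * ((1 + ‖c‖) / (2 * √‖c‖)) := by
  have hmem : ∀ z ∈ V, ‖φ z‖ < 1 := fun z hz => by simpa using hφ.maps hz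
  set χ : ℂ → ℂ := fun z => moeb c (φ z) with hχ
  have hχd : ∀ z ∈ V, HasDerivAt χ (deriv (moeb c) (φ z) * deriv φ z) z := fun z hz =>
    ((hasDerivAt_moeb hc (hmem z hz).le).differentiableAt.hasDerivAt).comp z
      ((hφ.diff.differentiableAt (hV.mem_nhds hz)).hasDerivAt)
  have hχdiff : DifferentiableOn ℂ χ V := fun z hz => (hχd z hz).differentiableAt.differentiableWithinAt
  have hχder : ∀ z ∈ V, deriv χ z ≠ 0 := fun z hz => by
    rw [(hχd z hz).deriv]; exact mul_ne_zero (moeb_deriv_ne hc (hmem z hz).le) (hφ.der z hz)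
  have hχinj : InjOn χ V := fun z hz w hw h => hφ.inj hz hw
    (moeb_injOn hc (by simpa using (hmem z hz).le) (by simpa using (hmem w hw).le) h)
  set V1 := χ '' V with hV1
  have hV1o := isOpen_image_of_deriv hV hV Subset.rfl hχdiff hχder
  have hV1b : V1 ⊆ 𝔻 := by
    rintro _ ⟨z, hz, rfl⟩
    simpa using moeb_norm_lt hc (hmem z hz)
  have h0V1 : (0 : ℂ) ∉ V1 := by
    rintro ⟨z, hz, h⟩
    refine hcV ⟨z, hz, ?_⟩
    rw [hχ] at h
    simp only [moeb, div_eq_zero_iff, moeb_den hc (hmem z hz).le, or_false] at h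
    linear_combination h
  have hE1 : IsPreconnected (𝔻bar \ V1) := by
    rw [(by rw [image_image] : V1 = moeb c '' (φ '' V)), moeb_image_compl hc (by
      rintro _ ⟨z, hz, rfl⟩; exact ball_subset_closedBall (hφ.maps hz))]
    exact hφ.conn.image _ ((moeb_continuousOn hc).mono sdiff_subset)
  have ⟨s, hs, hs2⟩ := exists_sqrt_sub hE1 (isClosed_closedBall.sdiff hV1o) (c := 0) (V := V1)
    ⟨1, ⟨by simp, fun h => by simpa using hV1b h⟩, by simp⟩ hV1o hV1b disjoint_sdiff_right ⟨by simp, h0V1⟩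
  simp only [sub_zero] at hs2
  have hs0 : ∀ z ∈ V1, s z ≠ 0 := fun z hz h => h0V1 (by grind)
  have hsd : ∀ z ∈ V1, HasDerivAt s (1 / (2 * s z)) z := fun z hz => by
    have h1 := (hs.differentiableAt (hV1o.mem_nhds hz)).hasDerivAt
    have h4 := (h1.pow 2).unique ((hasDerivAt_id z).congr_of_eventuallyEq (by filter_upwards [hV1o.mem_nhds hz] with w hw using hs2 w hw))
    refine h1.congr_deriv ?_
    symm
    rw [div_eq_iff (mul_ne_zero two_ne_zero (hs0 z hz))]
    simp at h4
    linear_combination -h4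
  have hsd' : ∀ z ∈ V1, deriv s z ≠ 0 := fun z hz => by rw [(hsd z hz).deriv]; simp [hs0 z hz]
  have hconn := isPreconnected_compl_sqrt hV1o hV1b (hVp.image _ hχdiff.continuousOn) ⟨_, mem_image_of_mem _ h0⟩ h0V1 hE1 hs hs2 hsd'
  have hsnorm : ∀ z ∈ V1, ‖s z‖ < 1 := fun z hz => by
    have h1 : ‖s z‖ ^ 2 < 1 := by rw [← norm_pow, hs2 z hz]; simpa using hV1b hz
    nlinarith [norm_nonneg (s z)]
  have hχ0 : χ 0 = -c := by simp [hχ, hφ.zero, moeb]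
  have hm0 : (-c) ∈ V1 := ⟨0, h0, hχ0⟩
  set b := s (-c) with hb
  have hb1 := hsnorm _ hm0
  have hbn : ‖b‖ ^ 2 = ‖c‖ := by rw [← norm_pow, hs2 _ hm0, norm_neg]
  have hd : ∀ z ∈ V, HasDerivAt (fun z => moeb b (s (χ z)))
      (deriv (moeb b) (s (χ z)) * (deriv s (χ z) * deriv χ z)) z := fun z hz => by
    have hz1 : χ z ∈ V1 := mem_image_of_mem _ hz
    exact ((hasDerivAt_moeb hb1 (hsnorm _ hz1).le).differentiableAt.hasDerivAt).comp z
      (((hsd _ hz1).differentiableAt.hasDerivAt).comp z (hχd z hz).differentiableAt.hasDerivAt)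
  refine ⟨fun z => moeb b (s (χ z)), ⟨?_, ?_, ?_, ?_, ?_, ?_⟩, ?_⟩
  · exact fun z hz => (hd z hz).differentiableAt.differentiableWithinAt
  · intro z hz w hw h
    have hz1 : χ z ∈ V1 := mem_image_of_mem _ hz
    have hw1 : χ w ∈ V1 := mem_image_of_mem _ hw
    apply hχinj hz hw
    rw [← hs2 _ hz1, moeb_injOn hb1 (by simpa using (hsnorm _ hz1).le) (by simpa using (hsnorm _ hw1).le) h, hs2 _ hw1]
  · intro z hz
    simpa using moeb_norm_lt hb1 (hsnorm _ (mem_image_of_mem _ hz))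
  · simp [hχ0, moeb, ← hb]
  · intro z hz
    have hz1 : χ z ∈ V1 := mem_image_of_mem _ hz
    rw [(hd z hz).deriv]
    exact mul_ne_zero (moeb_deriv_ne hb1 (hsnorm _ hz1).le) (mul_ne_zero (hsd' _ hz1) (hχder z hz))
  · rw [(by rw [image_image, hV1, image_image] : (fun z => moeb b (s (χ z))) '' V = moeb b '' (s '' V1)), moeb_image_compl hb1]
    · exact hconn.image _ ((moeb_continuousOn hb1).mono sdiff_subset)
    · rintro _ ⟨z, hz, rfl⟩
      simpa using (hsnorm z hz).le
  · rw [(hd 0 h0).deriv, (hχd 0 h0).deriv, hχ0, (hsd _ hm0).deriv, hφ.zero,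
      (hasDerivAt_moeb hc (by simp)).deriv, (hasDerivAt_moeb hb1 (by rw [← hb]; exact hb1.le)).deriv, ← hb,
      (by rw [← hbn, Real.sqrt_sq (norm_pos_iff.2 (hs0 _ hm0)).le] : √‖c‖ = ‖b‖)]
    have p1 : 0 < 1 - ‖b‖ ^ 2 := by nlinarith
    have p2 : 0 < 1 - ‖c‖ ^ 2 := by nlinarith [norm_nonneg c]
    rw [(by rw [mul_comm, mul_conj']; push_cast; ring : (1 - conj b * b) = ((1 - ‖b‖ ^ 2 : ℝ) : ℂ))]
    simp only [mul_zero, sub_zero, one_pow, div_one, norm_mul, norm_div, norm_pow, norm_real, norm_one,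
      Real.norm_of_nonneg p1.le, Real.norm_of_nonneg p2.le, RCLike.norm_ofNat]
    rw [← hbn] at p2 ⊢
    field_simp
    ring

/-- `ψ` maps the unit disc biholomorphically onto `V`, with inverse `φ`, and `ψ 0 = 0`. -/
structure IsRiemannMap (V : Set ℂ) (ψ φ : ℂ → ℂ) : Prop where
  diff : DifferentiableOn ℂ ψ 𝔻
  diff_inv : DifferentiableOn ℂ φ V
  maps : MapsTo ψ 𝔻 V
  maps_inv : MapsTo φ V 𝔻
  left_inv : ∀ z ∈ 𝔻, φ (ψ z) = z
  right_inv : ∀ v ∈ V, ψ (φ v) = v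
  zero : ψ 0 = 0

lemma isOpen_image_of_deriv_ne {f : ℂ → ℂ} (hV : IsOpen V) (hVp : IsPreconnected V)
    (hf : DifferentiableOn ℂ f V) (hz : z ∈ V) (hd : deriv f z ≠ 0) : IsOpen (f '' V) := by
  rcases (hf.analyticOnNhd hV).is_constant_or_isOpen hVp with ⟨w, hw⟩ | h
  · exfalso
    apply hd
    rw [(by filter_upwards [hV.mem_nhds hz] with u hu using hw u hu : f =ᶠ[𝓝 z] fun _ => w).deriv_eq]; simp
  · exact h V Subset.rfl hV

lemma koebe_factor {r ρ : ℝ} (hr : 0 < r) (hrρ : r ≤ ρ) (hρ : ρ < 1) :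
    1 + (1 - √ρ) ^ 2 / 2 ≤ (1 + r) / (2 * √r) := by
  have h1 := Real.sqrt_pos.2 hr
  have h2 := Real.sqrt_le_sqrt hrρ
  have h3 : √ρ < 1 := by rw [Real.sqrt_lt' one_pos]; simpa
  have h4 := (Real.sq_sqrt hr.le).symm
  rw [le_div_iff₀ (by positivity)]
  nlinarith [mul_nonneg (sub_nonneg.2 h2) (by linarith : 0 ≤ 2 - √r - √ρ), mul_pos h1 (by linarith : 0 < 1 - √r),
    mul_nonneg (by linarith : 0 ≤ 1 - √r) (sq_nonneg (1 - √ρ)),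
    mul_nonneg h1.le (mul_nonneg (sub_nonneg.2 h2) (by linarith : 0 ≤ 2 - √r - √ρ))]

theorem exists_riemannMap (hV : IsOpen V) (hVp : IsPreconnected V) (h0 : (0 : ℂ) ∈ V) (hVR : V ⊆ ball 0 R) (hreg : interior (closure V) ⊆ V) (hVc : IsPreconnected Vᶜ) :
    ∃ ψ φ : ℂ → ℂ, IsRiemannMap V ψ φ := by
  have ⟨r₀, hr₀, hr₀V⟩ := Metric.isOpen_iff.1 hV 0 h0
  have hne := RMClass.scale (by simpa using hVR h0) hVR hVc
  set S : Set ℝ := (fun φ : ℂ → ℂ => ‖deriv φ 0‖) '' {φ | RMClass V φ} with hS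
  have hSb : BddAbove S := by
    refine ⟨2 / r₀, ?_⟩
    rintro _ ⟨φ, hφ, rfl⟩
    refine norm_deriv_le_div_of_mapsTo_ball (hφ.diff.mono hr₀V) (fun z hz => ?_) hr₀
    have := hφ.maps (hr₀V hz)
    rw [hφ.zero]
    rw [mem_ball_zero_iff] at this
    simp; linarith
  set M := sSup S with hM
  have hMle : ∀ φ, RMClass V φ → ‖deriv φ 0‖ ≤ M := fun φ hφ => le_csSup hSb ⟨φ, hφ, rfl⟩
  have hMpos := (norm_pos_iff.2 (hne.der 0 h0)).trans_le (hMle _ hne)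
  have hex : ∀ n : ℕ, ∃ φ, RMClass V φ ∧ M - 1 / ((n : ℝ) + 1) < ‖deriv φ 0‖ := fun n => by
    obtain ⟨_, ⟨φ, hφ, rfl⟩, h⟩ := exists_lt_of_lt_csSup (show S.Nonempty from ⟨_, _, hne, rfl⟩)
      (show M - 1 / ((n : ℝ) + 1) < sSup S by rw [← hM]; have : 0 < 1 / ((n : ℝ) + 1) := by positivity
                                              linarith)
    exact ⟨φ, hφ, h⟩
  choose F hF hFM using hex
  have hlim1 : Tendsto (fun n : ℕ => M - 1 / ((n : ℝ) + 1)) atTop (𝓝 M) := by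
    simpa using tendsto_const_nhds.sub (tendsto_one_div_add_atTop_nhds_zero_nat (𝕜 := ℝ))
  have hcover : ∀ ρ : ℝ, ρ < 1 → ∀ᶠ n in atTop, ball (0 : ℂ) ρ ⊆ F n '' V := by
    intro ρ hρ
    rcases le_or_gt ρ 0 with h | h
    · simp [ball_eq_empty.2 h]
    have h3 : √ρ < 1 := by rw [Real.sqrt_lt' one_pos]; simpa
    set κ := 1 + (1 - √ρ) ^ 2 / 2 with hκ
    have hκ1 : 1 < κ := by
      have : 0 < (1 - √ρ) ^ 2 := by have : 0 < 1 - √ρ := by linarith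
                                    positivity
      linarith
    have hev : ∀ᶠ n : ℕ in atTop, M < (M - 1 / ((n : ℝ) + 1)) * κ :=
      (hlim1.mul_const κ).eventually (lt_mem_nhds (by nlinarith))
    filter_upwards [hev] with n hn c hc
    by_contra hcV
    have hcρ : ‖c‖ < ρ := by simpa using hc
    have ⟨φ', hφ', he⟩ := (hF n).koebe hV hVp h0 (hcρ.trans hρ) hcV
    have h5 := hMle _ hφ'
    rw [he] at h5
    have h7 : ‖deriv (F n) 0‖ * κ ≤ M :=
      (mul_le_mul_of_nonneg_left (koebe_factor (norm_pos_iff.2 (by rintro rfl; exact hcV ⟨0, h0, (hF n).zero⟩)) hcρ.le hρ) (norm_nonneg _)).trans h5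
    nlinarith [hFM n]
  set P : ℕ → ℂ → ℂ := fun n => Function.invFunOn (F n) V with hP
  have hPV : ∀ n, ∀ z ∈ F n '' V, P n z ∈ V ∧ F n (P n z) = z := fun n z hz =>
    ⟨Function.invFunOn_mem hz, Function.invFunOn_eq hz⟩
  have hPF : ∀ n, ∀ v ∈ V, P n (F n v) = v := fun n v hv => (hF n).inj.leftInvOn_invFunOn hv
  have hPd : ∀ n, ∀ v ∈ V, HasDerivAt (P n) (deriv (F n) v)⁻¹ (F n v) := fun n =>
    hasDerivAt_inverse_on hV (hF n).diff (hF n).der (hPF n)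
  let l : Ultrafilter ℕ := Filter.hyperfilter ℕ
  have hl := Nat.hyperfilter_le_atTop
  set φ : ℂ → ℂ := fun z => limUnder (l : Filter ℕ) fun n => F n z with hφ
  set ψ : ℂ → ℂ := fun z => limUnder (l : Filter ℕ) fun n => P n z with hψ
  have ⟨hFφ, hφd⟩ := montel_ultrafilter l hV (f := F) (C := 1) (g := φ) (Eventually.of_forall fun n => (hF n).diff)
    (Eventually.of_forall fun n z hz => by simpa using (mem_ball_zero_iff.1 ((hF n).maps hz)).le)
    (fun z => rfl)
  have hPψ : ∀ ρ : ℝ, ρ < 1 → TendstoLocallyUniformlyOn P ψ l (ball 0 ρ) ∧ DifferentiableOn ℂ ψ (ball 0 ρ) := by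
    intro ρ hρ
    refine montel_ultrafilter l isOpen_ball (C := R) ?_ ?_ (fun z => rfl)
    · filter_upwards [hl (hcover ρ hρ)] with n hn z hz
      obtain ⟨v, hv, rfl⟩ := hn hz
      exact (hPd n v hv).differentiableAt.differentiableWithinAt
    · filter_upwards [hl (hcover ρ hρ)] with n hn z hz
      exact (mem_ball_zero_iff.1 (hVR (hPV n z (hn hz)).1)).le
  have hin : ∀ z ∈ 𝔻, ∃ ρ < 1, z ∈ ball (0 : ℂ) ρ := fun z hz => by
    have ⟨ρ, h1, h2⟩ := exists_between (mem_ball_zero_iff.1 hz)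
    exact ⟨ρ, h2, by simpa using h1⟩
  have hψd : DifferentiableOn ℂ ψ 𝔻 := fun z hz => by
    have ⟨ρ, hρ, hzρ⟩ := hin z hz
    exact ((hPψ ρ hρ).2.differentiableAt (isOpen_ball.mem_nhds hzρ)).differentiableWithinAt
  have hP0 : ∀ n, deriv (P n) 0 = (deriv (F n) 0)⁻¹ := fun n => by
    have := hPd n 0 h0
    rw [(hF n).zero] at this
    exact this.deriv
  have hψ0 : deriv ψ 0 ≠ 0 := by
    have ⟨hT, hD⟩ := hPψ (1/2) (by norm_num)
    have h1 := hT.deriv (by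
      filter_upwards [hl (hcover (1/2) (by norm_num))] with n hn z hz
      obtain ⟨v, hv, rfl⟩ := hn hz
      exact (hPd n v hv).differentiableAt.differentiableWithinAt) isOpen_ball
    have h3 : M⁻¹ ≤ ‖deriv ψ 0‖ := by
      refine ge_of_tendsto ((h1.tendsto_at (mem_ball_self (by norm_num : (0:ℝ) < 1/2))).norm) (Eventually.of_forall fun n => ?_)
      simp only [Function.comp, hP0, norm_inv]
      exact inv_anti₀ (norm_pos_iff.2 ((hF n).der 0 h0)) (hMle _ (hF n))
    intro h
    rw [h, norm_zero] at h3
    have := inv_pos.2 hMpos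
    linarith
  have hφ0 : deriv φ 0 ≠ 0 := by
    have h1 := hFφ.deriv (Eventually.of_forall fun n => (hF n).diff) hV
    have h3 : M ≤ ‖deriv φ 0‖ := by
      refine le_of_tendsto_of_tendsto (hlim1.mono_left hl) ((h1.tendsto_at h0).norm) (Eventually.of_forall fun n => ?_)
      exact (hFM n).le
    intro h
    rw [h, norm_zero] at h3
    linarith
  have hψV : MapsTo ψ 𝔻 V := by
    have ho := isOpen_image_of_deriv_ne isOpen_ball (convex_ball _ _).isPreconnected hψd (mem_ball_self one_pos) hψ0
    have hcl : ψ '' 𝔻 ⊆ closure V := by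
      rintro _ ⟨z, hz, rfl⟩
      have ⟨ρ, hρ, hzρ⟩ := hin z hz
      refine mem_closure_of_tendsto ((hPψ ρ hρ).1.tendsto_at hzρ) ?_
      filter_upwards [hl (hcover ρ hρ)] with n hn using (hPV n z (hn hzρ)).1
    exact fun z hz => hreg (interior_maximal hcl ho (mem_image_of_mem _ hz))
  have hφV : MapsTo φ V 𝔻 := by
    have hcl : φ '' V ⊆ 𝔻bar := by
      rintro _ ⟨z, hz, rfl⟩
      refine isClosed_closedBall.mem_of_tendsto (hFφ.tendsto_at hz) ?_
      exact Eventually.of_forall fun n => ball_subset_closedBall ((hF n).maps hz)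
    intro z hz
    have := interior_maximal hcl (isOpen_image_of_deriv_ne hV hVp hφd h0 hφ0) (mem_image_of_mem _ hz)
    rwa [interior_closedBall _ one_ne_zero] at this
  refine ⟨ψ, φ, hψd, hφd, hψV, hφV, fun z hz => ?_, fun v hv => ?_, ?_⟩
  · have ⟨ρ, hρ, hzρ⟩ := hin z hz
    have h2 := hFφ.tendsto_comp (hφd.continuousOn _ (hψV hz)) (hψV hz)
      (tendsto_nhdsWithin_iff.2 ⟨(hPψ ρ hρ).1.tendsto_at hzρ, by
        filter_upwards [hl (hcover ρ hρ)] with n hn using (hPV n z (hn hzρ)).1⟩)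
    refine tendsto_nhds_unique h2 (tendsto_const_nhds.congr' ?_)
    filter_upwards [hl (hcover ρ hρ)] with n hn using (hPV n z (hn hzρ)).2.symm
  · have ⟨ρ, hρ, hzρ⟩ := hin (φ v) (hφV hv)
    have h1 := hFφ.tendsto_at hv
    have h2 := (hPψ ρ hρ).1.tendsto_comp ((hPψ ρ hρ).2.continuousOn _ hzρ) hzρ
      (tendsto_nhdsWithin_iff.2 ⟨h1, h1.eventually (isOpen_ball.mem_nhds hzρ)⟩)
    refine tendsto_nhds_unique h2 (tendsto_const_nhds.congr' ?_)
    filter_upwards with n using (hPF n v hv).symm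
  · refine tendsto_nhds_unique ((hPψ (1/2) (by norm_num)).1.tendsto_at (mem_ball_self (by norm_num : (0:ℝ) < 1/2))) (tendsto_const_nhds.congr' ?_)
    filter_upwards with n
    have := hPF n 0 h0
    rw [(hF n).zero] at this
    exact this.symm

lemma det_toSpanSingleton_complex (c : ℂ) :
    ((ContinuousLinearMap.toSpanSingleton ℂ c).restrictScalars ℝ : ℂ →L[ℝ] ℂ).det = ‖c‖ ^ 2 := by
  rw [ContinuousLinearMap.det, ← Complex.normSq_eq_norm_sq, ← Algebra.norm_complex_apply, Algebra.norm_apply]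
  congr 1
  ext <;> simp [mul_comm]

lemma lintegral_deriv_sq_lt_top {h : ℂ → ℂ} (hW : IsOpen W) (hd : DifferentiableOn ℂ h W)
    (hi : InjOn h W) (hb : h '' W ⊆ ball 0 R) :
    ∫⁻ z in W, ‖deriv h z‖ₑ ^ 2 < ⊤ := by
  have h1 : ∀ x ∈ W, HasFDerivWithinAt h
      ((ContinuousLinearMap.toSpanSingleton ℂ (deriv h x)).restrictScalars ℝ : ℂ →L[ℝ] ℂ) W x := by
    intro x hx
    exact ((hd.differentiableAt (hW.mem_nhds hx)).hasDerivAt.hasFDerivAt.restrictScalars ℝ).hasFDerivWithinAt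
  have h2 := lintegral_abs_det_fderiv_eq_addHaar_image volume hW.measurableSet h1 hi
  have h3 : ∀ z, ENNReal.ofReal |((ContinuousLinearMap.toSpanSingleton ℂ (deriv h z)).restrictScalars ℝ :
      ℂ →L[ℝ] ℂ).det| = ‖deriv h z‖ₑ ^ 2 := by
    intro z
    rw [det_toSpanSingleton_complex, abs_of_nonneg (by positivity), ENNReal.ofReal_pow (norm_nonneg _), ofReal_norm]
  simp only [h3] at h2
  rw [h2]
  exact (measure_mono hb).trans_lt measure_ball_lt_top

lemma lintegral_lintegral_deriv_sq_lt_top {h : ℂ → ℂ} (hW : IsOpen W) (hd : DifferentiableOn ℂ h W)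
    (hi : InjOn h W) (hb : h '' W ⊆ ball 0 R) {I J : Set ℝ} (hI : MeasurableSet I)
    (hJ : MeasurableSet J) (hIJ : ∀ s ∈ I, ∀ t ∈ J, (⟨s, t⟩ : ℂ) ∈ W) :
    ∫⁻ s in I, ∫⁻ t in J, ‖deriv h ⟨s, t⟩‖ₑ ^ 2 < ⊤ := by
  have h1 := lintegral_deriv_sq_lt_top hW hd hi hb
  rw [← lintegral_indicator hW.measurableSet, ← (volume_preserving_equiv_real_prod.symm).lintegral_comp_emb
    measurableEquivRealProd.symm.measurableEmbedding] at h1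
  have hm : Measurable fun z => (W.indicator fun z => ‖deriv h z‖ₑ ^ 2) z := by
    refine Measurable.indicator ?_ hW.measurableSet
    exact (measurable_deriv h).enorm.pow_const 2
  rw [Measure.volume_eq_prod, lintegral_prod _ (by
    exact (hm.comp measurableEquivRealProd.symm.measurable).aemeasurable)] at h1
  refine lt_of_le_of_lt ?_ h1
  rw [← lintegral_indicator hI]
  refine lintegral_mono fun s => ?_
  by_cases hs : s ∈ I
  · rw [indicator_of_mem hs, ← lintegral_indicator hJ]
    refine lintegral_mono fun t => ?_
    by_cases ht : t ∈ J
    · rw [indicator_of_mem ht]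
      simp only [measurableEquivRealProd_symm_apply]
      rw [indicator_of_mem (hIJ s hs t ht)]
    · simp [indicator_of_notMem ht]
  · simp [indicator_of_notMem hs]

lemma measurable_lintegral_deriv_sq (h : ℂ → ℂ) (J : Set ℝ) :
    Measurable fun s : ℝ => ∫⁻ t in J, ‖deriv h ⟨s, t⟩‖ₑ ^ 2 := by
  refine Measurable.lintegral_prod_right' (f := fun p : ℝ × ℝ => ‖deriv h ⟨p.1, p.2⟩‖ₑ ^ 2) ?_
  exact ((measurable_deriv h).comp measurableEquivRealProd.symm.measurable).enorm.pow_const 2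

/-- A vertical segment of finite energy has an image of finite length: endpoints exist and
oscillation is controlled. -/
lemma exists_limits_of_energy {h : ℂ → ℂ} (hW : IsOpen W) (hd : DifferentiableOn ℂ h W) (hab : a < b) (hsW : ∀ t ∈ Ioo a b, (⟨s, t⟩ : ℂ) ∈ W) {δ : ℝ}
    (hE : ∫⁻ t in Ioo a b, ‖deriv h ⟨s, t⟩‖ₑ ^ 2 ≤ ENNReal.ofReal δ) (hδ : 0 ≤ δ) {η : ℝ} (hη : 0 < η) :
    (∃ y, Tendsto (fun t : ℝ => h ⟨s, t⟩) (𝓝[>] a) (𝓝 y)) ∧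
    (∃ y, Tendsto (fun t : ℝ => h ⟨s, t⟩) (𝓝[<] b) (𝓝 y)) ∧
    ∀ t ∈ Ioo a b, ∀ t' ∈ Ioo a b, dist (h ⟨s, t⟩) (h ⟨s, t'⟩) ≤ (b - a) * η + η⁻¹ * δ := by
  set u : ℝ → ℂ := fun t => deriv h ⟨s, t⟩ with hu
  have hmeas : Measurable u := (measurable_deriv h).comp
    (measurableEquivRealProd.symm.measurable.comp (by fun_prop : Measurable fun t : ℝ => (s, t)))
  have hpt : ∀ t, ‖u t‖ₑ ≤ ENNReal.ofReal η + ENNReal.ofReal η⁻¹ * ‖u t‖ₑ ^ 2 := by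
    intro t
    rw [← ofReal_norm, ← ENNReal.ofReal_pow (norm_nonneg _), ← ENNReal.ofReal_mul (by positivity),
      ← ENNReal.ofReal_add hη.le (by positivity)]
    apply ENNReal.ofReal_le_ofReal
    have h1 : 0 ≤ (‖u t‖ - η) ^ 2 := sq_nonneg _
    have h3 : η + η⁻¹ * ‖u t‖ ^ 2 - ‖u t‖ = η⁻¹ * ((‖u t‖ - η) ^ 2 + ‖u t‖ * η) := by field_simp; ring
    have h4 : 0 ≤ η⁻¹ * ((‖u t‖ - η) ^ 2 + ‖u t‖ * η) := by positivity
    linarith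
  have hlint : ∫⁻ t in Ioo a b, ‖u t‖ₑ ≤ ENNReal.ofReal ((b - a) * η + η⁻¹ * δ) := by
    calc ∫⁻ t in Ioo a b, ‖u t‖ₑ ≤ ∫⁻ t in Ioo a b, (ENNReal.ofReal η + ENNReal.ofReal η⁻¹ * ‖u t‖ₑ ^ 2) :=
          lintegral_mono hpt
      _ = ENNReal.ofReal η * volume (Ioo a b) + ENNReal.ofReal η⁻¹ * ∫⁻ t in Ioo a b, ‖u t‖ₑ ^ 2 := by
          rw [lintegral_add_left measurable_const, lintegral_const_mul _ (hmeas.enorm.pow_const 2),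
            lintegral_const, Measure.restrict_apply_univ]
      _ ≤ ENNReal.ofReal η * ENNReal.ofReal (b - a) + ENNReal.ofReal η⁻¹ * ENNReal.ofReal δ := by
          rw [Real.volume_Ioo]; gcongr
      _ = _ := by
          rw [← ENNReal.ofReal_mul hη.le, ← ENNReal.ofReal_mul (by positivity),
            ← ENNReal.ofReal_add (mul_nonneg hη.le (by linarith)) (by positivity), mul_comm η]
  have hInt : IntegrableOn u (Ioo a b) := ⟨hmeas.aestronglyMeasurable, hlint.trans_lt ENNReal.ofReal_lt_top⟩
  have hnn : 0 ≤ (b - a) * η + η⁻¹ * δ := by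
    have : 0 < b - a := by linarith
    positivity
  have hnorm : ∫ t in Ioo a b, ‖u t‖ ≤ (b - a) * η + η⁻¹ * δ := by
    rw [integral_norm_eq_lintegral_enorm hmeas.aestronglyMeasurable]
    exact ENNReal.toReal_le_of_le_ofReal hnn hlint
  have hInt' : IntervalIntegrable (fun t => u t * I) volume a b := by
    rw [intervalIntegrable_iff_integrableOn_Ioo_of_le hab.le]
    exact hInt.mul_const I
  have hder : ∀ t ∈ Ioo a b, HasDerivAt (fun t : ℝ => h ⟨s, t⟩) (u t * I) t := by
    intro t ht
    have h1 : HasDerivAt (fun t : ℝ => (⟨s, t⟩ : ℂ)) I t := by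
      rw [(by funext t; exact mk_eq_add_mul_I s t : (fun t : ℝ => (⟨s, t⟩ : ℂ)) = fun t : ℝ => (s : ℂ) + t * I)]
      simpa using ((hasDerivAt_id t).ofReal_comp.mul_const I).const_add (s : ℂ)
    exact (hd.differentiableAt (hW.mem_nhds (hsW t ht))).hasDerivAt.comp t h1
  have hFTC : ∀ t ∈ Ioo a b, ∀ t' ∈ Ioo a b, ∫ x in t..t', u x * I = h ⟨s, t'⟩ - h ⟨s, t⟩ := by
    intro t ht t' ht'
    have hsub := (ordConnected_Ioo).uIcc_subset ht ht'
    refine intervalIntegral.integral_eq_sub_of_hasDerivAt (fun x hx => hder x (hsub hx)) ?_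
    refine hInt'.mono_set ?_
    rw [uIcc_of_le hab.le]; exact hsub.trans Ioo_subset_Icc_self
  obtain ⟨c, hc⟩ : (Ioo a b).Nonempty := nonempty_Ioo.2 hab
  have hprim := intervalIntegral.continuousOn_primitive_interval' hInt' (a := c)
    (by rw [uIcc_of_le hab.le]; exact Ioo_subset_Icc_self hc)
  rw [uIcc_of_le hab.le] at hprim
  have heq : ∀ t ∈ Ioo a b, h ⟨s, c⟩ + ∫ x in c..t, u x * I = h ⟨s, t⟩ := fun t ht => by rw [hFTC c hc t ht]; ring
  refine ⟨⟨h ⟨s, c⟩ + ∫ x in c..a, u x * I, ?_⟩, ⟨h ⟨s, c⟩ + ∫ x in c..b, u x * I, ?_⟩, fun t ht t' ht' => ?_⟩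
  · have h1 := (hprim a (left_mem_Icc.2 hab.le)).mono_left (nhdsWithin_mono a Ioo_subset_Icc_self)
    rw [nhdsWithin_Ioo_eq_nhdsGT hab] at h1
    refine (tendsto_const_nhds.add h1).congr' ?_
    filter_upwards [Ioo_mem_nhdsGT hab] with t ht using heq t ht
  · have h1 := (hprim b (right_mem_Icc.2 hab.le)).mono_left (nhdsWithin_mono b Ioo_subset_Icc_self)
    rw [nhdsWithin_Ioo_eq_nhdsLT hab] at h1
    refine (tendsto_const_nhds.add h1).congr' ?_
    filter_upwards [Ioo_mem_nhdsLT hab] with t ht using heq t ht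
  · rw [dist_comm, dist_eq_norm, ← hFTC t ht t' ht']
    refine le_trans ?_ hnorm
    refine (intervalIntegral.norm_integral_le_integral_norm_uIoc).trans ?_
    simp only [norm_mul, norm_I, mul_one]
    refine setIntegral_mono_set hInt.norm (Eventually.of_forall fun _ => norm_nonneg _) ?_
    exact (uIoc_subset_uIcc.trans ((ordConnected_Ioo).uIcc_subset ht ht')).eventuallyLE

/-- The conformal map from the strip `|Im w| < π/2` onto the disc sending `-∞` to `ζ`. -/
def stp (ζ w : ℂ) : ℂ := ζ * ((1 - exp w) / (1 + exp w))

/-- The inverse of `stp`. -/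
def stpInv (ζ z : ℂ) : ℂ := log ((ζ - z) / (ζ + z))

/-- The open interval of imaginary parts of the strip. -/
def stripI : Set ℝ := Ioo (-(π / 2)) (π / 2)

lemma exp_re_pos (hw : w.im ∈ stripI) : 0 < (exp w).re := by
  rw [exp_re]
  exact mul_pos (Real.exp_pos _) (Real.cos_pos_of_mem_Ioo hw)

lemma exp_re_nonneg (hw : w.im ∈ Icc (-(π / 2)) (π / 2)) : 0 ≤ (exp w).re := by
  rw [exp_re]
  exact mul_nonneg (Real.exp_pos _).le (Real.cos_nonneg_of_mem_Icc hw)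

lemma one_add_exp_ne (hw : w.im ∈ Icc (-(π / 2)) (π / 2)) : 1 + exp w ≠ 0 := by
  intro h
  have := congrArg re h
  have := exp_re_nonneg hw
  simp at *
  linarith

lemma stripI_subset : stripI ⊆ Icc (-(π / 2)) (π / 2) := Ioo_subset_Icc_self

lemma norm_stp_lt (hζ : ‖ζ‖ = 1) (hw : w.im ∈ stripI) : ‖stp ζ w‖ < 1 := by
  have h := exp_re_pos hw
  rw [stp, norm_mul, hζ, one_mul, norm_div, div_lt_one (norm_pos_iff.2 (one_add_exp_ne (stripI_subset hw)))]
  refine lt_of_pow_lt_pow_left₀ 2 (norm_nonneg _) ?_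
  rw [← normSq_eq_norm_sq, ← normSq_eq_norm_sq, normSq_apply, normSq_apply]
  simp only [sub_re, add_re, one_re, sub_im, add_im, one_im]
  nlinarith

lemma ratio_re_pos (hζ : ‖ζ‖ = 1) (hz : ‖z‖ < 1) : 0 < ((ζ - z) / (ζ + z)).re := by
  rw [div_re, ← add_div]
  refine div_pos ?_ (normSq_pos.2 (fun h => by rw [(by linear_combination h : ζ = -z), norm_neg] at hζ; linarith))
  have e1 : ζ.re * ζ.re + ζ.im * ζ.im = 1 := by rw [← normSq_apply, normSq_eq_norm_sq, hζ]; norm_num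
  have e2 : z.re * z.re + z.im * z.im < 1 := by rw [← normSq_apply, normSq_eq_norm_sq]; nlinarith [norm_nonneg z]
  simp only [sub_re, add_re, sub_im, add_im]
  nlinarith

lemma add_ne_zero_of_norm (hζ : ‖ζ‖ = 1) (hz : ‖z‖ < 1) : ζ + z ≠ 0 := fun h => by
  rw [(by linear_combination h : ζ = -z), norm_neg] at hζ; linarith

lemma sub_ne_zero_of_norm (hζ : ‖ζ‖ = 1) (hz : ‖z‖ < 1) : ζ - z ≠ 0 := fun h => by grind

lemma stpInv_im (hζ : ‖ζ‖ = 1) (hz : ‖z‖ < 1) : (stpInv ζ z).im ∈ stripI := by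
  rw [stpInv, log_im]
  exact abs_lt.1 (abs_arg_lt_pi_div_two_iff.2 (Or.inl (ratio_re_pos hζ hz)))

lemma stp_stpInv (hζ : ‖ζ‖ = 1) (hz : ‖z‖ < 1) : stp ζ (stpInv ζ z) = z := by
  have h1 := add_ne_zero_of_norm hζ hz
  have h0 : ζ ≠ 0 := by rw [← norm_pos_iff, hζ]; norm_num
  have h3 := one_add_exp_ne (stripI_subset (stpInv_im hζ hz))
  rw [stp]
  rw [stpInv, exp_log (div_ne_zero (sub_ne_zero_of_norm hζ hz) h1)] at *
  grind

lemma stpInv_stp (hζ : ‖ζ‖ = 1) (hw : w.im ∈ stripI) : stpInv ζ (stp ζ w) = w := by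
  have h3 := one_add_exp_ne (stripI_subset hw)
  have h1 : ζ - stp ζ w = ζ * (2 * exp w / (1 + exp w)) := by rw [stp]; field_simp; ring
  rw [stpInv, h1, (by rw [stp]; field_simp; ring : ζ + stp ζ w = ζ * (2 / (1 + exp w))), mul_div_mul_left _ _ (by rw [← norm_pos_iff, hζ]; norm_num)]
  rw [(by field_simp : 2 * exp w / (1 + exp w) / (2 / (1 + exp w)) = exp w)]
  refine log_exp ?_ ?_
  · have := hw.1; have := Real.pi_pos; linarith
  · have := hw.2; have := Real.pi_pos; linarith

lemma stpInv_re : (stpInv ζ z).re = Real.log (‖ζ - z‖ / ‖ζ + z‖) := by rw [stpInv, log_re, norm_div]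

lemma stp_injOn (hζ : ‖ζ‖ = 1) : InjOn (stp ζ) {w | w.im ∈ stripI} := fun w hw w' hw' h => by
  rw [← stpInv_stp hζ hw, h, stpInv_stp hζ hw']

lemma stp_differentiableAt (ζ : ℂ) (hw : w.im ∈ Icc (-(π / 2)) (π / 2)) :
    DifferentiableAt ℂ (stp ζ) w := by
  unfold stp
  fun_prop (disch := exact one_add_exp_ne hw)

lemma stpInv_differentiableAt (hζ : ‖ζ‖ = 1) (hz : ‖z‖ < 1) :
    DifferentiableAt ℂ (stpInv ζ) z := by
  unfold stpInv
  refine DifferentiableAt.clog ?_ (Or.inl (ratio_re_pos hζ hz))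
  fun_prop (disch := exact add_ne_zero_of_norm hζ hz)

lemma one_sub_I_div (x : ℝ) : (1 - x * I) / (1 + x * I) = exp (((-2 * Real.arctan x : ℝ) : ℂ) * I) := by
  have hs' : (√(1 + x ^ 2) : ℂ) ≠ 0 := by exact_mod_cast (Real.sqrt_pos.2 (by positivity)).ne'
  have h1 : ∀ σ : ℝ, σ = 1 ∨ σ = -1 → 1 + (σ * x : ℝ) * I = √(1 + x ^ 2) * exp (((σ * Real.arctan x : ℝ) : ℂ) * I) := by
    rintro σ (rfl | rfl) <;>
    · rw [exp_mul_I, ← ofReal_cos, ← ofReal_sin]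
      simp only [one_mul, neg_mul, Real.cos_neg, Real.sin_neg]
      rw [Real.cos_arctan, Real.sin_arctan]
      push_cast
      field_simp
      try ring
  have h4 : (1 - x * I : ℂ) = 1 + (-1 * x : ℝ) * I := by push_cast; ring
  rw [h4, (by push_cast; ring : (1 + x * I : ℂ) = 1 + (1 * x : ℝ) * I), h1 1 (Or.inl rfl), h1 (-1) (Or.inr rfl), mul_div_mul_left _ _ hs', ← exp_sub]
  congr 1; push_cast; ring

lemma stp_upper (ζ : ℂ) (s : ℝ) :
    stp ζ ⟨s, π / 2⟩ = ζ * exp (((-2 * Real.arctan (Real.exp s) : ℝ) : ℂ) * I) := by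
  rw [← one_sub_I_div, stp]
  have : exp ⟨s, π / 2⟩ = Real.exp s * I := by
    rw [mk_eq_add_mul_I, exp_add, ← ofReal_exp]
    push_cast
    rw [exp_pi_div_two_mul_I]
  rw [this]

lemma stp_lower (ζ : ℂ) (s : ℝ) :
    stp ζ ⟨s, -(π / 2)⟩ = ζ * exp (((2 * Real.arctan (Real.exp s) : ℝ) : ℂ) * I) := by
  have h := one_sub_I_div (-Real.exp s)
  rw [Real.arctan_neg, neg_mul_neg] at h
  rw [← h, stp]
  have : exp ⟨s, -(π / 2)⟩ = Real.exp s * -I := by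
    rw [mk_eq_add_mul_I, exp_add, ← ofReal_exp]
    push_cast
    rw [neg_mul, exp_neg, exp_pi_div_two_mul_I, inv_I]
  rw [this]
  push_cast; ring_nf

/-- The images of suitable vertical segments of the strip shrink. -/
def NullArcs {X : Type*} [PseudoMetricSpace X] (G : ℂ → X) : Prop :=
  ∀ ζ : ℂ, ‖ζ‖ = 1 → ∀ ε > 0, ∀ N : ℝ, ∃ s < N, ∀ t ∈ stripI, ∀ t' ∈ stripI,
    dist (G (stp ζ ⟨s, t⟩)) (G (stp ζ ⟨s, t'⟩)) ≤ ε

lemma tendsto_stpInv_re {α : Type*} {l : Filter α} {p : α → ℂ} (hη : ‖η‖ = 1)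
    (hp : Tendsto p l (𝓝 η)) (hpD : ∀ᶠ x in l, ‖p x‖ < 1) :
    Tendsto (fun x => (stpInv η (p x)).re) l atBot := by
  simp only [stpInv_re]
  refine Real.tendsto_log_nhdsGT_zero.comp (tendsto_nhdsWithin_iff.2 ⟨?_, ?_⟩)
  · have h1 : Tendsto (fun x => ‖η - p x‖ / ‖η + p x‖) l (𝓝 (‖η - η‖ / ‖η + η‖)) := by
      refine ((tendsto_const_nhds.sub hp).norm).div (tendsto_const_nhds.add hp).norm ?_
      rw [← two_mul, norm_mul, hη]; norm_num
    simpa using h1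
  · filter_upwards [hpD] with x hx
    exact div_pos (norm_pos_iff.2 (sub_ne_zero_of_norm hη hx)) (norm_pos_iff.2 (add_ne_zero_of_norm hη hx))

/-- A path landing at `η` crosses every null arc near `η`. -/
lemma exists_cross_of_landing {p : ℝ → ℂ} (hab : a < b) (hη : ‖η‖ = 1) (hp : ContinuousOn p (Ioo a b)) (hpD : ∀ t ∈ Ioo a b, ‖p t‖ < 1)
    (hl : Tendsto p (𝓝[<] b) (𝓝 η)) :
    ∃ N : ℝ, ∀ s < N, ∃ t ∈ Ioo a b, ∃ τ ∈ stripI, p t = stp η ⟨s, τ⟩ := by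
  obtain ⟨c, hc⟩ : (Ioo a b).Nonempty := nonempty_Ioo.2 hab
  have htend := tendsto_stpInv_re hη hl (by filter_upwards [Ioo_mem_nhdsLT hab] with t ht using hpD t ht)
  refine ⟨(stpInv η (p c)).re, fun s hs => ?_⟩
  have ⟨d, hd1, hd2⟩ := ((htend.eventually (eventually_lt_atBot s)).and (Ioo_mem_nhdsLT hc.2)).exists
  have hsub : Icc c d ⊆ Ioo a b := fun x hx => ⟨hc.1.trans_le hx.1, hx.2.trans_lt hd2.2⟩
  have hcont : ContinuousOn (fun t => (stpInv η (p t)).re) (Icc c d) := by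
    intro t ht
    have h1 := (stpInv_differentiableAt hη (hpD t (hsub ht))).continuousAt
    exact continuous_re.continuousAt.comp_continuousWithinAt (h1.comp_continuousWithinAt ((hp t (hsub ht)).mono hsub))
  have ⟨t, ht, hts⟩ := intermediate_value_Icc' hd2.1.le hcont ⟨hd1.le, hs.le⟩
  refine ⟨t, hsub ht, (stpInv η (p t)).im, stpInv_im hη (hpD t (hsub ht)), ?_⟩
  have : (⟨s, (stpInv η (p t)).im⟩ : ℂ) = stpInv η (p t) := by
    apply Complex.ext
    · exact hts.symm
    · rfl
  rw [this, stp_stpInv hη (hpD t (hsub ht))]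

variable {X : Type*} [MetricSpace X] {U U₁ U₂ : Set X} {G G₁ G₂ e e₁ e₂ : ℂ → X} {H H₁ H₂ : X → ℂ} {f : X ≃ₜ X} {L Q p q : ℝ → ℂ}

lemma NullArcs.limits_eq (hG : NullArcs G)
    {c d : ℝ} (hab : a < b) (hcd : c < d) (hη : ‖η‖ = 1) (hp : ContinuousOn p (Ioo a b)) (hpD : ∀ t ∈ Ioo a b, ‖p t‖ < 1)
    (hpl : Tendsto p (𝓝[<] b) (𝓝 η)) (hq : ContinuousOn q (Ioo c d)) (hqD : ∀ t ∈ Ioo c d, ‖q t‖ < 1)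
    (hql : Tendsto q (𝓝[<] d) (𝓝 η)) {y y' : X} (hy : Tendsto (fun t => G (p t)) (𝓝[<] b) (𝓝 y))
    (hy' : Tendsto (fun t => G (q t)) (𝓝[<] d) (𝓝 y')) : y = y' := by
  have key : ∀ ε > 0, dist y y' ≤ 3 * ε := by
    intro ε hε
    have ⟨a', ha', hA⟩ := mem_nhdsLT_iff_exists_mem_Ico_Ioo_subset hab |>.1 ((Metric.tendsto_nhds.1 hy) ε hε)
    have ⟨c', hc', hC⟩ := mem_nhdsLT_iff_exists_mem_Ico_Ioo_subset hcd |>.1 ((Metric.tendsto_nhds.1 hy') ε hε)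
    have ⟨N, hN⟩ := exists_cross_of_landing ha'.2 hη (hp.mono (Ioo_subset_Ioo_left ha'.1))
      (fun t ht => hpD t (Ioo_subset_Ioo_left ha'.1 ht)) hpl
    have ⟨N', hN'⟩ := exists_cross_of_landing hc'.2 hη (hq.mono (Ioo_subset_Ioo_left hc'.1))
      (fun t ht => hqD t (Ioo_subset_Ioo_left hc'.1 ht)) hql
    have ⟨s, hs, hsd⟩ := hG η hη ε hε (min N N')
    have ⟨t, ht, τ, hτ, e⟩ := hN s (hs.trans_le (min_le_left _ _))
    have ⟨t', ht', τ', hτ', e'⟩ := hN' s (hs.trans_le (min_le_right _ _))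
    have h1 := hsd τ hτ τ' hτ'
    rw [← e, ← e'] at h1
    have h2 : dist (G (p t)) y < ε := hA ht
    have h3 : dist (G (q t')) y' < ε := hC ht'
    have := dist_triangle4 y (G (p t)) (G (q t')) y'
    rw [dist_comm y (G (p t))] at this
    linarith
  by_contra hne
  have := dist_pos.2 hne
  linarith [key (dist y y' / 4) (by linarith)]

lemma exp_I_mul_mk (s t : ℝ) : exp (I * ⟨s, t⟩) = (Real.exp (-t) : ℂ) * exp (s * I) := by
  rw [mk_eq_add_mul_I, ofReal_exp, ← exp_add]
  congr 1
  push_cast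
  linear_combination (t : ℂ) * I_mul_I

lemma ae_of_forall_int {p : ℝ → Prop} (h : ∀ c : ℤ, ∀ᵐ θ ∂(volume.restrict (Ioo (c : ℝ) (c + 2))), p θ) :
    ∀ᵐ θ : ℝ, p θ := by
  have h1 : (⋃ c : ℤ, Ioo (c : ℝ) (c + 2)) = univ := by
    refine eq_univ_of_forall fun x => mem_iUnion.2 ⟨⌈x⌉ - 1, ?_, ?_⟩
    · push_cast; linarith [Int.ceil_lt_add_one x]
    · push_cast; linarith [Int.le_ceil x]
  rwa [← Measure.restrict_univ (μ := (volume : Measure ℝ)), ← h1, ae_restrict_iUnion_iff]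

/-- Bounded univalent functions have radial limits almost everywhere. -/
lemma ae_exists_radial_limit {g : ℂ → ℂ} (hd : DifferentiableOn ℂ g 𝔻) (hi : InjOn g 𝔻) (hb : g '' 𝔻 ⊆ ball 0 R) :
    ∀ᵐ θ : ℝ, ∃ y, Tendsto (fun r : ℝ => g (r * exp (θ * I))) (𝓝[<] 1) (𝓝 y) := by
  refine ae_of_forall_int fun c => ?_
  set W : Set ℂ := {w | (c : ℝ) < w.re ∧ w.re < c + 2 ∧ 0 < w.im ∧ w.im < 1} with hWdef
  have hW : IsOpen W := by
    refine (isOpen_lt continuous_const continuous_re).inter ((isOpen_lt continuous_re continuous_const).inter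
      ((isOpen_lt continuous_const continuous_im).inter (isOpen_lt continuous_im continuous_const)))
  have hE : ∀ w ∈ W, exp (I * w) ∈ 𝔻 := by
    intro w hw
    rw [mem_ball_zero_iff, norm_exp, Real.exp_lt_one_iff]
    simpa using hw.2.2.1
  have hEi : InjOn (fun w => exp (I * w)) W := by
    intro w hw w' hw' h
    have ⟨n, hn⟩ := exp_eq_exp_iff_exists_int.1 h
    have h1 : w - w' = n * (2 * π) := by
      apply mul_left_cancel₀ I_ne_zero
      linear_combination hn
    have h2 := congrArg re h1
    simp only [sub_re, mul_re, intCast_re, intCast_im, re_ofNat, im_ofNat, ofReal_re, ofReal_im] at h2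
    have hpi := Real.pi_gt_three
    have h3 : |(n : ℝ)| < 1 := by
      rw [abs_lt]
      have ⟨a1, a2, _⟩ := hw
      have ⟨b1, b2, _⟩ := hw'
      constructor <;> nlinarith
    rw [(by exact Int.abs_lt_one_iff.1 (by exact_mod_cast h3) : n = 0)] at h1
    simpa [sub_eq_zero] using h1
  have hdW : DifferentiableOn ℂ (fun w => g (exp (I * w))) W := hd.comp (by fun_prop) hE
  have hfin := lintegral_lintegral_deriv_sq_lt_top hW hdW (hi.comp hEi hE) (R := R)
    (by rintro _ ⟨w, hw, rfl⟩; exact hb ⟨_, hE w hw, rfl⟩)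
    (I := Ioo (c : ℝ) (c + 2)) (J := Ioo 0 1) measurableSet_Ioo measurableSet_Ioo
    (fun s hs t ht => ⟨hs.1, hs.2, ht.1, ht.2⟩)
  have hae := ae_lt_top (measurable_lintegral_deriv_sq (fun w => g (exp (I * w))) (Ioo 0 1)) hfin.ne
  filter_upwards [hae, ae_restrict_mem measurableSet_Ioo] with s hs hs'
  obtain ⟨⟨y, hy⟩, -, -⟩ := exists_limits_of_energy hW hdW one_pos
    (fun t ht => (⟨hs'.1, hs'.2, ht.1, ht.2⟩ : (⟨s, t⟩ : ℂ) ∈ W))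
    (δ := (∫⁻ t in Ioo 0 1, ‖deriv (fun w => g (exp (I * w))) ⟨s, t⟩‖ₑ ^ 2).toReal)
    (by rw [ENNReal.ofReal_toReal hs.ne]) ENNReal.toReal_nonneg one_pos
  refine ⟨y, ?_⟩
  have hlog : Tendsto (fun r : ℝ => -Real.log r) (𝓝[<] 1) (𝓝[>] 0) := by
    refine tendsto_nhdsWithin_iff.2 ⟨?_, ?_⟩
    · have : ContinuousAt (fun r : ℝ => -Real.log r) 1 := (Real.continuousAt_log one_ne_zero).neg
      simpa [ContinuousAt] using this.tendsto.mono_left nhdsWithin_le_nhds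
    · filter_upwards [Ioo_mem_nhdsLT (zero_lt_one' ℝ)] with r hr
      simpa using Real.log_neg hr.1 hr.2
  refine (hy.comp hlog).congr' ?_
  filter_upwards [Ioo_mem_nhdsLT (zero_lt_one' ℝ)] with r hr
  simp only [Function.comp, exp_I_mul_mk, neg_neg, Real.exp_log hr.1]

/-- Cross-cuts of small diameter with landing endpoints, with positive measure of levels. -/
lemma frequently_arcs {g : ℂ → ℂ} (hd : DifferentiableOn ℂ g 𝔻)
    (hi : InjOn g 𝔻) (hb : g '' 𝔻 ⊆ ball 0 R) (hζ : ‖ζ‖ = 1) {ε : ℝ}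
    (hε : 0 < ε) (N : ℝ) :
    ∃ᶠ s in ae (volume : Measure ℝ), s < N ∧ (∃ y, Tendsto (fun t : ℝ => g (stp ζ ⟨s, t⟩)) (𝓝[>] (-(π / 2))) (𝓝 y)) ∧
      (∃ y, Tendsto (fun t : ℝ => g (stp ζ ⟨s, t⟩)) (𝓝[<] (π / 2)) (𝓝 y)) ∧
      ∀ t ∈ stripI, ∀ t' ∈ stripI, dist (g (stp ζ ⟨s, t⟩)) (g (stp ζ ⟨s, t'⟩)) ≤ ε := by
  set W : Set ℂ := {w | w.im ∈ stripI} with hWdef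
  have hW : IsOpen W := isOpen_Ioo.preimage continuous_im
  have hE : ∀ w ∈ W, stp ζ w ∈ 𝔻 := fun w hw => mem_ball_zero_iff.2 (norm_stp_lt hζ hw)
  have hdW := hd.comp (fun w hw => (stp_differentiableAt ζ (stripI_subset hw)).differentiableWithinAt) hE
  have hfin := lintegral_lintegral_deriv_sq_lt_top hW hdW (hi.comp (stp_injOn hζ) hE) (R := R)
    (by rintro _ ⟨w, hw, rfl⟩; exact hb ⟨_, hE w hw, rfl⟩)
    (I := Iio N) (J := stripI) measurableSet_Iio measurableSet_Ioo
    (fun s hs t ht => ht)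
  have hpi := Real.pi_pos
  set η : ℝ := ε / (2 * π) with hη
  set δ : ℝ := ε / 2 * η with hδ
  have hδ0 : 0 < δ := by positivity
  have hfreq : ∃ᶠ s in ae (volume : Measure ℝ), s < N ∧
      ∫⁻ t in stripI, ‖deriv (fun w => g (stp ζ w)) ⟨s, t⟩‖ₑ ^ 2 ≤ ENNReal.ofReal δ := by
    intro hcon
    have h1 : ∀ᵐ s ∂(volume.restrict (Iio N)), ENNReal.ofReal δ ≤
        ∫⁻ t in stripI, ‖deriv (fun w => g (stp ζ w)) ⟨s, t⟩‖ₑ ^ 2 := by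
      rw [ae_restrict_iff' measurableSet_Iio]
      filter_upwards [hcon] with s hs hsN
      exact le_of_lt (not_le.1 fun h => hs ⟨hsN, h⟩)
    have h2 := lintegral_mono_ae h1
    rw [lintegral_const, Measure.restrict_apply_univ, Real.volume_Iio, ENNReal.mul_top (by simpa using hδ0)] at h2
    exact absurd hfin (not_lt.2 h2)
  refine hfreq.mono fun s hs => ⟨hs.1, ?_⟩
  have ⟨h1, h2, h3⟩ := exists_limits_of_energy (a := -(π / 2)) (b := π / 2) hW hdW (by linarith)
    (fun t ht => (ht : (⟨s, t⟩ : ℂ) ∈ W)) hs.2 hδ0.le (by positivity : 0 < η)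
  refine ⟨h1, h2, fun t ht t' ht' => (h3 t ht t' ht').trans (le_of_eq ?_)⟩
  grind

/-- A bounded holomorphic function omitting `a` has radial limit `a` only on a null set. -/
lemma ae_radial_limit_ne {g : ℂ → ℂ} (hd : DifferentiableOn ℂ g 𝔻)
    (hb : g '' 𝔻 ⊆ ball 0 R) {a : ℂ} (ha : ∀ z ∈ 𝔻, g z ≠ a) :
    ∀ᵐ θ : ℝ, ¬ Tendsto (fun r : ℝ => g (r * exp (θ * I))) (𝓝[<] 1) (𝓝 a) := by
  refine ae_of_forall_int fun c => ?_
  have hpi := Real.pi_gt_three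
  refine ae_restrict_of_ae_restrict_of_subset (show Ioo (c : ℝ) (c + 2) ⊆ Ioc (c : ℝ) (c + 2 * π) from fun x hx => ⟨hx.1, by linarith [hx.2]⟩) ?_
  have hR : 0 < R := by
    have := hb ⟨0, (by simp), rfl⟩
    rw [mem_ball_zero_iff] at this
    exact (norm_nonneg _).trans_lt this
  set M : ℝ := R + ‖a‖ with hM
  have hM0 : 0 < M := by positivity
  have hgM : ∀ z ∈ 𝔻, ‖g z - a‖ ≤ M := fun z hz => by
    have := hb ⟨z, hz, rfl⟩
    rw [mem_ball_zero_iff] at this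
    exact (norm_sub_le _ _).trans (by linarith)
  set r : ℕ → ℝ := fun n => 1 - 1 / (n + 2) with hr
  have hr01 : ∀ n, 0 < r n ∧ r n < 1 := by
    intro n
    have h1 : 0 < 1 / ((n : ℝ) + 2) := by positivity
    have h3 : 1 / ((n : ℝ) + 2) < 1 := by
      rw [div_lt_one (by positivity)]; have : (0 : ℝ) ≤ n := by positivity
      linarith
    constructor <;> simp only [hr] <;> linarith
  have hrlim : Tendsto r atTop (𝓝[<] 1) := by
    refine tendsto_nhdsWithin_iff.2 ⟨?_, Eventually.of_forall fun n => (hr01 n).2⟩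
    have : Tendsto (fun n : ℕ => (1 : ℝ) - 1 / ((n : ℝ) + 2)) atTop (𝓝 (1 - 0)) := by
      refine tendsto_const_nhds.sub ?_
      refine ((tendsto_one_div_add_atTop_nhds_zero_nat (𝕜 := ℝ)).comp (tendsto_add_atTop_nat 1)).congr fun n => ?_
      simp only [Function.comp]; push_cast; ring_nf
    simpa [hr] using this
  have hcm : ∀ n θ, circleMap 0 (r n) θ ∈ 𝔻 := fun n θ => by
    rw [mem_ball_zero_iff, norm_circleMap_zero, abs_of_pos (hr01 n).1]; exact (hr01 n).2
  set u : ℕ → ℝ → ℝ := fun n θ => Real.log M - Real.log ‖g (circleMap 0 (r n) θ) - a‖ with hu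
  have hu0 : ∀ n θ, 0 ≤ u n θ := fun n θ => sub_nonneg.2
    (Real.log_le_log (norm_pos_iff.2 (sub_ne_zero.2 (ha _ (hcm n θ)))) (hgM _ (hcm n θ)))
  have huc : ∀ n, Continuous (u n) := by
    intro n
    refine continuous_const.sub (Continuous.log ?_ fun θ => (norm_pos_iff.2 (sub_ne_zero.2 (ha _ (hcm n θ)))).ne')
    exact ((hd.continuousOn.comp_continuous (continuous_circleMap 0 _) (hcm n)).sub continuous_const).norm
  have hInt : ∀ n, ∫ θ in (c : ℝ)..(c + 2 * π), u n θ = 2 * π * (Real.log M - Real.log ‖g 0 - a‖) := by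
    intro n
    rw [(show Function.Periodic (u n) (2 * π) from fun θ => by simp only [hu, periodic_circleMap 0 (r n) θ]).intervalIntegral_add_eq c 0, zero_add]
    have hcl : closedBall (0 : ℂ) |r n| ⊆ 𝔻 := by rw [abs_of_pos (hr01 n).1]; exact closedBall_subset_ball (hr01 n).2
    have hav := (((hd.sub_const a).analyticOnNhd isOpen_ball).mono hcl).circleAverage_log_norm_of_ne_zero fun z hz => sub_ne_zero.2 (ha z (hcl hz))
    rw [Real.circleAverage_def, smul_eq_mul] at hav
    have h2 : ∫ θ in (0 : ℝ)..(2 * π), Real.log ‖g (circleMap 0 (r n) θ) - a‖ =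
        2 * π * Real.log ‖g 0 - a‖ := by
      rw [← hav]; field_simp
    have hi2 : IntervalIntegrable (fun θ => Real.log ‖g (circleMap 0 (r n) θ) - a‖) volume 0 (2 * π) := by
      have : Continuous fun θ => Real.log ‖g (circleMap 0 (r n) θ) - a‖ := by
        exact ((continuous_const (y := Real.log M)).sub (huc n)).congr fun θ => by simp [hu]
      exact this.intervalIntegrable _ _
    simp only [hu]
    rw [intervalIntegral.integral_sub intervalIntegrable_const hi2, h2, intervalIntegral.integral_const]
    simp; ring
  set C : ℝ := 2 * π * (Real.log M - Real.log ‖g 0 - a‖) with hC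
  have hl : ∀ n, ∫⁻ θ in Ioc (c : ℝ) (c + 2 * π), ENNReal.ofReal (u n θ) = ENNReal.ofReal C := by
    intro n
    rw [← hInt n, intervalIntegral.integral_of_le (by linarith),
      ofReal_integral_eq_lintegral_ofReal ?_ (Eventually.of_forall (hu0 n))]
    exact ((huc n).integrableOn_Icc).mono_set Ioc_subset_Icc_self
  have hfatou := lintegral_liminf_le' (μ := volume.restrict (Ioc (c : ℝ) (c + 2 * π)))
    (f := fun n θ => ENNReal.ofReal (u n θ))
    (fun n => ((huc n).measurable.ennreal_ofReal).aemeasurable) (u := atTop)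
  simp only [hl, liminf_const] at hfatou
  have hlt := ae_lt_top' (by
    exact (Measurable.liminf fun n => (huc n).measurable.ennreal_ofReal).aemeasurable)
    (hfatou.trans_lt ENNReal.ofReal_lt_top).ne
  filter_upwards [hlt] with θ hθ hcon
  have h1 : Tendsto (fun n => g (circleMap 0 (r n) θ) - a) atTop (𝓝[≠] 0) := by
    refine tendsto_nhdsWithin_iff.2 ⟨?_, Eventually.of_forall fun n => sub_ne_zero.2 (ha _ (hcm n θ))⟩
    have := (hcon.comp hrlim).sub_const a
    rw [sub_self] at this
    refine this.congr fun n => ?_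
    simp [circleMap]
  have h2 : Tendsto (fun n => u n θ) atTop atTop := by
    have h3 := Real.tendsto_log_nhdsGT_zero.comp (tendsto_norm_nhdsNE_zero.comp h1)
    simpa [hu, sub_eq_add_neg] using tendsto_atTop_add_const_left atTop (Real.log M) (tendsto_neg_atBot_atTop.comp h3)
  have h4 := (ENNReal.tendsto_ofReal_atTop.comp h2).liminf_eq
  simp only [Function.comp_def] at h4
  rw [h4] at hθ
  exact lt_irrefl _ hθ

lemma ae_arctan_exp {p : ℝ → Prop} (hp : ∀ᵐ θ : ℝ, p θ) (θ₀ : ℝ) {σ : ℝ} (hσ : σ ≠ 0) :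
    ∀ᵐ s : ℝ, p (θ₀ + σ * Real.arctan (Real.exp s)) := by
  set F : ℝ → ℝ := fun s => θ₀ + σ * Real.arctan (Real.exp s) with hF
  set L : ℝ → ℝ := fun θ => Real.log (Real.tan ((θ - θ₀) / σ)) with hL
  have hnull : volume ({θ | ¬ p θ} ∩ range F) = 0 := measure_mono_null inter_subset_left hp
  have h1 : DifferentiableOn ℝ L ({θ | ¬ p θ} ∩ range F) := by
    rintro _ ⟨-, s, rfl⟩
    have e : (F s - θ₀) / σ = Real.arctan (Real.exp s) := by simp [hF, mul_div_cancel_left₀ _ hσ]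
    refine DifferentiableAt.differentiableWithinAt ?_
    refine DifferentiableAt.log ?_ (by rw [e, Real.tan_arctan]; exact (Real.exp_pos _).ne')
    exact DifferentiableAt.comp (g := Real.tan) (f := fun θ => (θ - θ₀) / σ) (F s)
      (Real.differentiableAt_tan.2 (by rw [e]; exact (Real.cos_arctan_pos _).ne')) (by fun_prop)
  refine measure_mono_null (fun s hs => ?_) (addHaar_image_eq_zero_of_differentiableOn_of_addHaar_eq_zero volume h1 hnull)
  exact ⟨F s, ⟨hs, s, rfl⟩, (show ∀ s, L (F s) = s from fun s => by simp [hL, hF, mul_div_cancel_left₀ _ hσ, Real.tan_arctan]) s⟩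

lemma tendsto_stp_upper (ζ : ℂ) (s : ℝ) : Tendsto (fun t : ℝ => stp ζ ⟨s, t⟩) (𝓝[<] (π / 2))
      (𝓝 (ζ * exp (((-2 * Real.arctan (Real.exp s) : ℝ) : ℂ) * I))) := by
  rw [← stp_upper]
  have h : ContinuousAt (stp ζ) ⟨s, π / 2⟩ :=
    (stp_differentiableAt ζ (by simp only [mem_Icc]; constructor <;> linarith [Real.pi_pos])).continuousAt
  have h2 : Continuous fun t : ℝ => (⟨s, t⟩ : ℂ) := by
    rw [(by funext t; exact mk_eq_add_mul_I s t : (fun t : ℝ => (⟨s, t⟩ : ℂ)) = fun t : ℝ => (s : ℂ) + t * I)]; fun_prop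
  exact (h.comp (f := fun t : ℝ => (⟨s, t⟩ : ℂ)) h2.continuousAt).tendsto.mono_left nhdsWithin_le_nhds

lemma tendsto_stp_lower (ζ : ℂ) (s : ℝ) : Tendsto (fun t : ℝ => stp ζ ⟨s, t⟩) (𝓝[>] (-(π / 2)))
      (𝓝 (ζ * exp (((2 * Real.arctan (Real.exp s) : ℝ) : ℂ) * I))) := by
  rw [← stp_lower]
  have h : ContinuousAt (stp ζ) ⟨s, -(π / 2)⟩ :=
    (stp_differentiableAt ζ (by simp only [mem_Icc]; constructor <;> linarith [Real.pi_pos])).continuousAt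
  have h2 : Continuous fun t : ℝ => (⟨s, t⟩ : ℂ) := by
    rw [(by funext t; exact mk_eq_add_mul_I s t : (fun t : ℝ => (⟨s, t⟩ : ℂ)) = fun t : ℝ => (s : ℂ) + t * I)]; fun_prop
  exact (h.comp (f := fun t : ℝ => (⟨s, t⟩ : ℂ)) h2.continuousAt).tendsto.mono_left nhdsWithin_le_nhds

/-- A homeomorphism `G` from the unit disc onto `U` (with inverse `H`) whose boundary behaviour is
that of a conformal map: radial limits exist almost everywhere and avoid given points, and every
boundary point of the disc is cut off by short cross-cuts. -/
structure DiscModel (U : Set X) (G : ℂ → X) (H : X → ℂ) : Prop where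
  isOpen : IsOpen U
  cont : ContinuousOn G 𝔻
  cont_inv : ContinuousOn H U
  maps : MapsTo G 𝔻 U
  maps_inv : MapsTo H U 𝔻
  left_inv : ∀ z ∈ 𝔻, H (G z) = z
  right_inv : ∀ x ∈ U, G (H x) = x
  rad : ∀ a ∉ U, ∀ᵐ θ : ℝ, ∃ y ≠ a, Tendsto (fun r : ℝ => G (r * exp (θ * I))) (𝓝[<] 1) (𝓝 y)
  arcs : ∀ ζ : ℂ, ‖ζ‖ = 1 → ∀ ε > 0, ∀ N : ℝ, ∀ A : Set X, A.Finite → A ⊆ Uᶜ → ∃ s < N, ∃ y₁ ∉ A, ∃ y₂ ∉ A,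
    Tendsto (fun t : ℝ => G (stp ζ ⟨s, t⟩)) (𝓝[>] (-(π / 2))) (𝓝 y₁) ∧
    Tendsto (fun t : ℝ => G (stp ζ ⟨s, t⟩)) (𝓝[<] (π / 2)) (𝓝 y₂) ∧
    ∀ t ∈ stripI, ∀ t' ∈ stripI, dist (G (stp ζ ⟨s, t⟩)) (G (stp ζ ⟨s, t'⟩)) ≤ ε

lemma mk_cont (s : ℝ) : Continuous fun t : ℝ => (⟨s, t⟩ : ℂ) := by
  rw [(by funext t; exact mk_eq_add_mul_I s t : (fun t : ℝ => (⟨s, t⟩ : ℂ)) = fun t : ℝ => (s : ℂ) + t * I)]; fun_prop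

/-- The conclusion about arcs for univalent functions with the endpoints avoiding finitely many points. -/
lemma arcs_of_univalent {g : ℂ → ℂ} (hd : DifferentiableOn ℂ g 𝔻)
    (hi : InjOn g 𝔻) (hb : g '' 𝔻 ⊆ ball 0 R) (hζ : ‖ζ‖ = 1) {ε : ℝ}
    (hε : 0 < ε) (N : ℝ) {A : Set ℂ} (hA : A.Finite) (hAg : ∀ a ∈ A, ∀ z ∈ 𝔻, g z ≠ a) :
    ∃ s < N, ∃ y₁ ∉ A, ∃ y₂ ∉ A,
    Tendsto (fun t : ℝ => g (stp ζ ⟨s, t⟩)) (𝓝[>] (-(π / 2))) (𝓝 y₁) ∧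
    Tendsto (fun t : ℝ => g (stp ζ ⟨s, t⟩)) (𝓝[<] (π / 2)) (𝓝 y₂) ∧
    ∀ t ∈ stripI, ∀ t' ∈ stripI, dist (g (stp ζ ⟨s, t⟩)) (g (stp ζ ⟨s, t'⟩)) ≤ ε := by
  have hpi := Real.pi_pos
  have hnull : NullArcs g := by
    intro ξ hξ ε hε N
    have ⟨s, h1, _, _, h2⟩ := (frequently_arcs hd hi hb hξ hε N).exists
    exact ⟨s, h1, h2⟩
  have hrad : ∀ᵐ θ : ℝ, ∃ y ∉ A, Tendsto (fun r : ℝ => g (r * exp (θ * I))) (𝓝[<] 1) (𝓝 y) := by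
    filter_upwards [(ae_ball_iff hA.countable).2 fun a ha => ae_radial_limit_ne hd hb (hAg a ha), ae_exists_radial_limit hd hi hb] with θ h2 h3
    have ⟨y, hy⟩ := h3
    exact ⟨y, fun hyA => h2 y hyA hy, hy⟩
  obtain ⟨θ₀, hθ₀⟩ : ∃ θ₀ : ℝ, ζ = exp (θ₀ * I) := ⟨arg ζ, by
    have := norm_mul_exp_arg_mul_I ζ
    rw [hζ] at this; simpa using this.symm⟩
  obtain ⟨s, ⟨hsN, ⟨y₁, hy₁⟩, ⟨y₂, hy₂⟩, hdist⟩, ⟨u₁, hu₁A, hu₁⟩, ⟨u₂, hu₂A, hu₂⟩⟩ :=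
    ((frequently_arcs hd hi hb hζ hε N).and_eventually
      ((ae_arctan_exp hrad θ₀ (two_ne_zero)).and (ae_arctan_exp hrad θ₀ (σ := -2) (by norm_num)))).exists
  have hradc : ∀ θ : ℝ, ContinuousOn (fun r : ℝ => (r : ℂ) * exp (θ * I)) (Ioo (0:ℝ) 1) := fun θ => by fun_prop
  have hradn : ∀ θ : ℝ, ∀ r ∈ Ioo (0:ℝ) 1, ‖(r : ℂ) * exp (θ * I)‖ < 1 := fun θ r hr => by
    rw [norm_mul, norm_exp_ofReal_mul_I, mul_one, norm_real, Real.norm_of_nonneg hr.1.le]; exact hr.2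
  have hradl : ∀ θ : ℝ, Tendsto (fun r : ℝ => (r : ℂ) * exp (θ * I)) (𝓝[<] 1) (𝓝 (exp (θ * I))) := fun θ => by
    simpa using ((by fun_prop : Continuous fun r : ℝ => (r : ℂ) * exp (θ * I)).tendsto 1).mono_left (nhdsWithin_le_nhds (s := Iio 1))
  have hstpc : ContinuousOn (fun t : ℝ => stp ζ ⟨s, t⟩) (Ioo (-(π / 2)) (π / 2)) := fun t ht =>
    ((stp_differentiableAt ζ (w := ⟨s, t⟩) (stripI_subset ht)).continuousAt.comp
      (f := fun t : ℝ => (⟨s, t⟩ : ℂ)) (mk_cont s).continuousAt).continuousWithinAt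
  have hstpn : ∀ t ∈ Ioo (-(π / 2)) (π / 2), ‖stp ζ ⟨s, t⟩‖ < 1 := fun t ht => norm_stp_lt hζ ht
  have e₁ : y₁ = u₁ := by
    have hneg : Tendsto (fun t : ℝ => -t) (𝓝[<] (π / 2)) (𝓝[>] (-(π / 2))) := tendsto_neg_nhdsLT
    refine hnull.limits_eq (q := fun r : ℝ => (r : ℂ) * exp ((θ₀ + 2 * Real.arctan (Real.exp s) : ℝ) * I))
      (p := fun t => stp ζ ⟨s, -t⟩) (a := -(π / 2)) (b := π / 2) (c := 0) (d := 1)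
      (η := exp ((θ₀ + 2 * Real.arctan (Real.exp s) : ℝ) * I)) (by linarith) one_pos
      (norm_exp_ofReal_mul_I _) ?_ ?_ ?_ (hradc _) (hradn _) (hradl _) (hy₁.comp hneg) hu₁
    · exact hstpc.comp continuous_neg.continuousOn fun t ht => ⟨by linarith [ht.2], by linarith [ht.1]⟩
    · exact fun t ht => hstpn _ ⟨by linarith [ht.2], by linarith [ht.1]⟩
    · have := (tendsto_stp_lower ζ s).comp hneg
      rw [hθ₀, ← exp_add] at this
      rw [hθ₀, show ((θ₀ + 2 * Real.arctan (Real.exp s) : ℝ) : ℂ) * I =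
        θ₀ * I + ((2 * Real.arctan (Real.exp s) : ℝ) : ℂ) * I by push_cast; ring]
      exact this
  have e₂ : y₂ = u₂ := by
    refine hnull.limits_eq (q := fun r : ℝ => (r : ℂ) * exp ((θ₀ + -2 * Real.arctan (Real.exp s) : ℝ) * I))
      (p := fun t => stp ζ ⟨s, t⟩) (a := -(π / 2)) (b := π / 2) (c := 0) (d := 1)
      (η := exp ((θ₀ + -2 * Real.arctan (Real.exp s) : ℝ) * I)) (by linarith) one_pos
      (norm_exp_ofReal_mul_I _) hstpc hstpn ?_ (hradc _) (hradn _) (hradl _) hy₂ hu₂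
    have := (tendsto_stp_upper ζ s)
    rw [hθ₀, ← exp_add] at this
    rw [hθ₀, show ((θ₀ + -2 * Real.arctan (Real.exp s) : ℝ) : ℂ) * I =
      θ₀ * I + ((-2 * Real.arctan (Real.exp s) : ℝ) : ℂ) * I by push_cast; ring]
    exact this
  exact ⟨s, hsN, y₁, e₁ ▸ hu₁A, y₂, e₂ ▸ hu₂A, hy₁, hy₂, hdist⟩

/-- A Riemann map composed with a chart of a metric space is a disc model. -/
lemma IsRiemannMap.discModel (h : IsRiemannMap V ψ φ)
    (hV : IsOpen V) (hR : V ⊆ ball 0 R) {e' : X → ℂ} (he : IsOpenEmbedding e)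
    (hee' : ∀ z, e' (e z) = z) :
    DiscModel (e '' V) (e ∘ ψ) (φ ∘ e') := by
  have hmaps := h.maps
  have hinj : InjOn ψ 𝔻 := fun z hz w hw hzw => by rw [← h.left_inv z hz, hzw, h.left_inv w hw]
  have hb : ψ '' 𝔻 ⊆ ball 0 R := by rintro _ ⟨z, hz, rfl⟩; exact hR (hmaps hz)
  refine ⟨he.isOpenMap V hV, he.continuous.comp_continuousOn h.diff.continuousOn, ?_, ?_, ?_, ?_, ?_, ?_, ?_⟩
  · refine h.diff_inv.continuousOn.comp (t := V) ?_ ?_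
    · rintro _ ⟨z, hz, rfl⟩
      refine ContinuousAt.continuousWithinAt ?_
      rw [← he.continuousAt_iff]
      rw [(show e' ∘ e = id from funext hee')]; exact continuousAt_id
    · rintro _ ⟨z, hz, rfl⟩
      rw [hee']; exact hz
  · exact fun z hz => ⟨_, hmaps hz, rfl⟩
  · rintro _ ⟨z, hz, rfl⟩
    simp only [Function.comp, hee']; exact h.maps_inv hz
  · intro z hz
    simp only [Function.comp, hee', h.left_inv z hz]
  · rintro _ ⟨z, hz, rfl⟩
    simp only [Function.comp, hee', h.right_inv z hz]
  · intro a ha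
    by_cases hr : ∃ b, e b = a
    · obtain ⟨b, rfl⟩ := hr
      filter_upwards [ae_exists_radial_limit h.diff hinj hb, ae_radial_limit_ne h.diff hb (a := b)
        (fun z hz hzb => ha ⟨_, hzb ▸ hmaps hz, rfl⟩)] with θ h1 h2
      have ⟨y, hy⟩ := h1
      refine ⟨e y, fun hyb => h2 (he.injective hyb ▸ hy), (he.continuous.tendsto y).comp hy⟩
    · filter_upwards [ae_exists_radial_limit h.diff hinj hb] with θ h1
      have ⟨y, hy⟩ := h1
      exact ⟨e y, fun hyb => hr ⟨y, hyb⟩, (he.continuous.tendsto y).comp hy⟩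
  · intro ζ hζ ε hε N A hA hAU
    have huc := (isCompact_closedBall 0 R).uniformContinuousOn_of_continuous he.continuous.continuousOn
    have ⟨δ, hδ, hδe⟩ := Metric.uniformContinuousOn_iff_le.1 huc ε hε
    have ⟨s, hs, y₁, h₁, y₂, h₂, t₁, t₂, hd⟩ := arcs_of_univalent h.diff hinj hb hζ hδ N
      (A := e ⁻¹' A) (hA.preimage he.injective.injOn)
      (fun a ha z hz hza => hAU ha ⟨_, hza ▸ hmaps hz, rfl⟩)
    refine ⟨s, hs, e y₁, h₁, e y₂, h₂, (he.continuous.tendsto y₁).comp t₁, (he.continuous.tendsto y₂).comp t₂, ?_⟩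
    intro t ht t' ht'
    have hin : ∀ t ∈ stripI, ψ (stp ζ ⟨s, t⟩) ∈ closedBall (0:ℂ) R := fun t ht =>
      ball_subset_closedBall (hR (hmaps (mem_ball_zero_iff.2 (norm_stp_lt hζ ht))))
    exact hδe _ (hin t ht) _ (hin t' ht') (hd t ht t' ht')

lemma exists_continuous_log {E : Type*} [NormedAddCommGroup E] [NormedSpace ℝ E] {g : E → ℂ}
    (hg : Continuous g) (h0 : ∀ x, g x ≠ 0) : ∃ f : E → ℂ, Continuous f ∧ ∀ x, exp (f x) = g x := by
  have hs : IsSimplyConnected (univ : Set E) := by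
    have := (Homeomorph.Set.univ E).contractibleSpace
    show SimplyConnectedSpace _
    infer_instance
  have ⟨f, hf, he⟩ := exists_continuousOn_eqOn_exp_comp hs isOpen_univ hg.continuousOn (by simpa using h0)
  exact ⟨f, continuousOn_univ.1 hf, fun x => he (mem_univ x)⟩

/-- A continuous function whose exponential is constant on a preconnected set is constant. -/
lemma eq_of_exp_eq {α : Type*} [TopologicalSpace α] {S : Set α} (hS : IsPreconnected S) {μ : α → ℂ}
    (hμ : ContinuousOn μ S) (he : ∀ x ∈ S, exp (μ x) = 1) {x y : α} (hx : x ∈ S) (hy : y ∈ S) : μ x = μ y := by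
  have hm : MapsTo (fun x => (μ x).im / (2 * π)) S (range ((↑) : ℤ → ℝ)) := by
    intro x hx
    have ⟨n, hn⟩ := exp_eq_one_iff.1 (he x hx)
    refine ⟨n, ?_⟩
    have h3 := congrArg im hn
    simp at h3
    show (n : ℝ) = (μ x).im / (2 * π)
    rw [h3]; field_simp
  have hre : ∀ x ∈ S, (μ x).re = 0 := by
    intro x hx
    have ⟨n, hn⟩ := exp_eq_one_iff.1 (he x hx)
    rw [hn]; simp
  have hsub : ((fun x => (μ x).im / (2 * π)) '' S).Subsingleton := by
    exact ((countable_range _).isTotallyDisconnected) _ hm.image_subset (hS.image _ ((continuous_im.comp_continuousOn hμ).div_const _))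
  apply Complex.ext
  · rw [hre x hx, hre y hy]
  · exact (div_left_inj' (by positivity)).1 (hsub ⟨x, hx, rfl⟩ ⟨y, hy, rfl⟩)

lemma not_log_on_circle {p : ℂ} (hp : ‖p‖ < R) {μ : ℂ → ℂ} (hμ : ContinuousOn μ (sphere 0 R))
    (he : ∀ z ∈ sphere (0 : ℂ) R, exp (μ z) = z - p) : False := by
  have hR := (norm_nonneg _).trans_lt hp
  have hcm : ∀ t, circleMap 0 R t ∈ sphere (0 : ℂ) R := fun t => circleMap_mem_sphere 0 hR.le t
  have hne : ∀ t, circleMap 0 R t ≠ 0 := fun t => circleMap_ne_center hR.ne'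
  have hslit : ∀ t, 1 - p / circleMap 0 R t ∈ slitPlane := fun t => by
    refine Or.inl ?_
    rw [sub_re, one_re, sub_pos]
    refine (re_le_norm _).trans_lt ?_
    rw [norm_div, norm_circleMap_zero, abs_of_pos hR, div_lt_one hR]; exact hp
  set ν : ℝ → ℂ := fun t => μ (circleMap 0 R t) - log (1 - p / circleMap 0 R t) - t * I - Real.log R with hν
  have hνc : Continuous ν := by
    have h2 := (continuous_const.sub (continuous_const.div (continuous_circleMap 0 R) hne)).clog hslit
    exact (((hμ.comp_continuous (continuous_circleMap 0 R) hcm).sub h2).sub (by fun_prop)).sub continuous_const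
  have hνe : ∀ t ∈ (univ : Set ℝ), exp (ν t) = 1 := by
    intro t _
    have h1 := slitPlane_ne_zero (hslit t)
    rw [hν]; simp only
    rw [exp_sub, exp_sub, exp_sub, he _ (hcm t), exp_log h1, ← ofReal_exp, Real.exp_log hR, div_div, div_div,
      div_eq_one_iff_eq (by refine mul_ne_zero h1 (mul_ne_zero (exp_ne_zero _) (by exact_mod_cast hR.ne')))]
    rw [← (by simp [circleMap, mul_comm] : circleMap 0 R t = exp (t * I) * R), sub_mul, div_mul_cancel₀ _ (hne t), one_mul]
  have h := eq_of_exp_eq isPreconnected_univ hνc.continuousOn hνe (mem_univ 0) (mem_univ (2 * π))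
  have hper : circleMap (0 : ℂ) R (2 * π) = circleMap 0 R 0 := by
    have := periodic_circleMap (0 : ℂ) R 0
    rwa [zero_add] at this
  simp only [hν, hper] at h
  have h2 : ((2 * π : ℝ) : ℂ) * I = 0 := by
    push_cast at h ⊢
    linear_combination h
  simp [I_ne_zero, Real.pi_ne_zero] at h2

/-- `(z - p) / (z - q)` has a continuous logarithm on `K`. -/
def HasLog (K : Set ℂ) (p q : ℂ) : Prop :=
  ∃ μ : ℂ → ℂ, ContinuousOn μ K ∧ ∀ z ∈ K, exp (μ z) = (z - p) / (z - q)

/-- `p` and `q` lie in a common connected subset of the complement of `K`. -/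
def SameComp (K : Set ℂ) (p q : ℂ) : Prop :=
  ∃ C : Set ℂ, IsPreconnected C ∧ C ⊆ Kᶜ ∧ p ∈ C ∧ q ∈ C

lemma HasLog.symm {p q : ℂ} (h : HasLog K p q) : HasLog K q p := by
  have ⟨μ, hμ, he⟩ := h
  exact ⟨fun z => -μ z, hμ.neg, fun z hz => by rw [exp_neg, he z hz, inv_div]⟩

lemma SameComp.symm {p q : ℂ} (h : SameComp K p q) : SameComp K q p := by
  have ⟨C, h1, h2, h3, h4⟩ := h
  exact ⟨C, h1, h2, h4, h3⟩

lemma SameComp.hasLog {p q : ℂ} (hK : IsCompact K) (h : SameComp K p q) : HasLog K p q := by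
  have ⟨C, hC, hCK, hp, hq⟩ := h
  refine hC.induction₂ (fun p q => HasLog K p q) ?_ ?_ ?_ hp hq
  · intro x hx
    rcases K.eq_empty_or_nonempty with rfl | hne
    · exact Eventually.of_forall fun y => ⟨0, continuousOn_empty _, by simp⟩
    refine mem_nhdsWithin_of_mem_nhds ?_
    filter_upwards [ball_mem_nhds x (half_pos ((hK.isClosed.notMem_iff_infDist_pos hne).1 (hCK hx)))] with y hy
    have key : ∀ z ∈ K, (z - x) / (z - y) ∈ slitPlane ∧ z - y ≠ 0 := by
      intro z hz
      have h1 : infDist x K ≤ dist x z := infDist_le_dist_of_mem hz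
      have h2 : dist y x < infDist x K / 2 := hy
      have h3 : dist y x < dist y z := by
        have := dist_triangle x y z
        rw [dist_comm x y] at this; linarith
      have h4 : z - y ≠ 0 := by rw [← norm_pos_iff, ← dist_eq_norm, dist_comm]; exact dist_nonneg.trans_lt h3
      refine ⟨Or.inl ?_, h4⟩
      rw [(by field_simp; ring : (z - x) / (z - y) = 1 - (x - y) / (z - y)), sub_re, one_re, sub_pos]
      refine (re_le_norm _).trans_lt ?_
      rw [norm_div, div_lt_one (norm_pos_iff.2 h4), ← dist_eq_norm, ← dist_eq_norm, dist_comm x, dist_comm z]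
      exact h3
    refine ⟨fun z => log ((z - x) / (z - y)), ?_, fun z hz => exp_log (slitPlane_ne_zero (key z hz).1)⟩
    exact ContinuousOn.clog (ContinuousOn.div (by fun_prop) (by fun_prop) fun z hz => (key z hz).2) fun z hz => (key z hz).1
  · rintro x y w hx hy hw ⟨μ, hμ, he⟩ ⟨ν, hν, he'⟩
    refine ⟨fun z => μ z + ν z, hμ.add hν, fun z hz => ?_⟩
    have : z - y ≠ 0 := fun h => hCK hy (by rw [sub_eq_zero.1 h] at hz; exact hz)
    rw [exp_add, he z hz, he' z hz]
    field_simp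
  · exact fun x y _ _ h => h.symm

/-- Borsuk's criterion, one-sided version: the component of `p` is bounded. -/
lemma sameComp_of_hasLog_of_bounded {p q : ℂ} (hK : IsCompact K) (hpK : p ∉ K)
    (hb : connectedComponentIn Kᶜ p ⊆ ball 0 R) (h : HasLog K p q) : q ∈ connectedComponentIn Kᶜ p := by
  by_contra hq
  set O := connectedComponentIn Kᶜ p with hO
  have hpO : p ∈ O := mem_connectedComponentIn hpK
  have hfr : frontier O ⊆ K := by
    intro x hx
    by_contra hxK
    have h2 := isPreconnected_connectedComponentIn.subset_closure (subset_insert x O)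
        (insert_subset (frontier_subset_closure hx) subset_closure)
    have h3 := h2.subset_connectedComponentIn (mem_insert_of_mem _ hpO)
      (insert_subset hxK (connectedComponentIn_subset _ _))
    have := hx.2
    rw [hK.isClosed.isOpen_compl.connectedComponentIn.interior_eq] at this
    exact this (h3 (mem_insert _ _))
  have ⟨μ, hμ, he⟩ := h
  have ⟨μ', hμ'⟩ := ContinuousMap.exists_restrict_eq hK.isClosed (⟨K.domRestrict μ, hμ.domRestrict⟩ : C(K, ℂ))
  classical
  set F : ℂ → ℂ := fun z => if z ∈ O then (z - q) * exp (μ' z) else z - p with hF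
  have hFc : Continuous F := by
    refine Continuous.if (fun z hz => ?_) (by fun_prop) (by fun_prop)
    have hzK := hfr hz
    have hzq : z - q ≠ 0 := by
      intro h0
      have := he z hzK
      rw [h0, div_zero] at this
      exact exp_ne_zero _ this
    rw [(show ∀ z ∈ K, μ' z = μ z from fun z hz => by exact congrArg (fun f => f ⟨z, hz⟩) hμ') z hzK, he z hzK, mul_div_cancel₀ _ hzq]
  have hF0 : ∀ z, F z ≠ 0 := by
    intro z
    by_cases hz : z ∈ O
    · simp only [hF, if_pos hz]
      exact mul_ne_zero (sub_ne_zero.2 fun h => hq (h ▸ hz)) (exp_ne_zero _)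
    · simp only [hF, if_neg hz]
      exact sub_ne_zero.2 fun h => hz (h ▸ hpO)
  have ⟨ν, hν, hνe⟩ := exists_continuous_log hFc hF0
  refine not_log_on_circle (R := R) (p := p) (mem_ball_zero_iff.1 (hb hpO)) hν.continuousOn fun z hz => ?_
  rw [hνe]
  have : z ∉ O := fun h => by
    have h1 := hb h
    rw [mem_ball_zero_iff] at h1
    rw [mem_sphere_zero_iff_norm] at hz
    linarith
  simp only [hF, if_neg this]

lemma isPreconnected_compl_closedBall_zero (hR : 0 ≤ R) : IsPreconnected (closedBall (0 : ℂ) R)ᶜ := by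
  have h1 : IsPreconnected ((fun p : ℝ × ℂ => (p.1 : ℂ) * p.2) '' (Ioi R ×ˢ 𝕊)) := by
    refine ((isPreconnected_Ioi).prod (isPreconnected_sphere (by simp) 0 1)).image _ ?_
    fun_prop
  convert h1
  ext z
  simp only [mem_compl_iff, mem_closedBall_zero_iff, not_le, mem_image, mem_prod, mem_Ioi,
    mem_sphere_zero_iff_norm, Prod.exists]
  constructor
  · intro h
    refine ⟨‖z‖, z / ‖z‖, ⟨h, ?_⟩, mul_div_cancel₀ _ (by exact_mod_cast (hR.trans_lt h).ne')⟩
    rw [norm_div, norm_real, norm_norm, div_self (hR.trans_lt h).ne']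
  · rintro ⟨r, w, ⟨hr, hw⟩, rfl⟩
    rw [norm_mul, hw, mul_one, norm_real, Real.norm_of_nonneg (hR.trans hr.le)]; exact hr

/-- Borsuk's separation criterion. -/
lemma HasLog.sameComp {p q : ℂ} (hK : IsCompact K) (hpK : p ∉ K) (hqK : q ∉ K)
    (h : HasLog K p q) : SameComp K p q := by
  have ⟨R, hR0, hR⟩ := hK.isBounded.subset_ball_lt 0 0
  have hfin : q ∈ connectedComponentIn Kᶜ p → SameComp K p q := fun h =>
    ⟨_, isPreconnected_connectedComponentIn, connectedComponentIn_subset _ _, mem_connectedComponentIn hpK, h⟩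
  by_cases hp : ∃ x ∈ connectedComponentIn Kᶜ p, x ∉ closedBall (0 : ℂ) R
  · by_cases hq : ∃ x ∈ connectedComponentIn Kᶜ q, x ∉ closedBall (0 : ℂ) R
    · have ⟨x, hx, hx'⟩ := hp
      have ⟨y, hy, hy'⟩ := hq
      apply hfin
      have h1 : (closedBall (0 : ℂ) R)ᶜ ⊆ connectedComponentIn Kᶜ p := by
        rw [connectedComponentIn_eq hx]
        exact (isPreconnected_compl_closedBall_zero hR0.le).subset_connectedComponentIn hx' (compl_subset_compl.2 (hR.trans ball_subset_closedBall))
      rw [connectedComponentIn_eq (h1 hy'), ← (connectedComponentIn_eq hy)]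
      exact mem_connectedComponentIn hqK
    · push Not at hq
      have hq' : connectedComponentIn Kᶜ q ⊆ ball 0 (R + 1) := fun x hx =>
        closedBall_subset_ball (lt_add_one R) (hq x hx)
      exact SameComp.symm ⟨_, isPreconnected_connectedComponentIn, connectedComponentIn_subset _ _,
        mem_connectedComponentIn hqK, sameComp_of_hasLog_of_bounded hK hqK hq' h.symm⟩
  · push Not at hp
    exact hfin (sameComp_of_hasLog_of_bounded hK hpK (fun x hx => closedBall_subset_ball (lt_add_one R) (hp x hx)) h)

/-- Janiszewski's theorem. -/
lemma SameComp.union {A B : Set ℂ} {p q : ℂ} (hA : IsCompact A) (hB : IsCompact B)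
    (hAB : IsPreconnected (A ∩ B)) (h1 : SameComp A p q) (h2 : SameComp B p q) : SameComp (A ∪ B) p q := by
  have ⟨μ, hμ, hμe⟩ := h1.hasLog hA
  have ⟨ν, hν, hνe⟩ := h2.hasLog hB
  have ⟨CA, _, hCA, hpA, hqA⟩ := h1
  have ⟨CB, _, hCB, hpB, hqB⟩ := h2
  have hpA := hCA hpA
  have hqA := hCA hqA
  have hpB := hCB hpB
  have hqB := hCB hqB
  refine HasLog.sameComp (hA.union hB) (by simp [mem_compl_iff] at *; tauto) (by simp [mem_compl_iff] at *; tauto) ?_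
  obtain ⟨c, hc1, hc⟩ : ∃ c : ℂ, exp c = 1 ∧ ∀ z ∈ A ∩ B, μ z = ν z + c := by
    rcases (A ∩ B).eq_empty_or_nonempty with he | ⟨x, hx⟩
    · exact ⟨0, exp_zero, fun z hz => by simp [he] at hz⟩
    · have he1 : ∀ z ∈ A ∩ B, exp (μ z - ν z) = 1 := fun z hz => by
        rw [exp_sub, hμe z hz.1, hνe z hz.2, div_self]
        grind
      refine ⟨μ x - ν x, he1 x hx, fun z hz => ?_⟩
      have := eq_of_exp_eq hAB ((hμ.mono inter_subset_left).sub (hν.mono inter_subset_right)) he1 hz hx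
      simp only [Pi.sub_apply] at this
      linear_combination this
  classical
  refine ⟨fun z => if z ∈ A then μ z else ν z + c, ?_, fun z hz => ?_⟩
  · refine ContinuousOn.union_of_isClosed ?_ ?_ hA.isClosed hB.isClosed
    · exact hμ.congr fun z hz => if_pos hz
    · refine (hν.add_const c).congr fun z hz => ?_
      by_cases hzA : z ∈ A
      · rw [if_pos hzA, hc z ⟨hzA, hz⟩]
      · rw [if_neg hzA]
  · beta_reduce
    by_cases hzA : z ∈ A
    · rw [if_pos hzA, hμe z hzA]
    · rw [if_neg hzA, exp_add, hc1, mul_one, hνe z (hz.resolve_left hzA)]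

/-- An arc does not separate the plane. -/
lemma sameComp_arc {h : ℝ → ℂ} (hc : ContinuousOn h (Icc a b)) (hi : InjOn h (Icc a b)) {p q : ℂ}
    (hp : p ∉ h '' Icc a b) (hq : q ∉ h '' Icc a b) : SameComp (h '' Icc a b) p q := by
  refine HasLog.sameComp (isCompact_Icc.image_of_continuousOn hc) hp hq ?_
  rcases lt_or_ge b a with hab | hab
  · rw [Icc_eq_empty (not_le.2 hab), image_empty]
    exact ⟨0, continuousOn_empty _, by simp⟩
  set k : ℝ → ℂ := fun t => h (projIcc a b hab t) with hk
  have hkm : ∀ t, k t ∈ h '' Icc a b := fun t => ⟨_, (projIcc a b hab t).2, rfl⟩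
  have hkc := hc.comp_continuous (continuous_subtype_val.comp continuous_projIcc) fun t => (projIcc a b hab t).2
  have hqne : ∀ t, k t - q ≠ 0 := fun t h0 => hq (sub_eq_zero.1 h0 ▸ hkm t)
  have ⟨l, hl, hle⟩ := exists_continuous_log (g := fun t => (k t - p) / (k t - q))
    ((hkc.sub continuous_const).div (hkc.sub continuous_const) hqne)
    (fun t => div_ne_zero ((show ∀ t, k t - p ≠ 0 from fun t h0 => hp (sub_eq_zero.1 h0 ▸ hkm t)) t) (hqne t))
  refine ⟨fun z => l (Function.invFunOn h (Icc a b) z), ?_, ?_⟩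
  · refine hl.comp_continuousOn ?_
    have : ContinuousOn (Function.invFunOn h (Icc a b)) (h '' Icc a b) := by
      rw [continuousOn_iff_isClosed]
      intro t ht
      refine ⟨h '' (Icc a b ∩ t), ?_, ?_⟩
      · exact ((isCompact_Icc.inter_right ht).image_of_continuousOn (hc.mono inter_subset_left)).isClosed
      · ext z
        constructor
        · rintro ⟨hz, x, hx, rfl⟩
          rw [mem_preimage, hi.leftInvOn_invFunOn hx] at hz
          exact ⟨⟨x, ⟨hx, hz⟩, rfl⟩, x, hx, rfl⟩
        · rintro ⟨⟨x, hx, rfl⟩, hz⟩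
          refine ⟨?_, hz⟩
          rw [mem_preimage, hi.leftInvOn_invFunOn hx.1]; exact hx.2
    exact this
  · rintro _ ⟨x, hx, rfl⟩
    simp only [hi.leftInvOn_invFunOn hx, hle, hk]
    rw [projIcc_of_mem hab hx]

lemma norm_sub_sq_of_norm_one {x m : ℂ} (hx : ‖x‖ = 1) (hm : ‖m‖ = 1) : ‖x - m‖ ^ 2 = 2 - 2 * (x * conj m).re := by
  rw [← normSq_eq_norm_sq, normSq_sub, normSq_eq_norm_sq, normSq_eq_norm_sq, hx, hm]; ring

namespace DiscModel

variable (h : DiscModel U G H)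
include h

lemma injOn : InjOn G 𝔻 := fun z hz w hw e => by rw [← h.left_inv z hz, e, h.left_inv w hw]

lemma mem_image_iff (hS : S ⊆ 𝔻) {x : X} :
    x ∈ G '' S ↔ x ∈ U ∧ H x ∈ S := by
  constructor
  · rintro ⟨z, hz, rfl⟩
    exact ⟨h.maps (hS hz), by rwa [h.left_inv z (hS hz)]⟩
  · rintro ⟨h1, h2⟩
    exact ⟨_, h2, h.right_inv x h1⟩

lemma isOpen_image (hS : S ⊆ 𝔻) (ho : IsOpen S) :
    IsOpen (G '' S) := by
  rw [(by ext x; exact h.mem_image_iff hS : G '' S = U ∩ H ⁻¹' S)]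
  exact h.cont_inv.isOpen_inter_preimage h.isOpen ho

lemma limit_notMem {ι : Type*} {l : Filter ι} [l.NeBot] {p : ι → ℂ} {y : X}
    (hζ : ‖ζ‖ = 1) (hp : ∀ᶠ i in l, p i ∈ 𝔻) (hpζ : Tendsto p l (𝓝 ζ))
    (hy : Tendsto (fun i => G (p i)) l (𝓝 y)) : y ∉ U := by
  intro hyU
  have h1 := ((h.cont_inv.continuousAt (h.isOpen.mem_nhds hyU)).tendsto).comp hy
  have h3 := h.maps_inv hyU
  rw [tendsto_nhds_unique (h1.congr' (by filter_upwards [hp] with i hi using h.left_inv _ hi)) hpζ, mem_ball_zero_iff, hζ] at h3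
  exact lt_irrefl _ h3

lemma limit_mem_frontier {ι : Type*} {l : Filter ι} [l.NeBot] {p : ι → ℂ} {y : X}
    (hζ : ‖ζ‖ = 1) (hp : ∀ᶠ i in l, p i ∈ 𝔻) (hpζ : Tendsto p l (𝓝 ζ))
    (hy : Tendsto (fun i => G (p i)) l (𝓝 y)) : y ∈ frontier U := by
  refine ⟨mem_closure_of_tendsto hy (by filter_upwards [hp] with i hi using h.maps hi), ?_⟩
  rw [h.isOpen.interior_eq]
  exact h.limit_notMem hζ hp hpζ hy

lemma nullArcs : NullArcs G := fun ζ hζ ε hε N => by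
  have ⟨s, hs, _, _, _, _, _, _, h1⟩ := h.arcs ζ hζ ε hε N ∅ finite_empty (empty_subset _)
  exact ⟨s, hs, h1⟩

lemma ae_rad {A : Set X} (hA : A.Finite) (hAU : A ⊆ Uᶜ) (hne : Uᶜ.Nonempty) :
    ∀ᵐ θ : ℝ, ∃ y ∉ A, Tendsto (fun r : ℝ => G (r * exp (θ * I))) (𝓝[<] 1) (𝓝 y) := by
  have ⟨a, ha⟩ := hne
  filter_upwards [(ae_ball_iff hA.countable).2 fun b hb => h.rad b (hAU hb), h.rad a ha] with θ h2 h3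
  have ⟨y, _, hy⟩ := h3
  refine ⟨y, fun hyA => ?_, hy⟩
  have ⟨y', hne, hy'⟩ := h2 y hyA
  exact hne (tendsto_nhds_unique hy' hy)

/-- Every arc of directions contains a direction with a radial limit outside a finite set. -/
lemma exists_rad {A : Set X} (hA : A.Finite) (hAU : A ⊆ Uᶜ) (hne : Uᶜ.Nonempty)
    (hab : a < b) : ∃ θ ∈ Ioo a b, ∃ y ∉ A, Tendsto (fun r : ℝ => G (r * exp (θ * I))) (𝓝[<] 1) (𝓝 y) := by
  by_contra hcon
  push Not at hcon
  have h0 : volume (Ioo a b) ≤ 0 := by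
    refine (measure_mono ?_).trans_eq (h.ae_rad hA hAU hne)
    intro θ hθ
    grind
  simp at h0
  linarith

lemma exists_cap {a : X} (ha : a ∉ U) {x₀ : ℂ} (hx₀ : ‖x₀‖ = 1) {ε : ℝ} (hε : 0 < ε) :
    ∃ m : ℂ, ∃ k : ℝ, ‖m‖ = 1 ∧ k < (x₀ * conj m).re ∧ 2 - 2 * k < ε ∧ ∃ ρ < 1, ∃ δ > 0, ∀ z ∈ 𝔻,
      ρ ≤ ‖z‖ → dist (G z) a < δ → (z * conj m).re ≠ k * ‖z‖ := by
  have hne : Uᶜ.Nonempty := ⟨a, ha⟩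
  obtain ⟨η, hη, hηc⟩ : ∃ η > 0, ∀ x, |x| < η → 1 - ε / 2 < Real.cos x := by
    have h1 : ∀ᶠ x in 𝓝 (0 : ℝ), 1 - ε / 2 < Real.cos x :=
      Real.continuous_cos.continuousAt.eventually_const_lt (by simp; linarith)
    have ⟨η, hη, h2⟩ := Metric.eventually_nhds_iff.1 h1
    exact ⟨η, hη, fun x hx => h2 (by simpa using hx)⟩
  set η' := min η (π / 2) with hη'
  have hη'0 : 0 < η' := lt_min hη (by positivity)
  set θ₀ := arg x₀
  have hx₀e : x₀ = exp (θ₀ * I) := by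
    have := norm_mul_exp_arg_mul_I x₀
    rw [hx₀] at this; simpa using this.symm
  have ⟨θ₁, hθ₁, y₁, hy₁, hl₁⟩ := h.exists_rad (finite_singleton a) (by simpa using ha) hne (sub_lt_self θ₀ hη'0)
  have ⟨θ₂, hθ₂, y₂, hy₂, hl₂⟩ := h.exists_rad (finite_singleton a) (by simpa using ha) hne (lt_add_of_pos_right θ₀ hη'0)
  have hηle : η' ≤ π / 2 := min_le_right _ _
  have hηle' : η' ≤ η := min_le_left _ _
  set mid := (θ₁ + θ₂) / 2 with hmid
  set hw := (θ₂ - θ₁) / 2 with hhw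
  have hre : ∀ r β : ℝ, ((r : ℂ) * exp (β * I) * conj (exp (mid * I))).re = r * Real.cos (β - mid) := by
    intro r β
    rw [← exp_conj, map_mul, conj_I, conj_ofReal, mul_assoc, ← exp_add, re_ofReal_mul]
    congr 1
    rw [(by push_cast; ring : (β : ℂ) * I + mid * -I = ((β - mid : ℝ) : ℂ) * I), exp_ofReal_mul_I_re]
  have hev : ∀ θ y, y ∉ ({a} : Set X) → Tendsto (fun r : ℝ => G (r * exp (θ * I))) (𝓝[<] 1) (𝓝 y) →
      ∃ ρ < 1, ∃ δ > 0, ∀ r : ℝ, r ∈ Ioo ρ 1 → δ ≤ dist (G (r * exp (θ * I))) a := by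
    intro θ y hy hl
    have hd := dist_pos.2 (by simpa using hy)
    have ⟨ρ, hρ, h2⟩ := (mem_nhdsLT_iff_exists_Ioo_subset).1 ((hl.dist tendsto_const_nhds).eventually (lt_mem_nhds (half_lt_self hd)))
    exact ⟨ρ, hρ, _, half_pos hd, fun r hr => le_of_lt (by simpa using h2 hr)⟩
  have ⟨ρ₁, hρ₁, δ₁, hδ₁, h₁⟩ := hev θ₁ y₁ hy₁ hl₁
  have ⟨ρ₂, hρ₂, δ₂, hδ₂, h₂⟩ := hev θ₂ y₂ hy₂ hl₂
  obtain ⟨ρ, hρm, hρ1⟩ : ∃ ρ, max (max ρ₁ ρ₂) 0 < ρ ∧ ρ < 1 := exists_between (by simp [hρ₁, hρ₂])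
  simp only [max_lt_iff] at hρm
  refine ⟨exp (mid * I), Real.cos hw, norm_exp_ofReal_mul_I _, ?_, ?_, ρ, hρ1, min δ₁ δ₂, lt_min hδ₁ hδ₂, ?_⟩
  · have := hre 1 θ₀
    rw [ofReal_one, one_mul, one_mul] at this
    rw [hx₀e, this, ← Real.cos_abs (θ₀ - mid)]
    refine Real.cos_lt_cos_of_nonneg_of_le_pi_div_two (abs_nonneg _) (by rw [hhw]; linarith [hθ₁.1, hθ₂.2]) ?_
    rw [abs_lt, hhw, hmid]; constructor <;> linarith [hθ₁.2, hθ₂.1]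
  · have := hηc hw (by rw [abs_lt, hhw]; constructor <;> linarith [hθ₁.1, hθ₂.2, hθ₁.2, hθ₂.1])
    linarith
  · intro z hz hρz hdz hEq
    have hze := (norm_mul_exp_arg_mul_I z).symm
    have h3 := hre ‖z‖ (arg z)
    rw [← hze, hEq, mul_comm] at h3
    have ⟨n, hn⟩ := Real.cos_eq_cos_iff.1 (mul_left_cancel₀ (hρm.2.trans_le hρz).ne' h3)
    have hz1 := mem_ball_zero_iff.1 hz
    have hcase : ∀ θ : ℝ, (∃ n : ℤ, arg z = θ + 2 * n * π) → exp (arg z * I) = exp (θ * I) := by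
      rintro θ ⟨n, hn⟩
      rw [hn, exp_eq_exp_iff_exists_int]
      exact ⟨n, by push_cast; ring⟩
    rcases hn with hn | hn
    · rw [hze, hcase θ₂ ⟨n, by rw [hmid, hhw] at hn; linarith⟩] at hdz
      linarith [h₂ ‖z‖ ⟨by linarith, hz1⟩, min_le_right δ₁ δ₂]
    · rw [hze, hcase θ₁ ⟨n, by rw [hmid, hhw] at hn; linarith⟩] at hdz
      linarith [h₁ ‖z‖ ⟨by linarith, hz1⟩, min_le_left δ₁ δ₂]

/-- Connected sets near the circle whose images are close to a point outside `U` are small. -/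
lemma small_of_image_small {a : X} (ha : a ∉ U) {ε : ℝ} (hε : 0 < ε) :
    ∃ ρ < 1, ∃ δ > 0, ∀ β : Set ℂ, IsPreconnected β → β ⊆ 𝔻 → (∀ z ∈ β, ρ ≤ ‖z‖) →
      (∀ z ∈ β, dist (G z) a < δ) → ∀ z ∈ β, ∀ w ∈ β, dist z w ≤ ε := by
  have main : ∃ ρ < 1, ∃ δ > 0, ∀ β : Set ℂ, IsPreconnected β → β ⊆ 𝔻 → (∀ z ∈ β, ρ ≤ ‖z‖) →
      (∀ z ∈ β, dist (G z) a < δ) → (∃ z ∈ β, 0 < ‖z‖ ∧ z / ‖z‖ ∈ 𝕊) → ∀ z ∈ β, ∀ w ∈ β, dist z w ≤ ε := by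
    refine (isCompact_sphere (0 : ℂ) 1).induction_on (p := fun S => ∃ ρ < 1, ∃ δ > 0, ∀ β : Set ℂ, IsPreconnected β →
      β ⊆ 𝔻 → (∀ z ∈ β, ρ ≤ ‖z‖) →
      (∀ z ∈ β, dist (G z) a < δ) → (∃ z ∈ β, 0 < ‖z‖ ∧ z / ‖z‖ ∈ S) → ∀ z ∈ β, ∀ w ∈ β, dist z w ≤ ε) ?_ ?_ ?_ ?_
    · exact ⟨0, zero_lt_one, 1, one_pos, fun β _ _ _ _ ⟨z, _, _, hz⟩ => hz.elim⟩
    · rintro S T hST ⟨ρ, hρ, δ, hδ, hh⟩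
      exact ⟨ρ, hρ, δ, hδ, fun β h1 h2 h3 h4 ⟨z, hz, hz0, hzS⟩ => hh β h1 h2 h3 h4 ⟨z, hz, hz0, hST hzS⟩⟩
    · rintro S T ⟨ρ, hρ, δ, hδ, hh⟩ ⟨ρ', hρ', δ', hδ', hh'⟩
      refine ⟨max ρ ρ', max_lt hρ hρ', min δ δ', lt_min hδ hδ', ?_⟩
      rintro β h1 h2 h3 h4 ⟨z, hz, hz0, hzS | hzT⟩
      · exact hh β h1 h2 (fun z hz => (le_max_left _ _).trans (h3 z hz))
          (fun z hz => (h4 z hz).trans_le (min_le_left _ _)) ⟨z, hz, hz0, hzS⟩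
      · exact hh' β h1 h2 (fun z hz => (le_max_right _ _).trans (h3 z hz))
          (fun z hz => (h4 z hz).trans_le (min_le_right _ _)) ⟨z, hz, hz0, hzT⟩
    · intro x₀ hx₀
      have ⟨m, k, hm, hk, hkε, ρ, hρ, δ, hδ, hh⟩ := h.exists_cap ha (mem_sphere_zero_iff_norm.1 hx₀)
        (show 0 < (ε / 4) ^ 2 by positivity)
      refine ⟨{x | k < (x * conj m).re}, ?_, max ρ (1 - ε / 4), max_lt hρ (by linarith), δ, hδ, ?_⟩
      · refine mem_nhdsWithin_of_mem_nhds ((isOpen_lt continuous_const ?_).mem_nhds hk)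
        fun_prop
      · rintro β h1 h2 h3 h4 ⟨z, hz, hz0, hzk⟩
        have hzk' : k * ‖z‖ < (z * conj m).re := by
          have e : z / ‖z‖ * conj m = ((‖z‖⁻¹ : ℝ) : ℂ) * (z * conj m) := by push_cast; ring
          rw [mem_ofPred_eq, e, re_ofReal_mul, inv_mul_eq_div, lt_div_iff₀ hz0] at hzk
          exact hzk
        have hall : ∀ w ∈ β, k * ‖w‖ < (w * conj m).re := by
          intro w hw
          by_contra hcon
          push Not at hcon
          have hc : ContinuousOn (fun w : ℂ => (w * conj m).re - k * ‖w‖) β := by fun_prop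
          have ⟨v, hv, hv0⟩ := h1.intermediate_value hw hz hc (show (0 : ℝ) ∈ Icc _ _ from ⟨by linarith, by linarith⟩)
          exact hh v (h2 hv) ((le_max_left _ _).trans (h3 v hv)) (h4 v hv) (by simp only at hv0; linarith)
        have hnear : ∀ w ∈ β, dist w m ≤ ε / 2 := by
          intro w hw
          have hw1 := mem_ball_zero_iff.1 (h2 hw)
          have hwρ := (le_max_right _ _).trans (h3 w hw)
          have hw2 := hall w hw
          rcases eq_or_lt_of_le (norm_nonneg w) with hw0 | hw0
          · rw [norm_eq_zero.1 hw0.symm] at hw2; simp at hw2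
          have hw0' : (‖w‖ : ℂ) ≠ 0 := by exact_mod_cast hw0.ne'
          have e1 : ‖w / ‖w‖‖ = 1 := by rw [norm_div, norm_real, norm_norm, div_self hw0.ne']
          have e : w / ‖w‖ * conj m = ((‖w‖⁻¹ : ℝ) : ℂ) * (w * conj m) := by push_cast; ring
          have h6 : k < (w / ‖w‖ * conj m).re := by rw [e, re_ofReal_mul, inv_mul_eq_div, lt_div_iff₀ hw0]; exact hw2
          have h7 : ‖w / ‖w‖ - m‖ ≤ ε / 4 := by
            refine le_of_sq_le_sq ?_ (by positivity)
            rw [norm_sub_sq_of_norm_one e1 hm]; linarith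
          have h8 : ‖w - w / ‖w‖‖ ≤ ε / 4 := by
            have : w - w / ‖w‖ = ((‖w‖ - 1 : ℝ) : ℂ) * (w / ‖w‖) := by push_cast; field_simp
            rw [this, norm_mul, e1, mul_one, norm_real, Real.norm_eq_abs, abs_le]
            constructor <;> linarith
          rw [dist_eq_norm, show w - m = (w - w / ‖w‖) + (w / ‖w‖ - m) by ring]
          exact (norm_add_le _ _).trans (by linarith)
        intro z hz w hw
        exact (dist_triangle_right z w m).trans (by linarith [hnear z hz, hnear w hw])
  have ⟨ρ, hρ, δ, hδ, hh⟩ := main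
  refine ⟨max ρ (1 / 2), max_lt hρ (by norm_num), δ, hδ, fun β h1 h2 h3 h4 z hz => ?_⟩
  refine hh β h1 h2 (fun z hz => (le_max_left _ _).trans (h3 z hz)) h4 ⟨z, hz, ?_, ?_⟩ z hz
  · exact lt_of_lt_of_le (by norm_num) ((le_max_right _ _).trans (h3 z hz))
  · rw [mem_sphere_zero_iff_norm, norm_div, norm_real, norm_norm, div_self (lt_of_lt_of_le (by norm_num) ((le_max_right _ _).trans (h3 z hz))).ne']

lemma eventually_norm_gt {a : X} (ha : a ∉ U) {ι : Type*} {l : Filter ι} {p : ι → ℂ}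
    (hp : ∀ᶠ i in l, p i ∈ 𝔻) (hy : Tendsto (fun i => G (p i)) l (𝓝 a)) {ρ : ℝ} (hρ : ρ < 1) :
    ∀ᶠ i in l, ρ < ‖p i‖ := by
  have hsub : closedBall (0 : ℂ) ρ ⊆ 𝔻 := closedBall_subset_ball hρ
  have hc := (isCompact_closedBall 0 ρ).image_of_continuousOn (h.cont.mono hsub)
  filter_upwards [hp, hy.eventually (hc.isClosed.isOpen_compl.mem_nhds (by rintro ⟨z, hz, rfl⟩; exact ha (h.maps (hsub hz))))] with i h1 h2
  by_contra hcon
  exact h2 ⟨p i, by rw [mem_closedBall_zero_iff]; exact not_lt.1 hcon, rfl⟩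

/-- Paths whose images converge to a boundary point land at a point of the circle. -/
lemma landing {c : ℝ} (hcb : c < b) (hp : ContinuousOn p (Ioo c b)) (hpD : ∀ t ∈ Ioo c b, p t ∈ 𝔻) {a : X} (ha : a ∉ U)
    (hy : Tendsto (fun t => G (p t)) (𝓝[<] b) (𝓝 a)) : ∃ ζ : ℂ, ‖ζ‖ = 1 ∧ Tendsto p (𝓝[<] b) (𝓝 ζ) := by
  have hev : ∀ᶠ t in 𝓝[<] b, p t ∈ 𝔻 := by filter_upwards [Ioo_mem_nhdsLT hcb] with t ht using hpD t ht
  have hcau : Cauchy (map p (𝓝[<] b)) := by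
    rw [Metric.cauchy_iff]
    refine ⟨inferInstance, fun ε hε => ?_⟩
    have ⟨ρ, hρ, δ, hδ, hh⟩ := h.small_of_image_small ha (half_pos hε)
    have h1 := (h.eventually_norm_gt ha hev hy hρ).and ((hy.eventually (ball_mem_nhds a hδ)).and (Ioo_mem_nhdsLT hcb))
    have ⟨c', hc', h2⟩ := (mem_nhdsLT_iff_exists_Ioo_subset).1 h1
    refine ⟨p '' Ioo c' b, image_mem_map (Ioo_mem_nhdsLT hc'), ?_⟩
    intro x hx y hy
    refine (hh (p '' Ioo c' b) (isPreconnected_Ioo.image _ (hp.mono fun t ht => (h2 ht).2.2)) ?_ ?_ ?_ x hx y hy).trans_lt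
      (half_lt_self hε)
    · rintro _ ⟨t, ht, rfl⟩; exact hpD t (h2 ht).2.2
    · rintro _ ⟨t, ht, rfl⟩; exact (h2 ht).1.le
    · rintro _ ⟨t, ht, rfl⟩; exact (h2 ht).2.1
  have ⟨ζ, hζ⟩ := CompleteSpace.complete hcau
  refine ⟨ζ, ?_, hζ⟩
  have hζ' : Tendsto p (𝓝[<] b) (𝓝 ζ) := hζ
  refine le_antisymm (le_of_tendsto hζ'.norm (hev.mono fun t ht => (mem_ball_zero_iff.1 ht).le)) ?_
  refine le_of_forall_lt fun ρ hρ => ?_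
  have ⟨ρ', h1, h2⟩ := exists_between hρ
  exact h1.trans_le (ge_of_tendsto hζ'.norm ((h.eventually_norm_gt ha hev hy h2).mono fun t ht => ht.le))

lemma landing_right {c : ℝ} (hcb : c < b) (hp : ContinuousOn p (Ioo c b))
    (hpD : ∀ t ∈ Ioo c b, p t ∈ 𝔻) {a : X} (ha : a ∉ U)
    (hy : Tendsto (fun t => G (p t)) (𝓝[>] c) (𝓝 a)) : ∃ ζ : ℂ, ‖ζ‖ = 1 ∧ Tendsto p (𝓝[>] c) (𝓝 ζ) := by
  have ⟨ζ, hζ, hl⟩ := h.landing (p := fun t => p (-t)) (c := -b) (b := -c) (by linarith)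
    (hp.comp continuous_neg.continuousOn fun t ht => ⟨by linarith [ht.2], by linarith [ht.1]⟩)
    (fun t ht => hpD _ ⟨by linarith [ht.2], by linarith [ht.1]⟩) ha (hy.comp tendsto_neg_nhdsLT_neg)
  refine ⟨ζ, hζ, ?_⟩
  simpa [Function.comp_def] using hl.comp tendsto_neg_nhdsGT

end DiscModel

lemma isPreconnected_circle : IsPreconnected 𝕊 := isPreconnected_sphere (by simp) 0 1

namespace DiscModel

variable (h : DiscModel U G H)
include h

lemma isOpen_diff_crossCut {g : ℝ → X} (hg : ContinuousOn g (Icc 0 1))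
    (h0 : g 0 ∈ frontier U) (h1 : g 1 ∈ frontier U) : IsOpen (U \ g '' Ioo 0 1) := by
  have hfr : ∀ x ∈ frontier U, x ∉ U := fun x hx hxU => by
    have := hx.2; rw [h.isOpen.interior_eq] at this; exact this hxU
  rw [(by grind : U \ g '' Ioo 0 1 = U \ g '' Icc 0 1)]
  exact h.isOpen.sdiff (isCompact_Icc.image_of_continuousOn hg).isClosed

set_option maxHeartbeats 1000000 in
/-- Both sides of a cross-cut accumulate on the whole cross-cut. -/
lemma crossCut_subset_closure [LocallyConnectedSpace X] {γ D : Set X} (hγ : IsCrossCut U γ)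
    (hD : IsCompOf (U \ γ) D) : γ ⊆ closure D := by
  obtain ⟨g, hg, hgi, hgU, hg0, hg1, rfl, D₁, D₂, hcomps, -, -⟩ := hγ
  have hDo := hD.isOpen (h.isOpen_diff_crossCut hg hg0 hg1)
  have hfr : ∀ x ∈ frontier U, x ∉ U := fun x hx hxU => by
    have := hx.2; rw [h.isOpen.interior_eq] at this; exact this hxU
  obtain ⟨D', hD', hne⟩ : ∃ D', IsCompOf (U \ g '' Ioo 0 1) D' ∧ D' ≠ D := by
    by_cases e : D₁ = D
    · exact ⟨D₂, hcomps.2.1, fun e' => hcomps.2.2.1 (e.trans e'.symm)⟩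
    · exact ⟨D₁, hcomps.1, e⟩
  have ⟨d, hd⟩ := hD.nonempty
  have ⟨d', hd'⟩ := hD'.nonempty
  rintro _ ⟨t₀, ht₀, rfl⟩
  by_contra hcl
  obtain ⟨t₁, t₂, ht₁, ht₁₀, ht₀₂, ht₂, hmiss⟩ : ∃ t₁ t₂, 0 < t₁ ∧ t₁ < t₀ ∧ t₀ < t₂ ∧ t₂ < 1 ∧
      ∀ t ∈ Icc t₁ t₂, g t ∉ closure D := by
    have hc := hg.continuousAt (Icc_mem_nhds ht₀.1 ht₀.2)
    have ⟨ε, hε, h2⟩ := Metric.eventually_nhds_iff.1 ((hc.eventually (isClosed_closure.isOpen_compl.mem_nhds hcl)).and (Ioo_mem_nhds ht₀.1 ht₀.2))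
    have hin : ∀ t, |t - t₀| < ε → g t ∉ closure D ∧ t ∈ Ioo (0 : ℝ) 1 := fun t ht => h2 ht
    refine ⟨t₀ - ε / 2, t₀ + ε / 2, ?_, by linarith, by linarith, ?_, ?_⟩
    · exact (hin (t₀ - ε / 2) (by rw [abs_lt]; constructor <;> linarith)).2.1
    · exact (hin (t₀ + ε / 2) (by rw [abs_lt]; constructor <;> linarith)).2.2
    · intro t ht
      exact (hin t (by rw [abs_lt]; constructor <;> linarith [ht.1, ht.2])).1
  have hpc : ContinuousOn (fun t => H (g t)) (Ioo 0 1) := h.cont_inv.comp (hg.mono Ioo_subset_Icc_self) hgU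
  have hpD : ∀ t ∈ Ioo (0 : ℝ) 1, H (g t) ∈ 𝔻 := fun t ht => h.maps_inv (hgU t ht)
  have hGp : ∀ t ∈ Ioo (0 : ℝ) 1, G (H (g t)) = g t := fun t ht => h.right_inv _ (hgU t ht)
  have ⟨ζ₀, hζ₀, hl₀⟩ := h.landing_right zero_lt_one hpc hpD (hfr _ hg0) (by
    refine ((hg 0 (left_mem_Icc.2 zero_le_one)).mono_left (nhdsWithin_le_of_mem (Icc_mem_nhdsGT zero_lt_one))).congr' ?_
    filter_upwards [Ioo_mem_nhdsGT (zero_lt_one' ℝ)] with t ht using (hGp t ht).symm)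
  have ⟨ζ₁, hζ₁, hl₁⟩ := h.landing zero_lt_one hpc hpD (hfr _ hg1) (by
    refine ((hg 1 (right_mem_Icc.2 zero_le_one)).mono_left (nhdsWithin_le_of_mem (Icc_mem_nhdsLT zero_lt_one))).congr' ?_
    filter_upwards [Ioo_mem_nhdsLT (zero_lt_one' ℝ)] with t ht using (hGp t ht).symm)
  set q := extendFrom (Ioo (0 : ℝ) 1) (fun t => H (g t)) with hq
  have hqc := continuousOn_Icc_extendFrom_Ioo hpc hl₀ hl₁
  have hq0 : q 0 = ζ₀ := eq_lim_at_left_extendFrom_Ioo zero_lt_one hl₀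
  have hq1 : q 1 = ζ₁ := eq_lim_at_right_extendFrom_Ioo zero_lt_one hl₁
  have hqt : ∀ t ∈ Ioo (0 : ℝ) 1, q t = H (g t) := fun t ht => extendFrom_eq (subset_closure ht) (hpc t ht)
  have hqD : ∀ t ∈ Ioo (0 : ℝ) 1, q t ∉ 𝕊 := fun t ht hs => by
    have := hpD t ht
    rw [← hqt t ht, mem_ball_zero_iff] at this
    rw [mem_sphere_zero_iff_norm] at hs; linarith
  have hq0s : q 0 ∈ 𝕊 := by rw [hq0]; simpa using hζ₀
  have hq1s : q 1 ∈ 𝕊 := by rw [hq1]; simpa using hζ₁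
  have hqi : ∀ s ∈ Ioo (0 : ℝ) 1, ∀ t ∈ Ioo (0 : ℝ) 1, q s = q t → s = t := by
    intro s hs t ht e
    rw [hqt s hs, hqt t ht] at e
    apply hgi hs ht
    rw [← hGp s hs, e, hGp t ht]
  -- points to be joined
  have hdU := hD.subset hd
  have hdU' := hD'.subset hd'
  have hout : ∀ x : X, (x ∈ U ∧ x ∉ g '' Ioo 0 1) → ∀ S ⊆ Icc (0 : ℝ) 1, H x ∉ q '' S := by
    rintro x ⟨hxU, hx⟩ S hS ⟨t, htS, ht⟩
    have hxb := h.maps_inv hxU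
    have ht1 := hS htS
    have hns : H x ∉ 𝕊 := fun hs => by
      rw [mem_ball_zero_iff] at hxb
      rw [mem_sphere_zero_iff_norm] at hs; linarith
    rcases eq_or_lt_of_le ht1.1 with rfl | h2
    · exact hns (ht ▸ hq0s)
    rcases eq_or_lt_of_le ht1.2 with rfl | h3
    · exact hns (ht ▸ hq1s)
    refine hx ⟨t, ⟨h2, h3⟩, ?_⟩
    rw [hqt t ⟨h2, h3⟩] at ht
    rw [← hGp t ⟨h2, h3⟩, ht, h.right_inv x hxU]
  have hcirc : SameComp 𝕊 (H d) (H d') := by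
    refine ⟨𝔻, (convex_ball 0 1).isPreconnected, fun z hz hs => ?_, h.maps_inv hdU.1, h.maps_inv hdU'.1⟩
    rw [mem_ball_zero_iff] at hz
    rw [mem_sphere_zero_iff_norm] at hs; linarith
  have hA : Icc 0 t₁ ⊆ Icc (0 : ℝ) 1 := Icc_subset_Icc le_rfl (by linarith)
  have hB : Icc t₂ 1 ⊆ Icc (0 : ℝ) 1 := Icc_subset_Icc (by linarith) le_rfl
  have hsA : ∀ t ∈ Icc 0 t₁, q t ∈ 𝕊 → t = 0 := fun t ht hs => by grind
  have hsB : ∀ t ∈ Icc t₂ 1, q t ∈ 𝕊 → t = 1 := fun t ht hs => by grind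
  have hiA : InjOn q (Icc 0 t₁) := by
    intro s hs t ht e
    by_cases h1 : q s ∈ 𝕊
    · rw [hsA s hs h1, hsA t ht (e ▸ h1)]
    · refine hqi s ⟨lt_of_le_of_ne hs.1 ?_, by linarith [hs.2]⟩ t ⟨lt_of_le_of_ne ht.1 ?_, by linarith [ht.2]⟩ e
      · rintro rfl; exact h1 hq0s
      · rintro rfl; exact (e ▸ h1) hq0s
  have hiB : InjOn q (Icc t₂ 1) := by
    intro s hs t ht e
    by_cases h1 : q s ∈ 𝕊
    · rw [hsB s hs h1, hsB t ht (e ▸ h1)]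
    · refine hqi s ⟨by linarith [hs.1], lt_of_le_of_ne hs.2 ?_⟩ t ⟨by linarith [ht.1], lt_of_le_of_ne ht.2 ?_⟩ e
      · rintro rfl; exact h1 hq1s
      · rintro rfl; exact (e ▸ h1) hq1s
  have hcA := isCompact_Icc.image_of_continuousOn (hqc.mono hA)
  have hcB := isCompact_Icc.image_of_continuousOn (hqc.mono hB)
  have hS : IsCompact 𝕊 := isCompact_sphere 0 1
  have hKA : SameComp (𝕊 ∪ q '' Icc 0 t₁) (H d) (H d') := by
    refine hcirc.union hS hcA ?_ (sameComp_arc (hqc.mono hA) hiA (hout d hdU _ hA) (hout d' hdU' _ hA))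
    refine Set.Subsingleton.isPreconnected ?_
    rintro _ ⟨hs, t, ht, rfl⟩ _ ⟨hs', t', ht', rfl⟩
    rw [hsA t ht hs, hsA t' ht' hs']
  have hKB : SameComp (𝕊 ∪ q '' Icc t₂ 1) (H d) (H d') := by
    refine hcirc.union hS hcB ?_ (sameComp_arc (hqc.mono hB) hiB (hout d hdU _ hB) (hout d' hdU' _ hB))
    refine Set.Subsingleton.isPreconnected ?_
    rintro _ ⟨hs, t, ht, rfl⟩ _ ⟨hs', t', ht', rfl⟩
    rw [hsB t ht hs, hsB t' ht' hs']
  have hK := hKA.union (hS.union hcA) (hS.union hcB) (by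
    have : (𝕊 ∪ q '' Icc 0 t₁) ∩ (𝕊 ∪ q '' Icc t₂ 1) = 𝕊 := by
      rw [← union_inter_distrib_left, union_eq_left]
      rintro _ ⟨⟨s, hs, rfl⟩, t, ht, e⟩
      by_contra hns
      have := hqi t ⟨by linarith [ht.1], lt_of_le_of_ne ht.2 (by rintro rfl; exact (e ▸ hns) hq1s)⟩
        s ⟨lt_of_le_of_ne hs.1 (by rintro rfl; exact hns hq0s), by linarith [hs.2]⟩ e
      linarith [ht.1, hs.2]
    rw [this]; exact isPreconnected_circle) hKB
  have ⟨C, hC, hCK, hdC, hdC'⟩ := hK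
  have hCb : C ⊆ 𝔻 := by
    refine hC.subset_left_of_subset_union isOpen_ball (isClosed_closedBall (x := (0 : ℂ)) (ε := 1)).isOpen_compl ?_ ?_
      ⟨_, hdC, h.maps_inv hdU.1⟩
    · exact disjoint_compl_right.mono_left ball_subset_closedBall
    · intro z hz
      by_cases h1 : z ∈ 𝔻bar
      · refine Or.inl ?_
        have : z ∉ 𝕊 := fun hs => hCK hz (Or.inl (Or.inl hs))
        rw [mem_closedBall_zero_iff] at h1
        rw [mem_sphere_zero_iff_norm] at this
        rw [mem_ball_zero_iff]
        exact lt_of_le_of_ne h1 this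
      · exact Or.inr h1
  have hsub : G '' C ⊆ D := by
    refine (hC.image _ (h.cont.mono hCb)).subset_of_closure_inter_subset hDo ⟨d, ⟨_, hdC, h.right_inv d hdU.1⟩, hd⟩ ?_
    rintro x ⟨hxcl, z, hz, rfl⟩
    refine hD.closure_inter_subset ⟨hxcl, h.maps (hCb hz), ?_⟩
    rintro ⟨t, ht, e⟩
    have hzq : q t = z := by rw [hqt t ht, e, h.left_inv z (hCb hz)]
    grind
  have hd'D := hsub ⟨_, hdC', h.right_inv d' hdU'.1⟩
  apply hne
  refine Subset.antisymm (hD.subset_of_preconnected hD'.isPreconnected hD'.subset ⟨d', hd', hd'D⟩)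
    (hD'.subset_of_preconnected hD.isPreconnected hD.subset ⟨d', hd'D, hd'⟩)

end DiscModel

/-- The level of a point of `U` in the strip coordinates at `ζ`. -/
def stripLevel {X : Type*} (H : X → ℂ) (ζ : ℂ) (x : X) : ℝ := (stpInv ζ (H x)).re

/-- The part of `U` below level `s` in the strip coordinates at `ζ`. -/
def lowerPart {X : Type*} (U : Set X) (H : X → ℂ) (ζ : ℂ) (s : ℝ) : Set X := {x ∈ U | stripLevel H ζ x < s}

/-- The part of `U` above level `s` in the strip coordinates at `ζ`. -/
def upperPart {X : Type*} (U : Set X) (H : X → ℂ) (ζ : ℂ) (s : ℝ) : Set X := {x ∈ U | s < stripLevel H ζ x}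

/-- The part of `U` at level `s` in the strip coordinates at `ζ`. -/
def levelCut {X : Type*} (U : Set X) (H : X → ℂ) (ζ : ℂ) (s : ℝ) : Set X := {x ∈ U | stripLevel H ζ x = s}

/-- Data of a shrinking sequence of level cross-cuts at `ζ`. -/
structure EndSeq (G : ℂ → X) (ζ : ℂ) (s : ℕ → ℝ) (y z : ℕ → X) : Prop where
  lo : ∀ n, Tendsto (fun t : ℝ => G (stp ζ ⟨s n, t⟩)) (𝓝[>] (-(π / 2))) (𝓝 (y n))
  hi : ∀ n, Tendsto (fun t : ℝ => G (stp ζ ⟨s n, t⟩)) (𝓝[<] (π / 2)) (𝓝 (z n))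
  anti : ∀ m n, m < n → s n < s m - 1
  small : ∀ ε > 0, ∃ N, ∀ n ≥ N, ∀ t ∈ stripI, ∀ t' ∈ stripI, dist (G (stp ζ ⟨s n, t⟩)) (G (stp ζ ⟨s n, t'⟩)) ≤ ε
  disj : ∀ m n, m ≠ n → Disjoint ({y m, z m} : Set X) {y n, z n}

lemma EndSeq.exists_lt {s : ℕ → ℝ} {y z : ℕ → X}
    (h : EndSeq G ζ s y z) (N : ℝ) : ∃ n₀, ∀ n ≥ n₀, s n < N := by
  have h1 : ∀ n : ℕ, s n ≤ s 0 - n := by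
    intro n
    induction n with
    | zero => simp
    | succ n ih => push_cast; linarith [h.anti n (n + 1) (Nat.lt_succ_self n)]
  have ⟨n₀, hn₀⟩ := exists_nat_gt (s 0 - N)
  refine ⟨n₀, fun n hn => ?_⟩
  linarith [(by exact_mod_cast hn : (n₀ : ℝ) ≤ n), h1 n]

lemma norm_sub_lt_of_level (hζ : ‖ζ‖ = 1) (hz : ‖z‖ < 1) (hs : (stpInv ζ z).re < s) :
    ‖z - ζ‖ < 2 * Real.exp s := by
  have h2 := norm_pos_iff.2 (add_ne_zero_of_norm hζ hz)
  rw [stpInv_re, Real.log_lt_iff_lt_exp (div_pos (norm_pos_iff.2 (sub_ne_zero_of_norm hζ hz)) h2), div_lt_iff₀ h2] at hs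
  rw [norm_sub_rev]
  have h3 : ‖ζ + z‖ ≤ 2 := (norm_add_le _ _).trans (by linarith)
  nlinarith [Real.exp_pos s]

lemma level_lt_iff (hζ : ‖ζ‖ = 1) (hz : ‖z‖ < 1) :
    (stpInv ζ z).re < s ↔ ‖ζ - z‖ < Real.exp s * ‖ζ + z‖ := by
  have h2 := norm_pos_iff.2 (add_ne_zero_of_norm hζ hz)
  rw [stpInv_re, Real.log_lt_iff_lt_exp (div_pos (norm_pos_iff.2 (sub_ne_zero_of_norm hζ hz)) h2), div_lt_iff₀ h2]

lemma lt_level_iff (hζ : ‖ζ‖ = 1) (hz : ‖z‖ < 1) :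
    s < (stpInv ζ z).re ↔ Real.exp s * ‖ζ + z‖ < ‖ζ - z‖ := by
  have h2 := norm_pos_iff.2 (add_ne_zero_of_norm hζ hz)
  rw [stpInv_re, Real.lt_log_iff_exp_lt (div_pos (norm_pos_iff.2 (sub_ne_zero_of_norm hζ hz)) h2), lt_div_iff₀ h2]

namespace DiscModel

variable (h : DiscModel U G H)
include h

lemma norm_lt {x : X} (hx : x ∈ U) : ‖H x‖ < 1 := mem_ball_zero_iff.1 (h.maps_inv hx)

lemma exists_frontier (hne : Uᶜ.Nonempty) {A : Set X} (hA : A.Finite) (hAU : A ⊆ Uᶜ)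
    {O : Set ℂ} (hO : IsOpen O) (hζ : ‖ζ‖ = 1) (hζO : ζ ∈ O) :
    (frontier (G '' (O ∩ 𝔻)) ∩ (frontier U \ A)).Nonempty := by
  have hζe : exp ((arg ζ : ℝ) * I) = ζ := by
    have := norm_mul_exp_arg_mul_I ζ
    rw [hζ] at this; simpa using this
  have hnh : ∀ᶠ θ : ℝ in 𝓝 (arg ζ), exp (θ * I) ∈ O := by
    apply (by fun_prop : Continuous fun θ : ℝ => exp (θ * I)).continuousAt.eventually_mem
    rw [hζe]; exact hO.mem_nhds hζO
  have ⟨ε, hε, hε'⟩ := Metric.eventually_nhds_iff.1 hnh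
  have ⟨θ, hθ, y, hy, hl⟩ := h.exists_rad hA hAU hne (show arg ζ < arg ζ + ε by linarith)
  have hθO : exp (θ * I) ∈ O := hε' (by rw [Real.dist_eq, abs_lt]; constructor <;> linarith [hθ.1, hθ.2])
  have hrad : Tendsto (fun r : ℝ => (r : ℂ) * exp (θ * I)) (𝓝[<] 1) (𝓝 (exp (θ * I))) := by
    simpa using ((by fun_prop : Continuous fun r : ℝ => (r : ℂ) * exp (θ * I)).tendsto 1).mono_left (nhdsWithin_le_nhds (s := Iio 1))
  have hball : ∀ᶠ r : ℝ in 𝓝[<] 1, (r : ℂ) * exp (θ * I) ∈ 𝔻 := by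
    filter_upwards [Ioo_mem_nhdsLT (zero_lt_one' ℝ)] with r hr
    rw [mem_ball_zero_iff, norm_mul, norm_exp_ofReal_mul_I, mul_one, norm_real, Real.norm_of_nonneg hr.1.le]
    exact hr.2
  refine ⟨y, ⟨?_, fun hyi => ?_⟩, h.limit_mem_frontier (norm_exp_ofReal_mul_I θ) hball hrad hl, hy⟩
  · refine mem_closure_of_tendsto hl ?_
    filter_upwards [hball, hrad.eventually (hO.mem_nhds hθO)] with r h1 h2 using ⟨_, ⟨h2, h1⟩, rfl⟩
  · obtain ⟨z, hz, rfl⟩ := interior_subset hyi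
    exact (h.limit_notMem (norm_exp_ofReal_mul_I θ) hball hrad hl) (h.maps hz.2)

lemma frontier_notMem {x : X} (hx : x ∈ frontier U) : x ∉ U := fun hxU => by
  have := hx.2; rw [h.isOpen.interior_eq] at this; exact this hxU

section
variable (hζ : ‖ζ‖ = 1)
include hζ

lemma strip_mem (hw : w.im ∈ stripI) : G (stp ζ w) ∈ U := h.maps (mem_ball_zero_iff.2 (norm_stp_lt hζ hw))

lemma level_strip (hw : w.im ∈ stripI) :
    stripLevel H ζ (G (stp ζ w)) = w.re := by
  rw [stripLevel, h.left_inv _ (mem_ball_zero_iff.2 (norm_stp_lt hζ hw)), stpInv_stp hζ hw]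

lemma strip_inv {x : X} (hx : x ∈ U) :
    G (stp ζ (stpInv ζ (H x))) = x := by
  rw [stp_stpInv hζ (h.norm_lt hx), h.right_inv x hx]

lemma strip_continuousOn : ContinuousOn (fun w => G (stp ζ w)) {w | w.im ∈ stripI} :=
  h.cont.comp (fun w hw => (stp_differentiableAt ζ (stripI_subset hw)).continuousAt.continuousWithinAt)
    fun w hw => mem_ball_zero_iff.2 (norm_stp_lt hζ hw)

lemma level_continuousOn : ContinuousOn (stripLevel H ζ) U := by
  have h1 : ContinuousOn (stpInv ζ) 𝔻 := fun z hz =>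
    (stpInv_differentiableAt hζ (mem_ball_zero_iff.1 hz)).continuousAt.continuousWithinAt
  exact continuous_re.comp_continuousOn (h1.comp h.cont_inv h.maps_inv)

lemma lowerPart_isOpen (s : ℝ) : IsOpen (lowerPart U H ζ s) :=
  (h.level_continuousOn hζ).isOpen_inter_preimage h.isOpen isOpen_Iio

lemma upperPart_isOpen (s : ℝ) : IsOpen (upperPart U H ζ s) :=
  (h.level_continuousOn hζ).isOpen_inter_preimage h.isOpen isOpen_Ioi

lemma image_strip (S : Set ℝ) :
    {x ∈ U | stripLevel H ζ x ∈ S} = (fun w => G (stp ζ w)) '' (S ×ℂ stripI) := by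
  ext x
  constructor
  · rintro ⟨hx, hs⟩
    exact ⟨_, ⟨hs, stpInv_im hζ (h.norm_lt hx)⟩, h.strip_inv hζ hx⟩
  · rintro ⟨w, ⟨hw, hw'⟩, rfl⟩
    refine ⟨h.strip_mem hζ hw', ?_⟩
    simpa [h.level_strip hζ hw'] using hw

lemma isPreconnected_strip {S : Set ℝ} (hS : Convex ℝ S) :
    IsPreconnected {x ∈ U | stripLevel H ζ x ∈ S} := by
  rw [h.image_strip hζ]
  refine IsPreconnected.image ?_ _ ((h.strip_continuousOn hζ).mono fun w hw => hw.2)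
  exact ((hS.linear_preimage reLm).inter ((convex_Ioo _ _).linear_preimage imLm)).isPreconnected

lemma lowerPart_isPreconnected (s : ℝ) : IsPreconnected (lowerPart U H ζ s) := h.isPreconnected_strip hζ (convex_Iio s)

lemma upperPart_isPreconnected (s : ℝ) : IsPreconnected (upperPart U H ζ s) := h.isPreconnected_strip hζ (convex_Ioi s)

lemma exists_level (s : ℝ) : ∃ x ∈ U, stripLevel H ζ x = s := by
  have h0 : (⟨s, 0⟩ : ℂ).im ∈ stripI := ⟨by show -(π / 2) < 0; linarith [Real.pi_pos], by show 0 < π / 2; linarith [Real.pi_pos]⟩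
  exact ⟨_, h.strip_mem hζ h0, h.level_strip hζ h0⟩

lemma lowerPart_nonempty (s : ℝ) : (lowerPart U H ζ s).Nonempty := by
  have ⟨x, hx, e⟩ := h.exists_level hζ (s - 1)
  exact ⟨x, hx, by rw [e]; linarith⟩

lemma upperPart_nonempty (s : ℝ) : (upperPart U H ζ s).Nonempty := by
  have ⟨x, hx, e⟩ := h.exists_level hζ (s + 1)
  exact ⟨x, hx, by rw [e]; linarith⟩

lemma hasTwoComps_cut (s : ℝ) :
    HasTwoComps (U \ levelCut U H ζ s) (lowerPart U H ζ s) (upperPart U H ζ s) := by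
  have : U \ levelCut U H ζ s = lowerPart U H ζ s ∪ upperPart U H ζ s := by
    ext x
    constructor
    · rintro ⟨h1, h2⟩
      rcases lt_trichotomy (stripLevel H ζ x) s with h3 | h3 | h3
      · exact Or.inl ⟨h1, h3⟩
      · exact (h2 ⟨h1, h3⟩).elim
      · exact Or.inr ⟨h1, h3⟩
    · rintro (⟨h1, h2⟩ | ⟨h1, h2⟩)
      · exact ⟨h1, fun h3 => h2.ne h3.2⟩
      · exact ⟨h1, fun h3 => h2.ne' h3.2⟩
  rw [this]
  refine hasTwoComps_of_open (h.lowerPart_isOpen hζ s) (h.upperPart_isOpen hζ s) ?_ (h.lowerPart_isPreconnected hζ s)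
    (h.upperPart_isPreconnected hζ s) (h.lowerPart_nonempty hζ s) (h.upperPart_nonempty hζ s)
  exact disjoint_left.2 fun x h1 h2 => lt_asymm h1.2 h2.2

lemma lowerPart_eq (s : ℝ) :
    lowerPart U H ζ s = G '' ({z | ‖ζ - z‖ < Real.exp s * ‖ζ + z‖} ∩ 𝔻) := by
  ext x
  rw [h.mem_image_iff inter_subset_right]
  refine and_congr_right fun hx => ?_
  rw [stripLevel, level_lt_iff hζ (h.norm_lt hx)]
  exact (and_iff_left (h.maps_inv hx)).symm

lemma upperPart_eq (s : ℝ) :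
    upperPart U H ζ s = G '' ({z | Real.exp s * ‖ζ + z‖ < ‖ζ - z‖} ∩ 𝔻) := by
  ext x
  rw [h.mem_image_iff inter_subset_right]
  refine and_congr_right fun hx => ?_
  rw [stripLevel, lt_level_iff hζ (h.norm_lt hx)]
  exact (and_iff_left (h.maps_inv hx)).symm

lemma tendsto_cut_left {y : X}
    (hy : Tendsto (fun t : ℝ => G (stp ζ ⟨s, t⟩)) (𝓝[>] (-(π / 2))) (𝓝 y)) : y ∈ frontier U := by
  refine h.limit_mem_frontier ?_ ?_ (tendsto_stp_lower ζ s) hy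
  · rw [norm_mul, hζ, norm_exp_ofReal_mul_I, one_mul]
  · filter_upwards [Ioo_mem_nhdsGT (show -(π / 2) < π / 2 by linarith [Real.pi_pos])] with t ht
    exact mem_ball_zero_iff.2 (norm_stp_lt hζ ht)

lemma tendsto_cut_right {y : X}
    (hy : Tendsto (fun t : ℝ => G (stp ζ ⟨s, t⟩)) (𝓝[<] (π / 2)) (𝓝 y)) : y ∈ frontier U := by
  refine h.limit_mem_frontier ?_ ?_ (tendsto_stp_upper ζ s) hy
  · rw [norm_mul, hζ, norm_exp_ofReal_mul_I, one_mul]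
  · filter_upwards [Ioo_mem_nhdsLT (show -(π / 2) < π / 2 by linarith [Real.pi_pos])] with t ht
    exact mem_ball_zero_iff.2 (norm_stp_lt hζ ht)

lemma exists_cut_param {y z : X} (hy : Tendsto (fun t : ℝ => G (stp ζ ⟨s, t⟩)) (𝓝[>] (-(π / 2))) (𝓝 y))
    (hz : Tendsto (fun t : ℝ => G (stp ζ ⟨s, t⟩)) (𝓝[<] (π / 2)) (𝓝 z)) :
    ∃ g : ℝ → X, ContinuousOn g (Icc 0 1) ∧ InjOn g (Ioo 0 1) ∧ (∀ t ∈ Ioo (0:ℝ) 1, g t ∈ U) ∧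
      g 0 = y ∧ g 1 = z ∧ levelCut U H ζ s = g '' Ioo 0 1 := by
  have hpi := Real.pi_pos
  set l : ℝ → ℝ := fun t => π * (t - 1 / 2) with hl
  have hlm : ∀ t ∈ Ioo (0 : ℝ) 1, l t ∈ stripI := fun t ht => by
    simp only [hl, stripI, mem_Ioo]; constructor <;> nlinarith [ht.1, ht.2]
  have hlc : Continuous l := by fun_prop
  set p : ℝ → X := fun t => G (stp ζ ⟨s, l t⟩) with hp
  have hpc := (h.strip_continuousOn hζ).comp ((mk_cont s).comp hlc).continuousOn fun t ht => hlm t ht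
  have h0 : Tendsto p (𝓝[>] 0) (𝓝 y) := by
    refine hy.comp (tendsto_nhdsWithin_iff.2 ⟨?_, ?_⟩)
    · convert ((hlc.tendsto 0).mono_left (nhdsWithin_le_nhds (s := Ioi 0))) using 2; simp [hl]; ring
    · filter_upwards [Ioo_mem_nhdsGT (zero_lt_one' ℝ)] with t ht using (hlm t ht).1
  have h1 : Tendsto p (𝓝[<] 1) (𝓝 z) := by
    refine hz.comp (tendsto_nhdsWithin_iff.2 ⟨?_, ?_⟩)
    · convert ((hlc.tendsto 1).mono_left (nhdsWithin_le_nhds (s := Iio 1))) using 2; simp [hl]; ring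
    · filter_upwards [Ioo_mem_nhdsLT (zero_lt_one' ℝ)] with t ht using (hlm t ht).2
  have hext : ∀ t ∈ Ioo (0 : ℝ) 1, extendFrom (Ioo (0 : ℝ) 1) p t = p t := fun t ht =>
    extendFrom_eq (subset_closure ht) (hpc t ht)
  refine ⟨extendFrom (Ioo 0 1) p, continuousOn_Icc_extendFrom_Ioo hpc h0 h1, ?_, ?_,
    eq_lim_at_left_extendFrom_Ioo zero_lt_one h0, eq_lim_at_right_extendFrom_Ioo zero_lt_one h1, ?_⟩
  · intro t ht t' ht' e
    rw [hext t ht, hext t' ht'] at e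
    have h2 := h.injOn (mem_ball_zero_iff.2 (norm_stp_lt hζ (w := ⟨s, l t⟩) (hlm t ht)))
      (mem_ball_zero_iff.2 (norm_stp_lt hζ (w := ⟨s, l t'⟩) (hlm t' ht'))) e
    have h3 := congrArg im (stp_injOn hζ (hlm t ht) (hlm t' ht') h2)
    simp only [hl] at h3
    have := mul_left_cancel₀ hpi.ne' h3
    linarith
  · intro t ht
    rw [hext t ht]
    exact h.strip_mem hζ (hlm t ht)
  · rw [image_congr hext]
    ext x
    constructor
    · rintro ⟨hx, hxs⟩
      have hi := stpInv_im hζ (h.norm_lt hx)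
      refine ⟨(stpInv ζ (H x)).im / π + 1 / 2, ⟨?_, ?_⟩, ?_⟩
      · have := hi.1
        have : -(1 / 2) < (stpInv ζ (H x)).im / π := by rw [lt_div_iff₀ hpi]; linarith
        linarith
      · have := hi.2
        have : (stpInv ζ (H x)).im / π < 1 / 2 := by rw [div_lt_iff₀ hpi]; linarith
        linarith
      · have e : (⟨s, l ((stpInv ζ (H x)).im / π + 1 / 2)⟩ : ℂ) = stpInv ζ (H x) := by
          apply Complex.ext
          · exact hxs.symm
          · simp only [hl]; field_simp; ring
        rw [hp]; simp only [e]
        exact h.strip_inv hζ hx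
    · rintro ⟨t, ht, rfl⟩
      exact ⟨h.strip_mem hζ (hlm t ht), h.level_strip hζ (hlm t ht)⟩

lemma isCrossCut_levelCut (hne : Uᶜ.Nonempty) {y z : X}
    (hy : Tendsto (fun t : ℝ => G (stp ζ ⟨s, t⟩)) (𝓝[>] (-(π / 2))) (𝓝 y))
    (hz : Tendsto (fun t : ℝ => G (stp ζ ⟨s, t⟩)) (𝓝[<] (π / 2)) (𝓝 z)) : IsCrossCut U (levelCut U H ζ s) := by
  obtain ⟨g, hg, hgi, hgU, rfl, rfl, hcut⟩ := h.exists_cut_param hζ hy hz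
  have hyU := h.tendsto_cut_left hζ hy
  have hzU := h.tendsto_cut_right hζ hz
  have hA : ({g 0, g 1} : Set X) ⊆ Uᶜ := by
    rintro x (rfl | rfl)
    · exact h.frontier_notMem hyU
    · exact h.frontier_notMem hzU
  have hdiff : frontier U \ {g 0, g 1} ⊆ frontier U \ g '' Icc 0 1 := by
    rintro x ⟨hx, hxn⟩
    refine ⟨hx, ?_⟩
    rintro ⟨t, ht, rfl⟩
    rcases eq_or_lt_of_le ht.1 with rfl | h2
    · exact hxn (Or.inl rfl)
    rcases eq_or_lt_of_le ht.2 with rfl | h3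
    · exact hxn (Or.inr rfl)
    exact h.frontier_notMem hx (hgU t ⟨h2, h3⟩)
  have hz0 : ζ ≠ 0 := by rw [← norm_pos_iff, hζ]; exact one_pos
  have hz2 : 0 < ‖ζ + ζ‖ := by rw [← two_mul, norm_mul, hζ]; norm_num
  refine ⟨g, hg, hgi, hgU, hyU, hzU, hcut, _, _, h.hasTwoComps_cut hζ s, ?_, ?_⟩
  · rw [h.lowerPart_eq hζ]
    refine (h.exists_frontier hne (toFinite _) hA (isOpen_lt (by fun_prop) (by fun_prop)) hζ ?_).mono
      (inter_subset_inter_right _ hdiff)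
    simp only [mem_ofPred_eq, sub_self, norm_zero]
    exact mul_pos (Real.exp_pos s) hz2
  · rw [h.upperPart_eq hζ]
    refine (h.exists_frontier hne (toFinite _) hA (isOpen_lt (by fun_prop) (by fun_prop)) (ζ := -ζ)
      (by rw [norm_neg, hζ]) ?_).mono (inter_subset_inter_right _ hdiff)
    simp only [mem_ofPred_eq, sub_neg_eq_add, add_neg_cancel, norm_zero, mul_zero]
    exact hz2

lemma bdIn_lowerPart (s : ℝ) :
    bdIn U (lowerPart U H ζ s) ⊆ levelCut U H ζ s := by
  rintro x ⟨⟨hcl, hn⟩, hxU⟩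
  refine ⟨hxU, le_antisymm ?_ (not_lt.1 fun h1 => hn ⟨hxU, h1⟩)⟩
  by_contra hlt
  have ⟨v, hv, hv'⟩ := mem_closure_iff.1 hcl _ (h.upperPart_isOpen hζ s) ⟨hxU, not_le.1 hlt⟩
  exact lt_asymm hv.2 hv'.2

lemma closure_bdIn_lowerPart {y z : X} (hy : Tendsto (fun t : ℝ => G (stp ζ ⟨s, t⟩)) (𝓝[>] (-(π / 2))) (𝓝 y))
    (hz : Tendsto (fun t : ℝ => G (stp ζ ⟨s, t⟩)) (𝓝[<] (π / 2)) (𝓝 z)) :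
    closure (bdIn U (lowerPart U H ζ s)) ⊆ levelCut U H ζ s ∪ {y, z} := by
  obtain ⟨g, hg, hgi, hgU, rfl, rfl, hcut⟩ := h.exists_cut_param hζ hy hz
  have h1 := closure_minimal ((h.bdIn_lowerPart hζ s).trans (hcut.subset.trans (image_mono Ioo_subset_Icc_self)))
      (isCompact_Icc.image_of_continuousOn hg).isClosed
  refine h1.trans ?_
  rintro _ ⟨t, ht, rfl⟩
  grind

end

lemma exists_endSeq (hζ : ‖ζ‖ = 1) : ∃ s y z, EndSeq G ζ s y z := by
  classical
  have ⟨F, hP, hr⟩ := exists_seq_of_forall_finset_exists (α := ℝ × ℝ × X × X)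
    (fun q => (0 < q.2.1 ∧ Tendsto (fun t : ℝ => G (stp ζ ⟨q.1, t⟩)) (𝓝[>] (-(π / 2))) (𝓝 q.2.2.1)) ∧
      Tendsto (fun t : ℝ => G (stp ζ ⟨q.1, t⟩)) (𝓝[<] (π / 2)) (𝓝 q.2.2.2) ∧
      ∀ t ∈ stripI, ∀ t' ∈ stripI, dist (G (stp ζ ⟨q.1, t⟩)) (G (stp ζ ⟨q.1, t'⟩)) ≤ q.2.1)
    (fun p q => q.1 < p.1 - 1 ∧ q.2.1 ≤ p.2.1 / 2 ∧ Disjoint ({p.2.2.1, p.2.2.2} : Set X) {q.2.2.1, q.2.2.2}) (by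
      intro S hS
      obtain ⟨N, hN⟩ : ∃ N : ℝ, ∀ p ∈ S, N ≤ p.1 - 1 := by
        have ⟨N, hN⟩ := (S.image fun p => p.1 - 1).bddBelow
        exact ⟨N, fun p hp => hN (Finset.mem_coe.2 (Finset.mem_image_of_mem (fun p => p.1 - 1) hp))⟩
      obtain ⟨ε, hε, hεS⟩ : ∃ ε > 0, ∀ p ∈ S, ε ≤ p.2.1 / 2 := by
        rcases S.eq_empty_or_nonempty with rfl | hSn
        · exact ⟨1, one_pos, by simp⟩
        · have ⟨p₀, hp₀, hmin⟩ := S.exists_min_image (fun p => p.2.1 / 2) hSn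
          exact ⟨p₀.2.1 / 2, half_pos (hS p₀ hp₀).1.1, hmin⟩
      set A : Set X := ⋃ p ∈ S, {p.2.2.1, p.2.2.2} with hA
      have hAU : A ⊆ Uᶜ := by
        refine iUnion₂_subset fun p hp => ?_
        rintro x (rfl | rfl)
        · exact h.frontier_notMem (h.tendsto_cut_left hζ (hS p hp).1.2)
        · exact h.frontier_notMem (h.tendsto_cut_right hζ (hS p hp).2.1)
      have ⟨s, hs, y, hy, z, hz, h1, h2, h3⟩ := h.arcs ζ hζ ε hε N A (S.finite_toSet.biUnion fun p _ => toFinite _) hAU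
      refine ⟨(s, ε, y, z), ⟨⟨hε, h1⟩, h2, h3⟩, fun p hp => ⟨hs.trans_le (hN p hp), hεS p hp, ?_⟩⟩
      have hsub := subset_biUnion_of_mem (u := fun p : ℝ × ℝ × X × X => ({p.2.2.1, p.2.2.2} : Set X)) hp
      refine disjoint_left.2 fun x hx hx' => ?_
      rcases hx' with rfl | rfl
      · exact hy (hsub hx)
      · exact hz (hsub hx))
  refine ⟨fun n => (F n).1, fun n => (F n).2.2.1, fun n => (F n).2.2.2, fun n => (hP n).1.2, fun n => (hP n).2.1,
    fun m n hmn => (hr m n hmn).1, fun ε hε => ?_, fun m n hmn => ?_⟩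
  · have h1 : ∀ n : ℕ, (F n).2.1 ≤ (F 0).2.1 * (1 / 2) ^ n := by
      intro n
      induction n with
      | zero => simp
      | succ n ih => 
        rw [pow_succ]
        linarith [(hr n (n + 1) (Nat.lt_succ_self n)).2.1]
    have h2 : Tendsto (fun n : ℕ => (F 0).2.1 * (1 / 2 : ℝ) ^ n) atTop (𝓝 0) := by
      simpa using (tendsto_pow_atTop_nhds_zero_of_lt_one (r := (1 / 2 : ℝ)) (by norm_num) (by norm_num)).const_mul (F 0).2.1
    have ⟨N, hN⟩ := eventually_atTop.1 (h2.eventually (gt_mem_nhds hε))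
    exact ⟨N, fun n hn t ht t' ht' => ((hP n).2.2 t ht t' ht').trans ((h1 n).trans (hN n hn).le)⟩
  · rcases lt_or_gt_of_ne hmn with h1 | h1
    · exact (hr m n h1).2.2
    · exact (hr n m h1).2.2.symm

end DiscModel

lemma lowerPart_mono {X : Type*} {U : Set X} {H : X → ℂ} (h : s ≤ t) :
    lowerPart U H ζ s ⊆ lowerPart U H ζ t := fun _ hx => ⟨hx.1, hx.2.trans_le h⟩

namespace DiscModel

variable (h : DiscModel U G H)
include h

lemma isCrossSection_lowerPart (hne : Uᶜ.Nonempty) (hζ : ‖ζ‖ = 1) {s : ℕ → ℝ}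
    {y z : ℕ → X} (hE : EndSeq G ζ s y z) (n : ℕ) : IsCrossSection U (lowerPart U H ζ (s n)) :=
  ⟨_, h.isCrossCut_levelCut hζ hne (hE.lo n) (hE.hi n), (h.hasTwoComps_cut hζ (s n)).1⟩

lemma isPEChain_lowerPart (hne : Uᶜ.Nonempty) (hζ : ‖ζ‖ = 1) {s : ℕ → ℝ}
    {y z : ℕ → X} (hE : EndSeq G ζ s y z) : IsPEChain U fun n => lowerPart U H ζ (s n) := by
  have hlt : ∀ m n, m < n → s n < s m := fun m n hmn => by linarith [hE.anti m n hmn]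
  refine ⟨h.isCrossSection_lowerPart hne hζ hE, fun i j hij => ?_, fun i j hij => ?_⟩
  · rcases hij.eq_or_lt with rfl | h1
    · exact Subset.rfl
    · exact lowerPart_mono (hlt _ _ h1).le
  · have key : ∀ n, {y n, z n} ⊆ Uᶜ := fun n => by
      rintro x (rfl | rfl)
      · exact h.frontier_notMem (h.tendsto_cut_left hζ (hE.lo n))
      · exact h.frontier_notMem (h.tendsto_cut_right hζ (hE.hi n))
    rw [← disjoint_iff_inter_eq_empty]
    refine (Disjoint.mono (h.closure_bdIn_lowerPart hζ (hE.lo i) (hE.hi i))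
      (h.closure_bdIn_lowerPart hζ (hE.lo j) (hE.hi j)) ?_)
    have hs : s i ≠ s j := by
      rcases lt_or_gt_of_ne hij with h1 | h1
      · exact (hlt _ _ h1).ne'
      · exact (hlt _ _ h1).ne
    refine disjoint_left.2 ?_
    rintro x (hx | hx) (hx' | hx')
    · exact hs (hx.2.symm.trans hx'.2)
    · exact key j hx' hx.1
    · exact key i hx hx'.1
    · exact disjoint_left.1 (hE.disj i j hij) hx hx'

lemma chainDivides_of_meets [CompactSpace X] [LocallyConnectedSpace X] (hζ : ‖ζ‖ = 1) {s : ℕ → ℝ} {y z : ℕ → X} (hE : EndSeq G ζ s y z) {D : ℕ → Set X} (hD : IsPEChain U D)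
    (hm : ∀ m n, (D m ∩ lowerPart U H ζ (s n)).Nonempty) : ChainDivides (fun n => lowerPart U H ζ (s n)) D := by
  intro j
  by_contra! hcon
  have hmeet : ∀ i ≥ j, ∃ M, ∀ n ≥ M, (closure (bdIn U (D i)) ∩ levelCut U H ζ (s n)).Nonempty := by
    intro i hi
    have ⟨γ, hγ, hDi⟩ := hD.1 i
    have hT := h.crossCut_subset_closure hγ hDi
    obtain ⟨g, hg, hgi, hgU, -, -, rfl, -⟩ := hγ
    have hgc := isPreconnected_Ioo.image _ (hg.mono Ioo_subset_Icc_self)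
    have hsub : g '' Ioo 0 1 ⊆ bdIn U (D i) := fun x hx =>
      ⟨⟨hT hx, fun hxD => (hDi.subset hxD).2 hx⟩, by obtain ⟨t, ht, rfl⟩ := hx; exact hgU t ht⟩
    have hγU : g '' Ioo 0 1 ⊆ U := fun x hx => (hsub hx).2
    have hlow : ∀ n, (g '' Ioo 0 1 ∩ lowerPart U H ζ (s n)).Nonempty := by
      intro n
      by_contra hempty
      rw [not_nonempty_iff_eq_empty, ← disjoint_iff_inter_eq_empty] at hempty
      refine hcon n (Subset.trans ?_ (hD.2.1 i j hi))
      refine hDi.subset_of_preconnected (h.lowerPart_isPreconnected hζ _) (fun x hx => ⟨hx.1, fun hx' =>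
        disjoint_left.1 hempty hx' hx⟩) ?_
      rw [inter_comm]; exact hm i n
    have h12 : g (1 / 2) ∈ g '' Ioo 0 1 := ⟨1 / 2, by constructor <;> norm_num, rfl⟩
    have ⟨M, hM⟩ := hE.exists_lt (stripLevel H ζ (g (1 / 2)))
    refine ⟨M, fun n hn => ?_⟩
    have ⟨x, hx, hxl⟩ := hlow n
    have ⟨w, hw, hws⟩ := hgc.intermediate_value hx h12 ((h.level_continuousOn hζ).mono hγU) ⟨hxl.2.le, (hM n hn).le⟩
    exact ⟨w, subset_closure (hsub hw), hγU hw, hws⟩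
  have ⟨M₁, h1⟩ := hmeet j le_rfl
  have ⟨M₂, h2⟩ := hmeet (j + 1) (Nat.le_succ j)
  have ⟨δ, hδ, hdis⟩ := (disjoint_iff_inter_eq_empty.2 (hD.2.2 j (j + 1) (Nat.succ_ne_self j).symm)).exists_thickenings
    isClosed_closure.isCompact isClosed_closure
  have ⟨N, hN⟩ := hE.small (δ / 2) (half_pos hδ)
  set n := max N (max M₁ M₂) with hn
  have ⟨a, ha, haU, has⟩ := h1 n (by simp [hn])
  have ⟨b, hb, hbU, hbs⟩ := h2 n (by simp [hn])
  have hform : ∀ x ∈ U, stripLevel H ζ x = s n → ∃ t ∈ stripI, G (stp ζ ⟨s n, t⟩) = x := fun x hx hxs => by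
    refine ⟨_, stpInv_im hζ (h.norm_lt hx), ?_⟩
    rw [← hxs]; exact h.strip_inv hζ hx
  obtain ⟨t, ht, rfl⟩ := hform a haU has
  obtain ⟨t', ht', rfl⟩ := hform b hbU hbs
  have hd := hN n (by simp [hn]) t ht t' ht'
  refine disjoint_left.1 hdis (mem_thickening_iff.2 ⟨_, ha, ?_⟩) (mem_thickening_iff.2 ⟨_, hb, hd.trans_lt (half_lt_self hδ)⟩)
  rw [dist_self]; exact hδ

lemma isPrimeChain_lowerPart [CompactSpace X] [LocallyConnectedSpace X] (hne : Uᶜ.Nonempty) (hζ : ‖ζ‖ = 1) {s : ℕ → ℝ} {y z : ℕ → X} (hE : EndSeq G ζ s y z) :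
    IsPrimeChain U fun n => lowerPart U H ζ (s n) := by
  refine ⟨h.isPEChain_lowerPart hne hζ hE, fun D' hD' hdiv => h.chainDivides_of_meets hζ hE hD' fun m n => ?_⟩
  have ⟨k, hk⟩ := hdiv n
  have ⟨x, hx⟩ := hD'.nonempty (max m k)
  exact ⟨x, hD'.2.1 _ _ (le_max_left m k) hx, hk (hD'.2.1 _ _ (le_max_right m k) hx)⟩

lemma exists_meets {D : ℕ → Set X} (hD : IsPEChain U D) :
    ∃ ζ : ℂ, ‖ζ‖ = 1 ∧ ∀ m s, (D m ∩ lowerPart U H ζ s).Nonempty := by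
  have hsub : ∀ m, D m ⊆ U := fun m => by
    have ⟨γ, _, hc⟩ := hD.1 m
    exact fun x hx => (hc.subset hx).1
  have hball : ∀ m, H '' D m ⊆ 𝔻 := fun m => by rintro _ ⟨x, hx, rfl⟩; exact h.maps_inv (hsub m hx)
  have hcb : ∀ m, closure (H '' D m) ⊆ 𝔻bar := fun m =>
    closure_minimal ((hball m).trans ball_subset_closedBall) isClosed_closedBall
  have hcpt : ∀ m, IsCompact (closure (H '' D m)) := fun m =>
    (isCompact_closedBall (0 : ℂ) 1).of_isClosed_subset isClosed_closure (hcb m)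
  have hne : ∀ m, (closure (H '' D m) ∩ sphere 0 1).Nonempty := by
    intro m
    by_contra hemp
    have hin : closure (H '' D m) ⊆ 𝔻 := fun z hz => by
      rcases (mem_closedBall_zero_iff.1 (hcb m hz)).lt_or_eq with h1 | h1
      · exact mem_ball_zero_iff.2 h1
      · exact (hemp ⟨z, hz, mem_sphere_zero_iff_norm.2 h1⟩).elim
    have hcl := ((hcpt m).image_of_continuousOn (h.cont.mono hin)).isClosed
    have hDsub : closure (D m) ⊆ G '' closure (H '' D m) :=
      closure_minimal (fun x hx => ⟨H x, subset_closure ⟨x, hx, rfl⟩, h.right_inv x (hsub m hx)⟩) hcl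
    obtain ⟨γ, ⟨g, -, -, -, -, -, -, D₁, D₂, hc, hf₁, hf₂⟩, hDm⟩ := hD.1 m
    have : (frontier (D m) ∩ frontier U).Nonempty := by
      rcases hc.eq_or hDm with e | e <;> rw [e]
      · exact hf₁.mono fun x hx => ⟨hx.1, hx.2.1⟩
      · exact hf₂.mono fun x hx => ⟨hx.1, hx.2.1⟩
    have ⟨x, hx1, hx2⟩ := this
    obtain ⟨z, hz, rfl⟩ := hDsub hx1.1
    exact h.frontier_notMem hx2 (h.maps (hin hz))
  have ⟨ζ, hζ⟩ := IsCompact.nonempty_iInter_of_sequence_nonempty_isCompact_isClosed (fun m => closure (H '' D m) ∩ 𝕊)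
    (fun m => inter_subset_inter_left _ (closure_mono (image_mono (hD.2.1 _ _ (Nat.le_succ m))))) hne
    ((hcpt 0).inter_right isClosed_sphere) fun m => isClosed_closure.inter isClosed_sphere
  rw [mem_iInter] at hζ
  have hζ1 := mem_sphere_zero_iff_norm.1 (hζ 0).2
  refine ⟨ζ, hζ1, fun m s => ?_⟩
  have hζO : ζ ∈ {z : ℂ | ‖ζ - z‖ < Real.exp s * ‖ζ + z‖} := by
    simp only [mem_ofPred_eq, sub_self, norm_zero, ← two_mul, norm_mul, hζ1]
    norm_num
    exact Real.exp_pos s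
  obtain ⟨_, hz, ⟨x, hx, rfl⟩⟩ := mem_closure_iff.1 (hζ m).1 _ (isOpen_lt (by fun_prop) (by fun_prop)) hζO
  exact ⟨x, hx, hsub m hx, (level_lt_iff hζ1 (h.norm_lt (hsub m hx))).2 hz⟩

/-- Lower parts at different boundary points are eventually disjoint. -/
lemma exists_disjoint_lowerPart {ζ' : ℂ} (hζ : ‖ζ‖ = 1) (hζ' : ‖ζ'‖ = 1) (hne : ζ ≠ ζ') :
    ∃ N, ∀ s ≤ N, ∀ t ≤ N, Disjoint (lowerPart U H ζ s) (lowerPart U H ζ' t) := by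
  have hd := norm_pos_iff.2 (sub_ne_zero.2 hne)
  refine ⟨Real.log (‖ζ - ζ'‖ / 4), fun s hs t ht => disjoint_left.2 fun x hx hx' => ?_⟩
  have h1 := norm_sub_lt_of_level hζ (h.norm_lt hx.1) hx.2
  have h2 := norm_sub_lt_of_level hζ' (h.norm_lt hx'.1) hx'.2
  have h3 := Real.exp_le_exp.2 hs
  have h4 := Real.exp_le_exp.2 ht
  rw [Real.exp_log (by positivity)] at h3 h4
  have h5 := norm_sub_le_norm_sub_add_norm_sub ζ (H x) ζ'
  rw [norm_sub_rev ζ (H x)] at h5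
  linarith

/-- Near a boundary point, lower parts at neighbouring boundary points are contained in a given lower part. -/
lemma exists_lowerPart_subset {ζ' : ℂ} (hζ : ‖ζ‖ = 1) (hζ' : ‖ζ'‖ = 1)
    (hs : ‖ζ - ζ'‖ < Real.exp s * ‖ζ + ζ'‖) : ∃ t, lowerPart U H ζ' t ⊆ lowerPart U H ζ s := by
  have hO : IsOpen {z : ℂ | ‖ζ - z‖ < Real.exp s * ‖ζ + z‖} := isOpen_lt (by fun_prop) (by fun_prop)
  have ⟨ε, hε, hb⟩ := Metric.isOpen_iff.1 hO ζ' hs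
  refine ⟨Real.log (ε / 2), fun x hx => ⟨hx.1, (level_lt_iff hζ (h.norm_lt hx.1)).2 (hb ?_)⟩⟩
  have := norm_sub_lt_of_level hζ' (h.norm_lt hx.1) hx.2
  rw [Real.exp_log (by positivity)] at this
  rw [mem_ball, dist_eq]; linarith

/-- The parametrization of the prime ends by the unit circle. -/
lemma exists_endMap [CompactSpace X] [LocallyConnectedSpace X] (hne : Uᶜ.Nonempty) :
    ∃ Z : ℂ → PrimeEnd U, (∀ ζ, ‖ζ‖ = 1 → ∀ E, PrimeEndDivides (Z ζ) E ↔ ∃ s, lowerPart U H ζ s ⊆ E) ∧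
      ∀ p, ∃ ζ, ‖ζ‖ = 1 ∧ Z ζ = p := by
  choose! s y z hE using fun (ζ : ℂ) (hζ : ‖ζ‖ = 1) => h.exists_endSeq hζ
  have hpc := fun (ζ : ℂ) (hζ : ‖ζ‖ = 1) => h.isPrimeChain_lowerPart hne hζ (hE ζ hζ)
  let c1 : PrimeChain U := ⟨_, hpc 1 norm_one⟩
  classical
  let Z : ℂ → PrimeEnd U := fun ζ => if hζ : ‖ζ‖ = 1 then Quot.mk _ ⟨_, hpc ζ hζ⟩ else Quot.mk _ c1
  have hZ : ∀ ζ (hζ : ‖ζ‖ = 1), Z ζ = Quot.mk _ ⟨_, hpc ζ hζ⟩ := fun ζ hζ => dif_pos hζ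
  refine ⟨Z, fun ζ hζ E => ⟨?_, ?_⟩, fun p => ?_⟩
  · rintro ⟨C, hC, N, hN⟩
    rw [hZ ζ hζ] at hC
    have ⟨m, hm⟩ := (PrimeEnd.mk_eq_iff.1 hC).2 N
    exact ⟨_, hm.trans (hN N le_rfl)⟩
  · rintro ⟨t, ht⟩
    have ⟨N, hN⟩ := (hE ζ hζ).exists_lt t
    exact ⟨_, (hZ ζ hζ).symm, N, fun i hi => (lowerPart_mono (hN i hi).le).trans ht⟩
  · induction p using Quot.ind with
    | mk C =>
      have ⟨ζ, hζ, hm⟩ := h.exists_meets C.2.1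
      refine ⟨ζ, hζ, ?_⟩
      rw [hZ ζ hζ]
      refine PrimeEnd.mk_eq_iff.2 ?_
      have h1 := h.chainDivides_of_meets hζ (hE ζ hζ) C.2.1 fun m n => hm m _
      exact ⟨h1, C.2.2 _ (h.isPEChain_lowerPart hne hζ (hE ζ hζ)) h1⟩

end DiscModel

namespace DiscModel

variable (h : DiscModel U G H)
include h

lemma t2Space_primeEndComp [CompactSpace X] [LocallyConnectedSpace X] (hne : Uᶜ.Nonempty) :
    T2Space (PrimeEndComp U) := by
  have ⟨Z, hZ, hZs⟩ := h.exists_endMap hne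
  have hsec : ∀ ζ, ‖ζ‖ = 1 → ∀ N, ∃ s < N, IsCrossSection U (lowerPart U H ζ s) := fun ζ hζ N => by
    have ⟨s, y, z, hE⟩ := h.exists_endSeq hζ
    have ⟨n, hn⟩ := hE.exists_lt N
    exact ⟨s n, hn n le_rfl, h.isCrossSection_lowerPart hne hζ hE n⟩
  have key : ∀ (x : ↥U) (p : PrimeEnd U), ∃ A B : Set (PrimeEndComp U), IsOpen A ∧ IsOpen B ∧ pePt U x ∈ A ∧
      peEnd U p ∈ B ∧ Disjoint A B := by
    intro x p
    obtain ⟨ζ, hζ, rfl⟩ := hZs p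
    have ⟨s, hs, hc⟩ := hsec ζ hζ (stripLevel H ζ x)
    refine ⟨_, _, isOpen_peOpen (h.upperPart_isOpen hζ s) fun x hx => hx.1, isOpen_peSection hc, ⟨x, rfl, x.2, hs⟩,
      Or.inr ⟨_, rfl, (hZ ζ hζ _).2 ⟨s, Subset.rfl⟩⟩, disjoint_peOpen_peSection ?_⟩
    exact disjoint_left.2 fun x h1 h2 => lt_asymm h1.2 h2.2
  refine ⟨fun a b hab => ?_⟩
  rcases a with x | p <;> rcases b with x' | p'
  · have ⟨A, B, hA, hB, hxA, hxB, hd⟩ := t2_separation (fun e => hab (congrArg Sum.inl (Subtype.ext e)))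
    refine ⟨_, _, isOpen_peOpen (hA.inter h.isOpen) inter_subset_right, isOpen_peOpen (hB.inter h.isOpen)
      inter_subset_right, ⟨x, rfl, hxA, x.2⟩, ⟨x', rfl, hxB, x'.2⟩, disjoint_left.2 ?_⟩
    rintro _ ⟨v, rfl, hv⟩ ⟨v', e, hv'⟩
    obtain rfl := Sum.inl.inj e
    exact disjoint_left.1 hd hv.1 hv'.1
  · exact key x p'
  · have ⟨A, B, hA, hB, h1, h2, h3⟩ := key x' p
    exact ⟨B, A, hB, hA, h2, h1, h3.symm⟩
  · obtain ⟨ζ, hζ, rfl⟩ := hZs p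
    obtain ⟨ζ', hζ', rfl⟩ := hZs p'
    have ⟨N, hN⟩ := h.exists_disjoint_lowerPart hζ hζ' (by rintro rfl; exact hab rfl)
    have ⟨s, hs, hc⟩ := hsec ζ hζ N
    have ⟨s', hs', hc'⟩ := hsec ζ' hζ' N
    exact ⟨_, _, isOpen_peSection hc, isOpen_peSection hc', Or.inr ⟨_, rfl, (hZ ζ hζ _).2 ⟨s, Subset.rfl⟩⟩,
      Or.inr ⟨_, rfl, (hZ ζ' hζ' _).2 ⟨s', Subset.rfl⟩⟩, disjoint_peSection (hN s hs.le s' hs'.le)⟩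

/-- Carathéodory's theorem: the prime ends compactification is a closed disc. -/
theorem exists_homeo [CompactSpace X] [LocallyConnectedSpace X] (hne : Uᶜ.Nonempty) : ∃ J : ↥𝔻bar ≃ₜ PrimeEndComp U,
      (∀ (z : ↥𝔻bar) (hz : ‖z.1‖ < 1), J z = pePt U ⟨G z, h.maps (mem_ball_zero_iff.2 hz)⟩) ∧
      ∀ z : ↥𝔻bar, ‖z.1‖ = 1 → ∃ p, J z = peEnd U p := by
  have ⟨Z, hZ, hZs⟩ := h.exists_endMap hne
  have := h.t2Space_primeEndComp hne
  have hcases : ∀ z : ↥𝔻bar, ¬ ‖z.1‖ < 1 → ‖z.1‖ = 1 := fun z hz =>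
    le_antisymm (mem_closedBall_zero_iff.1 z.2) (not_lt.1 hz)
  classical
  let j : ↥𝔻bar → PrimeEndComp U := fun z =>
    if hz : ‖z.1‖ < 1 then pePt U ⟨G z, h.maps (mem_ball_zero_iff.2 hz)⟩ else peEnd U (Z z)
  have hj1 : ∀ (z : ↥𝔻bar) (hz : ‖z.1‖ < 1), j z = pePt U ⟨G z, h.maps (mem_ball_zero_iff.2 hz)⟩ := fun z hz => dif_pos hz
  have hj2 : ∀ z : ↥𝔻bar, ‖z.1‖ = 1 → j z = peEnd U (Z z) := fun z hz => dif_neg (by rw [hz]; exact lt_irrefl _)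
  have hjo : ∀ (z : ↥𝔻bar) {V : Set X}, ‖z.1‖ < 1 → IsOpen V → G z ∈ V →
      ∀ᶠ w : ↥𝔻bar in 𝓝 z, ∃ _ : ‖(w : ℂ)‖ < 1, G w ∈ V := by
    intro z V hz hV hGV
    have h1 := (continuous_norm.comp continuous_subtype_val).continuousAt.eventually_lt continuousAt_const hz
    have h2 := ContinuousAt.comp (g := G) (h.cont.continuousAt (isOpen_ball.mem_nhds (mem_ball_zero_iff.2 hz))) continuous_subtype_val.continuousAt
    filter_upwards [h1, h2.eventually_mem (hV.mem_nhds hGV)] with w h3 h4 using ⟨h3, h4⟩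
  have hcont : Continuous j := by
    refine continuous_generateFrom_iff.2 ?_
    rintro _ (⟨V, hV, hVU, rfl⟩ | ⟨E, hE, rfl⟩)
    · refine isOpen_iff_mem_nhds.2 fun z hz => ?_
      have ⟨x, hx, hxV⟩ := hz
      by_cases hz1 : ‖z.1‖ < 1
      · rw [hj1 z hz1] at hx
        obtain rfl := Sum.inl.inj hx
        filter_upwards [hjo z hz1 hV hxV] with w ⟨hw, hwV⟩
        exact ⟨_, hj1 w hw, hwV⟩
      · rw [hj2 z (hcases z hz1)] at hx; cases hx
    · have ⟨γ, hγ, hc⟩ := id hE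
      have hEo : IsOpen E := by
        obtain ⟨g, hg, -, -, h0, h1, rfl, -⟩ := hγ
        exact hc.isOpen (h.isOpen_diff_crossCut hg h0 h1)
      refine isOpen_iff_mem_nhds.2 fun z hz => ?_
      by_cases hz1 : ‖z.1‖ < 1
      · rw [mem_preimage, hj1 z hz1] at hz
        rcases hz with ⟨x, hx, hxV⟩ | ⟨p, hp, -⟩
        · obtain rfl := Sum.inl.inj hx
          filter_upwards [hjo z hz1 hEo hxV] with w ⟨hw, hwV⟩
          exact Or.inl ⟨_, hj1 w hw, hwV⟩
        · cases hp
      · have hz1 := hcases z hz1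
        rw [mem_preimage, hj2 z hz1] at hz
        rcases hz with ⟨x, hx, -⟩ | ⟨p, hp, hpE⟩
        · cases hx
        obtain rfl := Sum.inr.inj hp
        have ⟨s, hs⟩ := (hZ _ hz1 E).1 hpE
        have hzO : (z : ℂ) ∈ {w : ℂ | ‖(z : ℂ) - w‖ < Real.exp s * ‖(z : ℂ) + w‖} := by
          simp only [mem_ofPred_eq, sub_self, norm_zero, ← two_mul, norm_mul, hz1]
          norm_num
          exact Real.exp_pos s
        filter_upwards [continuous_subtype_val.continuousAt.eventually_mem ((isOpen_lt (by fun_prop) (by fun_prop)).mem_nhds hzO)] with w hw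
        by_cases hw1 : ‖(w : ℂ)‖ < 1
        · refine Or.inl ⟨_, hj1 w hw1, hs (a := G w) ⟨h.maps (mem_ball_zero_iff.2 hw1), ?_⟩⟩
          show stripLevel H z (G w) < s
          rw [stripLevel, h.left_inv _ (mem_ball_zero_iff.2 hw1)]
          exact (level_lt_iff hz1 hw1).2 hw
        · have hw1 := hcases w hw1
          have ⟨t, ht⟩ := h.exists_lowerPart_subset hz1 hw1 hw
          exact Or.inr ⟨_, hj2 w hw1, (hZ _ hw1 E).2 ⟨t, ht.trans hs⟩⟩
  have hinj : Function.Injective j := by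
    intro z w hzw
    by_cases hz : ‖z.1‖ < 1 <;> by_cases hw : ‖(w : ℂ)‖ < 1
    · rw [hj1 z hz, hj1 w hw] at hzw
      exact Subtype.ext (h.injOn (mem_ball_zero_iff.2 hz) (mem_ball_zero_iff.2 hw) (congrArg Subtype.val (Sum.inl.inj hzw)))
    · rw [hj1 z hz, hj2 w (hcases w hw)] at hzw; cases hzw
    · rw [hj2 z (hcases z hz), hj1 w hw] at hzw; cases hzw
    · have hz := hcases z hz
      have hw := hcases w hw
      rw [hj2 z hz, hj2 w hw] at hzw
      have e := Sum.inr.inj hzw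
      by_contra hne'
      have ⟨N, hN⟩ := h.exists_disjoint_lowerPart hz hw (fun e => hne' (Subtype.ext e))
      have ⟨t, ht⟩ := (hZ _ hw _).1 (by rw [← e]; exact (hZ _ hz _).2 ⟨N, Subset.rfl⟩ : PrimeEndDivides (Z w) (lowerPart U H z N))
      have ⟨x, hx⟩ := h.lowerPart_nonempty hw (min t N)
      exact disjoint_left.1 (hN N le_rfl _ (min_le_right t N)) (ht (lowerPart_mono (min_le_left t N) hx)) hx
  have hsurj : Function.Surjective j := by
    rintro (x | p)
    · have hx := h.norm_lt x.2
      refine ⟨⟨H x, mem_closedBall_zero_iff.2 hx.le⟩, ?_⟩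
      rw [hj1 _ hx]
      exact congrArg Sum.inl (Subtype.ext (h.right_inv x x.2))
    · obtain ⟨ζ, hζ, rfl⟩ := hZs p
      exact ⟨⟨ζ, mem_closedBall_zero_iff.2 hζ.le⟩, hj2 ⟨ζ, _⟩ hζ⟩
  refine ⟨Continuous.homeoOfEquivCompactToT2 (f := Equiv.ofBijective j ⟨hinj, hsurj⟩) hcont, hj1, fun z hz => ⟨_, hj2 z hz⟩⟩

end DiscModel

/-- The branch of the logarithm on the closed upper half-plane with argument in `[0, π]`. -/
def logP (z : ℂ) : ℂ := log (-I * z) + I * (π / 2 : ℝ)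

/-- The branch of the logarithm on the closed lower half-plane with argument in `[-π, 0]`. -/
def logM (z : ℂ) : ℂ := log (I * z) - I * (π / 2 : ℝ)

lemma exp_I_mul_half_pi : exp (I * (π / 2 : ℝ)) = I := by rw [mul_comm]; push_cast; exact exp_pi_div_two_mul_I

lemma exp_logP (hz : z ≠ 0) : exp (logP z) = z := by
  rw [logP, exp_add, exp_log (mul_ne_zero (neg_ne_zero.2 I_ne_zero) hz), exp_I_mul_half_pi]
  ring_nf; rw [I_sq]; ring

lemma exp_logM (hz : z ≠ 0) : exp (logM z) = z := by
  rw [logM, exp_sub, exp_log (mul_ne_zero I_ne_zero hz), exp_I_mul_half_pi]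
  field_simp

lemma mem_slitPlane_of_re_nonneg (h : 0 ≤ z.re) (hz : z ≠ 0) : z ∈ slitPlane := by
  rcases h.eq_or_lt with h1 | h1
  · refine Or.inr fun h2 => hz (Complex.ext h1.symm h2)
  · exact Or.inl h1

lemma logP_continuousAt (h : 0 ≤ z.im) (hz : z ≠ 0) : ContinuousAt logP z := by
  have h1 := mem_slitPlane_of_re_nonneg (by simpa using h) (mul_ne_zero (neg_ne_zero.2 I_ne_zero) hz)
  exact (ContinuousAt.comp (g := log) (continuousAt_clog h1) (by fun_prop)).add continuousAt_const

lemma logM_continuousAt (h : z.im ≤ 0) (hz : z ≠ 0) : ContinuousAt logM z := by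
  have h1 := mem_slitPlane_of_re_nonneg (by simpa using h) (mul_ne_zero I_ne_zero hz)
  exact (ContinuousAt.comp (g := log) (continuousAt_clog h1) (by fun_prop)).sub continuousAt_const

lemma logP_im (h : 0 ≤ z.im) : 0 ≤ (logP z).im ∧ (logP z).im ≤ π := by
  have h1 : |arg (-I * z)| ≤ π / 2 := abs_arg_le_pi_div_two_iff.2 (by simpa using h)
  have h2 : (logP z).im = arg (-I * z) + π / 2 := by simp [logP, log_im]
  grind

lemma logM_im (h : z.im ≤ 0) : -π ≤ (logM z).im ∧ (logM z).im ≤ 0 := by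
  have h1 : |arg (I * z)| ≤ π / 2 := abs_arg_le_pi_div_two_iff.2 (by simpa using h)
  have h2 : (logM z).im = arg (I * z) - π / 2 := by simp [logM, log_im]
  grind

lemma logM_neg (z : ℂ) : logM (-z) = logP z - I * π := by
  rw [logM, logP]; rw [show I * -z = -I * z by ring]; push_cast; ring

lemma logP_neg (z : ℂ) : logP (-z) = logM z + I * π := by
  rw [logM, logP]; rw [show -I * -z = I * z by ring]; push_cast; ring

lemma logP_sub_logM_of_pos {d : ℝ} (hd : 0 < d) : logP d - logM d = 0 := by
  have h1 : log (-I * d) = Real.log d - I * (π / 2 : ℝ) := by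
    rw [mul_comm, log_ofReal_mul hd (neg_ne_zero.2 I_ne_zero), log_neg_I]; push_cast; ring
  have h2 : log (I * d) = Real.log d + I * (π / 2 : ℝ) := by
    rw [mul_comm, log_ofReal_mul hd I_ne_zero, log_I]; push_cast; ring
  rw [logP, logM, h1, h2]; ring

lemma logP_sub_logM_of_neg {d : ℝ} (hd : d < 0) : logP d - logM d = 2 * π * I := by
  have h := logP_sub_logM_of_pos (neg_pos.2 hd)
  have h1 := logP_neg ((-d : ℝ) : ℂ)
  have h2 := logM_neg ((-d : ℝ) : ℂ)
  push_cast at h h1 h2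
  grind

lemma eq_of_exp_eq_of_im {a b : ℂ} (h : exp a = exp b) (hi : |a.im - b.im| < 2 * π) : a = b := by
  have ⟨n, hn⟩ := exp_eq_exp_iff_exists_int.1 h
  have hpi := Real.pi_pos
  rw [(by rw [hn]; simp : a.im - b.im = n * (2 * π)), abs_mul, abs_of_pos (by positivity : 0 < 2 * π)] at hi
  rw [hn, (by exact Int.abs_lt_one_iff.1 (by exact_mod_cast (by nlinarith : |(n : ℝ)| < 1)) : n = 0)]; simp

lemma sub_eq_sub_of_exp {c : ℝ} {f g : ℝ → ℂ} (hf : ContinuousOn f (Icc c a)) (hg : ContinuousOn g (Icc c a))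
    (h : ∀ x ∈ Icc c a, exp (f x) = exp (g x)) {x y : ℝ} (hx : x ∈ Icc c a) (hy : y ∈ Icc c a) :
    f x - f y = g x - g y := by
  have h1 := eq_of_exp_eq isPreconnected_Icc (hf.sub hg) (fun x hx => by
    show exp (f x - g x) = 1
    rw [exp_sub, h x hx, div_self (exp_ne_zero _)]) hx hy
  simp only [Pi.sub_apply] at h1
  linear_combination h1

lemma arg_lt_of_norm_sub_one {q : ℂ} (h : ‖q - 1‖ < 1) : q ∈ slitPlane ∧ |(log q).im| < π / 2 := by
  have h1 : 0 < q.re := by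
    have := (abs_re_le_norm (q - 1)).trans_lt h
    rw [abs_lt] at this
    simp at this; linarith
  exact ⟨Or.inl h1, by rw [log_im]; exact abs_arg_lt_pi_div_two_iff.2 (Or.inl h1)⟩

/-- The change of the logarithm of a difference of curves around a corner. -/
lemma corner_increment {c : ℝ} (hca : c < a) {L0 L1 Q0 Q1 : ℝ → ℂ} {q : ℝ × ℝ → ℂ}
    (hQ0 : ContinuousOn Q0 (Icc c a)) (hQ1 : ContinuousOn Q1 (Icc c a))
    (hq : ContinuousOn q (Icc c a ×ˢ Icc c a)) (hq0 : ∀ p ∈ Icc c a ×ˢ Icc c a, q p ≠ 0)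
    (hqd : ∀ s ∈ Icc c a, ∀ t ∈ Icc c a, L1 t - L0 s = q (s, t) * (Q1 t - Q0 s))
    (hi0 : ∀ t ∈ Ico c a, (Q0 t).im < 0) (hi1 : ∀ t ∈ Ico c a, (Q1 t).im < 0)
    (hia0 : (Q0 a).im = 0) (hia1 : (Q1 a).im = 0) (hd : Q0 a ≠ Q1 a)
    (he1 : ∀ t ∈ Icc c a, ‖q (c, t) - 1‖ < 1) (he2 : ∀ s ∈ Icc c a, ‖q (s, c) - 1‖ < 1)
    (h1 : 0 ≤ (L1 a - L0 c).im) (h2 : (L1 c - L0 a).im ≤ 0)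
    {μ : ℝ × ℝ → ℂ} (hμ1 : ContinuousOn (fun t => μ (a, t)) (Icc c a)) (hμ2 : ContinuousOn (fun s => μ (s, a)) (Icc c a))
    (hμe1 : ∀ t ∈ Icc c a, exp (μ (a, t)) = L1 t - L0 a) (hμe2 : ∀ s ∈ Icc c a, exp (μ (s, a)) = L1 a - L0 s) :
    μ (a, c) - μ (c, a) = logM (L1 c - L0 a) - logP (L1 a - L0 c) + (logP (Q1 a - Q0 a) - logM (Q1 a - Q0 a)) := by
  have hcm := left_mem_Icc.2 hca.le
  have ham := right_mem_Icc.2 hca.le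
  let pr : ℝ → ℝ := fun x => projIcc c a hca.le x
  have hpr : Continuous pr := continuous_subtype_val.comp continuous_projIcc
  have hprm : ∀ x, pr x ∈ Icc c a := fun x => (projIcc c a hca.le x).2
  have hpre : ∀ x ∈ Icc c a, pr x = x := fun x hx => by simp only [pr, projIcc_of_mem hca.le hx]
  have ⟨Λ, hΛ, hΛe⟩ := exists_continuous_log (E := ℝ × ℝ) (g := fun p => q (pr p.1, pr p.2))
    (hq.comp_continuous (by fun_prop) fun p => ⟨hprm _, hprm _⟩) fun p => hq0 _ ⟨hprm _, hprm _⟩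
  replace hΛe : ∀ s ∈ Icc c a, ∀ t ∈ Icc c a, exp (Λ (s, t)) = q (s, t) := fun s hs t ht => by
    rw [hΛe]; simp only [hpre s hs, hpre t ht]
  have hle0 : ∀ t ∈ Icc c a, (Q0 t).im ≤ 0 := fun t ht => by grind
  have hle1 : ∀ t ∈ Icc c a, (Q1 t).im ≤ 0 := fun t ht => by grind
  have hne1 : ∀ t ∈ Icc c a, Q1 t - Q0 a ≠ 0 := fun t ht h => by grind
  have hne2 : ∀ s ∈ Icc c a, Q1 a - Q0 s ≠ 0 := fun t ht h => by grind
  have cΛ1 : ∀ s, Continuous fun t => Λ (s, t) := fun s => by fun_prop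
  have cΛ2 : ∀ t, Continuous fun s => Λ (s, t) := fun s => by fun_prop
  have cq1 : ∀ s ∈ Icc c a, ContinuousOn (fun t => q (s, t)) (Icc c a) := fun s hs =>
    hq.comp (by fun_prop) fun t ht => ⟨hs, ht⟩
  have cq2 : ∀ t ∈ Icc c a, ContinuousOn (fun s => q (s, t)) (Icc c a) := fun t ht =>
    hq.comp (by fun_prop) fun s hs => ⟨hs, ht⟩
  have e1 := sub_eq_sub_of_exp (f := fun t => Λ (c, t)) (g := fun t => log (q (c, t))) (cΛ1 c).continuousOn
      ((cq1 c hcm).clog fun t ht => (arg_lt_of_norm_sub_one (he1 t ht)).1)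
      (fun t ht => by rw [hΛe c hcm t ht, exp_log (hq0 _ ⟨hcm, ht⟩)]) ham hcm
  have e2 := sub_eq_sub_of_exp (f := fun t => Λ (t, c)) (g := fun t => log (q (t, c))) (cΛ2 c).continuousOn
      ((cq2 c hcm).clog fun t ht => (arg_lt_of_norm_sub_one (he2 t ht)).1)
      (fun t ht => by rw [hΛe t ht c hcm, exp_log (hq0 _ ⟨ht, hcm⟩)]) ham hcm
  have e3 : μ (a, c) - μ (a, a) = (Λ (a, c) + logM (Q1 c - Q0 a)) - (Λ (a, a) + logM (Q1 a - Q0 a)) := by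
    refine sub_eq_sub_of_exp (f := fun t => μ (a, t)) (g := fun t => Λ (a, t) + logM (Q1 t - Q0 a)) hμ1
      ((cΛ1 a).continuousOn.add fun t ht => ?_) (fun t ht => ?_) hcm ham
    · exact ContinuousAt.comp_continuousWithinAt (g := logM)
        (logM_continuousAt (by rw [sub_im, hia0, sub_zero]; exact hle1 t ht) (hne1 t ht)) ((hQ1 t ht).sub continuousWithinAt_const)
    · rw [hμe1 t ht, exp_add, hΛe a ham t ht, exp_logM (hne1 t ht), hqd a ham t ht]
  have e4 : μ (c, a) - μ (a, a) = (Λ (c, a) + logP (Q1 a - Q0 c)) - (Λ (a, a) + logP (Q1 a - Q0 a)) := by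
    refine sub_eq_sub_of_exp (f := fun t => μ (t, a)) (g := fun t => Λ (t, a) + logP (Q1 a - Q0 t)) hμ2
      ((cΛ2 a).continuousOn.add fun t ht => ?_) (fun t ht => ?_) hcm ham
    · exact ContinuousAt.comp_continuousWithinAt (g := logP)
        (logP_continuousAt (by rw [sub_im, hia1, zero_sub]; linarith [hle0 t ht]) (hne2 t ht)) (continuousWithinAt_const.sub (hQ0 t ht))
    · rw [hμe2 t ht, exp_add, hΛe t ht a ham, exp_logP (hne2 t ht), hqd t ht a ham]
  have hpi := Real.pi_pos
  have e5 : log (q (a, c)) + logM (Q1 c - Q0 a) = logM (L1 c - L0 a) := by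
    refine eq_of_exp_eq_of_im ?_ ?_
    · rw [exp_add, exp_log (hq0 _ ⟨ham, hcm⟩), exp_logM (hne1 c hcm), exp_logM (by rw [← hμe1 c hcm]; exact exp_ne_zero _), hqd a ham c hcm]
    · have a1 := (arg_lt_of_norm_sub_one (he2 a ham)).2
      have a2 := logM_im (z := Q1 c - Q0 a) (by rw [sub_im, hia0, sub_zero]; exact hle1 c hcm)
      have a3 := logM_im h2
      rw [abs_lt] at a1 ⊢
      rw [add_im]; constructor <;> linarith
  have e6 : log (q (c, a)) + logP (Q1 a - Q0 c) = logP (L1 a - L0 c) := by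
    refine eq_of_exp_eq_of_im ?_ ?_
    · rw [exp_add, exp_log (hq0 _ ⟨hcm, ham⟩), exp_logP (hne2 c hcm), exp_logP (by rw [← hμe2 c hcm]; exact exp_ne_zero _), hqd c hcm a ham]
    · have a1 := (arg_lt_of_norm_sub_one (he1 a ham)).2
      have a2 := logP_im (z := Q1 a - Q0 c) (by rw [sub_im, hia1, zero_sub]; linarith [hle0 c hcm])
      have a3 := logP_im h1
      rw [abs_lt] at a1 ⊢
      rw [add_im]; constructor <;> linarith
  linear_combination e3 - e4 + e2 - e1 + e5 - e6

/-- Two curves which agree with model curves near both ends and do not meet in between lie in the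
same order at both ends. -/
lemma crossing_log {c0 c1 : ℝ} (h0a : c0 < a) (hab : a ≤ b) (hb1 : b < c1) {L0 L1 Q0 Q1 R0 R1 : ℝ → ℂ}
    {q r : ℝ × ℝ → ℂ} (hL0 : ContinuousOn L0 (Icc c0 c1)) (hL1 : ContinuousOn L1 (Icc c0 c1))
    (hne : ∀ s ∈ Icc c0 c1, ∀ t ∈ Icc c0 c1, (a ≤ s ∨ a ≤ t) → (s ≤ b ∨ t ≤ b) → L1 t ≠ L0 s)
    (hQ0 : ContinuousOn Q0 (Icc c0 a)) (hQ1 : ContinuousOn Q1 (Icc c0 a))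
    (hq : ContinuousOn q (Icc c0 a ×ˢ Icc c0 a)) (hq0 : ∀ p ∈ Icc c0 a ×ˢ Icc c0 a, q p ≠ 0)
    (hqd : ∀ s ∈ Icc c0 a, ∀ t ∈ Icc c0 a, L1 t - L0 s = q (s, t) * (Q1 t - Q0 s))
    (hi0 : ∀ t ∈ Ico c0 a, (Q0 t).im < 0) (hi1 : ∀ t ∈ Ico c0 a, (Q1 t).im < 0)
    (hia0 : (Q0 a).im = 0) (hia1 : (Q1 a).im = 0) (hdQ : Q0 a ≠ Q1 a)
    (he1 : ∀ t ∈ Icc c0 a, ‖q (c0, t) - 1‖ < 1) (he2 : ∀ s ∈ Icc c0 a, ‖q (s, c0) - 1‖ < 1)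
    (hR0 : ContinuousOn R0 (Icc b c1)) (hR1 : ContinuousOn R1 (Icc b c1))
    (hr : ContinuousOn r (Icc b c1 ×ˢ Icc b c1)) (hr0 : ∀ p ∈ Icc b c1 ×ˢ Icc b c1, r p ≠ 0)
    (hrd : ∀ s ∈ Icc b c1, ∀ t ∈ Icc b c1, L1 t - L0 s = r (s, t) * (R1 t - R0 s))
    (hj0 : ∀ t ∈ Ioc b c1, 0 < (R0 t).im) (hj1 : ∀ t ∈ Ioc b c1, 0 < (R1 t).im)
    (hjb0 : (R0 b).im = 0) (hjb1 : (R1 b).im = 0) (hdR : R0 b ≠ R1 b)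
    (hf1 : ∀ t ∈ Icc b c1, ‖r (c1, t) - 1‖ < 1) (hf2 : ∀ s ∈ Icc b c1, ‖r (s, c1) - 1‖ < 1)
    (hlow0 : ∀ t ∈ Icc a c1, (L0 c0).im ≤ (L1 t).im) (hlow1 : ∀ t ∈ Icc a c1, (L1 c0).im ≤ (L0 t).im)
    (hup0 : ∀ t ∈ Icc c0 b, (L1 t).im ≤ (L0 c1).im) (hup1 : ∀ t ∈ Icc c0 b, (L0 t).im ≤ (L1 c1).im) :
    logP (Q1 a - Q0 a) - logM (Q1 a - Q0 a) = logP (R1 b - R0 b) - logM (R1 b - R0 b) := by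
  have h01 : c0 ≤ c1 := by linarith
  let pr : ℝ → ℝ := fun x => projIcc c0 c1 h01 x
  have hpr : Continuous pr := continuous_subtype_val.comp continuous_projIcc
  have hprm : ∀ x, pr x ∈ Icc c0 c1 := fun x => (projIcc c0 c1 h01 x).2
  have hpre : ∀ x ∈ Icc c0 c1, pr x = x := fun x hx => by simp only [pr, projIcc_of_mem h01 hx]
  let sh : ℝ × ℝ → ℝ := fun p => max 0 (a - max (pr p.1) (pr p.2)) - max 0 (min (pr p.1) (pr p.2) - b)
  have hsh : Continuous sh := by fun_prop
  let ρ1 : ℝ × ℝ → ℝ := fun p => pr p.1 + sh p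
  let ρ2 : ℝ × ℝ → ℝ := fun p => pr p.2 + sh p
  have hρ : ∀ p, ρ1 p ∈ Icc c0 c1 ∧ ρ2 p ∈ Icc c0 c1 ∧ (a ≤ ρ1 p ∨ a ≤ ρ2 p) ∧ (ρ1 p ≤ b ∨ ρ2 p ≤ b) := fun p => by
    have h1 := hprm p.1
    have h2 := hprm p.2
    simp only [ρ1, ρ2, sh]
    generalize pr p.1 = x at *
    generalize pr p.2 = y at *
    have ⟨h1, h1'⟩ := h1
    have ⟨h2, h2'⟩ := h2
    simp only [mem_Icc]
    rcases le_total x y with hxy | hxy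
    · rw [max_eq_right hxy, min_eq_left hxy]
      rcases le_total 0 (a - y) with h3 | h3
      · rw [max_eq_right h3, max_eq_left (by linarith)]
        exact ⟨⟨by linarith, by linarith⟩, ⟨by linarith, by linarith⟩, Or.inr (by linarith), Or.inl (by linarith)⟩
      · rw [max_eq_left h3]
        rcases le_total 0 (x - b) with h4 | h4
        · rw [max_eq_right h4]
          exact ⟨⟨by linarith, by linarith⟩, ⟨by linarith, by linarith⟩, Or.inr (by linarith), Or.inl (by linarith)⟩
        · rw [max_eq_left h4]
          exact ⟨⟨by linarith, by linarith⟩, ⟨by linarith, by linarith⟩, Or.inr (by linarith), Or.inl (by linarith)⟩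
    · rw [max_eq_left hxy, min_eq_right hxy]
      rcases le_total 0 (a - x) with h3 | h3
      · rw [max_eq_right h3, max_eq_left (by linarith)]
        exact ⟨⟨by linarith, by linarith⟩, ⟨by linarith, by linarith⟩, Or.inl (by linarith), Or.inr (by linarith)⟩
      · rw [max_eq_left h3]
        rcases le_total 0 (y - b) with h4 | h4
        · rw [max_eq_right h4]
          exact ⟨⟨by linarith, by linarith⟩, ⟨by linarith, by linarith⟩, Or.inl (by linarith), Or.inr (by linarith)⟩
        · rw [max_eq_left h4]
          exact ⟨⟨by linarith, by linarith⟩, ⟨by linarith, by linarith⟩, Or.inl (by linarith), Or.inr (by linarith)⟩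
  have ⟨μ, hμ, hμe'⟩ := exists_continuous_log (E := ℝ × ℝ) (g := fun p => L1 (ρ2 p) - L0 (ρ1 p))
    ((hL1.comp_continuous (by fun_prop) fun p => (hρ p).2.1).sub (hL0.comp_continuous (by fun_prop) fun p => (hρ p).1))
    fun p => sub_ne_zero.2 (hne _ (hρ p).1 _ (hρ p).2.1 (hρ p).2.2.1 (hρ p).2.2.2)
  have hμe : ∀ s ∈ Icc c0 c1, ∀ t ∈ Icc c0 c1, (a ≤ s ∨ a ≤ t) → (s ≤ b ∨ t ≤ b) → exp (μ (s, t)) = L1 t - L0 s := by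
    intro s hs t ht h1 h2
    have : sh (s, t) = 0 := by grind
    rw [hμe']
    simp only [ρ1, ρ2, this, hpre s hs, hpre t ht, add_zero]
  have hδ : ∀ s ∈ Icc c0 c1, ∀ t ∈ Icc c0 c1, (a ≤ s ∨ a ≤ t) → (s ≤ b ∨ t ≤ b) → L1 t - L0 s ≠ 0 :=
    fun s hs t ht h1 h2 => sub_ne_zero.2 (hne s hs t ht h1 h2)
  have m0 := left_mem_Icc.2 h01
  have m1 := right_mem_Icc.2 h01
  have ma : a ∈ Icc c0 c1 := ⟨by linarith, by linarith⟩
  have mb : b ∈ Icc c0 c1 := ⟨by linarith, by linarith⟩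
  have cμ1 : ∀ s, Continuous fun t => μ (s, t) := fun s => by fun_prop
  have cμ2 : ∀ t, Continuous fun s => μ (s, t) := fun s => by fun_prop
  have low : ∀ t ∈ Icc c0 a, t ∈ Icc c0 c1 := fun t ht => ⟨ht.1, by linarith [ht.2]⟩
  have up : ∀ t ∈ Icc b c1, t ∈ Icc c0 c1 := fun t ht => ⟨by linarith [ht.1], ht.2⟩
  have k1 := corner_increment h0a hQ0 hQ1 hq hq0 hqd hi0 hi1 hia0 hia1 hdQ he1 he2
    (by rw [sub_im, sub_nonneg]; exact hlow0 a ⟨le_rfl, by linarith⟩)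
    (by rw [sub_im, sub_nonpos]; exact hlow1 a ⟨le_rfl, by linarith⟩)
    (cμ1 a).continuousOn (cμ2 a).continuousOn
    (fun t ht => hμe a ma t (low t ht) (Or.inl le_rfl) (Or.inl hab))
    (fun s hs => hμe s (low s hs) a ma (Or.inr le_rfl) (Or.inr hab))
  have neg_mem : ∀ {t}, t ∈ Icc (-c1) (-b) → -t ∈ Icc b c1 := fun ht => ⟨by linarith [ht.2], by linarith [ht.1]⟩
  have hnc : ContinuousOn (fun t : ℝ => -t) (Icc (-c1) (-b)) := continuous_neg.continuousOn
  have k2 := corner_increment (c := -c1) (a := -b) (by linarith) (L0 := fun t => -L0 (-t)) (L1 := fun t => -L1 (-t))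
    (Q0 := fun t => -R0 (-t)) (Q1 := fun t => -R1 (-t)) (q := fun p => r (-p.1, -p.2))
    (hR0.comp hnc fun t ht => neg_mem ht).neg (hR1.comp hnc fun t ht => neg_mem ht).neg
    (hr.comp (by fun_prop) fun p hp => ⟨neg_mem hp.1, neg_mem hp.2⟩)
    (fun p hp => hr0 _ ⟨neg_mem hp.1, neg_mem hp.2⟩)
    (fun s hs t ht => by grind)
    (fun t ht => by rw [neg_im, neg_lt_zero]; exact hj0 _ ⟨by linarith [ht.2], by linarith [ht.1]⟩)
    (fun t ht => by rw [neg_im, neg_lt_zero]; exact hj1 _ ⟨by linarith [ht.2], by linarith [ht.1]⟩)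
    (by simp only [neg_neg]; rw [neg_im, hjb0, neg_zero]) (by simp only [neg_neg]; rw [neg_im, hjb1, neg_zero])
    (by simp only [neg_neg]; exact fun h => hdR (neg_inj.1 h))
    (fun t ht => by simp only [neg_neg]; exact hf1 _ (neg_mem ht))
    (fun t ht => by simp only [neg_neg]; exact hf2 _ (neg_mem ht))
    (by simp only [neg_neg, sub_im, neg_im]; linarith [hup0 b ⟨by linarith, le_rfl⟩])
    (by simp only [neg_neg, sub_im, neg_im]; linarith [hup1 b ⟨by linarith, le_rfl⟩])
    (μ := fun p => μ (-p.1, -p.2) + π * I)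
    (by fun_prop) (by fun_prop)
    (fun t ht => by
      rw [exp_add, exp_pi_mul_I]; simp only [neg_neg]
      rw [hμe b mb _ (up _ (neg_mem ht)) (Or.inl hab) (Or.inl le_rfl)]; ring)
    (fun t ht => by
      rw [exp_add, exp_pi_mul_I]; simp only [neg_neg]
      rw [hμe _ (up _ (neg_mem ht)) b mb (Or.inr hab) (Or.inr le_rfl)]; ring)
  simp only [neg_neg] at k2
  rw [show -L1 c1 - -L0 b = -(L1 c1 - L0 b) by ring, show -L1 b - -L0 c1 = -(L1 b - L0 c1) by ring,
    show -R1 b - -R0 b = -(R1 b - R0 b) by ring, logM_neg, logM_neg, logP_neg, logP_neg] at k2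
  have e1 : μ (c1, c0) - μ (a, c0) = logM (L1 c0 - L0 c1) - logM (L1 c0 - L0 a) := by
    have hs : ∀ s ∈ Icc a c1, s ∈ Icc c0 c1 := fun s hs => ⟨by linarith [hs.1], hs.2⟩
    refine sub_eq_sub_of_exp (c := a) (a := c1) (f := fun s => μ (s, c0)) (g := fun s => logM (L1 c0 - L0 s))
      (cμ2 _).continuousOn (fun s h => ?_) (fun s h => ?_) ⟨by linarith, le_rfl⟩ ⟨le_rfl, by linarith⟩
    · exact ContinuousAt.comp_continuousWithinAt (g := logM)
        (logM_continuousAt (by rw [sub_im, sub_nonpos]; exact hlow1 s h) (hδ _ (hs s h) _ m0 (Or.inl h.1) (Or.inr (by linarith))))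
        (continuousWithinAt_const.sub ((hL0 s (hs s h)).mono hs))
    · rw [hμe s (hs s h) _ m0 (Or.inl h.1) (Or.inr (by linarith)),
        exp_logM (hδ _ (hs s h) _ m0 (Or.inl h.1) (Or.inr (by linarith)))]
  have e2 : μ (c1, b) - μ (c1, c0) = logM (L1 b - L0 c1) - logM (L1 c0 - L0 c1) := by
    have hs : ∀ s ∈ Icc c0 b, s ∈ Icc c0 c1 := fun s hs => ⟨hs.1, by linarith [hs.2]⟩
    refine sub_eq_sub_of_exp (c := c0) (a := b) (f := fun s => μ (c1, s)) (g := fun s => logM (L1 s - L0 c1))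
      (cμ1 _).continuousOn (fun s h => ?_) (fun s h => ?_) ⟨by linarith, le_rfl⟩ ⟨le_rfl, by linarith⟩
    · exact ContinuousAt.comp_continuousWithinAt (g := logM)
        (logM_continuousAt (by rw [sub_im, sub_nonpos]; exact hup0 s h) (hδ _ m1 _ (hs s h) (Or.inl (by linarith)) (Or.inr h.2)))
        (((hL1 s (hs s h)).mono hs).sub continuousWithinAt_const)
    · rw [hμe _ m1 s (hs s h) (Or.inl (by linarith)) (Or.inr h.2),
        exp_logM (hδ _ m1 _ (hs s h) (Or.inl (by linarith)) (Or.inr h.2))]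
  have e3 : μ (c0, c1) - μ (b, c1) = logP (L1 c1 - L0 c0) - logP (L1 c1 - L0 b) := by
    have hs : ∀ s ∈ Icc c0 b, s ∈ Icc c0 c1 := fun s hs => ⟨hs.1, by linarith [hs.2]⟩
    refine sub_eq_sub_of_exp (c := c0) (a := b) (f := fun s => μ (s, c1)) (g := fun s => logP (L1 c1 - L0 s))
      (cμ2 _).continuousOn (fun s h => ?_) (fun s h => ?_) ⟨le_rfl, by linarith⟩ ⟨by linarith, le_rfl⟩
    · exact ContinuousAt.comp_continuousWithinAt (g := logP)
        (logP_continuousAt (by rw [sub_im, sub_nonneg]; exact hup1 s h) (hδ _ (hs s h) _ m1 (Or.inr (by linarith)) (Or.inl h.2)))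
        (continuousWithinAt_const.sub ((hL0 s (hs s h)).mono hs))
    · rw [hμe s (hs s h) _ m1 (Or.inr (by linarith)) (Or.inl h.2),
        exp_logP (hδ _ (hs s h) _ m1 (Or.inr (by linarith)) (Or.inl h.2))]
  have e4 : μ (c0, a) - μ (c0, c1) = logP (L1 a - L0 c0) - logP (L1 c1 - L0 c0) := by
    have hs : ∀ s ∈ Icc a c1, s ∈ Icc c0 c1 := fun s hs => ⟨by linarith [hs.1], hs.2⟩
    refine sub_eq_sub_of_exp (c := a) (a := c1) (f := fun s => μ (c0, s)) (g := fun s => logP (L1 s - L0 c0))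
      (cμ1 _).continuousOn (fun s h => ?_) (fun s h => ?_) ⟨le_rfl, by linarith⟩ ⟨by linarith, le_rfl⟩
    · exact ContinuousAt.comp_continuousWithinAt (g := logP)
        (logP_continuousAt (by rw [sub_im, sub_nonneg]; exact hlow0 s h) (hδ _ m0 _ (hs s h) (Or.inr h.1) (Or.inl (by linarith))))
        (((hL1 s (hs s h)).mono hs).sub continuousWithinAt_const)
    · rw [hμe _ m0 s (hs s h) (Or.inr h.1) (Or.inl (by linarith)),
        exp_logP (hδ _ m0 _ (hs s h) (Or.inr h.1) (Or.inl (by linarith)))]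
  linear_combination -k2 - k1 - e1 - e2 - e3 - e4

/-- A univalent function on the lower half-plane asymptotic to the identity. -/
structure LowMap (A : ℂ → ℂ) : Prop where
  diff : DifferentiableOn ℂ A {v | v.im < 0}
  deriv_ne : ∀ v : ℂ, v.im < 0 → deriv A v ≠ 0
  inj : InjOn A {v | v.im < 0}
  near : ∃ C M : ℝ, ∀ v : ℂ, v.im < -M → ‖A v - v‖ ≤ C
  lip : ∃ M : ℝ, ∀ v w : ℂ, v.im < -M → w.im < -M → ‖(A v - v) - (A w - w)‖ ≤ 1 / 2 * ‖v - w‖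

/-- A curve `L` on `(0, a]` coming from `-i∞` and lifting to a curve `Q` in the lower half-plane
which reaches the boundary at time `a`. -/
structure LowEnd (A : ℂ → ℂ) (a : ℝ) (L Q : ℝ → ℂ) : Prop where
  contL : ContinuousOn L (Ioc 0 a)
  contQ : ContinuousOn Q (Ioc 0 a)
  im_neg : ∀ t ∈ Ioo 0 a, (Q t).im < 0
  im_zero : (Q a).im = 0
  eq : ∀ t ∈ Ioo 0 a, L t = A (Q t)
  tend : Tendsto (fun t => (Q t).im) (𝓝[>] 0) atBot

lemma LowMap.analyticAt (hA : LowMap A) (hv : v.im < 0) : AnalyticAt ℂ A v :=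
  hA.diff.analyticAt ((isOpen_im_lt 0).mem_nhds hv)

lemma LowMap.deriv_near (hA : LowMap A) : ∃ M : ℝ, ∀ v : ℂ, v.im < -M → ‖deriv A v - 1‖ < 1 := by
  have ⟨M, hM⟩ := hA.lip
  refine ⟨max M 0, fun v hv => ?_⟩
  have h1 : v.im < -M := by linarith [le_max_left M 0]
  have h2 := (hA.analyticAt (by linarith [le_max_right M 0])).differentiableAt.hasDerivAt.sub (hasDerivAt_id v)
  refine (h2.le_of_lip' (C := 1 / 2) (by norm_num) ?_).trans_lt (by norm_num)
  filter_upwards [(isOpen_im_lt (-M)).mem_nhds h1] with w hw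
  exact hM w v hw h1

lemma LowEnd.exists_bound (hA : LowMap A) (h : LowEnd A a L Q) :
    ∃ C, ∀ t ∈ Ioc 0 a, ‖L t - Q t‖ ≤ C := by
  have ⟨C, M, hM⟩ := hA.near
  have ⟨d, hd0, hd⟩ := (mem_nhdsGT_iff_exists_Ioo_subset).1 (h.tend.eventually (eventually_lt_atBot (min (-M) 0)))
  have ⟨C', hC'⟩ := (isCompact_Icc (a := d) (b := a)).exists_bound_of_continuousOn
    ((h.contL.sub h.contQ).mono fun t ht => ⟨lt_of_lt_of_le hd0 ht.1, ht.2⟩)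
  refine ⟨max C C', fun t ht => ?_⟩
  rcases lt_or_ge t d with h1 | h1
  · have h3 : (Q t).im < min (-M) 0 := hd ⟨ht.1, h1⟩
    rw [lt_min_iff] at h3
    rcases ht.2.eq_or_lt with rfl | h2
    · exact absurd h3.2 (by rw [h.im_zero]; exact lt_irrefl _)
    · rw [h.eq t ⟨ht.1, h2⟩]
      exact (hM _ h3.1).trans (le_max_left _ _)
  · exact (hC' t ⟨h1, ht.2⟩).trans (le_max_right _ _)

lemma LowEnd.norm_sub_sub_lt (hA : LowMap A) {L0 L1 Q0 Q1 : ℝ → ℂ}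
    (h0 : LowEnd A a L0 Q0) (h1 : LowEnd A a L1 Q1) (ha : 0 < a) :
    ∀ᶠ c in 𝓝[>] (0 : ℝ), ∀ t ∈ Ioc 0 a, Q1 t ≠ Q0 c → ‖(L1 t - L0 c) - (Q1 t - Q0 c)‖ < ‖Q1 t - Q0 c‖ := by
  have ⟨C0, hC0⟩ := h0.exists_bound hA
  have ⟨C1, hC1⟩ := h1.exists_bound hA
  have ⟨M, hM⟩ := hA.lip
  filter_upwards [Ioo_mem_nhdsGT ha, h0.tend.eventually (eventually_lt_atBot (-(C0 + C1 + |M|) - 1))] with c hc hci t ht hne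
  have hM0 := abs_nonneg M
  have hMM := le_abs_self M
  have b0 := hC0 c ⟨hc.1, hc.2.le⟩
  have b1 := hC1 t ht
  have n0 := (norm_nonneg _).trans b0
  have n1 := (norm_nonneg _).trans b1
  rw [show (L1 t - L0 c) - (Q1 t - Q0 c) = (L1 t - Q1 t) - (L0 c - Q0 c) by ring]
  rcases lt_or_ge (Q1 t).im (-|M|) with h2 | h2
  · rw [h1.eq t ⟨ht.1, lt_of_le_of_ne ht.2 fun h => by rw [h, h1.im_zero] at h2; linarith⟩, h0.eq c hc]
    refine (hM _ _ (by linarith) (by linarith)).trans_lt ?_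
    linarith [norm_pos_iff.2 (sub_ne_zero.2 hne)]
  · have h3 : C0 + C1 < ‖Q1 t - Q0 c‖ := by
      have := (le_abs_self _).trans (abs_im_le_norm (Q1 t - Q0 c))
      rw [sub_im] at this; linarith
    exact ((norm_sub_le _ _).trans (by linarith)).trans_lt h3

/-- Near a common end, the difference of two curves is a nonvanishing multiple of the difference of
their lifts. -/
lemma LowEnd.exists_quotient (hA : LowMap A) {L0 L1 Q0 Q1 : ℝ → ℂ}
    (h0 : LowEnd A a L0 Q0) (h1 : LowEnd A a L1 Q1) (ha : 0 < a) (hd : Q0 a ≠ Q1 a)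
    (hne : ∀ t ∈ Ioc 0 a, L1 t ≠ L0 a ∧ L1 a ≠ L0 t) :
    ∃ q : ℝ × ℝ → ℂ, ContinuousOn q (Ioc 0 a ×ˢ Ioc 0 a) ∧ (∀ p ∈ Ioc 0 a ×ˢ Ioc 0 a, q p ≠ 0) ∧
      (∀ s ∈ Ioc 0 a, ∀ t ∈ Ioc 0 a, L1 t - L0 s = q (s, t) * (Q1 t - Q0 s)) ∧
      ∀ᶠ c in 𝓝[>] (0 : ℝ), (∀ t ∈ Icc c a, ‖q (c, t) - 1‖ < 1) ∧ ∀ s ∈ Icc c a, ‖q (s, c) - 1‖ < 1 := by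
  classical
  have low : ∀ s ∈ Ioc 0 a, ∀ t ∈ Ioc 0 a, Q1 t = Q0 s → s < a ∧ t < a := by
    intro s hs t ht h
    rcases hs.2.eq_or_lt with rfl | h2 <;> rcases ht.2.eq_or_lt with rfl | h3
    · exact absurd h.symm hd
    · have := h1.im_neg t ⟨ht.1, h3⟩
      rw [h, h0.im_zero] at this; exact absurd this (lt_irrefl _)
    · have := h0.im_neg s ⟨hs.1, h2⟩
      rw [← h, h1.im_zero] at this; exact absurd this (lt_irrefl _)
    · exact ⟨h2, h3⟩
  refine ⟨fun p => if Q1 p.2 = Q0 p.1 then deriv A (Q0 p.1) else (L1 p.2 - L0 p.1) / (Q1 p.2 - Q0 p.1), ?_, ?_, ?_, ?_⟩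
  · rintro ⟨s, t⟩ ⟨hs, ht⟩
    have cQ0 : ContinuousWithinAt (fun p : ℝ × ℝ => Q0 p.1) (Ioc 0 a ×ˢ Ioc 0 a) (s, t) :=
      (h0.contQ s hs).comp continuousWithinAt_fst fun p hp => hp.1
    have cQ1 : ContinuousWithinAt (fun p : ℝ × ℝ => Q1 p.2) (Ioc 0 a ×ˢ Ioc 0 a) (s, t) :=
      (h1.contQ t ht).comp continuousWithinAt_snd fun p hp => hp.2
    have cL0 : ContinuousWithinAt (fun p : ℝ × ℝ => L0 p.1) (Ioc 0 a ×ˢ Ioc 0 a) (s, t) :=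
      (h0.contL s hs).comp continuousWithinAt_fst fun p hp => hp.1
    have cL1 : ContinuousWithinAt (fun p : ℝ × ℝ => L1 p.2) (Ioc 0 a ×ˢ Ioc 0 a) (s, t) :=
      (h1.contL t ht).comp continuousWithinAt_snd fun p hp => hp.2
    by_cases h : Q1 t = Q0 s
    · have ⟨hsa, hta⟩ := low s hs t ht h
      have han := hA.analyticAt (h0.im_neg s ⟨hs.1, hsa⟩)
      rw [ContinuousWithinAt, Metric.tendsto_nhds]
      intro ε hε
      simp only [h, if_true]
      have e1 := Metric.tendsto_nhds.1 (Filter.Tendsto.comp (han.deriv.continuousAt.tendsto) cQ0.tendsto) ε hε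
      have e2 : ∀ᶠ p : ℂ × ℂ in 𝓝 (Q0 s, Q0 s), ‖A p.1 - A p.2 - (p.1 - p.2) • deriv A (Q0 s)‖ ≤ ε / 2 * ‖p.1 - p.2‖ :=
        (hasDerivAtFilter_iff_isLittleO.1 han.hasStrictDerivAt).def (by positivity)
      have e3 : Tendsto (fun p : ℝ × ℝ => (Q1 p.2, Q0 p.1)) (𝓝[Ioc 0 a ×ˢ Ioc 0 a] (s, t)) (𝓝 (Q0 s, Q0 s)) := by
        have := cQ1.tendsto.prodMk_nhds cQ0.tendsto
        simp only [h] at this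
        exact this
      have e5 : ∀ᶠ p : ℝ × ℝ in 𝓝[Ioc 0 a ×ˢ Ioc 0 a] (s, t), p.1 < a ∧ p.2 < a :=
        (((isOpen_lt continuous_fst continuous_const).inter (isOpen_lt continuous_snd continuous_const)).mem_nhds
          ⟨hsa, hta⟩ : {p : ℝ × ℝ | p.1 < a} ∩ {p : ℝ × ℝ | p.2 < a} ∈ 𝓝 (s, t)) |> fun h => nhdsWithin_le_nhds h
      filter_upwards [e1, e3.eventually e2, self_mem_nhdsWithin, e5] with p h1' h2' h4 h5
      split_ifs with h6
      · exact h1'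
      · have hn := norm_pos_iff.2 (sub_ne_zero.2 h6)
        rw [h1.eq _ ⟨h4.2.1, h5.2⟩, h0.eq _ ⟨h4.1.1, h5.1⟩, dist_eq_norm,
          div_sub' (sub_ne_zero.2 h6), norm_div, div_lt_iff₀ hn]
        refine lt_of_le_of_lt h2' ?_
        have := mul_pos hε hn
        linarith
    · refine ((cL1.sub cL0).div (cQ1.sub cQ0) (sub_ne_zero.2 h)).congr_of_eventuallyEq ?_ (by simp [h])
      filter_upwards [((cQ1.sub cQ0).tendsto.eventually_ne (sub_ne_zero.2 h)).mono fun p hp => sub_ne_zero.1 hp] with p hp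
      simp [hp]
  · rintro ⟨s, t⟩ ⟨hs, ht⟩
    simp only
    split_ifs with h
    · exact hA.deriv_ne _ (h0.im_neg s ⟨hs.1, (low s hs t ht h).1⟩)
    · refine div_ne_zero (sub_ne_zero.2 fun h2 => ?_) (sub_ne_zero.2 h)
      rcases hs.2.eq_or_lt with rfl | hsa
      · exact (hne t ht).1 h2
      rcases ht.2.eq_or_lt with rfl | hta
      · exact (hne s hs).2 h2
      rw [h1.eq t ⟨ht.1, hta⟩, h0.eq s ⟨hs.1, hsa⟩] at h2
      exact h (hA.inj (h1.im_neg t ⟨ht.1, hta⟩) (h0.im_neg s ⟨hs.1, hsa⟩) h2)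
  · intro s hs t ht
    simp only
    split_ifs with h
    · have ⟨hsa, hta⟩ := low s hs t ht h
      rw [h1.eq t ⟨ht.1, hta⟩, h0.eq s ⟨hs.1, hsa⟩, h]; simp
    · rw [div_mul_cancel₀ _ (sub_ne_zero.2 h)]
  · have ⟨M, hM⟩ := hA.deriv_near
    filter_upwards [h0.norm_sub_sub_lt hA h1 ha, h1.norm_sub_sub_lt hA h0 ha, Ioo_mem_nhdsGT ha,
      h0.tend.eventually (eventually_lt_atBot (-M)), h1.tend.eventually (eventually_lt_atBot (-M))] with c k0 k1 hc k2 k3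
    refine ⟨fun t ht => ?_, fun s hs => ?_⟩
    · split_ifs with h
      · exact hM _ k2
      · rw [div_sub_one (sub_ne_zero.2 h), norm_div, div_lt_one (norm_pos_iff.2 (sub_ne_zero.2 h))]
        exact k0 t ⟨hc.1.trans_le ht.1, ht.2⟩ h
    · split_ifs with h
      · exact hM _ (by rw [← h]; exact k3)
      · rw [div_sub_one (sub_ne_zero.2 h), norm_div, div_lt_one (norm_pos_iff.2 (sub_ne_zero.2 h))]
        have := k1 s ⟨hc.1.trans_le hs.1, hs.2⟩ (Ne.symm h)
        rwa [show L0 s - L1 c - (Q0 s - Q1 c) = -(L1 c - L0 s - (Q1 c - Q0 s)) by ring, norm_neg, norm_sub_rev (Q0 s)] at this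

lemma LowEnd.tendsto_im (hA : LowMap A) (h : LowEnd A a L Q) (ha : 0 < a) :
    Tendsto (fun t => (L t).im) (𝓝[>] 0) atBot := by
  have ⟨C, hC⟩ := h.exists_bound hA
  have h2 : Tendsto (fun t => (Q t).im + C) (𝓝[>] 0) atBot := tendsto_atBot_add_const_right _ _ h.tend
  refine tendsto_atBot_mono' (𝓝[>] 0) ?_ h2
  filter_upwards [Ioo_mem_nhdsGT ha] with t ht
  have h1 := (le_abs_self _).trans ((abs_im_le_norm (L t - Q t)).trans (hC t ⟨ht.1, ht.2.le⟩))
  rw [sub_im] at h1; linarith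

/-- A curve from `-i∞` to `+i∞` modelled on univalent maps near both ends. -/
structure CrossCurve (A B : ℂ → ℂ) (L Q R : ℝ → ℂ) : Prop where
  cont : ContinuousOn L (Ioo 0 1)
  low : LowEnd A (1 / 3) L Q
  high : LowEnd B (1 / 3) (fun t => -L (1 - t)) (fun t => -R (1 - t))

lemma CrossCurve.exists_upper (hA : LowMap A) {R : ℝ → ℂ}
    (h : CrossCurve A B L Q R) : ∃ C, ∀ t ∈ Ioc (0 : ℝ) (2 / 3), (L t).im ≤ C := by
  have ⟨d, hd0, hd⟩ := (mem_nhdsGT_iff_exists_Ioo_subset).1 ((h.low.tendsto_im hA (by norm_num)).eventually (eventually_lt_atBot 0))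
  have ⟨C', hC'⟩ := (isCompact_Icc (a := d) (b := 2 / 3)).exists_bound_of_continuousOn
    (h.cont.mono fun t ht => ⟨lt_of_lt_of_le hd0 ht.1, lt_of_le_of_lt ht.2 (by norm_num)⟩)
  refine ⟨max 0 C', fun t ht => ?_⟩
  rcases lt_or_ge t d with h1 | h1
  · exact (show (L t).im < 0 from hd ⟨ht.1, h1⟩).le.trans (le_max_left _ _)
  · exact ((le_abs_self _).trans (abs_im_le_norm _)).trans ((hC' t ⟨h1, ht.2⟩).trans (le_max_right _ _))

lemma CrossCurve.reflect {R : ℝ → ℂ} (h : CrossCurve A B L Q R) :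
    CrossCurve B A (fun t => -L (1 - t)) (fun t => -R (1 - t)) (fun t => -Q (1 - t)) where
  cont := (h.cont.comp (by fun_prop) fun t ht => ⟨by linarith [ht.2], by linarith [ht.1]⟩).neg
  low := h.high
  high := by simpa using h.low

lemma LowEnd.eventually_im_le (hA : LowMap A) (h : LowEnd A a L Q) (ha : 0 < a)
    {S : Set ℝ} {L' : ℝ → ℂ} {C : ℝ} (hC : ∀ t ∈ S, C ≤ (L' t).im) :
    ∀ᶠ c in 𝓝[>] (0 : ℝ), ∀ t ∈ S, (L c).im ≤ (L' t).im := by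
  filter_upwards [(h.tendsto_im hA ha).eventually (eventually_le_atBot C)] with c hc t ht
  exact hc.trans (hC t ht)

lemma logP_sub_logM_inj (hz : z.im = 0) (hw : w.im = 0) (hz0 : 0 < z.re)
    (h : logP z - logM z = logP w - logM w) : 0 ≤ w.re := by
  by_contra! hw0
  rw [show z = (z.re : ℂ) from Complex.ext rfl (by simpa using hz), show w = (w.re : ℂ) from Complex.ext rfl (by simpa using hw),
    logP_sub_logM_of_pos hz0, logP_sub_logM_of_neg hw0] at h
  exact two_pi_I_ne_zero h.symm

lemma logP_sub_logM_inj' (hz : z.im = 0) (hw : w.im = 0) (hz0 : z.re < 0)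
    (h : logP z - logM z = logP w - logM w) : w.re ≤ 0 := by
  by_contra! hw0
  rw [show z = (z.re : ℂ) from Complex.ext rfl (by simpa using hz), show w = (w.re : ℂ) from Complex.ext rfl (by simpa using hw),
    logP_sub_logM_of_pos hw0, logP_sub_logM_of_neg hz0] at h
  exact two_pi_I_ne_zero h

/-- Two disjoint cross curves are ordered in the same way at both ends. -/
lemma CrossCurve.order (hA : LowMap A) (hB : LowMap B) {L0 Q0 R0 L1 Q1 R1 : ℝ → ℂ}
    (h0 : CrossCurve A B L0 Q0 R0) (h1 : CrossCurve A B L1 Q1 R1)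
    (hne : ∀ s ∈ Ioo (0 : ℝ) 1, ∀ t ∈ Ioo (0 : ℝ) 1, (1 / 3 ≤ s ∨ 1 / 3 ≤ t) → (s ≤ 2 / 3 ∨ t ≤ 2 / 3) → L1 t ≠ L0 s) :
    (0 < (Q1 (1 / 3) - Q0 (1 / 3)).re → 0 ≤ (R1 (2 / 3) - R0 (2 / 3)).re) ∧
      ((Q1 (1 / 3) - Q0 (1 / 3)).re < 0 → (R1 (2 / 3) - R0 (2 / 3)).re ≤ 0) := by
  by_cases hdQ : Q0 (1 / 3) = Q1 (1 / 3)
  · rw [hdQ, sub_self, zero_re]; exact ⟨fun h => absurd h (lt_irrefl _), fun h => absurd h (lt_irrefl _)⟩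
  by_cases hdR : R0 (2 / 3) = R1 (2 / 3)
  · rw [hdR, sub_self, zero_re]; exact ⟨fun _ => le_rfl, fun _ => le_rfl⟩
  have iQ0 := h0.low.im_zero
  have iQ1 := h1.low.im_zero
  have iR0 : (R0 (2 / 3)).im = 0 := by
    have := h0.high.im_zero
    norm_num at this; exact this
  have iR1 : (R1 (2 / 3)).im = 0 := by
    have := h1.high.im_zero
    norm_num at this; exact this
  suffices key : logP (Q1 (1 / 3) - Q0 (1 / 3)) - logM (Q1 (1 / 3) - Q0 (1 / 3))
      = logP (R1 (2 / 3) - R0 (2 / 3)) - logM (R1 (2 / 3) - R0 (2 / 3)) by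
    exact ⟨fun h => logP_sub_logM_inj (by rw [sub_im, iQ0, iQ1, sub_zero]) (by rw [sub_im, iR0, iR1, sub_zero]) h key,
      fun h => logP_sub_logM_inj' (by rw [sub_im, iQ0, iQ1, sub_zero]) (by rw [sub_im, iR0, iR1, sub_zero]) h key⟩
  have h13 : (0 : ℝ) < 1 / 3 := by norm_num
  have ⟨q, hq, hq0, hqd, hqe⟩ := h0.low.exists_quotient hA h1.low h13 hdQ fun t ht =>
    ⟨hne _ (by norm_num) t ⟨ht.1, by linarith [ht.2]⟩ (Or.inl le_rfl) (Or.inl (by norm_num)),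
      hne t ⟨ht.1, by linarith [ht.2]⟩ _ (by norm_num) (Or.inr le_rfl) (Or.inr (by norm_num))⟩
  have ⟨r, hr, hr0, hrd, hre⟩ := h0.high.exists_quotient hB h1.high h13
    (by norm_num; exact fun h => hdR h) fun t ht => by grind
  have ⟨C0, hC0⟩ := h0.exists_upper hA
  have ⟨C1, hC1⟩ := h1.exists_upper hA
  have ⟨C2, hC2⟩ := h0.reflect.exists_upper hB
  have ⟨C3, hC3⟩ := h1.reflect.exists_upper hB
  have lower : ∀ {L : ℝ → ℂ} {C : ℝ}, (∀ t ∈ Ioc (0 : ℝ) (2 / 3), (-L (1 - t)).im ≤ C) → ∀ t ∈ Ico (1 / 3 : ℝ) 1, -C ≤ (L t).im :=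
    fun h t ht => by
      have := h (1 - t) ⟨by linarith [ht.2], by linarith [ht.1]⟩
      rw [sub_sub_cancel, neg_im] at this; linarith
  have upper : ∀ {L : ℝ → ℂ} {C : ℝ}, (∀ t ∈ Ioc (0 : ℝ) (2 / 3), (L t).im ≤ C) → ∀ t ∈ Ico (1 / 3 : ℝ) 1, -C ≤ (-L (1 - t)).im :=
    fun h t ht => by
      have := h (1 - t) ⟨by linarith [ht.2], by linarith [ht.1]⟩
      rw [neg_im]; linarith
  have ⟨c0, hc0, hc0e, hl0, hl1⟩ := ((show ∀ᶠ c in 𝓝[>] (0 : ℝ), c ∈ Ioo 0 (1 / 3) from Ioo_mem_nhdsGT h13).and (hqe.and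
    ((h0.low.eventually_im_le hA h13 (lower hC3)).and (h1.low.eventually_im_le hA h13 (lower hC2))))).exists
  have ⟨c1, hc1, hc1e, hu0, hu1⟩ := ((show ∀ᶠ c in 𝓝[>] (0 : ℝ), c ∈ Ioo 0 (1 / 3) from Ioo_mem_nhdsGT h13).and (hre.and
    ((h0.high.eventually_im_le hB h13 (upper hC1)).and (h1.high.eventually_im_le hB h13 (upper hC0))))).exists
  have m1 : ∀ {t}, t ∈ Icc c0 (1 / 3) → t ∈ Ioc 0 (1 / 3) := fun ht => ⟨hc0.1.trans_le ht.1, ht.2⟩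
  have m2 : ∀ {t}, t ∈ Icc (2 / 3) (1 - c1) → 1 - t ∈ Ioc 0 (1 / 3) := fun ht => ⟨by linarith [ht.2, hc1.1], by linarith [ht.1]⟩
  have m2' : ∀ {t}, t ∈ Icc (2 / 3) (1 - c1) → 1 - t ∈ Icc c1 (1 / 3) := fun ht => ⟨by linarith [ht.2, hc1.1], by linarith [ht.1]⟩
  have m3 : ∀ {t}, t ∈ Icc c0 (1 - c1) → t ∈ Ioo 0 1 := fun ht => ⟨hc0.1.trans_le ht.1, by linarith [ht.2, hc1.1]⟩
  have rc : ∀ {R : ℝ → ℂ}, ContinuousOn (fun t => -R (1 - t)) (Ioc 0 (1 / 3)) → ContinuousOn R (Icc (2 / 3) (1 - c1)) := fun {R} h => by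
    refine ((h.comp (f := fun t => 1 - t) (by fun_prop) fun t ht => m2 ht).neg).congr fun t _ => ?_
    simp [Function.comp_def]
  refine crossing_log (c0 := c0) (c1 := 1 - c1) (a := 1 / 3) (b := 2 / 3) (q := q) (r := fun p => r (1 - p.1, 1 - p.2)) hc0.2 (by norm_num) (by linarith [hc1.2])
    (h0.cont.mono fun t ht => m3 ht) (h1.cont.mono fun t ht => m3 ht) (fun s hs t ht => hne s (m3 hs) t (m3 ht))
    (h0.low.contQ.mono fun t ht => m1 ht) (h1.low.contQ.mono fun t ht => m1 ht)
    (hq.mono fun p hp => ⟨m1 hp.1, m1 hp.2⟩) (fun p hp => hq0 p ⟨m1 hp.1, m1 hp.2⟩)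
    (fun s hs t ht => hqd s (m1 hs) t (m1 ht)) (fun t ht => h0.low.im_neg t ⟨hc0.1.trans_le ht.1, ht.2⟩)
    (fun t ht => h1.low.im_neg t ⟨hc0.1.trans_le ht.1, ht.2⟩) iQ0 iQ1 hdQ (fun t ht => hc0e.1 t ht) (fun t ht => hc0e.2 t ht)
    (rc h0.high.contQ) (rc h1.high.contQ) (hr.comp (by fun_prop) fun p hp => ⟨m2 hp.1, m2 hp.2⟩)
    (fun p hp => hr0 _ ⟨m2 hp.1, m2 hp.2⟩) (fun s hs t ht => ?_) (fun t ht => ?_) (fun t ht => ?_) iR0 iR1 hdR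
    (fun t ht => ?_) (fun t ht => ?_)
    (fun t ht => hl0 t ⟨ht.1, by linarith [ht.2, hc1.1]⟩) (fun t ht => hl1 t ⟨ht.1, by linarith [ht.2, hc1.1]⟩)
    (fun t ht => ?_) (fun t ht => ?_)
  · have := hrd _ (m2 hs) _ (m2 ht)
    simp only [sub_sub_cancel] at this
    linear_combination -this
  · have := h0.high.im_neg (1 - t) ⟨by linarith [ht.2, hc1.1], by linarith [ht.1]⟩
    rw [sub_sub_cancel, neg_im] at this; linarith
  · have := h1.high.im_neg (1 - t) ⟨by linarith [ht.2, hc1.1], by linarith [ht.1]⟩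
    rw [sub_sub_cancel, neg_im] at this; linarith
  · simp only [sub_sub_cancel]; exact hc1e.1 _ (m2' ht)
  · simp only [sub_sub_cancel]; exact hc1e.2 _ (m2' ht)
  · have := hu0 (1 - t) ⟨by linarith [ht.2], by linarith [ht.1, hc0.1]⟩
    simp only [sub_sub_cancel, neg_im] at this; linarith
  · have := hu1 (1 - t) ⟨by linarith [ht.2], by linarith [ht.1, hc0.1]⟩
    simp only [sub_sub_cancel, neg_im] at this; linarith

abbrev CDisc := ↥𝔻bar

lemma CDisc.norm_le (z : CDisc) : ‖z.1‖ ≤ 1 := mem_closedBall_zero_iff.1 z.2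

/-- `Φ` is a homeomorphism of the closed disc which represents `g` in the disc coordinate `G`. -/
structure DiscMap (G : ℂ → X) (g : X ≃ₜ X) (Φ : CDisc ≃ₜ CDisc) : Prop where
  norm_lt : ∀ z : CDisc, ‖(Φ z).1‖ < 1 ↔ ‖z.1‖ < 1
  eq : ∀ z : CDisc, ‖z.1‖ < 1 → G (Φ z) = g (G z)
  zero : ∀ z : CDisc, (z : ℂ) = 0 → (Φ z).1 = 0

variable {Φ Φ₁ Φ₂ : CDisc ≃ₜ CDisc}

namespace DiscMap
variable {g : X ≃ₜ X}

lemma norm_eq (h : DiscMap G g Φ) {z : CDisc} (hz : ‖z.1‖ = 1) : ‖(Φ z).1‖ = 1 :=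
  le_antisymm (CDisc.norm_le _) (not_lt.1 fun h1 => by have := (h.norm_lt z).1 h1; linarith)

lemma norm_symm (h : DiscMap G g Φ) (z : CDisc) : ‖(Φ.symm z).1‖ < 1 ↔ ‖z.1‖ < 1 := by
  rw [← h.norm_lt, Φ.apply_symm_apply]

lemma norm_symm_eq (h : DiscMap G g Φ) {z : CDisc} (hz : ‖z.1‖ = 1) : ‖(Φ.symm z).1‖ = 1 :=
  le_antisymm (CDisc.norm_le _) (not_lt.1 fun h1 => by have := (h.norm_symm z).1 h1; linarith)

lemma one (G : ℂ → X) : DiscMap G (1 : X ≃ₜ X) (1 : CDisc ≃ₜ CDisc) := ⟨fun _ => Iff.rfl, fun _ _ => rfl, fun _ h => h⟩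

lemma mul {g' : X ≃ₜ X} {Φ' : CDisc ≃ₜ CDisc} (h : DiscMap G g Φ) (h' : DiscMap G g' Φ') : DiscMap G (g * g') (Φ * Φ') :=
  ⟨fun z => (h.norm_lt _).trans (h'.norm_lt z), fun z hz => (h.eq _ ((h'.norm_lt z).2 hz)).trans (congrArg g (h'.eq z hz)),
    fun z hz => h.zero _ (h'.zero z hz)⟩

lemma pow (h : DiscMap G g Φ) (n : ℕ) : DiscMap G (g ^ n) (Φ ^ n) := by
  induction n with
  | zero => exact one G
  | succ n ih => rw [pow_succ, pow_succ]; exact ih.mul h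

lemma inv (h : DiscMap G g Φ) : DiscMap G g⁻¹ Φ⁻¹ :=
  ⟨fun z => h.norm_symm z, fun z hz => by
    have h1 := h.eq (Φ.symm z) ((h.norm_symm z).2 hz)
    rw [Φ.apply_symm_apply] at h1
    exact (g.symm_apply_apply (G (Φ.symm z))).symm.trans (congrArg g.symm h1.symm), fun z hz => by
    have h1 : Φ ⟨0, by simp⟩ = z := Subtype.ext ((h.zero _ rfl).trans hz.symm)
    rw [← h1]; exact congrArg Subtype.val (Φ.symm_apply_apply _)⟩

/-- The component of the origin in the complement of the preimage of `Z`. -/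
def originComp (G : ℂ → X) (Z : Set X) : Set ℂ := connectedComponentIn {z ∈ 𝔻 | G z ∉ Z} 0

lemma originComp_image (h : DiscMap G g Φ) {Z : Set X} (h0 : G 0 ∉ Z) :
    (fun z : CDisc => (Φ z).1) '' (Subtype.val ⁻¹' originComp G Z) ⊆ originComp G (g '' Z) := by
  have hs : originComp G Z ⊆ {z ∈ 𝔻 | G z ∉ Z} := connectedComponentIn_subset _ _
  have hp : IsPreconnected (Subtype.val ⁻¹' originComp G Z : Set CDisc) := by
    rw [← Topology.IsInducing.subtypeVal.isPreconnected_image, Subtype.image_preimage_coe,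
      inter_eq_right.2 fun z hz => ball_subset_closedBall (hs hz).1]
    exact isPreconnected_connectedComponentIn
  refine IsPreconnected.subset_connectedComponentIn (hp.image _ (by fun_prop)) ⟨⟨0, by simp⟩, mem_connectedComponentIn ⟨by simp, h0⟩, h.zero _ rfl⟩ ?_
  rintro _ ⟨z, hz, rfl⟩
  have hz1 := mem_ball_zero_iff.1 (hs hz).1
  refine ⟨mem_ball_zero_iff.2 ((h.norm_lt z).2 hz1), ?_⟩
  rw [h.eq z hz1]
  rintro ⟨x, hx, hxe⟩
  exact (hs hz).2 (g.injective hxe ▸ hx)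

end DiscMap

open DiscMap

namespace DiscModel

variable (h : DiscModel U G H)
include h

lemma isOpen_notMem {Z : Set X} (hZ : IsClosed Z) : IsOpen {z ∈ 𝔻 | G z ∉ Z} :=
  h.cont.isOpen_inter_preimage isOpen_ball hZ.isOpen_compl

lemma exists_norm_one_closure {Z : Set X} (hZ : IsClosed Z) (h0 : G 0 ∉ Z) {W : Set X}
    (hW : IsPreconnected W) (hW0 : G 0 ∈ W) (hWU : ¬ W ⊆ U) (hWZ : Disjoint W Z) :
    ∃ z : ℂ, ‖z‖ = 1 ∧ z ∈ closure (originComp G Z) := by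
  by_contra! hcon
  have hsb : originComp G Z ⊆ 𝔻 := fun z hz => ((connectedComponentIn_subset _ _) hz).1
  have hc1 := closure_minimal (hsb.trans ball_subset_closedBall) isClosed_closedBall
  have hcb : closure (originComp G Z) ⊆ 𝔻 := fun z hz =>
    mem_ball_zero_iff.2 (lt_of_le_of_ne (mem_closedBall_zero_iff.1 (hc1 hz)) fun e => hcon z e hz)
  have hcp := (isCompact_closedBall (0 : ℂ) 1).of_isClosed_subset isClosed_closure hc1
  have hGo := h.isOpen_image hsb (h.isOpen_notMem hZ).connectedComponentIn
  have hci : IsCompOf {z ∈ 𝔻 | G z ∉ Z} (originComp G Z) := ⟨0, ⟨by simp, h0⟩, rfl⟩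
  have hsub := hW.subset_left_of_subset_union hGo ((hcp.image_of_continuousOn (h.cont.mono hcb)).isClosed).isOpen_compl
    (disjoint_compl_right.mono_left (image_mono subset_closure) : Disjoint (G '' originComp G Z) (G '' closure (originComp G Z))ᶜ)
    (fun x hx => by
      by_cases hxc : x ∈ G '' closure (originComp G Z)
      · obtain ⟨z, hz, rfl⟩ := hxc
        exact Or.inl ⟨z, hci.closure_inter_subset ⟨hz, hcb hz, hWZ.notMem_of_mem_left hx⟩, rfl⟩
      · exact Or.inr hxc) ⟨G 0, hW0, 0, mem_connectedComponentIn ⟨by simp, h0⟩, rfl⟩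
  exact hWU (hsub.trans (by rintro _ ⟨z, hz, rfl⟩; exact h.maps (hsb hz)))

lemma exists_unhidden [CompactSpace X] {g : X ≃ₜ X} (hΦ : DiscMap G g Φ)
    {Z : Set X} (hZ : IsClosed Z) (hZg : Disjoint Z (g '' Z)) (h0 : G 0 ∉ Z) (h0' : G 0 ∉ g '' Z)
    {β : ℝ → ℂ} (hab : a < b) (hβ : ContinuousOn β (Ico a b)) (hβ1 : ∀ t ∈ Ico a b, ‖β t‖ < 1)
    (hβZ : ∀ t ∈ Ico a b, G (β t) ∈ Z) {p : ℂ} (hp : ‖p‖ = 1) (hβp : Tendsto β (𝓝[<] b) (𝓝 p))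
    {W : Set X} (hW : IsPreconnected W) (hW0 : G 0 ∈ W) (hWU : ¬ W ⊆ U) (hWZ : Disjoint W Z)
    (hmin : ∀ T : Set CDisc, IsClosed T → T.Nonempty → (∀ z ∈ T, ‖z.1‖ = 1) → (∀ z ∈ T, Φ z ∈ T) →
      ∀ z : CDisc, ‖z.1‖ = 1 → z ∈ T) :
    ∃ z ∈ originComp G (g '' Z), G z ∈ Z := by
  by_contra! hcon
  have hs1 : originComp G (g '' Z) ⊆ {z ∈ 𝔻 | G z ∉ g '' Z} := connectedComponentIn_subset _ _
  have hm1 : (0 : ℂ) ∈ originComp G (g '' Z) := mem_connectedComponentIn ⟨by simp, h0'⟩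
  have h10 : originComp G (g '' Z) ⊆ originComp G Z := isPreconnected_connectedComponentIn.subset_connectedComponentIn hm1
    fun z hz => ⟨(hs1 hz).1, hcon z hz⟩
  set S : Set CDisc := Subtype.val ⁻¹' originComp G Z with hS
  have hSv : Subtype.val '' S = originComp G Z := by
    rw [hS, Subtype.image_preimage_coe, inter_eq_right]
    exact fun z hz => ball_subset_closedBall ((connectedComponentIn_subset _ _ hz : z ∈ {z ∈ 𝔻 | G z ∉ Z}).1)
  have hmap : ∀ z : CDisc, (z : ℂ) ∈ closure (originComp G Z) → (Φ z).1 ∈ closure (originComp G (g '' Z)) := fun z hz => by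
    rw [← hSv, ← closure_subtype] at hz
    exact closure_mono (hΦ.originComp_image h0)
      (image_closure_subset_closure_image (f := fun z : CDisc => (Φ z).1) (by fun_prop) (mem_image_of_mem _ hz))
  have ⟨q, hq1, hq⟩ := h.exists_norm_one_closure hZ h0 hW hW0 hWU hWZ
  have hall := hmin {z | ‖z.1‖ = 1 ∧ (z : ℂ) ∈ closure (originComp G Z)}
    ((isClosed_eq (by fun_prop) continuous_const).inter (isClosed_closure.preimage continuous_subtype_val))
    ⟨⟨q, by simp [hq1]⟩, hq1, hq⟩ (fun z hz => hz.1) (fun z hz => ⟨hΦ.norm_eq hz.1, closure_mono h10 (hmap z hz.2)⟩)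
  have hpN : p ∈ closure (originComp G (g '' Z)) := by
    have := hmap (Φ.symm ⟨p, by simp [hp]⟩) (hall _ (hΦ.norm_symm_eq hp)).2
    rwa [Φ.apply_symm_apply _] at this
  have ⟨δ, hδ, hdis⟩ := hZg.exists_thickenings hZ.isCompact (g.isClosedMap _ hZ)
  have ⟨s, hs, harc⟩ := h.nullArcs p hp (δ / 2) (by positivity) (min 0 (stpInv p (β a)).re)
  have hlev : ContinuousOn (fun z => (stpInv p z).re) 𝔻 := fun z hz =>
    (continuous_re.continuousAt.comp (stpInv_differentiableAt hp (mem_ball_zero_iff.1 hz)).continuousAt).continuousWithinAt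
  have hbIoo : ∀ᶠ t in 𝓝[<] b, t ∈ Ioo a b := Ioo_mem_nhdsLT hab
  have ⟨t1, ht1, ht1s⟩ := (hbIoo.and
    ((tendsto_stpInv_re hp hβp (hbIoo.mono fun t ht => hβ1 t ⟨ht.1.le, ht.2⟩)).eventually (eventually_lt_atBot s))).exists
  have ⟨t, ht, hts⟩ := isPreconnected_Icc.intermediate_value (a := t1) (b := a) (right_mem_Icc.2 ht1.1.le)
    (left_mem_Icc.2 ht1.1.le) (f := fun t => (stpInv p (β t)).re)
    (hlev.comp (hβ.mono fun t ht => ⟨ht.1, ht.2.trans_lt ht1.2⟩) fun t ht =>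
      mem_ball_zero_iff.2 (hβ1 t ⟨ht.1, ht.2.trans_lt ht1.2⟩)) ⟨ht1s.le, (hs.trans_le (min_le_right _ _)).le⟩
  have htI : t ∈ Ico a b := ⟨ht.1, ht.2.trans_lt ht1.2⟩
  set γ : ℝ → ℂ := fun τ => stp p ⟨s, τ⟩ with hγ
  have hγ0 : γ (stpInv p (β t)).im = β t := by
    simp only [hγ]
    rw [show (⟨s, (stpInv p (β t)).im⟩ : ℂ) = stpInv p (β t) from Complex.ext hts.symm rfl, stp_stpInv hp (hβ1 t htI)]
  have hti := stpInv_im hp (hβ1 t htI)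
  have hmiss : ∀ τ ∈ stripI, G (γ τ) ∉ g '' Z := fun τ hτ hg => by
    have hd := harc τ hτ _ hti
    change dist (G (γ τ)) (G (γ _)) ≤ δ / 2 at hd
    rw [hγ0] at hd
    exact hdis.notMem_of_mem_left (mem_thickening_iff.2 ⟨_, hβZ t htI, hd.trans_lt (by linarith)⟩)
      (self_subset_thickening hδ _ hg)
  have hγpre := (isPreconnected_Ioo).image _ fun τ hτ =>
    ((stp_differentiableAt p (w := ⟨s, τ⟩) (stripI_subset hτ)).continuousAt.comp (mk_cont s).continuousAt).continuousWithinAt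
  -- the level arc meets the component of the origin
  have hmeet : ∃ τ ∈ stripI, γ τ ∈ originComp G (g '' Z) := by
    have hev := (tendsto_stpInv_re hp (p := fun z => z) (tendsto_id.mono_left nhdsWithin_le_nhds)
        (eventually_mem_nhdsWithin.mono fun z hz => mem_ball_zero_iff.1 (hs1 hz).1)).eventually (eventually_lt_atBot s)
    have := mem_closure_iff_nhdsWithin_neBot.1 hpN
    have ⟨z, hzs, hz⟩ := (hev.and eventually_mem_nhdsWithin).exists
    have hz0 : (stpInv p 0).re = 0 := by rw [stpInv_re]; simp [hp]
    have ⟨w, hw, hws⟩ := (isPreconnected_connectedComponentIn (F := {z ∈ 𝔻 | G z ∉ g '' Z}) (x := 0)).intermediate_value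
      hz hm1 (hlev.mono fun z hz => (hs1 hz).1) ⟨hzs.le, by rw [hz0]; exact (hs.trans_le (min_le_left _ _)).le⟩
    have hw1 := mem_ball_zero_iff.1 (hs1 hw).1
    refine ⟨(stpInv p w).im, stpInv_im hp hw1, ?_⟩
    simp only [hγ]
    rwa [show (⟨s, (stpInv p w).im⟩ : ℂ) = stpInv p w from Complex.ext hws.symm rfl, stp_stpInv hp hw1]
  have ⟨τ, hτ, hτN⟩ := hmeet
  have hsub : γ '' stripI ⊆ originComp G (g '' Z) := by
    have := hγpre.subset_connectedComponentIn (mem_image_of_mem _ hτ) (F := {z ∈ 𝔻 | G z ∉ g '' Z})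
      (by rintro _ ⟨τ, hτ, rfl⟩; exact ⟨(fun τ hτ => mem_ball_zero_iff.2 (norm_stp_lt hp (w := ⟨s, τ⟩) hτ)) τ hτ, hmiss τ hτ⟩)
    rwa [originComp, connectedComponentIn_eq hτN]
  exact hcon (β t) (hγ0 ▸ hsub (mem_image_of_mem _ hti)) (hβZ t htI)

end DiscModel

/-- Between the last zero and the first visit to a closed set. -/
lemma exists_subarc {γ : ℝ → ℂ} (hγ : ContinuousOn γ (Icc 0 1)) (h0 : γ 0 = 0) {C : Set ℝ} (hC : IsClosed C)
    (hCI : C ⊆ Icc 0 1) (hne : C.Nonempty) (hC0 : ∀ t ∈ C, γ t ≠ 0) :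
    ∃ t₀ t₁, 0 ≤ t₀ ∧ t₀ < t₁ ∧ t₁ ≤ 1 ∧ γ t₀ = 0 ∧ (∀ t ∈ Ioc t₀ t₁, γ t ≠ 0) ∧ t₁ ∈ C ∧ ∀ t ∈ Ico t₀ t₁, t ∉ C := by
  have ⟨t₁, ht₁, hmin⟩ := (isCompact_Icc.of_isClosed_subset hC hCI).exists_isLeast hne
  have ⟨t₀, ht₀, hmax⟩ := (isCompact_Icc.of_isClosed_subset
    ((hγ.mono (Icc_subset_Icc_right (hCI ht₁).2)).preimage_isClosed_of_isClosed isClosed_Icc isClosed_singleton) inter_subset_left :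
      IsCompact (Icc 0 t₁ ∩ γ ⁻¹' {0})).exists_isGreatest ⟨0, ⟨le_rfl, (hCI ht₁).1⟩, h0⟩
  have h01 := lt_of_le_of_ne ht₀.1.2 fun e => hC0 t₁ ht₁ (e ▸ ht₀.2)
  refine ⟨t₀, t₁, ht₀.1.1, h01, (hCI ht₁).2, ht₀.2, fun t ht h => ?_, ht₁, fun t ht h => (hmin h).not_gt ht.2⟩
  exact ht.1.not_ge (hmax ⟨⟨ht₀.1.1.trans ht.1.le, ht.2⟩, h⟩)

/-- The covering `v ↦ exp (-2πiv)` of the punctured plane; the lower half-plane covers the punctured disc. -/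
def ee (v : ℂ) : ℂ := exp (-(2 * π * I) * v)

lemma ee_ne_zero (v : ℂ) : ee v ≠ 0 := exp_ne_zero _

@[fun_prop] lemma continuous_ee : Continuous ee := by unfold ee; fun_prop

lemma norm_ee (v : ℂ) : ‖ee v‖ = Real.exp (2 * π * v.im) := by rw [ee, norm_exp]; congr 1; simp

lemma ee_eq_iff : ee v = ee w ↔ ∃ k : ℤ, w = v + k := by
  rw [ee, ee, exp_eq_exp_iff_exists_int]
  constructor
  · rintro ⟨n, hn⟩
    refine ⟨n, mul_left_cancel₀ two_pi_I_ne_zero ?_⟩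
    linear_combination hn
  · rintro ⟨k, rfl⟩
    exact ⟨k, by ring⟩

lemma ee_add_int (v : ℂ) (k : ℤ) : ee (v + k) = ee v := (ee_eq_iff.2 ⟨k, rfl⟩).symm

lemma ee_neg (v : ℂ) : ee (-v) = (ee v)⁻¹ := by rw [ee, ee, ← exp_neg]; ring_nf

lemma norm_ee_lt : ‖ee v‖ < 1 ↔ v.im < 0 := by
  rw [norm_ee, Real.exp_lt_one_iff]
  constructor <;> intro h <;> nlinarith [Real.pi_pos]

lemma norm_ee_eq : ‖ee v‖ = 1 ↔ v.im = 0 := by rw [norm_ee, Real.exp_eq_one_iff]; simp [Real.pi_ne_zero]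

lemma norm_ee_le : ‖ee v‖ ≤ 1 ↔ v.im ≤ 0 := by rw [le_iff_lt_or_eq, norm_ee_lt, norm_ee_eq, le_iff_lt_or_eq]

lemma exists_ee (hz : z ≠ 0) : ∃ v, ee v = z :=
  ⟨log z / (-(2 * π * I)), by rw [ee, mul_div_cancel₀ _ (neg_ne_zero.2 two_pi_I_ne_zero), exp_log hz]⟩

lemma exists_continuous_ee {E : Type*} [NormedAddCommGroup E] [NormedSpace ℝ E] {g : E → ℂ}
    (hg : Continuous g) (h0 : ∀ x, g x ≠ 0) : ∃ f : E → ℂ, Continuous f ∧ ∀ x, ee (f x) = g x := by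
  have ⟨f, hf, hfe⟩ := exists_continuous_log hg h0
  exact ⟨fun x => f x / (-(2 * π * I)), by fun_prop, fun x => by
    rw [ee, mul_div_cancel₀ _ (neg_ne_zero.2 two_pi_I_ne_zero), hfe]⟩

lemma eq_add_int_of_ee {α : Type*} [TopologicalSpace α] {S : Set α} (hS : IsPreconnected S) {μ ν : α → ℂ}
    (hμ : ContinuousOn μ S) (hν : ContinuousOn ν S) (he : ∀ x ∈ S, ee (μ x) = ee (ν x)) :
    ∃ k : ℤ, ∀ x ∈ S, ν x = μ x + k := by
  rcases S.eq_empty_or_nonempty with rfl | ⟨x₀, hx₀⟩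
  · exact ⟨0, by simp⟩
  have ⟨k, hk⟩ := ee_eq_iff.1 (he x₀ hx₀)
  refine ⟨k, fun x hx => ?_⟩
  have h2 := eq_of_exp_eq hS (μ := fun x => -(2 * π * I) * (ν x - μ x)) (by fun_prop) (fun x hx => by
    have := he x hx
    rw [mul_sub, exp_sub]
    simp only [ee] at this
    rw [this, div_self (exp_ne_zero _)]) hx hx₀
  have h3 := mul_left_cancel₀ (neg_ne_zero.2 two_pi_I_ne_zero) h2
  rw [hk] at h3
  linear_combination h3

lemma tendsto_ee_zero {ι : Type*} {l : Filter ι} {f : ι → ℂ} :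
    Tendsto (fun i => ee (f i)) l (𝓝 0) ↔ Tendsto (fun i => (f i).im) l atBot := by
  rw [tendsto_zero_iff_norm_tendsto_zero]
  simp only [norm_ee]
  rw [Real.tendsto_exp_comp_nhds_zero, tendsto_const_mul_atBot_of_pos (by positivity)]

/-- Two complementary open charts of a sphere, glued by inversion. -/
structure TwoCharts (e₁ e₂ : ℂ → X) : Prop where
  emb₁ : IsOpenEmbedding e₁
  emb₂ : IsOpenEmbedding e₂
  range₁ : range e₁ = {e₂ 0}ᶜ
  range₂ : range e₂ = {e₁ 0}ᶜ
  inv : ∀ z ≠ 0, e₂ z = e₁ z⁻¹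

namespace TwoCharts

lemma symm (h : TwoCharts e₁ e₂) : TwoCharts e₂ e₁ :=
  ⟨h.emb₂, h.emb₁, h.range₂, h.range₁, fun z hz => by rw [h.inv _ (inv_ne_zero hz), inv_inv]⟩

lemma ee_neg_eq (h : TwoCharts e₁ e₂) (v : ℂ) : e₂ (ee (-v)) = e₁ (ee v) := by
  rw [h.inv _ (ee_ne_zero _), ee_neg, inv_inv]

lemma ne₁ (h : TwoCharts e₁ e₂) (v : ℂ) : e₁ (ee v) ≠ e₁ 0 := fun e => ee_ne_zero v (h.emb₁.injective e)

lemma ne₂ (h : TwoCharts e₁ e₂) (z : ℂ) : e₁ z ≠ e₂ 0 := fun e => by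
  have : e₁ z ∈ range e₁ := ⟨z, rfl⟩
  rw [h.range₁] at this
  exact this e

lemma exists_eq (h : TwoCharts e₁ e₂) {x : X} (hx : x ≠ e₂ 0) : ∃ z, e₁ z = x := by
  exact (by rw [h.range₁]; exact hx : x ∈ range e₁)

lemma continuous (h : TwoCharts e₁ e₂) : Continuous fun v => e₁ (ee v) := h.emb₁.continuous.comp continuous_ee

lemma lift (h : TwoCharts e₁ e₂) {E : Type*} [NormedAddCommGroup E] [NormedSpace ℝ E] {c : E → X} (hc : Continuous c)
    (h1 : ∀ x, c x ≠ e₁ 0) (h2 : ∀ x, c x ≠ e₂ 0) : ∃ M : E → ℂ, Continuous M ∧ ∀ x, e₁ (ee (M x)) = c x := by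
  choose g hg using fun x => h.exists_eq (h2 x)
  have hgc := h.emb₁.isInducing.continuous_iff.2 (by rwa [show e₁ ∘ g = c from funext hg])
  have ⟨M, hM, hMe⟩ := exists_continuous_ee hgc fun x e => h1 x (by rw [← hg, e])
  exact ⟨M, hM, fun x => by rw [hMe, hg]⟩

lemma eq_add_int (h : TwoCharts e₁ e₂) {α : Type*} [TopologicalSpace α] {S : Set α} (hS : IsPreconnected S) {μ ν : α → ℂ}
    (hμ : ContinuousOn μ S) (hν : ContinuousOn ν S) (he : ∀ x ∈ S, e₁ (ee (μ x)) = e₁ (ee (ν x))) :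
    ∃ k : ℤ, ∀ x ∈ S, ν x = μ x + k := eq_add_int_of_ee hS hμ hν fun x hx => h.emb₁.injective (he x hx)

end TwoCharts

/-- A parametrisation of a half-open interval by the line. -/
lemma exists_line_param (ha : 0 < a) : ∃ r s : ℝ → ℝ, Continuous r ∧ (∀ x, r x ∈ Ioc 0 a) ∧
    ContinuousOn s (Ioc 0 a) ∧ ∀ t ∈ Ioc 0 a, r (s t) = t := by
  refine ⟨fun x => a * min (Real.exp x) 1, fun t => Real.log (t / a), by fun_prop, fun x => ⟨by positivity, ?_⟩, ?_, fun t ht => ?_⟩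
  · nlinarith [min_le_right (Real.exp x) 1]
  · exact ContinuousOn.log (by fun_prop) fun t ht => (div_pos ht.1 ha).ne'
  · simp only []
    rw [Real.exp_log (div_pos ht.1 ha), min_eq_left ((div_le_one ha).2 ht.2), mul_div_cancel₀ _ ha.ne']

lemma TwoCharts.lift_Ioc (h : TwoCharts e₁ e₂) (ha : 0 < a)
    {c : ℝ → X} (hc : ContinuousOn c (Ioc 0 a)) (h1 : ∀ t ∈ Ioc 0 a, c t ≠ e₁ 0) (h2 : ∀ t ∈ Ioc 0 a, c t ≠ e₂ 0) :
    ∃ M : ℝ → ℂ, ContinuousOn M (Ioc 0 a) ∧ ∀ t ∈ Ioc 0 a, e₁ (ee (M t)) = c t := by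
  have ⟨r, s, hr, hrI, hs, hrs⟩ := exists_line_param ha
  have ⟨M, hM, hMe⟩ := h.lift (c := c ∘ r) (hc.comp_continuous hr hrI) (fun x => h1 _ (hrI x)) (fun x => h2 _ (hrI x))
  exact ⟨M ∘ s, hM.comp_continuousOn hs, fun t ht => by simp [hMe, hrs t ht]⟩

lemma exists_ee_Ioc (ha : 0 < a) {κ : ℝ → ℂ} (hκ : ContinuousOn κ (Ioc 0 a)) (h0 : ∀ t ∈ Ioc 0 a, κ t ≠ 0) :
    ∃ Q : ℝ → ℂ, ContinuousOn Q (Ioc 0 a) ∧ ∀ t ∈ Ioc 0 a, ee (Q t) = κ t := by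
  have ⟨r, s, hr, hrI, hs, hrs⟩ := exists_line_param ha
  have ⟨M, hM, hMe⟩ := exists_continuous_ee (g := κ ∘ r) (hκ.comp_continuous hr hrI) (fun x => h0 _ (hrI x))
  exact ⟨M ∘ s, hM.comp_continuousOn hs, fun t ht => by simp [hMe, hrs t ht]⟩

/-- A disc coordinate of the domain `U` together with its lift `A` to the universal covers. -/
structure Side (e : ℂ → X) (U : Set X) (G : ℂ → X) (H : X → ℂ) (A : ℂ → ℂ) : Prop where
  model : DiscModel U G H
  low : LowMap A
  per : ∀ v, A (v + 1) = A v + 1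
  eq : ∀ v : ℂ, v.im < 0 → e (ee (A v)) = G (ee v)
  zero : G 0 = e 0

lemma Side.per_int
    (h : Side e U G H A) (v : ℂ) (k : ℤ) : A (v + k) = A v + k := by
  have hn : ∀ (n : ℕ) v, A (v + n) = A v + n := fun n => by
    induction n with
    | zero => simp
    | succ n ih => intro v; push_cast; rw [← add_assoc, h.per, ih, add_assoc]
  obtain ⟨n, rfl | rfl⟩ := k.eq_nat_or_neg
  · exact_mod_cast hn n v
  · have := hn n (v + -n)
    rw [neg_add_cancel_right] at this
    push_cast
    rw [this]; ring

/-- A path from the centre of the disc to the boundary lifts to the universal covers. -/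
lemma Side.exists_lowEnd (hT : TwoCharts e₁ e₂) (h : Side e₁ U G H A) (ha : 0 < a) {κ : ℝ → ℂ} (hκ : ContinuousOn κ (Icc 0 a)) (h0 : κ 0 = 0)
    (hne : ∀ t ∈ Ioc 0 a, κ t ≠ 0) (hlt : ∀ t ∈ Ioo 0 a, ‖κ t‖ < 1) (ha1 : ‖κ a‖ = 1) {M : ℝ → ℂ}
    (hM : ContinuousOn M (Ioc 0 a)) (hMe : ∀ t ∈ Ioo 0 a, e₁ (ee (M t)) = G (κ t)) : ∃ Q, LowEnd A a M Q := by
  have ⟨Q, hQ, hQe⟩ := exists_ee_Ioc ha (hκ.mono Ioc_subset_Icc_self) hne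
  have him : ∀ t ∈ Ioo 0 a, (Q t).im < 0 := fun t ht => norm_ee_lt.1 (by rw [hQe t ⟨ht.1, ht.2.le⟩]; exact hlt t ht)
  have ⟨k, hk⟩ := hT.eq_add_int isPreconnected_Ioo (μ := fun t => A (Q t)) (ν := M)
    (fun t ht => ((h.low.diff.differentiableAt ((isOpen_im_lt (0 : ℝ)).mem_nhds (him t ht))).continuousAt.comp_continuousWithinAt
      ((hQ t ⟨ht.1, ht.2.le⟩).mono Ioo_subset_Ioc_self))) (hM.mono Ioo_subset_Ioc_self) (fun t ht => by
      rw [h.eq _ (him t ht), hQe t ⟨ht.1, ht.2.le⟩, hMe t ht])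
  refine ⟨fun t => Q t + k, hM, hQ.add continuousOn_const, fun t ht => by simpa using him t ht, ?_, fun t ht => ?_, ?_⟩
  · simpa using norm_ee_eq.1 (by rw [hQe a ⟨ha, le_rfl⟩, ha1])
  · rw [hk t ht, h.per_int]
  · simp only [add_im, intCast_im, add_zero]
    refine tendsto_ee_zero.1 (Tendsto.congr' ?_ (h0 ▸ ((hκ 0 ⟨le_rfl, ha.le⟩).tendsto.mono_left
      (nhdsWithin_le_of_mem (mem_of_superset (Ioo_mem_nhdsGT ha) Ioo_subset_Icc_self)))))
    filter_upwards [Ioc_mem_nhdsGT ha] with t ht using (hQe t ht).symm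

namespace IsRiemannMap

lemma exists_log (h : IsRiemannMap V ψ φ) :
    ∃ k : ℂ → ℂ, DifferentiableOn ℂ k 𝔻 ∧ ∀ z ∈ 𝔻, ψ z = z * exp (k z) := by
  have h0 : (0 : ℂ) ∈ 𝔻 := by simp
  set q := dslope ψ 0 with hq
  have hqd : DifferentiableOn ℂ q 𝔻 := (differentiableOn_dslope (isOpen_ball.mem_nhds h0)).2 h.diff
  have hψ : ∀ z, ψ z = z * q z := fun z => by
    have := sub_smul_dslope ψ 0 z
    rw [h.zero, sub_zero, sub_zero, smul_eq_mul] at this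
    exact this.symm
  have hq0 : ∀ z ∈ 𝔻, q z ≠ 0 := fun z hz hqz => by
    rcases eq_or_ne z 0 with rfl | hz0
    · rw [hq, dslope_same] at hqz
      have h1 : HasDerivAt ψ 0 0 := by
        have := (h.diff.differentiableAt (isOpen_ball.mem_nhds h0)).hasDerivAt
        rwa [hqz] at this
      have h3 := (h.diff_inv _ (h.maps h0)).hasDerivWithinAt.comp 0 (h1.hasDerivWithinAt (s := 𝔻)) h.maps
      have h5 := (h3.congr (fun z hz => (h.left_inv z hz).symm) (h.left_inv 0 h0).symm)
      have h6 := (isOpen_ball.uniqueDiffWithinAt h0).eq_deriv _ h5 ((hasDerivAt_id (0 : ℂ)).hasDerivWithinAt)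
      simp at h6
    · have h1 := h.left_inv z hz
      rw [hψ, hqz, mul_zero, (by have := h.left_inv 0 h0; rwa [h.zero] at this : φ 0 = 0)] at h1
      exact hz0 h1.symm
  have ⟨k, hk⟩ := ((hqd.deriv isOpen_ball).div hqd hq0).isExactOn_ball
  have hc : ∀ z ∈ 𝔻, q z * exp (-k z) = q 0 * exp (-k 0) := fun z hz => by
    have hd : ∀ w ∈ 𝔻, HasDerivWithinAt (fun w => q w * exp (-k w)) 0 𝔻 w := fun w hw => by
      refine (((hqd.differentiableAt (isOpen_ball.mem_nhds hw)).hasDerivAt.mul (hk w hw).neg.cexp).hasDerivWithinAt (s := 𝔻)).congr_deriv ?_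
      have hw0 := hq0 w hw
      simp only [Pi.div_apply, Pi.neg_apply]
      field_simp
      ring
    have := (convex_ball (0 : ℂ) 1).norm_image_sub_le_of_norm_hasDerivWithin_le (C := 0) hd (by simp) h0 hz
    rw [zero_mul] at this
    exact sub_eq_zero.1 (norm_le_zero_iff.1 this)
  have hne : q 0 * exp (-k 0) ≠ 0 := mul_ne_zero (hq0 0 h0) (exp_ne_zero _)
  refine ⟨fun z => k z + log (q 0 * exp (-k 0)), fun z hz =>
    ((hk z hz).differentiableAt.add_const _).differentiableWithinAt, fun z hz => ?_⟩
  rw [exp_add, exp_log hne, ← hc z hz, hψ, mul_left_comm (exp (k z)), ← exp_add, add_neg_cancel, exp_zero, mul_one]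

/-- The lift of a Riemann map to the logarithmic coordinates. -/
lemma exists_lowMap (h : IsRiemannMap V ψ φ) :
    ∃ A : ℂ → ℂ, LowMap A ∧ (∀ v, A (v + 1) = A v + 1) ∧ ∀ v : ℂ, v.im < 0 → ee (A v) = ψ (ee v) := by
  have ⟨k, hk, hψ⟩ := h.exists_log
  have hed : ∀ v, HasDerivAt ee (-(2 * π * I) * ee v) v := fun v => by
    exact (((hasDerivAt_id v).const_mul (-(2 * π * I : ℂ))).cexp).congr_deriv (by simp only [ee, id]; ring)
  set D : ℂ → ℂ := fun v => -(k (ee v) / (2 * π * I)) with hD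
  have hball : ∀ v : ℂ, v.im < 0 → ee v ∈ 𝔻 := fun v hv => mem_ball_zero_iff.2 (norm_ee_lt.2 hv)
  have hDd : ∀ v : ℂ, v.im < 0 → HasDerivAt D (ee v * deriv k (ee v)) v := fun v hv => by
    refine (((((hk.differentiableAt (isOpen_ball.mem_nhds (hball v hv))).hasDerivAt).comp v (hed v)).div_const (2 * π * I)).neg).congr_deriv ?_
    field_simp
  have hAe : ∀ v : ℂ, v.im < 0 → ee (v + D v) = ψ (ee v) := fun v hv => by
    rw [hψ _ (hball v hv), ee, mul_add, exp_add]
    congr 2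
    simp only [hD]
    field_simp
  have hAd : ∀ v : ℂ, v.im < 0 → DifferentiableAt ℂ (fun v => v + D v) v := fun v hv =>
    differentiableAt_id.add (hDd v hv).differentiableAt
  have hper : ∀ v, D (v + 1) = D v := fun v => by
    simp only [hD]; rw [show ee (v + 1) = ee v by simpa using ee_add_int v 1]
  have hker : ∀ᶠ z in 𝓝 (0 : ℂ), ‖z * deriv k z‖ < 1 / 2 ∧ ‖k z - k 0‖ < 1 := by
    have h0 : (0 : ℂ) ∈ 𝔻 := by simp
    have hc := ((hk.deriv isOpen_ball).continuousOn.continuousAt (isOpen_ball.mem_nhds h0))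
    refine ((continuousAt_id.mul hc).norm.eventually_lt_const (by simp)).and
      (((hk.continuousOn.continuousAt (isOpen_ball.mem_nhds h0)).sub continuousAt_const).norm.eventually_lt_const (by simp))
  have ⟨δ, hδ, hker⟩ := Metric.eventually_nhds_iff.1 hker
  set M : ℝ := max 0 (-(Real.log δ / (2 * π))) with hM
  have hM' : ∀ v : ℂ, v.im < -M → v.im < 0 ∧ dist (ee v) 0 < δ := fun v hv => by
    refine ⟨hv.trans_le (by simp [hM]), ?_⟩
    rw [dist_zero_right, norm_ee, ← Real.lt_log_iff_exp_lt hδ]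
    have h1 : v.im < Real.log δ / (2 * π) := hv.trans_le (by linarith [le_max_right 0 (-(Real.log δ / (2 * π)))])
    rw [lt_div_iff₀ (by positivity)] at h1
    linarith
  refine ⟨fun v => v + D v, ⟨fun v hv => (hAd v hv).differentiableWithinAt, fun v hv he => ?_, fun v hv w hw e => ?_,
    ⟨(1 + ‖k 0‖) / (2 * π), M, fun v hv => ?_⟩, M, fun v w hv hw => ?_⟩, fun v => ?_, hAe⟩
  · -- the composition with `φ` is the identity
    have h1 := (hed (v + D v)).comp v (he ▸ (hAd v hv).hasDerivAt)
    rw [mul_zero] at h1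
    have h3 := (h.diff_inv _ (h.maps (hball v hv))).hasDerivWithinAt.congr_deriv rfl
    have h4 := HasDerivWithinAt.comp v ((hAe v hv).symm ▸ h3) h1.hasDerivWithinAt (fun w hw => by
      simpa [hAe w hw] using h.maps (hball w hw))
    rw [mul_zero] at h4
    have h5 := h4.congr (f₁ := ee) (fun w hw => by simp [hAe w hw, h.left_inv _ (hball w hw)])
      (by simp [hAe v hv, h.left_inv _ (hball v hv)])
    have h6 := ((isOpen_im_lt (0 : ℝ)).uniqueDiffWithinAt hv).eq_deriv _ h5 (hed v).hasDerivWithinAt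
    exact mul_ne_zero (neg_ne_zero.2 two_pi_I_ne_zero) (ee_ne_zero v) h6.symm
  · have h1 := congrArg (fun x => φ (ee x)) e
    simp only [hAe v hv, hAe w hw, h.left_inv _ (hball v hv), h.left_inv _ (hball w hw)] at h1
    obtain ⟨n, rfl⟩ := ee_eq_iff.1 h1
    simp only [(show ∀ (v : ℂ) (n : ℤ), D (v + n) = D v from fun v n => by simp only [hD, ee_add_int])] at e
    linear_combination e
  · have ⟨h1, h2⟩ := hM' v hv
    rw [add_sub_cancel_left]
    simp only [hD, norm_neg, norm_div, norm_mul, Complex.norm_I, Complex.norm_ofNat, norm_real, Real.norm_of_nonneg Real.pi_pos.le, mul_one]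
    gcongr
    have := norm_add_le (k (ee v) - k 0) (k 0)
    grind
  · simp only [add_sub_cancel_left]
    refine Convex.norm_image_sub_le_of_norm_hasDerivWithin_le (s := {v : ℂ | v.im < -M})
      (fun x hx => (hDd x (hM' x hx).1).hasDerivWithinAt) (fun x hx => (hker (hM' x hx).2).1.le)
      (convex_halfSpace_im_lt _) hw hv
  · simp only [hper]; ring

end IsRiemannMap

/-- The point of the closed disc below which the (projected) point `v` of the closed lower half-plane lies. -/
def lowDisc (v : ℂ) : CDisc := ⟨ee ⟨v.re, min v.im 0⟩, mem_closedBall_zero_iff.2 (norm_ee_le.2 (min_le_right _ _))⟩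

lemma continuous_lowDisc : Continuous lowDisc := by
  have h : Continuous fun v : ℂ => (⟨v.re, min v.im 0⟩ : ℂ) := by
    convert (by fun_prop : Continuous fun v : ℂ => ((v.re : ℂ) + (min v.im 0 : ℝ) * I)) using 2 with v
    simp [Complex.ext_iff]
  exact (continuous_ee.comp h).subtype_mk _

lemma lowDisc_coe (hv : v.im ≤ 0) : (lowDisc v : ℂ) = ee v := by simp only [lowDisc, min_eq_left hv]

lemma lowDisc_eq (hv : v.im ≤ 0) {z : CDisc} (h : ee v = z) : lowDisc v = z := Subtype.ext ((lowDisc_coe hv).trans h)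

lemma TwoCharts.lift_homeo (hT : TwoCharts e₁ e₂)
    (h1 : f (e₁ 0) = e₁ 0) (h2 : f (e₂ 0) = e₂ 0) : ∃ F : ℂ → ℂ, Continuous F ∧ (∀ v, e₁ (ee (F v)) = f (e₁ (ee v))) ∧
      ∃ d : ℤ, ∀ v, F (v + 1) = F v + d := by
  have ⟨F, hF, hFe⟩ := hT.lift (f.continuous.comp hT.continuous) (fun v e => hT.ne₁ v (f.injective (e.trans h1.symm)))
    (fun v e => hT.ne₂ _ (f.injective (e.trans h2.symm)))
  refine ⟨F, hF, hFe, ?_⟩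
  have ⟨d, hd⟩ := hT.eq_add_int isPreconnected_univ hF.continuousOn (ν := fun v => F (v + 1)) (by fun_prop) fun v _ => by
    rw [hFe, hFe]; simp only [Function.comp]; rw [show ee (v + 1) = ee v by simpa using ee_add_int v 1]
  exact ⟨d, fun v => hd v trivial⟩

/-- `Fb` is the lift of the disc homeomorphism `Φ`, conjugated by `A` to `F`. -/
structure SideLift (A F Fb : ℂ → ℂ) (Φ : CDisc ≃ₜ CDisc) (d : ℤ) : Prop where
  cont : Continuous Fb
  ee_eq : ∀ v : ℂ, v.im ≤ 0 → ee (Fb v) = Φ (lowDisc v)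
  comm : ∀ v : ℂ, v.im < 0 → A (Fb v) = F (A v)
  per : ∀ v : ℂ, v.im ≤ 0 → Fb (v + 1) = Fb v + d

section
variable {d : ℤ}

lemma Side.exists_sideLift (hT : TwoCharts e₁ e₂) (h : Side e₁ U G H A) (hΦ : DiscMap G f Φ) (hF : Continuous F)
    (hFe : ∀ v, e₁ (ee (F v)) = f (e₁ (ee v))) (hFd : ∀ v, F (v + 1) = F v + d) : ∃ Fb, SideLift A F Fb Φ d := by
  have ⟨Fb, hFb, hFbe⟩ := exists_continuous_ee (g := fun v => (Φ (lowDisc v) : ℂ))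
    (continuous_subtype_val.comp (Φ.continuous.comp continuous_lowDisc)) fun v e => by
      have h1 : Φ (lowDisc v) = Φ ⟨0, by simp⟩ := Subtype.ext (e.trans (hΦ.zero _ rfl).symm)
      exact ee_ne_zero _ (congrArg Subtype.val (Φ.injective h1))
  have hneg : ∀ v : ℂ, v.im < 0 → (Fb v).im < 0 := fun v hv => norm_ee_lt.1 (by
    rw [hFbe, hΦ.norm_lt, lowDisc_coe hv.le]; exact norm_ee_lt.2 hv)
  have hAc := h.low.diff.continuousOn
  have ⟨k, hk⟩ := hT.eq_add_int (convex_halfSpace_im_lt 0).isPreconnected (μ := fun v => A (Fb v)) (ν := fun v => F (A v))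
    (hAc.comp hFb.continuousOn hneg) (hF.comp_continuousOn hAc) (fun v hv => by
      rw [h.eq _ (hneg v hv), hFbe, hΦ.eq _ (by rw [lowDisc_coe hv.le]; exact norm_ee_lt.2 hv), lowDisc_coe hv.le, hFe, h.eq _ hv])
  have hcomm : ∀ v : ℂ, v.im < 0 → A (Fb v + k) = F (A v) := fun v hv => by rw [h.per_int, hk v hv]
  refine ⟨fun v => Fb v + k, by fun_prop, fun v _ => by rw [ee_add_int, hFbe], hcomm, fun v hv => ?_⟩
  have hlt : ∀ v : ℂ, v.im < 0 → Fb (v + 1) + k = Fb v + k + d := fun v hv => by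
    refine h.low.inj (by simpa using hneg (v + 1) (by simpa using hv)) (by simpa using hneg v hv) ?_
    rw [hcomm _ (by simpa using hv), h.per, hFd, h.per_int, hcomm _ hv]
  exact (EqOn.closure (fun v hv => hlt v hv) (by fun_prop) (by fun_prop)) (by rw [closure_setOfPred_im_lt]; exact hv : v ∈ closure {v : ℂ | v.im < 0})

namespace SideLift

lemma im_neg (h : SideLift A F Fb Φ d) (hΦ : DiscMap G f Φ) (hv : v.im < 0) : (Fb v).im < 0 :=
  norm_ee_lt.1 (by rw [h.ee_eq v hv.le, hΦ.norm_lt, lowDisc_coe hv.le]; exact norm_ee_lt.2 hv)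

lemma im_zero (h : SideLift A F Fb Φ d) (hΦ : DiscMap G f Φ) (hv : v.im = 0) : (Fb v).im = 0 :=
  norm_ee_eq.1 (by rw [h.ee_eq v hv.le]; exact hΦ.norm_eq (by rw [lowDisc_coe hv.le]; exact norm_ee_eq.2 hv))

lemma im_nonpos (h : SideLift A F Fb Φ d) (hΦ : DiscMap G f Φ) (hv : v.im ≤ 0) : (Fb v).im ≤ 0 := by
  rcases hv.lt_or_eq with h1 | h1
  exacts [(h.im_neg hΦ h1).le, (h.im_zero hΦ h1).le]

lemma comp {F' Fb' : ℂ → ℂ} {Φ' : CDisc ≃ₜ CDisc} {f' : X ≃ₜ X} (h : SideLift A F Fb Φ 1) (h' : SideLift A F' Fb' Φ' 1)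
    (hΦ' : DiscMap G f' Φ') : SideLift A (F ∘ F') (Fb ∘ Fb') (Φ * Φ') 1 where
  cont := h.cont.comp h'.cont
  ee_eq v hv := by
    have h2 := h'.im_nonpos hΦ' hv
    simp only [Function.comp]
    rw [h.ee_eq _ h2, lowDisc_eq h2 (h'.ee_eq v hv)]; rfl
  comm v hv := by simp only [Function.comp]; rw [h.comm _ (h'.im_neg hΦ' hv), h'.comm v hv]
  per v hv := by
    simp only [Function.comp]
    rw [h'.per v hv, Int.cast_one, h.per _ (h'.im_nonpos hΦ' hv), Int.cast_one]

lemma iterate (h : SideLift A F Fb Φ 1) (hΦ : DiscMap G f Φ) (n : ℕ) : SideLift A F^[n] Fb^[n] (Φ ^ n) 1 := by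
  induction n with
  | zero => exact ⟨continuous_id, fun v hv => (lowDisc_coe hv).symm, fun _ _ => rfl, fun v _ => by simp⟩
  | succ n ih => rw [Function.iterate_succ, Function.iterate_succ, pow_succ]; exact ih.comp h hΦ

lemma lowEnd (h : SideLift A F Fb Φ d) (hΦ : DiscMap G f Φ) (hF : Continuous F) (ha : 0 < a)
    (hL : LowEnd A a L Q) : LowEnd A a (F ∘ L) (Fb ∘ Q) where
  contL := hF.comp_continuousOn hL.contL
  contQ := h.cont.comp_continuousOn hL.contQ
  im_neg t ht := h.im_neg hΦ (hL.im_neg t ht)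
  im_zero := h.im_zero hΦ hL.im_zero
  eq t ht := by simp only [Function.comp]; rw [hL.eq t ht, h.comm _ (hL.im_neg t ht)]
  tend := by
    have h1 : Tendsto (fun z : CDisc => (Φ z).1) (𝓝 ⟨0, by simp⟩) (𝓝 0) := by
      have h0 := (by fun_prop : Continuous fun z : CDisc => (Φ z).1).tendsto ⟨0, by simp⟩
      rwa [hΦ.zero ⟨0, by simp⟩ rfl] at h0
    have h2 : Tendsto (fun t => lowDisc (Q t)) (𝓝[>] 0) (𝓝 ⟨0, by simp⟩) := by
      rw [tendsto_subtype_rng]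
      refine (tendsto_ee_zero.2 hL.tend).congr' ?_
      filter_upwards [Ioo_mem_nhdsGT ha] with t ht using (lowDisc_coe (hL.im_neg t ht).le).symm
    refine tendsto_ee_zero.1 ((h1.comp h2).congr' ?_)
    filter_upwards [Ioo_mem_nhdsGT ha] with t ht using (h.ee_eq _ (hL.im_neg t ht).le).symm

lemma real_eq (h : SideLift A F Fb Φ d) (hΦ : DiscMap G f Φ) (x : ℝ) : Fb x = ((Fb x).re : ℂ) :=
  Complex.ext rfl (by rw [h.im_zero hΦ (ofReal_im x), ofReal_im])

lemma degree_eq_one (h : SideLift A F Fb Φ d) (hΦ : DiscMap G f Φ)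
    (hfix : ∀ z : CDisc, ‖z.1‖ = 1 → Φ z ≠ z) : d = 1 := by
  by_contra hd
  have hc : Continuous fun x : ℝ => (Fb x).re - x := (continuous_re.comp (h.cont.comp continuous_ofReal)).sub continuous_id
  obtain ⟨m, hm⟩ : ∃ m : ℤ, (m : ℝ) ∈ uIcc ((Fb (0 : ℝ)).re - (0 : ℝ)) ((Fb (1 : ℝ)).re - (1 : ℝ)) := by
    rw [(by have := congrArg re (h.per (0 : ℝ) (by simp)); simpa using this : (Fb (1 : ℝ)).re = (Fb (0 : ℝ)).re + d)]
    simp only [mem_uIcc]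
    rcases lt_or_gt_of_ne hd with hd | hd
    · have : (d : ℝ) + 1 ≤ 1 := by exact_mod_cast hd
      exact ⟨⌊(Fb (0 : ℝ)).re⌋, Or.inr ⟨by linarith [Int.lt_floor_add_one (Fb (0 : ℝ)).re], by
        linarith [Int.floor_le (Fb (0 : ℝ)).re]⟩⟩
    · have : (1 : ℝ) + 1 ≤ d := by exact_mod_cast hd
      exact ⟨⌈(Fb (0 : ℝ)).re⌉, Or.inl ⟨by linarith [Int.le_ceil (Fb (0 : ℝ)).re], by
        linarith [Int.ceil_lt_add_one (Fb (0 : ℝ)).re]⟩⟩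
  have ⟨x, _, hx⟩ := intermediate_value_uIcc hc.continuousOn hm
  have hx' : Fb x = (x : ℂ) + m := by
    rw [h.real_eq hΦ, show (Fb x).re = x + m by simp only at hx; linarith]; push_cast; rfl
  have h2 := h.ee_eq x (by simp)
  rw [hx', ee_add_int] at h2
  exact hfix (lowDisc x) (by rw [lowDisc_coe (by simp)]; exact norm_ee_eq.2 (by simp))
    (Subtype.ext (by rw [← h2, lowDisc_coe (by simp)]))

lemma exists_circle_lift (h : SideLift A F Fb Φ 1) (hΦ : DiscMap G f Φ) :
    ∃ g : CircleDeg1Lift, StrictMono g ∧ Continuous g ∧ ∀ x : ℝ, Fb x = (g x : ℂ) := by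
  have hc : Continuous fun x : ℝ => (Fb x).re := continuous_re.comp (h.cont.comp continuous_ofReal)
  have hp : ∀ x : ℝ, (Fb (x + 1 : ℝ)).re = (Fb x).re + 1 := fun x => by
    have := congrArg re (h.per x (by simp)); simpa using this
  have hpn : ∀ (x : ℝ) (m : ℤ), (Fb (x + m : ℝ)).re = (Fb x).re + m := fun x m => by
    have h2 := (show Function.Periodic (fun x : ℝ => (Fb x).re - x) 1 from fun x => by simp only [hp]; ring).int_mul m x
    simp only [mul_one] at h2
    linarith
  have hinj : Function.Injective fun x : ℝ => (Fb x).re := fun x y e => by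
    have h1 : Φ (lowDisc x) = Φ (lowDisc y) := Subtype.ext (by
      rw [← h.ee_eq x (by simp), ← h.ee_eq y (by simp), h.real_eq hΦ, h.real_eq hΦ y]; simp only at e; rw [e])
    have h2 := congrArg Subtype.val (Φ.injective h1)
    rw [lowDisc_coe (by simp), lowDisc_coe (by simp), ee_eq_iff] at h2
    have ⟨m, hm⟩ := h2
    have hm' : y = x + m := by exact_mod_cast hm
    have h3 := hpn x m
    rw [← hm'] at h3
    simp only at e
    linarith
  have hsm : StrictMono fun x : ℝ => (Fb x).re := by
    rcases hc.strictMono_of_inj hinj with h1 | h1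
    · exact h1
    · have h2 := h1 (zero_lt_one (α := ℝ))
      have h3 := hp 0
      rw [zero_add] at h3
      linarith
  exact ⟨⟨⟨fun x => (Fb x).re, hsm.monotone⟩, hp⟩, hsm, hc, fun x => h.real_eq hΦ x⟩

end SideLift
end

lemma exists_int_of_coe_eq {x y : ℝ} (h : (x : 𝕋) = y) : ∃ m : ℤ, y = x + m := by
  have ⟨m, hm⟩ := (AddCircle.coe_eq_zero_iff (1 : ℝ)).1 (show ((y - x : ℝ) : 𝕋) = 0 by
    rw [AddCircle.coe_sub, h, sub_self])
  exact ⟨m, by simp at hm; linarith⟩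

lemma coe_add_intCast (x : ℝ) (m : ℤ) : ((x + m : ℝ) : 𝕋) = x := by
  have : ((m : ℝ) : 𝕋) = 0 := (AddCircle.coe_eq_zero_iff (1 : ℝ)).2 ⟨m, by simp⟩
  rw [AddCircle.coe_add, this, add_zero]

lemma exists_lift_addCircle {c : ℝ → 𝕋} (hc : Continuous c) :
    ∃ Θ : ℝ → ℝ, Continuous Θ ∧ ∀ x, (Θ x : 𝕋) = c x := by
  have ⟨M, hM, hMe⟩ := exists_continuous_ee (g := fun x => ((AddCircle.toCircle (c x) : Circle) : ℂ))
    (continuous_subtype_val.comp (AddCircle.continuous_toCircle.comp hc)) (fun x => Circle.coe_ne_zero _)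
  refine ⟨fun x => -(M x).re, by fun_prop, fun x => AddCircle.injective_toCircle one_ne_zero (Subtype.ext ?_)⟩
  have h0 : (M x).im = 0 := norm_ee_eq.1 (by rw [hMe]; exact Circle.norm_coe _)
  rw [AddCircle.toCircle_apply_mk, Circle.coe_exp, ← hMe, ee, show M x = ((M x).re : ℂ) from Complex.ext rfl (by simp [h0])]
  push_cast
  congr 1; ring

/-- A circle homeomorphism conjugate to a rotation has the rotation number of this rotation, up to sign. -/
lemma translationNumber_of_conj {g : CircleDeg1Lift} (hg : Continuous g) {c : ℝ → 𝕋} (hc : Continuous c)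
    (hper : ∀ x, c (x + 1) = c x) (hinj : ∀ x y, c x = c y → ∃ k : ℤ, y = x + k) {α : 𝕋}
    (hα : ∀ x, c (g x) = c x + α) :
    (g.translationNumber : 𝕋) = α ∨ (g.translationNumber : 𝕋) = -α := by
  have key : ∀ {c : ℝ → 𝕋} {α : 𝕋} (Θ : ℝ → ℝ), Continuous Θ → (∀ x, (Θ x : 𝕋) = c x) →
      (∀ x y, c x = c y → ∃ k : ℤ, y = x + k) → (∀ x, c (g x) = c x + α) → (∀ x, Θ (x + 1) = Θ x + 1) →
      (g.translationNumber : 𝕋) = α := by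
    intro c α Θ hΘ hΘc hinj hα hp
    have hpn : ∀ (x : ℝ) (m : ℤ), Θ (x + m) = Θ x + m := fun x m => by
      have h2 := (show Function.Periodic (fun x : ℝ => Θ x - x) 1 from fun x => by simp only [hp]; ring).int_mul m x
      simp only [mul_one] at h2
      linarith
    have hΘi : Function.Injective Θ := fun x y e => by
      obtain ⟨k, rfl⟩ := hinj x y (by rw [← hΘc, ← hΘc, e])
      rw [hpn] at e
      linarith
    have hsm : StrictMono Θ := by
      rcases hΘ.strictMono_of_inj hΘi with h1 | h1
      · exact h1
      · have := h1 (zero_lt_one (α := ℝ)); have h3 := hp 0; rw [zero_add] at h3; linarith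
    obtain ⟨a, rfl⟩ := QuotientAddGroup.mk_surjective α
    have ⟨k, hk⟩ := eq_add_int_of_ee isPreconnected_univ (μ := fun x => ((Θ x + a : ℝ) : ℂ)) (ν := fun x => (Θ (g x) : ℂ))
      (by fun_prop) (by fun_prop) (fun x _ => by
        have ⟨m, hm⟩ := exists_int_of_coe_eq (by rw [hΘc, hα, AddCircle.coe_add, hΘc] : ((Θ x + a : ℝ) : 𝕋) = ((Θ (g x) : ℝ) : 𝕋))
        exact ee_eq_iff.2 ⟨m, by rw [hm]; push_cast; ring⟩)
    let T : CircleDeg1Lift := ⟨⟨Θ, hsm.monotone⟩, hp⟩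
    have := CircleDeg1Lift.translationNumber_eq_of_semiconj (f := T) (g₁ := g)
      (g₂ := CircleDeg1Lift.translate (Multiplicative.ofAdd (a + k))) (fun x => by
        have h2 : Θ (g x) = Θ x + a + k := by exact_mod_cast (hk x trivial)
        rw [CircleDeg1Lift.translate_apply]
        change Θ (g x) = a + k + Θ x
        linarith)
    rw [this, CircleDeg1Lift.translationNumber_translate]
    exact coe_add_intCast a k
  have ⟨Θ, hΘ, hΘc⟩ := exists_lift_addCircle hc
  have ⟨m, hm⟩ := eq_add_int_of_ee isPreconnected_univ (μ := fun x => (Θ x : ℂ)) (ν := fun x => (Θ (x + 1) : ℂ))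
    (by fun_prop) (by fun_prop) (fun x _ => by
      have ⟨m, hm⟩ := exists_int_of_coe_eq (show (Θ x : 𝕋) = Θ (x + 1) by rw [hΘc, hΘc, hper])
      exact ee_eq_iff.2 ⟨m, by rw [hm]; push_cast; rfl⟩)
  have hm' : ∀ x, Θ (x + 1) = Θ x + m := fun x => by exact_mod_cast hm x trivial
  have h01 := hm' 0
  rw [zero_add] at h01
  have hm1 : m = 1 ∨ m = -1 := by
    rcases lt_trichotomy m 0 with hneg | rfl | hpos
    · by_contra! hne
      have h2 : (m : ℝ) ≤ -2 := by exact_mod_cast (show m ≤ -2 by have := hne.2; omega)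
      have ⟨x, hx, hxe⟩ := intermediate_value_uIcc (a := 0) (b := 1) hΘ.continuousOn
        (show Θ 0 - 1 ∈ uIcc (Θ 0) (Θ 1) from mem_uIcc.2 (Or.inr ⟨by linarith, by linarith⟩))
      have ⟨k, hk⟩ := hinj 0 x (by rw [← hΘc, ← hΘc, hxe, show Θ 0 - 1 = Θ 0 + ((-1 : ℤ) : ℝ) by push_cast; ring]; exact (coe_add_intCast _ _).symm)
      rw [uIcc_of_le zero_le_one, hk, zero_add] at hx
      have hk0 : 0 ≤ k := by exact_mod_cast hx.1
      have hk1 : k ≤ 1 := by exact_mod_cast hx.2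
      obtain rfl | rfl : k = 0 ∨ k = 1 := by omega
      · simp at hk; rw [hk] at hxe; linarith
      · simp at hk; rw [hk] at hxe; linarith
    · exfalso
      simp only [Int.cast_zero, add_zero] at h01
      have ⟨x, hx, hxe⟩ := intermediate_value_uIcc (a := 0) (b := 1 / 2) hΘ.continuousOn
        (show (Θ 0 + Θ (1 / 2)) / 2 ∈ uIcc (Θ 0) (Θ (1 / 2)) from mem_uIcc.2 (by grind))
      have ⟨y, hy, hye⟩ := intermediate_value_uIcc (a := 1 / 2) (b := 1) hΘ.continuousOn
        (show (Θ 0 + Θ (1 / 2)) / 2 ∈ uIcc (Θ (1 / 2)) (Θ 1) from mem_uIcc.2 (by grind))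
      rw [uIcc_of_le (by norm_num)] at hx hy
      have hne : Θ 0 ≠ Θ (1 / 2) := fun e => by
        have ⟨k, hk⟩ := hinj 0 (1 / 2) (by rw [← hΘc, ← hΘc, e])
        have h2 : 2 * k = 1 := by exact_mod_cast (by linarith : (2 * k : ℝ) = 1)
        omega
      have ⟨k, hk⟩ := hinj x y (by rw [← hΘc, ← hΘc, hxe, hye])
      have hk0' : 0 ≤ k := by exact_mod_cast (by linarith [hx.2, hy.1] : (0 : ℝ) ≤ k)
      have hk1' : k ≤ 1 := by exact_mod_cast (by linarith [hx.1, hy.2] : (k : ℝ) ≤ 1)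
      obtain rfl | rfl : k = 0 ∨ k = 1 := by omega
      · rw [(by simp at hk; linarith [hx.2, hy.1] : x = 1 / 2)] at hxe; exact hne (by linarith)
      · rw [(by simp at hk; linarith [hx.1, hy.2] : x = 0)] at hxe; exact hne (by linarith)
    · by_contra! hne
      have h2 : (2 : ℝ) ≤ m := by exact_mod_cast (show 2 ≤ m by have := hne.1; omega)
      have ⟨x, hx, hxe⟩ := intermediate_value_uIcc (a := 0) (b := 1) hΘ.continuousOn
        (show Θ 0 + 1 ∈ uIcc (Θ 0) (Θ 1) from mem_uIcc.2 (Or.inl ⟨by linarith, by linarith⟩))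
      have ⟨k, hk⟩ := hinj 0 x (by rw [← hΘc, ← hΘc, hxe]; simpa using (coe_add_intCast (Θ 0) 1).symm)
      rw [uIcc_of_le zero_le_one, hk, zero_add] at hx
      have hk0 : 0 ≤ k := by exact_mod_cast hx.1
      have hk1 : k ≤ 1 := by exact_mod_cast hx.2
      obtain rfl | rfl : k = 0 ∨ k = 1 := by omega
      · simp at hk; rw [hk] at hxe; linarith
      · simp at hk; rw [hk] at hxe; linarith
  rcases hm1 with rfl | rfl
  · exact Or.inl (key Θ hΘ hΘc hinj hα fun x => by simpa using hm' x)
  · refine Or.inr (key (c := fun x => -c x) (fun x => -Θ x) hΘ.neg (fun x => by rw [AddCircle.coe_neg, hΘc])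
      (fun x y h => hinj x y (neg_injective h)) (fun x => by rw [hα, neg_add]) fun x => ?_)
    have := hm' x
    push_cast at this
    linarith

/-- A homeomorphism conjugate to an irrational rotation is minimal, even for forward invariant sets. -/
lemma minimal_of_conj {θ : CDisc → 𝕋} (hθ : ContinuousOn θ {z | ‖z.1‖ = 1})
    (hi : InjOn θ {z | ‖z.1‖ = 1}) {β : 𝕋} (hβ : addOrderOf β = 0)
    (hc : ∀ z : CDisc, ‖z.1‖ = 1 → θ (Φ z) = θ z + β) (T : Set CDisc) (hT : IsClosed T) (hne : T.Nonempty)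
    (hT1 : ∀ z ∈ T, ‖z.1‖ = 1) (hΦT : ∀ z ∈ T, Φ z ∈ T) (z : CDisc) (hz : ‖z.1‖ = 1) : z ∈ T := by
  have ⟨x, hx⟩ := hne
  have horb : ∀ n : ℕ, θ x + n • β ∈ θ '' T := fun n => by
    induction n with
    | zero => exact ⟨x, hx, by simp⟩
    | succ n ih =>
      have ⟨y, hy, hye⟩ := ih
      exact ⟨Φ y, hΦT y hy, by rw [hc y (hT1 y hy), hye, succ_nsmul, add_assoc]⟩
  have hd : Dense (AddSubmonoid.closure {β} : Set 𝕋) := by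
    rw [dense_addSubmonoidClosure_iff_addSubgroupClosure, ← AddSubgroup.zmultiples_eq_closure, AddSubgroup.coe_zmultiples]
    have : Fact ((0 : ℝ) < 1) := ⟨zero_lt_one⟩
    exact AddCircle.denseRange_zsmul_iff.2 hβ
  have hall : ∀ γ, θ x + γ ∈ θ '' T := fun γ => by
    have h1 := closure_minimal (fun γ hγ => by
        obtain ⟨n, rfl⟩ := AddSubmonoid.mem_closure_singleton.1 hγ
        exact horb n) (((hT.isCompact.image_of_continuousOn (hθ.mono hT1)).isClosed).preimage (continuous_const.add continuous_id))
    exact h1 (hd γ)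
  have ⟨y, hy, hye⟩ := hall (θ z - θ x)
  rw [add_sub_cancel] at hye
  exact hi (hT1 y hy) hz hye ▸ hy

/-- The first exit of a path from a disc model lands at a point of the circle. -/
lemma DiscModel.exists_exit (h : DiscModel U G H) {c : ℝ → X}
    (hc : ContinuousOn c (Icc 0 1)) (h0 : c 0 ∈ U) (h1 : c 1 ∉ U) : ∃ τ ∈ Ioc (0 : ℝ) 1, c τ ∉ U ∧ (∀ s ∈ Ico 0 τ, c s ∈ U) ∧
      ContinuousOn (H ∘ c) (Ico 0 τ) ∧ ∃ ζ : ℂ, ‖ζ‖ = 1 ∧ Tendsto (H ∘ c) (𝓝[<] τ) (𝓝 ζ) := by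
  set C : Set ℝ := {t ∈ Icc (0 : ℝ) 1 | c t ∈ Uᶜ} with hC
  have hCc := isCompact_Icc.of_isClosed_subset (hc.preimage_isClosed_of_isClosed isClosed_Icc h.isOpen.isClosed_compl)
    fun t ht => ht.1
  have hm := hCc.sInf_mem ⟨1, ⟨zero_le_one, le_rfl⟩, h1⟩
  have hpos := lt_of_le_of_ne hm.1.1 fun e => hm.2 (e ▸ h0)
  have hin : ∀ s ∈ Ico 0 (sInf C), c s ∈ U := fun s hs => by
    by_contra hcs
    exact hs.2.not_ge (csInf_le hCc.bddBelow ⟨⟨hs.1, hs.2.le.trans hm.1.2⟩, hcs⟩)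
  have hsub : Ico 0 (sInf C) ⊆ Icc 0 1 := fun s hs => ⟨hs.1, hs.2.le.trans hm.1.2⟩
  have hcc := h.cont_inv.comp (hc.mono hsub) hin
  refine ⟨sInf C, ⟨hpos, hm.1.2⟩, hm.2, hin, hcc, h.landing hpos (hcc.mono Ioo_subset_Ico_self)
    (fun t ht => h.maps_inv (hin t ⟨ht.1.le, ht.2⟩)) hm.2 ?_⟩
  refine (((hc _ hm.1).tendsto.mono_left (nhdsWithin_le_of_mem (mem_of_superset (Ioo_mem_nhdsLT hpos)
    (Ioo_subset_Ico_self.trans hsub))))).congr' ?_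
  filter_upwards [Ioo_mem_nhdsLT hpos] with t ht using (h.right_inv _ (hin t ⟨ht.1.le, ht.2⟩)).symm

lemma Side.ne₂ (hT : TwoCharts e₁ e₂) (h : Side e₁ U G H A) (hz : ‖z‖ < 1) : G z ≠ e₂ 0 := by
  rcases eq_or_ne z 0 with rfl | h0
  · rw [h.zero]; exact hT.ne₂ 0
  · obtain ⟨v, rfl⟩ := _root_.exists_ee h0
    rw [← h.eq v (norm_ee_lt.1 hz)]; exact hT.ne₂ _

lemma Side.ne₁ (hT : TwoCharts e₁ e₂) (h : Side e₁ U G H A) (hz : ‖z‖ < 1) (h0 : z ≠ 0) : G z ≠ e₁ 0 := by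
  obtain ⟨v, rfl⟩ := _root_.exists_ee h0
  rw [← h.eq v (norm_ee_lt.1 hz)]; exact hT.ne₁ _

/-- A path in the disc followed by a path in the sphere up to its exit gives a curve reaching the boundary. -/
lemma Side.exists_access (hT : TwoCharts e₁ e₂) (h : Side e₁ U G H A) {γ : ℝ → ℂ} (hγ : ContinuousOn γ (Icc 0 1)) (hγ0 : γ 0 = 0)
    (hγne : ∀ t ∈ Ioc (0 : ℝ) 1, γ t ≠ 0) (hγ1 : ∀ t ∈ Icc (0 : ℝ) 1, ‖γ t‖ < 1) {c : ℝ → X} (hc : ContinuousOn c (Icc 0 1))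
    (hc0 : c 0 = G (γ 1)) (hc1 : c 1 ∉ U) (hce : ∀ t ∈ Icc (0 : ℝ) 1, c t ≠ e₁ 0) (hce' : ∀ t ∈ Icc (0 : ℝ) 1, c t ≠ e₂ 0) :
    ∃ τ ∈ Ioc (0 : ℝ) 1, c τ ∉ U ∧ (∀ s ∈ Ico 0 τ, c s ∈ U) ∧ ∃ M Q, LowEnd A (1 / 3) M Q ∧
      (∀ t ∈ Ioo (0 : ℝ) (1 / 6), e₁ (ee (M t)) = G (γ (6 * t))) ∧
      ∀ t ∈ Icc (1 / 6 : ℝ) (1 / 3), e₁ (ee (M t)) = c ((6 * t - 1) * τ) := by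
  have h11 := mem_ball_zero_iff.2 (hγ1 1 ⟨zero_le_one, le_rfl⟩)
  have ⟨τ, hτ, hcτ, hin, hHc, ζ, hζ, hl⟩ := h.model.exists_exit hc (hc0 ▸ h.model.maps h11) hc1
  have hH0 : ∀ x ∈ U, x ≠ e₁ 0 → H x ≠ 0 := fun x hx hxe e => hxe (by rw [← h.model.right_inv x hx, e, h.zero])
  set p : ℝ → ℂ := fun s => if s < τ then H (c s) else ζ with hp
  have hpc : ContinuousOn p (Icc 0 τ) := fun s hs => by
    rcases hs.2.lt_or_eq with h1 | rfl
    · refine (ContinuousWithinAt.congr_of_eventuallyEq ((hHc s ⟨hs.1, h1⟩).mono_of_mem_nhdsWithin ?_) ?_ (if_pos h1))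
      · exact mem_nhdsWithin.2 ⟨Iio τ, isOpen_Iio, h1, fun x hx => ⟨hx.2.1, hx.1⟩⟩
      · filter_upwards [mem_nhdsWithin_of_mem_nhds (Iio_mem_nhds h1)] with x hx using if_pos hx
    · have : ContinuousWithinAt p (Iic s) s := by
        rw [← Iio_insert, continuousWithinAt_insert_self]
        refine Tendsto.congr' ?_ (show Tendsto (H ∘ c) (𝓝[<] s) (𝓝 (p s)) by simp only [hp, lt_irrefl, if_false]; exact hl)
        filter_upwards [self_mem_nhdsWithin] with x hx using (if_pos hx).symm
      exact this.mono Icc_subset_Iic_self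
  have hp0 : p 0 = γ 1 := by simp only [hp, if_pos hτ.1, hc0]; exact h.model.left_inv _ h11
  set κ : ℝ → ℂ := fun t => γ (min (6 * t) 1) + (p (max (6 * t - 1) 0 * τ) - p 0) with hκ
  have hκ1 : ∀ t, t ≤ 1 / 6 → κ t = γ (6 * t) := fun t ht => by
    simp only [hκ]
    rw [min_eq_left (by linarith), max_eq_right (by linarith), zero_mul, sub_self, add_zero]
  have hκ2 : ∀ t, 1 / 6 ≤ t → κ t = p ((6 * t - 1) * τ) := fun t ht => by grind
  have hr : ∀ t ∈ Ico (1 / 6 : ℝ) (1 / 3), (6 * t - 1) * τ ∈ Ico 0 τ := fun t ht =>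
    ⟨mul_nonneg (by linarith [ht.1]) hτ.1.le, by nlinarith [ht.2, hτ.1]⟩
  have hκ3 : ∀ t ∈ Ico (1 / 6 : ℝ) (1 / 3), κ t = H (c ((6 * t - 1) * τ)) := fun t ht => by
    rw [hκ2 t ht.1]; exact if_pos (hr t ht).2
  have hκc : ContinuousOn κ (Icc 0 (1 / 3)) := by
    refine (hγ.comp (by fun_prop) fun t ht => ⟨le_min (by linarith [ht.1]) zero_le_one, min_le_right _ _⟩).add
      ((hpc.comp (by fun_prop) fun t ht => ⟨mul_nonneg (le_max_right _ _) hτ.1.le, ?_⟩).sub continuousOn_const)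
    have : max (6 * t - 1) 0 ≤ 1 := max_le (by linarith [ht.2]) zero_le_one
    nlinarith [hτ.1]
  have h31 : κ (1 / 3) = ζ := by rw [hκ2 _ (by norm_num)]; norm_num [hp]
  have hκlt : ∀ t ∈ Ico (0 : ℝ) (1 / 3), ‖κ t‖ < 1 := fun t ht => by
    rcases le_total t (1 / 6) with h6 | h6
    · rw [hκ1 t h6]; exact hγ1 _ ⟨by linarith [ht.1], by linarith⟩
    · rw [hκ3 t ⟨h6, ht.2⟩]; exact mem_ball_zero_iff.1 (h.model.maps_inv (hin _ (hr t ⟨h6, ht.2⟩)))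
  have hκne : ∀ t ∈ Ioc (0 : ℝ) (1 / 3), κ t ≠ 0 := fun t ht => by grind
  have hGκ : ∀ t ∈ Ico (1 / 6 : ℝ) (1 / 3), G (κ t) = c ((6 * t - 1) * τ) := fun t ht => by
    rw [hκ3 t ht, h.model.right_inv _ (hin _ (hr t ht))]
  set c' : ℝ → X := fun t => if t < 1 / 3 then G (κ t) else c τ with hc'
  have hc'2 : ∀ t ∈ Icc (1 / 6 : ℝ) (1 / 3), c' t = c ((6 * t - 1) * τ) := fun t ht => by grind
  have hc'c : ContinuousOn c' (Ioc 0 (1 / 3)) := fun t ht => by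
    rcases ht.2.lt_or_eq with h3 | h3
    · have h5 := h.model.cont.comp (hκc.mono Ico_subset_Icc_self) fun t ht => mem_ball_zero_iff.2 (hκlt t ht)
      refine ContinuousWithinAt.congr_of_eventuallyEq ((h5 t ⟨ht.1.le, h3⟩).mono_of_mem_nhdsWithin ?_) ?_ (if_pos h3)
      · exact mem_nhdsWithin.2 ⟨Iio (1 / 3), isOpen_Iio, h3, fun x hx => ⟨hx.2.1.le, hx.1⟩⟩
      · filter_upwards [mem_nhdsWithin_of_mem_nhds (Iio_mem_nhds h3)] with x hx using if_pos hx
    · have h5 : ContinuousOn (fun t => c ((6 * t - 1) * τ)) (Icc (1 / 6) (1 / 3)) :=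
        hc.comp (by fun_prop) fun t ht => ⟨mul_nonneg (by linarith [ht.1]) hτ.1.le, by nlinarith [ht.2, hτ.1, hτ.2]⟩
      have h6 : t ∈ Icc (1 / 6 : ℝ) (1 / 3) := ⟨by rw [h3]; norm_num, ht.2⟩
      refine ContinuousWithinAt.congr_of_eventuallyEq ((h5 t h6).mono_of_mem_nhdsWithin ?_) ?_ (hc'2 t h6)
      · exact mem_nhdsWithin.2 ⟨Ioi (1 / 6), isOpen_Ioi, by rw [h3]; norm_num, fun x hx => ⟨le_of_lt hx.1, hx.2.2⟩⟩
      · exact mem_nhdsWithin.2 ⟨Ioi (1 / 6), isOpen_Ioi, by rw [h3]; norm_num, fun x hx => hc'2 x ⟨le_of_lt hx.1, hx.2.2⟩⟩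
  have ⟨M, hM, hMe⟩ := hT.lift_Ioc (by norm_num) hc'c (fun t ht => by
    rcases ht.2.lt_or_eq with h3 | h3
    · simp only [hc', if_pos h3]; exact h.ne₁ hT (hκlt t ⟨ht.1.le, h3⟩) (hκne t ht)
    · simp only [hc', if_neg h3.not_lt]; exact hce τ ⟨hτ.1.le, hτ.2⟩) (fun t ht => by
    rcases ht.2.lt_or_eq with h3 | h3
    · simp only [hc', if_pos h3]; exact h.ne₂ hT (hκlt t ⟨ht.1.le, h3⟩)
    · simp only [hc', if_neg h3.not_lt]; exact hce' τ ⟨hτ.1.le, hτ.2⟩)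
  have ⟨Q, hQ⟩ := h.exists_lowEnd hT (by norm_num) hκc (by rw [hκ1 0 (by norm_num), mul_zero, hγ0]) hκne
    (fun t ht => hκlt t ⟨ht.1.le, ht.2⟩) (by rw [h31, hζ]) hM fun t ht => by rw [hMe t ⟨ht.1, ht.2.le⟩]; exact if_pos ht.2
  grind

/-- Accessible boundary points are dense in the boundary. -/
lemma Side.exists_access_near (hT : TwoCharts e₁ e₂) (h : Side e₁ U G H A) {y : X} (hy : y ∈ frontier U) (hye : y ≠ e₂ 0) {N : Set X} (hN : N ∈ 𝓝 y) :
    ∃ M Q, LowEnd A (1 / 3) M Q ∧ (∀ t ∈ Ioo (0 : ℝ) (1 / 3), e₁ (ee (M t)) ∈ U) ∧ e₁ (ee (M (1 / 3))) ∈ N ∧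
      e₁ (ee (M (1 / 3))) ∉ U := by
  obtain ⟨z, rfl⟩ := hT.exists_eq hye
  have hyU : e₁ z ∉ U := fun h1 => (h.model.isOpen.frontier_eq ▸ hy).2 h1
  have ⟨ε, hε, hεN⟩ := Metric.mem_nhds_iff.1 (inter_mem (hT.emb₁.continuous.continuousAt hN)
    (isOpen_ne.mem_nhds (show z ≠ 0 from fun e => hyU (e ▸ (h.zero ▸ h.model.maps (by simp))))))
  obtain ⟨_, ⟨a, ha, rfl⟩, haU⟩ := mem_closure_iff_nhds.1 (frontier_subset_closure hy) (e₁ '' ball z ε)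
    ((hT.emb₁.isOpenMap _ isOpen_ball).mem_nhds ⟨z, mem_ball_self hε, rfl⟩)
  have hseg : ∀ t ∈ Icc (0 : ℝ) 1, AffineMap.lineMap a z t ∈ ball z ε := fun t ht =>
    (convex_ball z ε).lineMap_mem ha (mem_ball_self hε) ht
  have hHa := h.model.maps_inv haU
  have hHa0 : H (e₁ a) ≠ 0 := fun e => (hεN ha).2 (hT.emb₁.injective (by rw [← h.model.right_inv _ haU, e, h.zero]))
  have ⟨τ, hτ, hcτ, hin, M, Q, hQ, h1, h2⟩ := h.exists_access hT (γ := fun t => t * H (e₁ a)) (by fun_prop) (by simp)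
    (fun t ht => mul_ne_zero (by exact_mod_cast ht.1.ne') hHa0) (fun t ht => by
      rw [norm_mul, norm_real, Real.norm_of_nonneg ht.1]
      nlinarith [mem_ball_zero_iff.1 hHa, ht.2, norm_nonneg (H (e₁ a)), ht.1])
    (c := fun t => e₁ (AffineMap.lineMap a z t)) (hT.emb₁.continuous.comp (by fun_prop)).continuousOn
    (by simp [h.model.right_inv _ haU]) (by simpa using hyU)
    (fun t ht e => (hεN (hseg t ht)).2 (hT.emb₁.injective e)) (fun t ht => hT.ne₂ _)
  refine ⟨M, Q, hQ, fun t ht => ?_, ?_, ?_⟩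
  · rcases lt_or_ge t (1 / 6) with h6 | h6
    · rw [h1 t ⟨ht.1, h6⟩]
      refine h.model.maps (mem_ball_zero_iff.2 ?_)
      rw [norm_mul, norm_real, Real.norm_of_nonneg (by linarith [ht.1])]
      nlinarith [mem_ball_zero_iff.1 hHa, norm_nonneg (H (e₁ a)), ht.1]
    · rw [h2 t ⟨h6, ht.2.le⟩]
      exact hin _ ⟨mul_nonneg (by linarith) hτ.1.le, by nlinarith [ht.2, hτ.1]⟩
  · rw [h2 _ ⟨by norm_num, le_rfl⟩, show (6 * (1 / 3 : ℝ) - 1) * τ = τ by ring]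
    exact (hεN (hseg τ ⟨hτ.1.le, hτ.2⟩)).1
  · rwa [h2 _ ⟨by norm_num, le_rfl⟩, show (6 * (1 / 3 : ℝ) - 1) * τ = τ by ring]

lemma LowEnd.congr {L' : ℝ → ℂ} (h : LowEnd A a L Q) (he : EqOn L' L (Ioc 0 a)) : LowEnd A a L' Q where
  contL := h.contL.congr he
  contQ := h.contQ
  im_neg := h.im_neg
  im_zero := h.im_zero
  eq t ht := by rw [he ⟨ht.1, ht.2.le⟩, h.eq t ht]
  tend := h.tend

lemma Side.sideLift_add (h : Side e U G H A) (k : ℤ) : SideLift A (· + (k : ℂ)) (· + (k : ℂ)) 1 1 where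
  cont := by fun_prop
  ee_eq v hv := by rw [ee_add_int]; exact (lowDisc_coe hv).symm
  comm v _ := h.per_int v k
  per v _ := by push_cast; ring

/-- A curve crossing from the domain `U₁` to the domain `U₂` through the set `S`, in logarithmic coordinates. -/
structure CrossArc {X : Type*} (e : ℂ → X) (U₁ U₂ : Set X) (A B : ℂ → ℂ) (S : Set ℂ) (L Q R : ℝ → ℂ) : Prop where
  curve : CrossCurve A B L Q R
  low : ∀ t ∈ Ioo (0 : ℝ) (1 / 3), e (ee (L t)) ∈ U₁
  mid : ∀ t ∈ Icc (1 / 3 : ℝ) (2 / 3), L t ∈ S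
  high : ∀ t ∈ Ioo (2 / 3 : ℝ) 1, e (ee (L t)) ∈ U₂

namespace CrossArc

lemma order {X : Type*} {e : ℂ → X} {U₁ U₂ : Set X} {S' : Set ℂ} {L L' Q Q' R R' : ℝ → ℂ}
    (h : CrossArc e U₁ U₂ A B S L Q R) (h' : CrossArc e U₁ U₂ A B S' L' Q' R') (hA : LowMap A) (hB : LowMap B)
    (hU : Disjoint U₁ U₂) (hL : ∀ t ∈ Ioo (0 : ℝ) 1, L t ∉ S') (hL' : ∀ t ∈ Ioo (0 : ℝ) 1, L' t ∉ S) :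
    (0 < (Q' (1 / 3) - Q (1 / 3)).re → 0 ≤ (R' (2 / 3) - R (2 / 3)).re) ∧
      ((Q' (1 / 3) - Q (1 / 3)).re < 0 → (R' (2 / 3) - R (2 / 3)).re ≤ 0) := by
  refine h.curve.order hA hB h'.curve fun s hs t ht h1 h2 he => ?_
  by_cases hs' : s ∈ Icc (1 / 3 : ℝ) (2 / 3)
  · exact hL' t ht (he ▸ h.mid s hs')
  by_cases ht' : t ∈ Icc (1 / 3 : ℝ) (2 / 3)
  · exact hL s hs (he ▸ h'.mid t ht')
  rw [mem_Icc, not_and_or, not_le, not_le] at hs' ht'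
  rcases hs' with hs' | hs'
  · have h3 : t ∈ Ioo (2 / 3 : ℝ) 1 := ⟨by
      rcases ht' with ht' | ht'
      · rcases h1 with h1 | h1 <;> linarith
      · exact ht', ht.2⟩
    exact hU.notMem_of_mem_left (h.low s ⟨hs.1, hs'⟩) (he ▸ h'.high t h3)
  · exact hU.notMem_of_mem_left (h'.low t (⟨ht.1, by grind⟩)) (he ▸ h.high s ⟨hs', hs.2⟩)

lemma map {R : ℝ → ℂ}
    (h : CrossArc e U₁ U₂ A B S L Q R) (hΦ₁ : DiscMap G₁ f Φ₁)
    (hΦ₂ : DiscMap G₂ f Φ₂) {F' Fb' : ℂ → ℂ} (hF : Continuous F) (h₁ : SideLift A F Fb Φ₁ 1) (h₂ : SideLift B F' Fb' Φ₂ 1)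
    (hF' : ∀ v, F' v = -F (-v)) (hFe : ∀ v, e (ee (F v)) = f (e (ee v))) (hU₁ : ∀ x ∈ U₁, f x ∈ U₁)
    (hU₂ : ∀ x ∈ U₂, f x ∈ U₂) : CrossArc e U₁ U₂ A B (F '' S) (F ∘ L) (Fb ∘ Q) (fun t => -Fb' (-R t)) where
  curve :=
    { cont := hF.comp_continuousOn h.curve.cont
      low := h₁.lowEnd hΦ₁ hF (by norm_num) h.curve.low
      high := by
        simp only [neg_neg]
        refine (h₂.lowEnd hΦ₂ (by rw [show F' = fun v => -F (-v) from funext hF']; fun_prop) (by norm_num) h.curve.high).congr fun t _ => ?_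
        simp [hF'] }
  low t ht := by simp only [Function.comp]; rw [hFe]; exact hU₁ _ (h.low t ht)
  mid t ht := ⟨_, h.mid t ht, rfl⟩
  high t ht := by simp only [Function.comp]; rw [hFe]; exact hU₂ _ (h.high t ht)

end CrossArc

/-- A ray through the centre which avoids the points with real part close to `c`. -/
lemma TwoCharts.exists_ray (hT : TwoCharts e₁ e₂) (hU₂ : IsOpen U₂)
    (h2 : e₂ 0 ∈ U₂) (hU : Disjoint U₁ U₂) (v₀ : ℂ) : ∃ W : Set X, IsPreconnected W ∧ e₁ 0 ∈ W ∧ ¬ W ⊆ U₁ ∧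
      ∀ v ∈ ball v₀ (1 / 4), e₁ (ee v) ∉ W := by
  set ω := ee (v₀.re + 1 / 2 : ℝ) with hω
  refine ⟨(fun r : ℝ => e₁ (r * ω)) '' Ici 0, isPreconnected_Ici.image _ (hT.emb₁.continuous.comp (by fun_prop)).continuousOn,
    ⟨0, self_mem_Ici, by simp⟩, fun hsub => ?_, ?_⟩
  · have ht : Tendsto (fun r : ℝ => e₂ (r⁻¹ * ω⁻¹)) atTop (𝓝 (e₂ 0)) := by
      refine (hT.emb₂.continuous.tendsto 0).comp ?_
      simpa using ((continuous_ofReal.tendsto 0).comp tendsto_inv_atTop_zero).mul_const _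
    have ⟨r, hr, hr0⟩ := ((ht.eventually (hU₂.mem_nhds h2)).and (eventually_gt_atTop 0)).exists
    change e₂ ((r⁻¹ : ℝ) * ω⁻¹) ∈ U₂ at hr
    rw [ofReal_inv, hT.inv _ (mul_ne_zero (inv_ne_zero (by exact_mod_cast hr0.ne')) (inv_ne_zero (ee_ne_zero _))), mul_inv, inv_inv, inv_inv] at hr
    exact hU.notMem_of_mem_left (hsub ⟨r, hr0.le, rfl⟩) hr
  · rintro v hv ⟨r, hr, he⟩
    have h1 := hT.emb₁.injective he
    obtain ⟨s, hs⟩ : ∃ s : ℝ, Real.exp (2 * π * s) = r := ⟨Real.log r / (2 * π), by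
      rw [mul_div_cancel₀ _ (by positivity), Real.exp_log (lt_of_le_of_ne hr fun e => ee_ne_zero v (by rw [← h1, ← e]; simp))]⟩
    have h3 : ee (⟨v₀.re + 1 / 2, s⟩ : ℂ) = ee v := by
      rw [← h1, ← hs, hω, ee, ee, ofReal_exp, ← exp_add]
      congr 1
      apply Complex.ext <;> simp
    have ⟨k, hk⟩ := ee_eq_iff.1 h3
    have h5 := (abs_re_le_norm (v - v₀)).trans_lt (mem_ball_iff_norm.1 hv)
    rw [sub_re, (by rw [hk]; simp : v.re = v₀.re + 1 / 2 + k), abs_lt] at h5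
    have h6' : (-1 : ℤ) < k := by exact_mod_cast (by linarith [h5.1] : (-1 : ℝ) < k)
    have h7' : k < 0 := by exact_mod_cast (by linarith [h5.2] : (k : ℝ) < 0)
    omega

lemma exists_crossArc [CompactSpace X] (hT : TwoCharts e₁ e₂) (h₁ : Side e₁ U₁ G₁ H₁ A₁) (hU₂ : IsOpen U₂) (h2 : e₂ 0 ∈ U₂)
    (hU : Disjoint U₁ U₂) {g : X ≃ₜ X} (hΦ : DiscMap G₁ g Φ) (hg0 : g (e₁ 0) = e₁ 0)
    (hmin : ∀ T : Set CDisc, IsClosed T → T.Nonempty → (∀ z ∈ T, ‖z.1‖ = 1) → (∀ z ∈ T, Φ z ∈ T) →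
      ∀ z : CDisc, ‖z.1‖ = 1 → z ∈ T)
    {Mr Qr : ℝ → ℂ} (hr : LowEnd A₂ (1 / 3) Mr Qr) (hrU : ∀ t ∈ Ioo (0 : ℝ) (1 / 3), e₂ (ee (Mr t)) ∈ U₂) {va v₀ : ℂ}
    (hv₀ : Mr (1 / 3) = -v₀) (hva : e₁ (ee va) ∈ U₁) (hv₀U : e₁ (ee v₀) ∉ U₁) (hSd : segment ℝ va v₀ ⊆ ball v₀ (1 / 4))
    (hSg : ∀ v ∈ segment ℝ va v₀, ∀ w ∈ segment ℝ va v₀, e₁ (ee v) ≠ g (e₁ (ee w)))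
    (hSr : ∀ w ∈ segment ℝ va v₀, ∀ t ∈ Ioo (0 : ℝ) (1 / 3), e₂ (ee (Mr t)) ≠ g (e₁ (ee w)))
    (hSk : ∀ v ∈ segment ℝ va v₀, ∀ t ∈ Ioo (0 : ℝ) (1 / 3), ∀ k : ℤ, k ≠ 0 → -Mr t + k ≠ v) :
    ∃ L Q, CrossArc e₁ U₁ U₂ A₁ A₂ (segment ℝ va v₀) L Q (fun t => -Qr (1 - t)) ∧
      (∀ t ∈ Ioo (0 : ℝ) 1, ∀ w ∈ segment ℝ va v₀, e₁ (ee (L t)) ≠ g (e₁ (ee w))) ∧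
      ∀ t ∈ Ioo (0 : ℝ) 1, ∀ k : ℤ, k ≠ 0 → L t + k ∉ segment ℝ va v₀ := by
  set S := segment ℝ va v₀ with hS
  set σ : ℝ → ℂ := fun s => AffineMap.lineMap va v₀ s with hσ
  have hσc : Continuous σ := by simp only [hσ]; fun_prop
  have hσ1 : σ 1 = v₀ := by simp [hσ]
  have hσS : ∀ s ∈ Icc (0 : ℝ) 1, σ s ∈ S := fun s hs => by rw [hS, segment_eq_image_lineMap]; exact ⟨s, hs, rfl⟩
  set Z : Set X := (fun v => e₁ (ee v)) '' S with hZ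
  have hZc : IsClosed Z := by
    exact ((by rw [hS, segment_eq_image_lineMap]; exact isCompact_Icc.image (by fun_prop) : IsCompact S).image hT.continuous).isClosed
  have h0Z : G₁ 0 ∉ Z := by rw [h₁.zero]; rintro ⟨v, -, hv⟩; exact hT.ne₁ v hv
  have h0gZ : G₁ 0 ∉ g '' Z := by
    rw [h₁.zero]; rintro ⟨_, ⟨v, -, rfl⟩, hv⟩; exact hT.ne₁ v (g.injective (hv.trans hg0.symm))
  have hcS : Continuous fun s => e₁ (ee (σ s)) := hT.continuous.comp hσc
  have ⟨b, hb, _, hbin, hbc, p, hp, hbp⟩ := h₁.model.exists_exit hcS.continuousOn (by rwa [(by simp [hσ] : σ 0 = va)]) (by rwa [hσ1])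
  have ⟨W, hW, hW0, hWU, hWv⟩ := hT.exists_ray hU₂ h2 hU v₀
  have ⟨z, hz, hzZ⟩ := h₁.model.exists_unhidden hΦ hZc (disjoint_left.2 (by
      rintro _ ⟨v, hv, rfl⟩ ⟨_, ⟨w, hw, rfl⟩, he⟩; exact hSg v hv w hw he.symm)) h0Z h0gZ hb.1 hbc
    (fun t ht => mem_ball_zero_iff.1 (h₁.model.maps_inv (hbin t ht)))
    (fun t ht => by
      simp only [Function.comp]
      rw [h₁.model.right_inv _ (hbin t ht)]; exact ⟨_, hσS t ⟨ht.1, ht.2.le.trans hb.2⟩, rfl⟩)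
    hp hbp hW (by rwa [h₁.zero]) hWU (disjoint_right.2 (by rintro _ ⟨v, hv, rfl⟩; exact hWv v (hSd hv))) hmin
  have hOo : IsOpen (DiscMap.originComp G₁ (g '' Z)) := (h₁.model.isOpen_notMem (g.isClosedMap _ hZc)).connectedComponentIn
  have hm1 : (0 : ℂ) ∈ DiscMap.originComp G₁ (g '' Z) := mem_connectedComponentIn ⟨by simp, h0gZ⟩
  have hOs : DiscMap.originComp G₁ (g '' Z) ⊆ {z ∈ 𝔻 | G₁ z ∉ g '' Z} := connectedComponentIn_subset _ _
  have ⟨γ, hγ⟩ := ((hOo.isConnected_iff_isPathConnected).1 ⟨⟨_, hm1⟩, isPreconnected_connectedComponentIn⟩).joinedIn 0 hm1 z hz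
  have hγe : ∀ t, γ.extend t ∈ DiscMap.originComp G₁ (g '' Z) := fun t => hγ _
  have hGγ := h₁.model.cont.comp_continuous γ.continuous_extend fun t => (hOs (hγe t)).1
  have ⟨t₀, t₁, ht₀, ht01, ht₁, hγ0, hγne, hC1, hC⟩ := exists_subarc (γ := γ.extend) γ.continuous_extend.continuousOn
    γ.extend_zero (C := {t ∈ Icc (0 : ℝ) 1 | G₁ (γ.extend t) ∈ Z}) (isClosed_Icc.inter (hZc.preimage hGγ)) (fun t ht => ht.1)
    ⟨1, ⟨zero_le_one, le_rfl⟩, by rw [γ.extend_one]; exact hzZ⟩ (fun t ht e => h0Z (e ▸ ht.2))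
  have ⟨w, hwS, hw⟩ := hC1.2
  rw [hS, segment_eq_image_lineMap] at hwS
  obtain ⟨τ₀, hτ₀, rfl⟩ := hwS
  change e₁ (ee (σ τ₀)) = _ at hw
  have ⟨τ, hτ, hcτ, hin, M, Q, hQ, hM1, hM2⟩ := h₁.exists_access hT (γ := fun s => γ.extend (t₀ + s * (t₁ - t₀)))
    (γ.continuous_extend.comp (by fun_prop)).continuousOn (by simpa using hγ0)
    (fun t ht => hγne _ ⟨by nlinarith [ht.1], by nlinarith [ht.2]⟩) (fun t ht => mem_ball_zero_iff.1 (hOs (hγe _)).1)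
    (c := fun s => e₁ (ee (σ (τ₀ + s * (1 - τ₀))))) (hT.continuous.comp (hσc.comp (by fun_prop))).continuousOn
    (by simpa using hw) (by simpa [hσ1] using hv₀U) (fun t ht => hT.ne₁ _) (fun t ht => hT.ne₂ _)
  have hrange : ∀ s ∈ Icc (0 : ℝ) 1, τ₀ + s * (1 - τ₀) ∈ Icc (0 : ℝ) 1 := fun s hs =>
    ⟨by nlinarith [hs.1, hτ₀.1, hτ₀.2], by nlinarith [hs.2, hτ₀.2]⟩
  have ⟨m, hm⟩ := hT.eq_add_int isPreconnected_Icc (hQ.contL.mono fun t ht => ⟨by linarith [ht.1], ht.2⟩)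
    (ν := fun t => σ (τ₀ + (6 * t - 1) * τ * (1 - τ₀))) (hσc.comp (by fun_prop)).continuousOn hM2
  have hQ' := h₁.sideLift_add m |>.lowEnd (DiscMap.one G₁) (by fun_prop) (by norm_num) hQ
  set N : ℝ → ℂ := (· + (m : ℂ)) ∘ M with hN
  have hNe : ∀ t, e₁ (ee (N t)) = e₁ (ee (M t)) := fun t => by simp only [hN, Function.comp, ee_add_int]
  have hr6 : ∀ t ∈ Icc (1 / 6 : ℝ) (1 / 3), (6 * t - 1) * τ ∈ Icc (0 : ℝ) 1 := fun t ht =>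
    ⟨mul_nonneg (by linarith [ht.1]) hτ.1.le, by nlinarith [ht.2, hτ.1, hτ.2]⟩
  set τ' := τ₀ + τ * (1 - τ₀) with hτ'
  have hN3 : N (1 / 3) = σ τ' := by grind
  set L : ℝ → ℂ := fun t => N (min t (1 / 3)) + (σ (τ' + max 0 (min (3 * t - 1) 1) * (1 - τ')) - σ τ') +
    (Mr (1 / 3) - Mr (min (1 - t) (1 / 3))) with hL
  have hL1 : ∀ t, t ≤ 1 / 3 → L t = N t := fun t ht => by
    simp only [hL]
    rw [min_eq_left ht, min_eq_right (show (1 / 3 : ℝ) ≤ 1 - t by linarith), min_eq_left (by linarith), max_eq_left (by linarith)]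
    simp
  have hL2 : ∀ t ∈ Icc (1 / 3 : ℝ) (2 / 3), L t = σ (τ' + (3 * t - 1) * (1 - τ')) := fun t ht => by
    simp only [hL]
    rw [min_eq_right ht.1, min_eq_right (show (1 / 3 : ℝ) ≤ 1 - t by linarith [ht.2]), min_eq_left (by linarith [ht.2]),
      max_eq_right (by linarith [ht.1]), hN3]
    ring
  have hL3 : ∀ t, 2 / 3 ≤ t → L t = -Mr (1 - t) := fun t ht => by grind
  have hτ'I := hrange τ ⟨hτ.1.le, hτ.2⟩
  have hmid : ∀ t ∈ Icc (1 / 3 : ℝ) (2 / 3), L t ∈ S := fun t ht => by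
    rw [hL2 t ht]
    exact hσS _ ⟨by nlinarith [hτ'I.1, hτ'I.2, ht.1], by nlinarith [hτ'I.1, hτ'I.2, ht.2]⟩
  have hmid' : ∀ t ∈ Icc (1 / 6 : ℝ) (2 / 3), L t ∈ S := fun t ht => by
    rcases le_total t (1 / 3) with h3 | h3
    · rw [hL1 t h3, (show ∀ t ∈ Icc (1 / 6 : ℝ) (1 / 3), N t = σ (τ₀ + (6 * t - 1) * τ * (1 - τ₀)) from fun t ht => (hm t ht).symm) t ⟨ht.1, h3⟩]
      exact hσS _ (hrange _ (hr6 t ⟨ht.1, h3⟩))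
    · exact hmid t ⟨h3, ht.2⟩
  have hlow : ∀ t ∈ Ioo (0 : ℝ) (1 / 6), t₀ + 6 * t * (t₁ - t₀) ∈ Ico t₀ t₁ := fun t ht =>
    ⟨by nlinarith [ht.1], by nlinarith [ht.2]⟩
  have hL6 : ∀ t ∈ Ioo (0 : ℝ) (1 / 6), e₁ (ee (L t)) = G₁ (γ.extend (t₀ + 6 * t * (t₁ - t₀))) := fun t ht => by
    rw [hL1 t (by linarith [ht.2]), hNe, hM1 t ht]
  have hL4 : ∀ t, 2 / 3 ≤ t → e₁ (ee (L t)) = e₂ (ee (Mr (1 - t))) := fun t ht => by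
    rw [hL3 t ht, ← hT.ee_neg_eq, neg_neg]
  refine ⟨L, (· + (m : ℂ)) ∘ Q, ⟨⟨?_, hQ'.congr fun t ht => hL1 t ht.2, ?_⟩, fun t ht => ?_, hmid, fun t ht => ?_⟩, fun t ht w hw => ?_,
    fun t ht k hk hmem => ?_⟩
  · refine ((hQ'.contL.comp (by fun_prop) fun t ht => ⟨lt_min ht.1 (by norm_num), min_le_right _ _⟩).add
      (Continuous.continuousOn (by fun_prop))).add (continuousOn_const.sub (hr.contL.comp (by fun_prop) fun t ht =>
        ⟨lt_min (by linarith [ht.2]) (by norm_num), min_le_right _ _⟩))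
  · simp only [neg_neg, sub_sub_cancel]
    exact hr.congr fun t ht => by rw [hL3 _ (by linarith [ht.2])]; simp
  · rcases lt_or_ge t (1 / 6) with h6 | h6
    · rw [hL6 t ⟨ht.1, h6⟩]; exact h₁.model.maps (hOs (hγe _)).1
    · rw [hL1 t ht.2.le, hNe, hM2 t ⟨h6, ht.2.le⟩]
      exact hin _ ⟨mul_nonneg (by linarith) hτ.1.le, by nlinarith [ht.2, hτ.1]⟩
  · rw [hL4 t ht.1.le]; exact hrU _ ⟨by linarith [ht.2], by linarith [ht.1]⟩
  · rcases lt_or_ge t (1 / 6) with h6 | h6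
    · rw [hL6 t ⟨ht.1, h6⟩]
      exact fun e => (hOs (hγe _)).2 ⟨_, ⟨w, hw, rfl⟩, e.symm⟩
    · rcases le_or_gt t (2 / 3) with h3 | h3
      · exact hSg _ (hmid' t ⟨h6, h3⟩) w hw
      · rw [hL4 t h3.le]
        exact hSr w hw _ ⟨by linarith [ht.2], by linarith⟩
  · rcases lt_or_ge t (1 / 6) with h6 | h6
    · have h7 := hlow t ⟨ht.1, h6⟩
      refine hC _ h7 ⟨⟨ht₀.trans h7.1, h7.2.le.trans ht₁⟩, L t + k, hmem, ?_⟩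
      simp only [ee_add_int]
      exact hL6 t ⟨ht.1, h6⟩
    · rcases le_or_gt t (2 / 3) with h3 | h3
      · have h7 := mem_ball_iff_norm.1 (hSd (hmid' t ⟨h6, h3⟩))
        have h8 := mem_ball_iff_norm.1 (hSd hmem)
        have h9 : ‖(k : ℂ)‖ < 1 := by
          have := norm_sub_le (L t + k - v₀) (L t - v₀)
          grind
        exact hk (Int.abs_lt_one_iff.1 (by exact_mod_cast h9))
      · rw [hL3 t h3.le] at hmem
        exact hSk _ hmem (1 - t) ⟨by linarith [ht.2], by linarith⟩ k hk rfl

lemma isOpenMap_ee : IsOpenMap ee := by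
  exact isOpenMap_exp.comp (Homeomorph.mulLeft₀ _ (neg_ne_zero.2 two_pi_I_ne_zero)).isOpenMap

lemma LowEnd.exists_compact (hA : LowMap A) (ha : 0 < a) (h : LowEnd A a L Q) (hb : b ≤ a) :
    ∃ E : Set ℂ, IsCompact E ∧ (∀ t ∈ Ioc 0 b, ee (L t) ∈ E) ∧ ∀ z ∈ E, z = 0 ∨ ∃ t ∈ Ioc 0 b, z = ee (L t) := by
  set m : ℝ → ℂ := fun t => if 0 < t then ee (L t) else 0 with hm
  have hmc : ContinuousOn m (Icc 0 a) := fun t ht => by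
    rcases ht.1.lt_or_eq with h0 | rfl
    · have h1 := continuous_ee.continuousAt.comp_continuousWithinAt (h.contL t ⟨h0, ht.2⟩)
      refine ContinuousWithinAt.congr_of_eventuallyEq (h1.mono_of_mem_nhdsWithin ?_) ?_ (if_pos h0)
      · exact mem_nhdsWithin.2 ⟨Ioi 0, isOpen_Ioi, h0, fun x hx => ⟨hx.1, hx.2.2⟩⟩
      · filter_upwards [mem_nhdsWithin_of_mem_nhds (Ioi_mem_nhds h0)] with x hx using if_pos hx
    · have : ContinuousWithinAt m (Ici 0) 0 := by
        rw [← Ioi_insert, continuousWithinAt_insert_self]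
        refine Tendsto.congr' ?_ (show Tendsto (fun t => ee (L t)) (𝓝[>] 0) (𝓝 (m 0)) by
          simp only [hm, lt_irrefl, if_false]; exact tendsto_ee_zero.2 (h.tendsto_im hA ha))
        filter_upwards [self_mem_nhdsWithin] with x hx using (if_pos hx).symm
      exact this.mono Icc_subset_Ici_self
  refine ⟨m '' Icc 0 b, isCompact_Icc.image_of_continuousOn (hmc.mono (Icc_subset_Icc_right hb)),
    fun t ht => ⟨t, ⟨ht.1.le, ht.2⟩, if_pos ht.1⟩, ?_⟩
  grind

lemma exists_displacement [CompactSpace X] (hT : TwoCharts e₁ e₂) (h₁ : Side e₁ U₁ G₁ H₁ A₁) (h₂ : Side e₂ U₂ G₂ H₂ A₂)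
    (hU : Disjoint U₁ U₂) (hfr : frontier U₁ = frontier U₂) (hΦ₁ : DiscMap G₁ f Φ₁)
    (hΦ₂ : DiscMap G₂ f Φ₂) (hf0 : f (e₁ 0) = e₁ 0) (hfU₁ : ∀ x, f x ∈ U₁ ↔ x ∈ U₁) (hfU₂ : ∀ x, f x ∈ U₂ ↔ x ∈ U₂)
    (hmin : ∀ T : Set CDisc, IsClosed T → T.Nonempty → (∀ z ∈ T, ‖z.1‖ = 1) → (∀ z ∈ T, Φ₁ z ∈ T) →
      ∀ z : CDisc, ‖z.1‖ = 1 → z ∈ T)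
    (hmin' : ∀ T : Set CDisc, IsClosed T → T.Nonempty → (∀ z ∈ T, ‖z.1‖ = 1) → (∀ z ∈ T, Φ₁⁻¹ z ∈ T) →
      ∀ z : CDisc, ‖z.1‖ = 1 → z ∈ T)
    {y₀ : X} (hy₀ : y₀ ∈ frontier U₁) (hfy₀ : f y₀ ≠ y₀) {F' Fb₁ Fb₂ : ℂ → ℂ} (hF : Continuous F)
    (hFe : ∀ v, e₁ (ee (F v)) = f (e₁ (ee v))) (hF' : ∀ v, F' v = -F (-v)) (hs₁ : SideLift A₁ F Fb₁ Φ₁ 1)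
    (hs₂ : SideLift A₂ F' Fb₂ Φ₂ 1) :
    ∃ x x' y : ℝ, |x - x'| ≤ 1 ∧ |((Fb₁ x).re - x') + ((Fb₂ y).re - y)| ≤ 1 := by
  have h10 := h₁.zero ▸ h₁.model.maps (by simp)
  have h20 := h₂.zero ▸ h₂.model.maps (by simp)
  have hfr1 : ∀ x ∈ frontier U₁, x ∉ U₁ := fun x hx h => (h₁.model.isOpen.frontier_eq ▸ hx).2 h
  have hfr2 : ∀ x ∈ frontier U₂, x ∉ U₂ := fun x hx h => (h₂.model.isOpen.frontier_eq ▸ hx).2 h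
  have ⟨Mr, Qr, hr, hrU, hyN, hyU₂⟩ := h₂.exists_access_near hT.symm (hfr ▸ hy₀) (fun e => hfr1 _ hy₀ (by rw [e]; exact h10))
    ((isOpen_ne_fun f.continuous continuous_id).mem_nhds hfy₀)
  set v₀ := -Mr (1 / 3) with hv₀
  have hev : ∀ v, e₁ (ee (-v)) = e₂ (ee v) := fun v => by rw [← hT.ee_neg_eq, neg_neg]
  rw [← hev, ← hv₀] at hyN hyU₂
  have hfy := hyN
  have hMt : Tendsto Mr (𝓝[<] (1 / 3)) (𝓝 (-v₀)) := by
    rw [hv₀, neg_neg]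
    exact (hr.contL _ ⟨by norm_num, le_rfl⟩).tendsto.mono_left (nhdsWithin_le_of_mem
      (mem_of_superset (Ioo_mem_nhdsLT (show (0 : ℝ) < 1 / 3 by norm_num)) Ioo_subset_Ioc_self))
  have hyfr : e₁ (ee v₀) ∈ frontier U₂ := by
    rw [h₂.model.isOpen.frontier_eq]
    refine ⟨mem_closure_of_tendsto (f := fun t => e₁ (ee (-Mr t))) (b := 𝓝[<] (1 / 3)) ?_ ?_, hyU₂⟩
    · have hMn : Tendsto (fun t => -Mr t) (𝓝[<] (1 / 3)) (𝓝 v₀) := by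
        have := hMt.neg
        rwa [neg_neg] at this
      exact (hT.continuous.tendsto v₀).comp hMn
    · filter_upwards [Ioo_mem_nhdsLT (show (0 : ℝ) < 1 / 3 by norm_num)] with t ht
      rw [hev]; exact hrU t ht
  have hyU₁ := hfr1 _ (hfr ▸ hyfr)
  -- a small disc around `v₀`
  have ⟨O, O', hO, hO', hyO, hyO', hOO⟩ := t2_separation hfy
  have hn1 : ∀ᶠ v in 𝓝 v₀, f (e₁ (ee v)) ∈ O ∧ e₁ (ee v) ∈ O' :=
    ((f.continuous.comp hT.continuous).continuousAt.eventually (hO.mem_nhds hyO)).and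
      (hT.continuous.continuousAt.eventually (hO'.mem_nhds hyO'))
  have ⟨E, hE, hEm, hEs⟩ := hr.exists_compact h₂.low (by norm_num) le_rfl
  have hEc := (hE.image hT.emb₂.continuous).isClosed
  have hEU : ∀ x ∈ e₂ '' E, x ∈ U₂ ∨ x = e₁ (ee v₀) := by
    rintro _ ⟨z, hz, rfl⟩
    rcases hEs z hz with rfl | ⟨t, ht, rfl⟩
    · exact Or.inl h20
    · rcases ht.2.lt_or_eq with h3 | h3
      · exact Or.inl (hrU t ⟨ht.1, h3⟩)
      · rw [h3, hv₀, hev]; exact Or.inr rfl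
  have hn2 := (f.continuous.comp hT.continuous).continuousAt.eventually (hEc.isOpen_compl.mem_nhds fun h => by
      rcases hEU _ h with h | h
      · exact hyU₂ ((hfU₂ _).1 h)
      · exact hfy h)
  have hn3 := (f.symm.continuous.comp hT.continuous).continuousAt.eventually (hEc.isOpen_compl.mem_nhds fun h => by
      rcases hEU _ h with h | h
      · exact hyU₂ (by have := (hfU₂ _).2 h; simp only [Function.comp, Homeomorph.apply_symm_apply] at this; exact this)
      · exact hfy (f.symm_apply_eq.1 h).symm)
  have ⟨b, hb, hbM⟩ := (mem_nhdsLT_iff_exists_mem_Ico_Ioo_subset (show (0 : ℝ) < 1 / 3 by norm_num)).1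
    (hMt.eventually (ball_mem_nhds _ (show (0 : ℝ) < 1 / 4 by norm_num)))
  have ⟨D, hD, hDm, hDs⟩ := hr.exists_compact h₂.low (by norm_num) hb.2.le
  have hn4 := hT.continuous.continuousAt.eventually ((hD.image hT.emb₂.continuous).isClosed.isOpen_compl.mem_nhds (by
      rintro ⟨z, hz, he⟩
      rcases hDs z hz with rfl | ⟨t, ht, rfl⟩
      · exact hyU₂ ((show e₂ 0 = e₁ (ee v₀) from he) ▸ h20)
      · exact hyU₂ ((show e₂ (ee (Mr t)) = e₁ (ee v₀) from he) ▸ hrU t ⟨ht.1, ht.2.trans_lt hb.2⟩)))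
  have ⟨ε, hε, hball⟩ := Metric.eventually_nhds_iff_ball.1 (hn1.and (hn2.and (hn3.and (hn4.and
    (ball_mem_nhds v₀ (show (0 : ℝ) < 1 / 4 by norm_num))))))
  obtain ⟨_, ⟨va, hva, rfl⟩, hvaU⟩ := mem_closure_iff_nhds.1 (frontier_subset_closure (hfr ▸ hyfr : e₁ (ee v₀) ∈ frontier U₁))
    ((fun v => e₁ (ee v)) '' ball v₀ ε)
    (((hT.emb₁.isOpenMap.comp isOpenMap_ee) _ isOpen_ball).mem_nhds ⟨v₀, mem_ball_self hε, rfl⟩)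
  have hS := (convex_ball _ _).segment_subset hva (mem_ball_self hε)
  have hSk : ∀ v ∈ segment ℝ va v₀, ∀ t ∈ Ioo (0 : ℝ) (1 / 3), ∀ k : ℤ, k ≠ 0 → -Mr t + k ≠ v := fun v hv t ht k hk e => by
    have ⟨_, _, _, h4, h5⟩ := hball v (hS hv)
    rcases le_or_gt t b with htb | htb
    · exact h4 ⟨_, hDm t ⟨ht.1, htb⟩, by rw [← e, ee_add_int, hev]⟩
    · have h6 : Mr t ∈ ball (-v₀) (1 / 4) := hbM ⟨htb, ht.2⟩
      rw [dist_eq_norm] at h5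
      rw [mem_ball_iff_norm] at h6
      have h9 : ‖(k : ℂ)‖ < 1 := by
        have := norm_add_le (v - v₀) (Mr t - -v₀)
        rw [show v - v₀ + (Mr t - -v₀) = k by rw [← e]; ring] at this
        linarith
      rw [Complex.norm_intCast] at h9
      exact hk (Int.abs_lt_one_iff.1 (by exact_mod_cast h9))
  have hSd : segment ℝ va v₀ ⊆ ball v₀ (1 / 4) := fun v hv => (hball v (hS hv)).2.2.2.2
  have hne : ∀ v ∈ segment ℝ va v₀, ∀ w ∈ segment ℝ va v₀, f (e₁ (ee v)) ≠ e₁ (ee w) := fun v hv w hw e =>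
    hOO.notMem_of_mem_left (hball v (hS hv)).1.1 (e ▸ (hball w (hS hw)).1.2)
  have hinv : ∀ x, (f⁻¹ : X ≃ₜ X) (f x) = x := f.symm_apply_apply
  have hinv' : ∀ x, f ((f⁻¹ : X ≃ₜ X) x) = x := f.apply_symm_apply
  have ⟨L, Q, hu, hu1, hu2⟩ := exists_crossArc hT h₁ h₂.model.isOpen h20 hU hΦ₁ hf0 hmin hr hrU (neg_neg _).symm hvaU hyU₁ hSd
    (fun v hv w hw e => hne w hw v hv e.symm)
    (fun w hw t ht e => (hball w (hS hw)).2.1 ⟨_, hEm t ⟨ht.1, ht.2.le⟩, e⟩) hSk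
  have ⟨L', Q', hv, hv1, hv2⟩ := exists_crossArc hT h₁ h₂.model.isOpen h20 hU hΦ₁.inv (by rw [← hf0, hinv, hf0]) hmin' hr hrU
    (neg_neg _).symm hvaU hyU₁ hSd (fun v hv w hw e => hne v hv w hw (by rw [e, hinv']))
    (fun w hw t ht e => (hball w (hS hw)).2.2.1 ⟨_, hEm t ⟨ht.1, ht.2.le⟩, e⟩) hSk
  have hQ0 : ∀ {Q : ℝ → ℂ}, (Q (1 / 3)).im = 0 → Q (1 / 3) = ((Q (1 / 3)).re : ℝ) := fun {Q} h => by
    apply Complex.ext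
    · rw [ofReal_re]
    · rw [ofReal_im, h]
  refine ⟨(Q' (1 / 3)).re, (Q (1 / 3)).re, (Qr (1 / 3)).re, ?_, ?_⟩
  · have key : ∀ k : ℤ, k ≠ 0 → (0 < (Q' (1 / 3)).re - (Q (1 / 3)).re + k → 0 ≤ (k : ℝ)) ∧
        ((Q' (1 / 3)).re - (Q (1 / 3)).re + k < 0 → (k : ℝ) ≤ 0) := fun k hk => by
      have hm := hv.map (DiscMap.one G₁) (DiscMap.one G₂) (F := (· + (k : ℂ))) (F' := (· + ((-k : ℤ) : ℂ))) (by fun_prop)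
        (h₁.sideLift_add k) (h₂.sideLift_add (-k)) (fun v => by push_cast; ring) (fun v => by rw [ee_add_int]; rfl)
        (fun x hx => hx) (fun x hx => hx)
      have := hu.order hm h₁.low h₂.low hU (fun t ht => by
        rintro ⟨w, hw, he⟩
        refine hu2 t ht (-k) (neg_ne_zero.2 hk) ?_
        rw [← he]; simpa using hw) (fun t ht h => hv2 t ht k hk h)
      norm_num at this ⊢
      refine ⟨fun h => this.1 (by linarith), fun h => this.2 (by linarith)⟩
    rw [abs_le]
    constructor
    · by_contra! h
      have := (key 1 one_ne_zero).2 (by push_cast; linarith)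
      norm_num at this
    · by_contra! h
      have := (key (-1) (by norm_num)).1 (by push_cast; linarith)
      norm_num at this
  · set a := (Fb₁ (Q' (1 / 3)).re).re - (Q (1 / 3)).re with ha
    set c := (Fb₂ (Qr (1 / 3)).re).re - (Qr (1 / 3)).re with hc
    have key : ∀ k : ℤ, (0 < a + k → 0 ≤ k - c) ∧ (a + k < 0 → k - c ≤ 0) := fun k => by
      have hm := hv.map ((DiscMap.one G₁).mul hΦ₁) ((DiscMap.one G₂).mul hΦ₂) (F := (· + (k : ℂ)) ∘ F)
        (F' := (· + ((-k : ℤ) : ℂ)) ∘ F') (by fun_prop)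
        ((h₁.sideLift_add k).comp hs₁ hΦ₁) ((h₂.sideLift_add (-k)).comp hs₂ hΦ₂)
        (fun v => by simp only [Function.comp, hF']; push_cast; ring)
        (fun v => by simp only [Function.comp, ee_add_int, hFe]; rfl)
        (fun x hx => (hfU₁ x).2 hx) (fun x hx => (hfU₂ x).2 hx)
      have := hu.order hm h₁.low h₂.low hU (fun t ht => by
        rintro ⟨w, hw, he⟩
        refine hu1 t ht w hw ?_
        rw [← he]; simp only [Function.comp, ee_add_int, hFe]) (fun t ht h => by
        refine hv1 t ht _ h ?_
        simp only [Function.comp, ee_add_int, hFe, hinv])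
      rw [show (fun t => -(((· + ((-k : ℤ) : ℂ)) ∘ Fb₂) (-(-Qr (1 - t))))) (2 / 3) - (fun t => -Qr (1 - t)) (2 / 3) =
        -Fb₂ (Qr (1 / 3)) + k + Qr (1 / 3) by norm_num; ring] at this
      simp only [Function.comp, sub_re, add_re, neg_re, intCast_re] at this
      rw [hQ0 hv.curve.low.im_zero, hQ0 hr.im_zero] at this
      simp only [ofReal_re] at this
      refine ⟨fun h => ?_, fun h => ?_⟩
      · have := this.1 (by linarith); linarith
      · have := this.2 (by linarith); linarith
    have k1 := (key (⌊-a⌋ + 1)).1 (by push_cast; linarith [Int.lt_floor_add_one (-a)])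
    have k2 := (key (⌈-a⌉ - 1)).2 (by push_cast; linarith [Int.ceil_lt_add_one (-a)])
    push_cast at k1 k2
    rw [abs_le]
    constructor <;> linarith [Int.floor_le (-a), Int.le_ceil (-a)]

lemma one_sub_re_pos (h : ‖w‖ ≤ 1) (h1 : w ≠ 1) : 0 < (1 - w).re := by
  by_contra! hc
  rw [sub_re, one_re] at hc
  have h2 := (re_le_norm w).trans h
  have h4 := sq_norm_sub_sq_re w
  have h5 : ‖w‖ ^ 2 ≤ 1 := by nlinarith [norm_nonneg w]
  exact h1 (Complex.ext (by linarith : w.re = 1) (by exact pow_eq_zero_iff (two_ne_zero) |>.1 (by nlinarith [sq_nonneg w.im])))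

lemma log_one_sub_ee {x : ℝ} (h0 : 0 < x) (h1 : x < 1) :
    log (1 - ee x) - log (1 - ee (-x)) = (π - 2 * π * x) * I := by
  have hn : ∀ y : ℝ, ee y = 1 → ∃ k : ℤ, y = k := fun y hy => by
    have ⟨k, hk⟩ := ee_eq_iff.1 (show ee 0 = ee y by rw [hy]; simp [ee])
    exact ⟨k, by exact_mod_cast (zero_add (k : ℂ) ▸ hk)⟩
  have hx : ee x ≠ 1 := fun h => by
    obtain ⟨k, rfl⟩ := hn x h
    have a1 : (0 : ℤ) < k := by exact_mod_cast h0
    have a2 : k < (1 : ℤ) := by exact_mod_cast h1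
    omega
  have hmul : ee x * ee (-x) = 1 := by rw [ee, ee, ← exp_add]; ring_nf; exact exp_zero
  have hx' : ee (-x) ≠ 1 := fun h => hx (by rw [h, mul_one] at hmul; exact hmul)
  have a1 := abs_lt.1 (abs_arg_lt_pi_div_two_iff.2 (Or.inl (one_sub_re_pos (norm_ee_le.2 (by simp)) hx)))
  have a2 := abs_lt.1 (abs_arg_lt_pi_div_two_iff.2 (Or.inl (one_sub_re_pos (norm_ee_le.2 (by simp)) hx')))
  have him : ((π - 2 * π * x) * I : ℂ).im = π - 2 * π * x := by simp
  refine exp_inj_of_neg_pi_lt_of_le_pi ?_ ?_ ?_ ?_ ?_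
  · rw [sub_im, log_im, log_im]; linarith
  · rw [sub_im, log_im, log_im]; linarith
  · rw [him]; nlinarith
  · rw [him]; nlinarith
  · rw [exp_sub, exp_log (sub_ne_zero.2 hx.symm), exp_log (sub_ne_zero.2 hx'.symm), div_eq_iff (sub_ne_zero.2 hx'.symm),
      show ((π - 2 * π * x) * I : ℂ) = π * I + -(2 * π * I) * x by ring, exp_add, exp_pi_mul_I, ← ee]
    linear_combination -hmul

lemma sub_eq_sub_of_exp_mul {μ ν k : ℝ → ℂ} {d : ℂ} (hμ : Continuous μ) (hν : Continuous ν) (hk : ∀ t, exp (μ t) = k t * c)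
    (hk' : ∀ t, exp (ν t) = k t * d) : μ 1 - ν 1 = μ 0 - ν 0 := by
  have hd : ∀ t, exp (μ t - ν t) = c / d := fun t => by
    have h1 := exp_ne_zero (ν t)
    rw [exp_sub, hk, hk']; rw [hk'] at h1
    exact mul_div_mul_left _ _ (left_ne_zero_of_mul h1)
  have := eq_of_exp_eq (isPreconnected_univ) (μ := fun t => μ t - ν t - (μ 0 - ν 0)) (by fun_prop)
    (fun t _ => by rw [exp_sub, hd, hd, div_self]; rw [← hd 0]; exact exp_ne_zero _) (mem_univ (1 : ℝ)) (mem_univ (0 : ℝ))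
  linear_combination this

/-- Two loops at different boundary points cannot have interleaved boundary directions. -/
lemma false_of_linked (hd : DifferentiableOn ℂ ψ 𝔻) (hi : InjOn ψ 𝔻)
    (hd0 : ∀ z ∈ 𝔻, deriv ψ z ≠ 0) {P P' J J' : ℝ → ℂ} {y y' : ℂ}
    (hP : Continuous P) (hP' : Continuous P') (hJ : Continuous J) (hJ' : Continuous J')
    (hPJ : ∀ t, ‖P t‖ < 1 ∧ J t = ψ (P t) ∨ ‖P t‖ = 1 ∧ J t = y) (hPJ' : ∀ t, ‖P' t‖ < 1 ∧ J' t = ψ (P' t) ∨ ‖P' t‖ = 1 ∧ J' t = y')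
    (hne : ∀ s t, ‖P s‖ = 1 → P' t ≠ P s) (hyy : y ≠ y') (hy : y ∉ ψ '' 𝔻) (hy' : y' ∉ ψ '' 𝔻)
    {c d : ℝ} (hab : a < b) (hbc : b < c) (hcd : c < d) (hda : d < a + 1)
    (ha : P 0 = ee a) (hc : P 1 = ee c) (hb : P' 0 = ee b) (hd' : P' 1 = ee d) : False := by
  classical
  have hJne : ∀ s t, P' t ≠ P s → J' t - J s ≠ 0 := fun s t h e => by
    rw [sub_eq_zero] at e
    rcases hPJ s with ⟨h1, h2⟩ | ⟨h1, h2⟩ <;> rcases hPJ' t with ⟨h3, h4⟩ | ⟨h3, h4⟩ <;> rw [h2, h4] at e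
    · exact h (hi (mem_ball_zero_iff.2 h3) (mem_ball_zero_iff.2 h1) e)
    · exact hy' ⟨_, mem_ball_zero_iff.2 h1, e.symm⟩
    · exact hy ⟨_, mem_ball_zero_iff.2 h3, e⟩
    · exact hyy e.symm
  have hlt : ∀ s t, P' t = P s → ‖P s‖ < 1 ∧ J s = ψ (P s) := fun s t h => (hPJ s).resolve_right fun h1 => hne s t h1.1 h
  set q : ℝ × ℝ → ℂ := fun p => if P' p.2 = P p.1 then deriv ψ (P p.1) else (J' p.2 - J p.1) / (P' p.2 - P p.1) with hq
  have hqc : Continuous q := continuous_iff_continuousAt.2 fun ⟨s, t⟩ => by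
    by_cases h : P' t = P s
    · have hs := mem_ball_zero_iff.2 (hlt s t h).1
      have han := (fun z hz => hd.analyticAt (isOpen_ball.mem_nhds hz)) _ hs
      have cP : Tendsto (fun p : ℝ × ℝ => P p.1) (𝓝 (s, t)) (𝓝 (P s)) := (hP.comp continuous_fst).tendsto (s, t)
      have cP' : Tendsto (fun p : ℝ × ℝ => P' p.2) (𝓝 (s, t)) (𝓝 (P s)) := h ▸ (hP'.comp continuous_snd).tendsto (s, t)
      rw [ContinuousAt, Metric.tendsto_nhds]
      intro ε hε
      have e1 := Metric.tendsto_nhds.1 (han.deriv.continuousAt.tendsto.comp cP) ε hε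
      have e2 : ∀ᶠ p : ℂ × ℂ in 𝓝 (P s, P s), ‖ψ p.1 - ψ p.2 - (p.1 - p.2) • deriv ψ (P s)‖ ≤ ε / 2 * ‖p.1 - p.2‖ :=
        (hasDerivAtFilter_iff_isLittleO.1 han.hasStrictDerivAt).def (by positivity)
      filter_upwards [e1, (cP'.prodMk_nhds cP).eventually e2, cP.eventually (isOpen_ball.mem_nhds hs),
        cP'.eventually (isOpen_ball.mem_nhds hs)] with p h1 h2 h3 h4
      simp only [hq, h, if_true]
      split_ifs with h6
      · exact h1
      · have hn := norm_pos_iff.2 (sub_ne_zero.2 h6)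
        rw [((hPJ p.1).resolve_right fun h => (mem_ball_zero_iff.1 h3).ne h.1).2,
          ((hPJ' p.2).resolve_right fun h => (mem_ball_zero_iff.1 h4).ne h.1).2, dist_eq_norm,
          div_sub' (sub_ne_zero.2 h6), norm_div, div_lt_iff₀ hn]
        refine lt_of_le_of_lt h2 ?_
        have := mul_pos hε hn
        linarith
    · have e0 : ContinuousAt (fun p : ℝ × ℝ => P' p.2 - P p.1) (s, t) := by fun_prop
      refine ((show Continuous fun p : ℝ × ℝ => J' p.2 - J p.1 by fun_prop).continuousAt.div e0 (sub_ne_zero.2 h)).congr ?_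
      filter_upwards [e0.eventually_ne (sub_ne_zero.2 h)] with p hp
      exact (if_neg (sub_ne_zero.1 hp)).symm
  have hq0 : ∀ p, q p ≠ 0 := fun p => by
    by_cases h : P' p.2 = P p.1
    · simp only [hq, h, if_true]
      exact hd0 _ (mem_ball_zero_iff.2 (hlt _ _ h).1)
    · simp only [hq, h, if_false]
      exact div_ne_zero (hJne _ _ h) (sub_ne_zero.2 h)
  have ⟨l, hl, hle⟩ := exists_continuous_log hqc hq0
  have hn : ∀ t, ‖P t‖ ≤ 1 := fun t => (hPJ t).elim (fun h => h.1.le) fun h => h.1.le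
  have hn' : ∀ t, ‖P' t‖ ≤ 1 := fun t => (hPJ' t).elim (fun h => h.1.le) fun h => h.1.le
  have n1 : ∀ x : ℝ, ‖ee x‖ = 1 := fun x => norm_ee_eq.2 (by simp)
  have z : ∀ {s}, ‖P s‖ = 1 → P s ≠ 0 := fun h e => by rw [e] at h; simp at h
  have z' : ∀ {s}, ‖P' s‖ = 1 → P' s ≠ 0 := fun h e => by rw [e] at h; simp at h
  have hne' : ∀ s t, ‖P' t‖ = 1 → P' t ≠ P s := fun s t h e => hne s t (e ▸ h) e
  have edge : ∀ s, ‖P s‖ = 1 → Continuous (fun t => l (s, t) + log (1 - P' t / P s)) ∧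
      ∀ t, exp (l (s, t) + log (1 - P' t / P s)) = (J' t - y) * (-(P s)⁻¹) := fun s hs => by
    have h1 : ∀ t, 0 < (1 - P' t / P s).re := fun t => one_sub_re_pos (by rw [norm_div, hs, div_one]; exact hn' t)
      fun e => hne s t hs ((div_eq_one_iff_eq (z hs)).1 e)
    refine ⟨(by fun_prop : Continuous fun t => l (s, t)).add
      (Continuous.clog (continuous_const.sub (hP'.div_const _)) fun t => Or.inl (h1 t)), fun t => ?_⟩
    rw [exp_add, exp_log (fun e => by have := h1 t; rw [e] at this; simp at this), hle]
    simp only [hq, hne s t hs, if_false, ((hPJ s).resolve_left fun h => h.1.ne hs).2]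
    have := sub_ne_zero.2 (hne s t hs)
    have := z hs
    field_simp
    ring
  have edge' : ∀ t, ‖P' t‖ = 1 → Continuous (fun s => l (s, t) + log (1 - P s / P' t)) ∧
      ∀ s, exp (l (s, t) + log (1 - P s / P' t)) = (J s - y') * (-(P' t)⁻¹) := fun t ht => by
    have h1 : ∀ s, 0 < (1 - P s / P' t).re := fun s => one_sub_re_pos (by rw [norm_div, ht, div_one]; exact hn s)
      fun e => hne' s t ht ((div_eq_one_iff_eq (z' ht)).1 e).symm
    refine ⟨(by fun_prop : Continuous fun s => l (s, t)).add
      (Continuous.clog (continuous_const.sub (hP.div_const _)) fun s => Or.inl (h1 s)), fun s => ?_⟩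
    rw [exp_add, exp_log (fun e => by have := h1 s; rw [e] at this; simp at this), hle]
    simp only [hq, hne' s t ht, if_false, ((hPJ' t).resolve_left fun h => h.1.ne ht).2]
    have := sub_ne_zero.2 (hne' s t ht)
    have := z' ht
    field_simp
    ring
  have A0 := edge 0 (ha ▸ n1 a)
  have A1 := edge 1 (hc ▸ n1 c)
  have B0 := edge' 0 (hb ▸ n1 b)
  have B1 := edge' 1 (hd' ▸ n1 d)
  have s1 := sub_eq_sub_of_exp_mul A1.1 A0.1 A1.2 A0.2
  have s2 := sub_eq_sub_of_exp_mul B1.1 B0.1 B1.2 B0.2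
  have hdiv : ∀ x y : ℝ, ee x / ee y = ee ((x - y : ℝ) : ℂ) ∧ ee y / ee x = ee (-((x - y : ℝ) : ℂ)) := fun x y => by
    rw [ee, ee, ← exp_sub, ← exp_sub, ee, ee]; push_cast; exact ⟨by ring_nf, by ring_nf⟩
  simp only [ha, hb, hc, hd', (hdiv d c).1, (hdiv d c).2, (hdiv d a).1, (hdiv d a).2, (hdiv c b).1, (hdiv c b).2, (hdiv b a).1,
    (hdiv b a).2] at s1 s2
  have t1 := log_one_sub_ee (show 0 < d - c by linarith) (by linarith)
  have t2 := log_one_sub_ee (show 0 < d - a by linarith) (by linarith)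
  have t3 := log_one_sub_ee (show 0 < c - b by linarith) (by linarith)
  have t4 := log_one_sub_ee (show 0 < b - a by linarith) (by linarith)
  push_cast at t1 t2 t3 t4 s1 s2
  refine two_pi_I_ne_zero ?_
  linear_combination s1 - s2 - t1 + t2 - t3 - t4

section
variable (hT : TwoCharts e₁ e₂) (hd : DifferentiableOn ℂ ψ 𝔻) (hG : ∀ z ∈ 𝔻, G z = e₁ (ψ z)) (hψ0 : ψ 0 = 0)
  (hΦ : DiscMap G f Φ) (hf1 : f (e₁ 0) = e₁ 0) (hf2 : f (e₂ 0) = e₂ 0)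
include hT hd hG hψ0 hΦ hf1 hf2

lemma exists_ray_loop (hζ : ‖ζ‖ = 1) (hw : f (e₁ w) = e₁ w)
    (hl : Tendsto (fun r : ℝ => G (r * ζ)) (𝓝[<] 1) (𝓝 (e₁ w))) :
    ∃ P J : ℝ → ℂ, Continuous P ∧ Continuous J ∧ (∀ t, ‖P t‖ < 1 ∧ J t = ψ (P t) ∨ ‖P t‖ = 1 ∧ J t = w) ∧
      (∀ t, ‖P t‖ = 1 → P t = P 0 ∨ P t = P 1) ∧ P 0 = ζ ∧ P 1 = Φ ⟨ζ, mem_closedBall_zero_iff.2 hζ.le⟩ := by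
  set cl : ℝ → ℝ := fun t => max 0 (min t 1) with hcl
  have hcm : ∀ t, cl t ∈ Icc (0 : ℝ) 1 := fun t => ⟨le_max_left _ _, max_le zero_le_one (min_le_right _ _)⟩
  have hclc : Continuous cl := by fun_prop
  have hn : ∀ {r : ℝ}, r ∈ Icc (0 : ℝ) 1 → ‖(r : ℂ) * ζ‖ = r := fun hr => by
    rw [norm_mul, hζ, mul_one, norm_real, Real.norm_of_nonneg hr.1]
  set ρ : ℝ → ℂ := Function.update (fun r : ℝ => ψ (r * ζ)) 1 w with hρ
  have hρ1 : ρ 1 = w := Function.update_self ..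
  have hρr : ∀ {r}, r ≠ 1 → ρ r = ψ (r * ζ) := fun h => Function.update_of_ne h ..
  have hb : ∀ {r : ℝ}, r ∈ Icc (0 : ℝ) 1 → r ≠ 1 → (r : ℂ) * ζ ∈ 𝔻 := fun hr h =>
    mem_ball_zero_iff.2 (by rw [hn hr]; exact lt_of_le_of_ne hr.2 h)
  have hρc : ContinuousOn ρ (Icc 0 1) := by
    refine continuousOn_update_iff.2 ⟨hd.continuousOn.comp (by fun_prop) fun r hr => hb hr.1 hr.2, fun _ => ?_⟩
    refine hT.emb₁.isInducing.tendsto_nhds_iff.2 ((hl.mono_left (nhdsWithin_mono _ fun r hr => lt_of_le_of_ne hr.1.2 hr.2)).congr' ?_)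
    filter_upwards [self_mem_nhdsWithin] with r hr using hG _ (hb hr.1 hr.2)
  set p : ℝ → CDisc := fun t => ⟨(cl t : ℂ) * ζ, mem_closedBall_zero_iff.2 (by rw [hn (hcm t)]; exact (hcm t).2)⟩ with hp
  have hpc : Continuous p := by
    refine Continuous.subtype_mk ?_ _
    fun_prop
  choose s hs using fun z => hT.exists_eq fun h => hT.ne₂ z (f.injective (h.trans hf2.symm))
  have hsc := hT.emb₁.isInducing.continuous_iff.2 (by
    rw [show e₁ ∘ s = f ∘ e₁ from funext hs]; exact f.continuous.comp hT.emb₁.continuous)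
  have hinj := hT.emb₁.injective
  have hs0 : s 0 = 0 := hinj (by rw [hs, hf1])
  have hsw : s w = w := hinj (by rw [hs, hw])
  have h1e : ∀ {t : ℝ}, t ≤ 1 / 2 → cl (2 * t - 1) = 0 := fun h => by grind
  have h2e : ∀ {t : ℝ}, 1 / 2 ≤ t → cl (1 - 2 * t) = 0 := fun h => by grind
  have hρ0 : ρ 0 = 0 := by rw [hρr zero_ne_one]; simp [hψ0]
  have hc1 : cl 1 = 1 := by simp [hcl]
  have e1 : ∀ {t : ℝ}, t ≤ 1 / 2 → ((p (1 - 2 * t) : ℂ) + Φ (p (2 * t - 1)) = (cl (1 - 2 * t) : ℂ) * ζ ∧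
      ρ (cl (1 - 2 * t)) + s (ρ (cl (2 * t - 1))) = ρ (cl (1 - 2 * t))) := fun h => by
    rw [h1e h, hρ0, hs0, add_zero, hΦ.zero (p _) (by simp [hp, h1e h]), add_zero]; exact ⟨rfl, rfl⟩
  have e2 : ∀ {t : ℝ}, 1 / 2 ≤ t → ((p (1 - 2 * t) : ℂ) + Φ (p (2 * t - 1)) = Φ (p (2 * t - 1)) ∧
      ρ (cl (1 - 2 * t)) + s (ρ (cl (2 * t - 1))) = s (ρ (cl (2 * t - 1)))) := fun h => by
    rw [h2e h, hρ0, zero_add, show (p (1 - 2 * _) : ℂ) = 0 by simp [hp, h2e h], zero_add]; exact ⟨rfl, rfl⟩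
  have hP0 : (p (1 - 2 * 0) : ℂ) + Φ (p (2 * 0 - 1)) = ζ := by rw [(e1 (by norm_num)).1]; simp [hc1]
  have hp1 : ∀ {t}, cl t = 1 → p t = ⟨ζ, mem_closedBall_zero_iff.2 hζ.le⟩ := fun h => Subtype.ext (by simp [hp, h])
  have hP1 : (p (1 - 2 * 1) : ℂ) + Φ (p (2 * 1 - 1)) = Φ ⟨ζ, mem_closedBall_zero_iff.2 hζ.le⟩ := by
    rw [(e2 (by norm_num)).1, hp1 (by norm_num [hc1])]
  refine ⟨fun t => (p (1 - 2 * t) : ℂ) + Φ (p (2 * t - 1)), fun t => ρ (cl (1 - 2 * t)) + s (ρ (cl (2 * t - 1))), ?_, ?_, ?_, ?_, hP0, hP1⟩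
  · exact (continuous_subtype_val.comp (hpc.comp (by fun_prop))).add
      (continuous_subtype_val.comp (Φ.continuous.comp (hpc.comp (by fun_prop))))
  · exact (hρc.comp_continuous (hclc.comp (by fun_prop)) fun t => hcm _).add
      (hsc.comp (hρc.comp_continuous (hclc.comp (by fun_prop)) fun t => hcm _))
  · intro t
    simp only
    rcases le_total t (1 / 2) with h | h
    · rw [(e1 h).1, (e1 h).2, hn (hcm _)]
      rcases eq_or_ne (cl (1 - 2 * t)) 1 with h1 | h1
      · exact Or.inr ⟨h1, by rw [h1, hρ1]⟩
      · exact Or.inl ⟨lt_of_le_of_ne (hcm _).2 h1, hρr h1⟩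
    · rw [(e2 h).1, (e2 h).2]
      rcases eq_or_ne (cl (2 * t - 1)) 1 with h1 | h1
      · exact Or.inr ⟨by rw [hp1 h1]; exact hΦ.norm_eq hζ, by rw [h1, hρ1, hsw]⟩
      · have h2 : ‖(p (2 * t - 1) : ℂ)‖ < 1 := mem_ball_zero_iff.1 (hb (hcm _) h1)
        have h3 := (hΦ.norm_lt _).2 h2
        refine Or.inl ⟨h3, hinj ?_⟩
        rw [hs, hρr h1, ← hG _ (hb (hcm _) h1), ← hG _ (mem_ball_zero_iff.2 h3), hΦ.eq _ h2]
  · intro t ht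
    simp only at ht ⊢
    rw [hP0, hP1]
    rcases le_total t (1 / 2) with h | h
    · rw [(e1 h).1] at ht ⊢
      grind
    · rw [(e2 h).1] at ht ⊢
      have h2 : ¬‖(p (2 * t - 1) : ℂ)‖ < 1 := fun h2 => ((hΦ.norm_lt _).2 h2).ne ht
      grind

/-- A homeomorphism whose action on the circle of directions has no fixed point moves some boundary point. -/
lemma exists_frontier_ne (h : DiscModel U G H) (h2U : e₂ 0 ∉ closure U) (hd0 : ∀ z ∈ 𝔻, deriv ψ z ≠ 0)
    {g : ℝ → ℝ} (hgc : Continuous g) (hgs : StrictMono g) (hg : ∀ x : ℝ, ee (g x) = Φ (lowDisc x))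
    (hfix : ∀ z : CDisc, ‖z.1‖ = 1 → Φ z ≠ z) : ∃ y ∈ frontier U, f y ≠ y := by
  by_contra! hcon
  have n1 : ∀ x : ℝ, ‖ee x‖ = 1 := fun x => norm_ee_eq.2 (by simp)
  have hlow : ∀ x : ℝ, lowDisc x = ⟨ee x, mem_closedBall_zero_iff.2 (n1 x).le⟩ := fun x => Subtype.ext (lowDisc_coe (by simp))
  have hi : InjOn ψ 𝔻 := fun z hz w hw e => h.injOn hz hw (by rw [hG z hz, hG w hw, e])
  have hg0 : Int.fract (g 0) ≠ 0 := fun h0 => by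
    refine hfix (lowDisc (0 : ℝ)) (by rw [hlow]; exact n1 0) (Subtype.ext ?_)
    rw [← hg, hlow, ← Int.floor_add_fract (g 0), h0]
    simpa using ee_add_int 0 ⌊g 0⌋
  set k := ⌊g 0⌋ with hk
  have hpos := lt_of_le_of_ne (Int.fract_nonneg _) hg0.symm
  obtain ⟨ε, hε, hε1, hε2⟩ : ∃ ε > 0, ε < g 0 - k ∧ g ε - k < 1 := by
    have h1 : ∀ᶠ x in 𝓝[>] (0 : ℝ), x < g 0 - k ∧ g x - k < 1 := nhdsWithin_le_nhds
      ((eventually_lt_nhds hpos).and ((hgc.sub continuous_const).continuousAt.eventually (eventually_lt_nhds (Int.fract_lt_one _))))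
    have ⟨x, h1, h2⟩ := (h1.and self_mem_nhdsWithin).exists
    exact ⟨x, h2, h1⟩
  have h2π : 0 < 2 * π := by positivity
  have rad : ∀ {A : Set X}, A.Finite → A ⊆ Uᶜ → ∀ {a b : ℝ}, a < b → ∃ x ∈ Ioo a b, ∃ w, e₁ w ∉ A ∧ e₁ w ∈ frontier U ∧
      Tendsto (fun r : ℝ => G (r * ee x)) (𝓝[<] 1) (𝓝 (e₁ w)) := fun hA hAU a b hab => by
    have ⟨θ, hθ, y, hy, hl⟩ := h.exists_rad hA hAU (⟨_, fun h' => h2U (subset_closure h')⟩) (show -(2 * π * b) < -(2 * π * a) by nlinarith)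
    rw [(by rw [ee]; push_cast; congr 1; field_simp : exp (θ * I) = ee (-θ / (2 * π) : ℝ))] at hl
    have hyf : y ∈ frontier U := by
      refine h.limit_mem_frontier (p := fun r : ℝ => r * ee (-θ / (2 * π) : ℝ)) (ζ := ee (-θ / (2 * π) : ℝ)) (n1 _) ?_ ?_ hl
      · filter_upwards [Ioo_mem_nhdsLT (show (0 : ℝ) < 1 by norm_num)] with r hr
        rw [mem_ball_zero_iff, norm_mul, n1, mul_one, norm_real, Real.norm_of_nonneg hr.1.le]; exact hr.2
      · have : Tendsto (fun r : ℝ => (r : ℂ) * ee (-θ / (2 * π) : ℝ)) (𝓝 1) (𝓝 ((1 : ℝ) * ee (-θ / (2 * π) : ℝ))) :=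
          (continuous_ofReal.mul continuous_const).tendsto 1
        rw [ofReal_one, one_mul] at this
        exact this.mono_left nhdsWithin_le_nhds
    obtain ⟨w, rfl⟩ := hT.exists_eq (fun e => h2U (e ▸ frontier_subset_closure hyf))
    refine ⟨_, ⟨?_, ?_⟩, w, hy, hyf, hl⟩
    · rw [lt_div_iff₀ h2π]; linarith [hθ.2]
    · rw [div_lt_iff₀ h2π]; linarith [hθ.1]
  have hfrU : ∀ {y}, y ∈ frontier U → y ∉ U := fun hy h' => (h.isOpen.frontier_eq ▸ hy).2 h'
  have ⟨a, ha, y, _, hy, hya⟩ := rad finite_empty (empty_subset _) hε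
  have ⟨b, hb, y', hyy, hy', hyb⟩ := rad (finite_singleton (e₁ y)) (by simpa using hfrU hy) ha.2
  have ⟨P, J, hP, hJ, hPJ, hPe, hP0, hP1⟩ := exists_ray_loop hT hd hG hψ0 hΦ hf1 hf2 (n1 a) (hcon _ hy) hya
  have ⟨P', J', hP', hJ', hPJ', hPe', hP0', hP1'⟩ := exists_ray_loop hT hd hG hψ0 hΦ hf1 hf2 (n1 b) (hcon _ hy') hyb
  have hgk : ∀ x : ℝ, ee ((g x - k : ℝ) : ℂ) = Φ ⟨ee x, mem_closedBall_zero_iff.2 (n1 x).le⟩ := fun x => by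
    rw [← hlow, ← hg]; simpa using (ee_add_int ((g x - k : ℝ) : ℂ) k).symm
  rw [← hgk] at hP1 hP1'
  have hψU : ∀ {w}, e₁ w ∈ frontier U → w ∉ ψ '' 𝔻 := by
    rintro w hw ⟨z, hz, rfl⟩
    exact hfrU hw (hG z hz ▸ h.maps hz)
  have i1 := hgs ha.1
  have i2 := hgs hb.1
  have i3 := hgs hb.2
  have hee : ∀ {x x' : ℝ}, x < x' → x' < x + 1 → ee x' ≠ ee x := fun {x x'} h1 h2 e => by
    have ⟨m, hm⟩ := ee_eq_iff.1 e.symm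
    have hm' : x' = x + (m : ℝ) := by exact_mod_cast hm
    have : (0 : ℤ) < m := by exact_mod_cast (show (0 : ℝ) < m by linarith)
    have : m < (1 : ℤ) := by exact_mod_cast (show (m : ℝ) < 1 by linarith)
    omega
  refine false_of_linked hd hi hd0 hP hP' hJ hJ' hPJ hPJ' (fun s t hs e => ?_) (fun e => hyy (by rw [e]; rfl)) (hψU hy) (hψU hy')
    hb.1 (show b < g a - k by linarith [hb.2]) (show g a - k < g b - k by linarith) (by linarith [ha.1]) hP0 hP1 hP0' hP1'
  have a1 := hPe s hs
  have a2 := hPe' t (e ▸ hs)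
  rw [e, hP0', hP1'] at a2
  grind
end

lemma DiscMap.mem_iff
    (hΦ : DiscMap G f Φ) (h : DiscModel U G H) (x : X) : f x ∈ U ↔ x ∈ U := by
  have key : ∀ {f : X ≃ₜ X} {Φ : CDisc ≃ₜ CDisc}, DiscMap G f Φ → ∀ x ∈ U, f x ∈ U := fun {f Φ} hΦ x hx => by
    have hz := mem_ball_zero_iff.1 (h.maps_inv hx)
    have h1 := hΦ.eq ⟨H x, mem_closedBall_zero_iff.2 hz.le⟩ hz
    rw [h.right_inv x hx] at h1
    exact h1 ▸ h.maps (mem_ball_zero_iff.2 ((hΦ.norm_lt _).2 hz))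
  refine ⟨fun hx => ?_, key hΦ x⟩
  have := key hΦ.inv _ hx
  rwa [show f⁻¹ (f x) = x from f.symm_apply_apply x] at this

lemma CircleDeg1Lift.abs_displacement_le (g : CircleDeg1Lift) (x : ℝ) : |g x - x - g.translationNumber| ≤ 2 := by
  have h2 : |g (Int.fract x) - Int.fract x - g 0| ≤ 1 := by
    have a := g.monotone (Int.fract_nonneg x)
    have b := g.monotone (Int.fract_lt_one x).le
    have c := g.map_add_one 0
    rw [zero_add] at c
    have := Int.fract_nonneg x; have := (Int.fract_lt_one x).le
    rw [abs_le]; constructor <;> linarith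
  have h3 := g.dist_map_zero_translationNumber_le
  rw [Real.dist_eq] at h3
  rw [← (g.map_fract_sub_fract_eq x)]
  calc _ = |(g (Int.fract x) - Int.fract x - g 0) + (g 0 - g.translationNumber)| := by ring_nf
    _ ≤ _ := (abs_add_le _ _).trans (by linarith)

/-- The translation numbers seen from the two sides of the common frontier are opposite. -/
theorem exists_opposite_circle_lift [CompactSpace X] (hT : TwoCharts e₁ e₂) (h₁ : Side e₁ U₁ G₁ H₁ A₁) (h₂ : Side e₂ U₂ G₂ H₂ A₂) (hd : DifferentiableOn ℂ ψ 𝔻) (hd0 : ∀ z ∈ 𝔻, deriv ψ z ≠ 0)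
    (hG : ∀ z ∈ 𝔻, G₁ z = e₁ (ψ z))
    (hU : Disjoint U₁ U₂) (hfr : frontier U₁ = frontier U₂) (hΦ₁ : DiscMap G₁ f Φ₁)
    (hΦ₂ : DiscMap G₂ f Φ₂) {θ : CDisc → 𝕋} (hθ : ContinuousOn θ {z | ‖z.1‖ = 1})
    (hi : InjOn θ {z | ‖z.1‖ = 1}) {α : 𝕋} (hα : addOrderOf α = 0)
    (hc : ∀ z : CDisc, ‖z.1‖ = 1 → θ (Φ₁ z) = θ z + α) :
    ∃ g : CircleDeg1Lift, StrictMono g ∧ Continuous g ∧ (∀ x : ℝ, Φ₂ (lowDisc x) = lowDisc (g x)) ∧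
      ((g.translationNumber : 𝕋) = α ∨ (g.translationNumber : 𝕋) = -α) := by
  have hf0 : ∀ {G : ℂ → X} {f : X ≃ₜ X} {Φ : CDisc ≃ₜ CDisc}, DiscMap G f Φ → f (G 0) = G 0 := fun {G f Φ} h => by
    have a := h.eq ⟨0, by simp⟩ (by simp)
    rw [h.zero _ rfl] at a
    exact a.symm
  have h10 : ∀ {f : X ≃ₜ X} {Φ : CDisc ≃ₜ CDisc}, DiscMap G₁ f Φ → f (e₁ 0) = e₁ 0 := fun h => by rw [← h₁.zero]; exact hf0 h
  have h20 : ∀ {f : X ≃ₜ X} {Φ : CDisc ≃ₜ CDisc}, DiscMap G₂ f Φ → f (e₂ 0) = e₂ 0 := fun h => by rw [← h₂.zero]; exact hf0 h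
  have h2U : e₂ 0 ∉ closure U₁ := fun hcl => by
    have := h₂.zero ▸ h₂.model.maps (by simp)
    exact (hU.closure_left h₂.model.isOpen).le_bot ⟨hcl, this⟩
  have hpow : ∀ (n : ℕ) (z : CDisc), ‖z.1‖ = 1 → θ ((Φ₁ ^ n) z) = θ z + n • α := fun n => by
    induction n with
    | zero => intro z _; simp
    | succ n ih =>
      intro z hz
      rw [pow_succ, show (Φ₁ ^ n * Φ₁) z = (Φ₁ ^ n) (Φ₁ z) from rfl, ih _ (hΦ₁.norm_eq hz), hc z hz, succ_nsmul', add_assoc]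
  have hord : ∀ n : ℕ, n ≠ 0 → addOrderOf (n • α) = 0 := fun n hn => by
    rw [addOrderOf_eq_zero_iff, isOfFinAddOrder_nsmul, not_or, ← addOrderOf_eq_zero_iff]
    exact ⟨hα, hn⟩
  have hfix : ∀ n : ℕ, n ≠ 0 → ∀ z : CDisc, ‖z.1‖ = 1 → (Φ₁ ^ n) z ≠ z := fun n hn z hz e => by
    have h := hpow n z hz
    rw [e, left_eq_add] at h
    have := hord n hn
    rw [h, addOrderOf_zero] at this
    exact one_ne_zero this
  have ⟨F, hF, hFe, d, hFd⟩ := hT.lift_homeo (h10 hΦ₁) (h20 hΦ₂)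
  have ⟨Fb₁, hs₁⟩ := h₁.exists_sideLift hT hΦ₁ hF hFe hFd
  obtain rfl : d = 1 := hs₁.degree_eq_one hΦ₁ (by simpa using hfix 1 one_ne_zero)
  set F' : ℂ → ℂ := fun v => -F (-v) with hF'
  have hF'e : ∀ v, e₂ (ee (F' v)) = f (e₂ (ee v)) := fun v => by
    rw [hF', hT.ee_neg_eq, hFe, (by rw [← hT.ee_neg_eq, neg_neg] : e₂ (ee v) = e₁ (ee (-v)))]
  have ⟨Fb₂, hs₂⟩ := h₂.exists_sideLift (d := 1) hT.symm hΦ₂ (F := F') (by fun_prop) hF'e fun v => by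
    have := hFd (-(v + 1))
    rw [show -(v + 1) + 1 = -v by ring] at this
    simp only [hF', this]; push_cast; ring
  have ⟨g₁, hg₁m, hg₁c, hg₁⟩ := hs₁.exists_circle_lift hΦ₁
  have ⟨g₂, hg₂m, hg₂c, hg₂⟩ := hs₂.exists_circle_lift hΦ₂
  have hit : ∀ {Fb : ℂ → ℂ} {g : CircleDeg1Lift}, (∀ x : ℝ, Fb x = (g x : ℂ)) → ∀ (n : ℕ) (x : ℝ), Fb^[n] x = ((g ^ n) x : ℂ) := by
    intro Fb g h n
    induction n with
    | zero => intro x; simp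
    | succ n ih => intro x; rw [Function.iterate_succ_apply, h, ih, pow_succ, CircleDeg1Lift.mul_apply]
  have n1 : ∀ x : ℝ, ‖(lowDisc x : ℂ)‖ = 1 := fun x => by rw [lowDisc_coe (by simp)]; exact norm_ee_eq.2 (by simp)
  have hlow : ∀ {Fb : ℂ → ℂ} {g : CircleDeg1Lift} {Φ : CDisc ≃ₜ CDisc} {A F : ℂ → ℂ}, (∀ x : ℝ, Fb x = (g x : ℂ)) →
      SideLift A F Fb Φ 1 → ∀ x : ℝ, Φ (lowDisc x) = lowDisc (g x) := fun hg hs x => Subtype.ext (by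
    rw [lowDisc_coe (by simp), ← hs.ee_eq _ (by simp), hg])
  have hsum : g₂.translationNumber = -g₁.translationNumber := by
    have hb : ∀ n : ℕ, n ≠ 0 → |n * (g₁.translationNumber + g₂.translationNumber)| ≤ 6 := fun n hn => by
      have hFn : ∀ v, F'^[n] v = -F^[n] (-v) := by
        clear hn
        induction n with
        | zero => simp
        | succ n ih => intro v; rw [Function.iterate_succ_apply, ih, Function.iterate_succ_apply, hF', neg_neg]
      have hFen : ∀ v, e₁ (ee (F^[n] v)) = (f ^ n) (e₁ (ee v)) := by
        clear hn hFn
        induction n with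
        | zero => simp
        | succ n ih => intro v; rw [Function.iterate_succ_apply, ih, hFe, pow_succ]; rfl
      have ⟨y₀, hy₀, hfy₀⟩ := exists_frontier_ne hT hd hG (hψ0 := by
        apply hT.emb₁.injective; rw [← hG 0 (by simp), h₁.zero]) (hΦ₁.pow n) (h10 (hΦ₁.pow n)) (h20 (hΦ₂.pow n)) h₁.model h2U hd0
        (g := ⇑(g₁ ^ n)) (by rw [CircleDeg1Lift.coe_pow]; exact hg₁c.iterate n) (by rw [CircleDeg1Lift.coe_pow]; exact hg₁m.iterate n)
        (fun x => by rw [← hit hg₁, (hs₁.iterate hΦ₁ n).ee_eq _ (by simp)]) (hfix n hn)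
      have ⟨x, x', y, hx, hy⟩ := exists_displacement hT h₁ h₂ hU hfr (hΦ₁.pow n) (hΦ₂.pow n) (h10 (hΦ₁.pow n))
        ((hΦ₁.pow n).mem_iff h₁.model) ((hΦ₂.pow n).mem_iff h₂.model)
        (minimal_of_conj hθ hi (hord n hn) (hpow n)) (minimal_of_conj hθ hi (β := -(n • α)) (by rw [addOrderOf_neg]; exact hord n hn)
          (fun z hz => by
            have := hpow n ((Φ₁ ^ n)⁻¹ z) ((hΦ₁.pow n).inv.norm_eq hz)
            rw [show (Φ₁ ^ n) ((Φ₁ ^ n)⁻¹ z) = z from (Φ₁ ^ n).apply_symm_apply z] at this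
            rw [this]; abel)) hy₀ hfy₀ (hF.iterate n) hFen hFn (hs₁.iterate hΦ₁ n) (hs₂.iterate hΦ₂ n)
      rw [hit hg₁, hit hg₂, ofReal_re, ofReal_re] at hy
      have a := (g₁ ^ n).abs_displacement_le x
      have b := (g₂ ^ n).abs_displacement_le y
      rw [CircleDeg1Lift.translationNumber_pow] at a b
      rw [abs_le] at *
      constructor <;> linarith [a.1, a.2, b.1, b.2, hx.1, hx.2, hy.1, hy.2]
    by_contra hne
    have hpos : 0 < |g₁.translationNumber + g₂.translationNumber| := abs_pos.2 fun h => hne (by linarith)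
    have ⟨n, hn⟩ := exists_nat_gt (6 / |g₁.translationNumber + g₂.translationNumber|)
    have := hb n (by rintro rfl; have : 0 < 6 / |g₁.translationNumber + g₂.translationNumber| := by positivity
                     push_cast at hn; linarith)
    rw [abs_mul, Nat.abs_cast] at this
    rw [div_lt_iff₀ hpos] at hn
    linarith
  refine ⟨g₂, hg₂m, hg₂c, hlow hg₂ hs₂, ?_⟩
  have hper : ∀ (x : ℝ) (k : ℤ), lowDisc ((x + k : ℝ) : ℂ) = lowDisc x := fun x k => Subtype.ext (by
    rw [lowDisc_coe (by simp), lowDisc_coe (by simp)]; push_cast; exact ee_add_int _ _)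
  rw [hsum, AddCircle.coe_neg, neg_inj, neg_eq_iff_eq_neg]
  refine (translationNumber_of_conj hg₁c (c := fun x : ℝ => θ (lowDisc x)) ?_ (fun x => ?_) (fun x y h => ?_) (fun x => ?_)).symm
  · exact hθ.comp_continuous (continuous_lowDisc.comp continuous_ofReal) n1
  · have := hper x 1
    grind
  · have := congrArg Subtype.val (hi (n1 x) (n1 y) h)
    rw [lowDisc_coe (by simp), lowDisc_coe (by simp), ee_eq_iff] at this
    have ⟨k, hk⟩ := this
    exact ⟨k, by exact_mod_cast hk⟩
  · simp only [← hlow hg₁ hs₁, hc _ (n1 x)]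

lemma exists_twoCharts_of_compl [CompactSpace X]
    (h : IsOpenEmbedding e₁) {p : X} (hr : range e₁ = {p}ᶜ) : ∃ e₂ : ℂ → X, TwoCharts e₁ e₂ ∧ e₂ 0 = p := by
  classical
  set e₂ : ℂ → X := fun z => if z = 0 then p else e₁ z⁻¹ with he₂
  have h0 : e₂ 0 = p := by simp [he₂]
  have hz : ∀ z ≠ 0, e₂ z = e₁ z⁻¹ := fun z hz => by simp [he₂, hz]
  have hp : ∀ z, e₁ z ≠ p := fun z => by have := mem_range_self (f := e₁) z; rwa [hr] at this
  have hinj : Function.Injective e₂ := fun z w e => by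
    rcases eq_or_ne z 0 with rfl | hz0 <;> rcases eq_or_ne w 0 with rfl | hw0
    · rfl
    · rw [h0, hz w hw0] at e; exact absurd e.symm (hp _)
    · rw [h0, hz z hz0] at e; exact absurd e (hp _)
    · rw [hz z hz0, hz w hw0] at e; exact inv_injective (h.injective e)
  have hn : ∀ z ≠ 0, e₂ =ᶠ[𝓝 z] fun z => e₁ z⁻¹ := fun z h => by
    filter_upwards [isOpen_compl_singleton.mem_nhds h] with w hw using hz w hw
  have hcont : Continuous e₂ := continuous_iff_continuousAt.2 fun z => by
    rcases eq_or_ne z 0 with rfl | hz0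
    · rw [ContinuousAt, h0, _root_.tendsto_nhds]
      intro O hO hpO
      have ⟨R, hR⟩ := (h.toIsEmbedding.isCompact_preimage_iff (fun x hx => by grind) |>.2 hO.isClosed_compl.isCompact).isBounded.subset_ball 0
      refine Metric.mem_nhds_iff.2 ⟨(|R| + 1)⁻¹, by positivity, fun w hw => ?_⟩
      rcases eq_or_ne w 0 with rfl | hw0
      · rw [mem_preimage, h0]; exact hpO
      · rw [mem_preimage, hz w hw0]
        by_contra hO'
        have h1 := mem_ball_zero_iff.1 (hR hO')
        rw [norm_inv] at h1
        have h2 := (lt_inv_comm₀ (norm_pos_iff.2 hw0) (by positivity)).1 (mem_ball_zero_iff.1 hw)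
        linarith [le_abs_self R]
    · exact ((h.continuous.continuousAt).comp (continuousAt_inv₀ hz0)).congr (hn z hz0).symm
  have hopen : IsOpenMap e₂ := IsOpenMap.of_nhds_le fun z => by
    intro s hs
    rcases eq_or_ne z 0 with rfl | hz0
    · have ⟨ε, hε, hεs⟩ := Metric.mem_nhds_iff.1 hs
      have hc : IsClosed (e₁ '' closedBall 0 ε⁻¹) := ((isCompact_closedBall _ _).image h.continuous).isClosed
      filter_upwards [hc.isOpen_compl.mem_nhds (by rintro ⟨w, -, hw⟩; exact hp w (hw.trans h0))] with x hx
      rcases eq_or_ne x p with rfl | hxp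
      · rw [← h0]; exact hεs (mem_ball_self hε)
      · obtain ⟨w, rfl⟩ : x ∈ range e₁ := by rw [hr]; exact hxp
        have hw : ε⁻¹ < ‖w‖ := by by_contra hw; exact hx ⟨w, mem_closedBall_zero_iff.2 (not_lt.1 hw), rfl⟩
        rw [← inv_inv w, ← hz _ (inv_ne_zero (norm_pos_iff.1 ((inv_pos.2 hε).trans hw)))]
        exact hεs (mem_ball_zero_iff.2 (by rw [norm_inv]; exact inv_lt_of_inv_lt₀ hε hw))
    · rw [hz z hz0]
      have h2 : Tendsto (fun w : ℂ => w⁻¹) (𝓝 z⁻¹) (𝓝 z) := by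
        have := (continuousAt_inv₀ (inv_ne_zero hz0)).tendsto; rwa [inv_inv] at this
      have h3 : ∀ᶠ w in 𝓝 z⁻¹, e₁ w ∈ s := by
        filter_upwards [h2 hs, isOpen_compl_singleton.mem_nhds (inv_ne_zero hz0)] with w hw hw0
        have := hz w⁻¹ (inv_ne_zero hw0)
        grind
      rw [← h.map_nhds_eq]; exact h3
  refine ⟨e₂, ⟨h, .of_continuous_injective_isOpenMap hcont hinj hopen, by rw [hr, h0], ?_, hz⟩, h0⟩
  ext x
  constructor
  · rintro ⟨z, rfl⟩ e
    rcases eq_or_ne z 0 with rfl | hz0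
    · rw [h0] at e; exact hp 0 (Eq.symm e)
    · rw [hz z hz0] at e
      exact inv_ne_zero hz0 (h.injective e)
  · intro hx
    rcases eq_or_ne x p with rfl | hxp
    · exact ⟨0, h0⟩
    · obtain ⟨w, rfl⟩ : x ∈ range e₁ := by rw [hr]; exact hxp
      exact ⟨w⁻¹, by rw [hz _ (inv_ne_zero (fun e => hx (by rw [e]; rfl))), inv_inv]⟩

lemma exists_twoCharts {p q : SphereTwo} (hpq : p ≠ q) : ∃ e₁ e₂ : ℂ → SphereTwo, TwoCharts e₁ e₂ ∧ e₁ 0 = p ∧ e₂ 0 = q := by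
  have : Fact (Module.finrank ℝ (EuclideanSpace ℝ (Fin 3)) = 2 + 1) := ⟨by simp⟩
  set s := stereographic' 2 q
  have hs : s.source = {q}ᶜ := stereographic'_source q
  have ht : s.target = univ := stereographic'_target q
  set c := Complex.orthonormalBasisOneI.repr.toHomeomorph with hc
  set e₁ : ℂ → SphereTwo := fun z => s.symm (c z + s p) with he₁
  have hopen : IsOpenEmbedding e₁ := by
    exact (s.symm.isOpenEmbedding (by simpa using ht)).comp ((Homeomorph.addRight (s p)).isOpenEmbedding.comp c.isOpenEmbedding)
  have hr : range e₁ = {q}ᶜ := by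
    rw [← hs, ← s.symm_image_target_eq_source, ht, image_univ]
    exact (c.trans (Homeomorph.addRight (s p))).surjective.range_comp s.symm
  have ⟨e₂, hT, h0⟩ := exists_twoCharts_of_compl hopen hr
  refine ⟨e₁, e₂, hT, ?_, h0⟩
  have : c 0 = 0 := Complex.orthonormalBasisOneI.repr.map_zero
  simp only [he₁, this, zero_add, s.left_inv (by rw [hs]; exact hpq)]

/-- Each of two complementary domains with a common frontier is the image of a Riemann map. -/
lemma TwoCharts.exists_side [CompactSpace X] (hT : TwoCharts e₁ e₂)
    (hU₁ : IsOpen U₁) (hU₂ : IsOpen U₂) (hp₁ : IsPreconnected U₁) (hp₂ : IsPreconnected U₂) (hd : Disjoint U₁ U₂)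
    (hun : U₁ᶜ = closure U₂) (h1 : e₁ 0 ∈ U₁) (h2 : e₂ 0 ∈ U₂) :
    ∃ (G : ℂ → X) (H : X → ℂ) (A ψ : ℂ → ℂ), Side e₁ U₁ G H A ∧ DifferentiableOn ℂ ψ 𝔻 ∧
      (∀ z ∈ 𝔻, deriv ψ z ≠ 0) ∧ ∀ z ∈ 𝔻, G z = e₁ (ψ z) := by
  set V := e₁ ⁻¹' U₁
  have hsub : U₁ ⊆ range e₁ := fun x hx => by rw [hT.range₁]; exact fun e => hd.le_bot ⟨hx, (show x = _ from e) ▸ h2⟩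
  have hV := hU₁.preimage hT.emb₁.continuous
  have him := image_preimage_eq_of_subset hsub
  have ⟨ε, hε, hεU⟩ := Metric.mem_nhds_iff.1 ((hU₂.preimage hT.emb₂.continuous).mem_nhds h2)
  have hbd : ∀ w : ℂ, ε⁻¹ < ‖w‖ → e₁ w ∈ U₂ := fun w hw => by
    have := hεU (mem_ball_zero_iff.2 (by rw [norm_inv]; exact inv_lt_of_inv_lt₀ hε hw))
    rwa [mem_preimage, hT.inv _ (inv_ne_zero (norm_pos_iff.1 ((inv_pos.2 hε).trans hw))), inv_inv] at this
  have hVR : V ⊆ ball 0 (ε⁻¹ + 1) := fun w hw => mem_ball_zero_iff.2 (by grind)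
  have hreg : interior (closure V) ⊆ V := fun w hw => by
    have h1 : e₁ '' interior (closure V) ⊆ closure U₁ := by
      refine (image_mono interior_subset).trans ((image_closure_subset_closure_image hT.emb₁.continuous).trans ?_)
      rw [him]
    have h2 : e₁ w ∉ closure U₂ := fun hcl => by
      have ⟨y, hy, hyU⟩ := mem_closure_iff.1 hcl _ (hT.emb₁.isOpenMap _ isOpen_interior) (mem_image_of_mem _ hw)
      exact (hd.closure_left hU₂).le_bot ⟨h1 hy, hyU⟩
    rw [← hun, notMem_compl_iff] at h2
    exact h2
  have hVc : IsPreconnected Vᶜ := by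
    have key : ∀ t t' : Set ℂ, IsClosed t → IsClosed t' → Vᶜ ⊆ t ∪ t' → (Vᶜ ∩ t').Nonempty → (closedBall (0 : ℂ) ε⁻¹)ᶜ ⊆ t →
        (closedBall (0 : ℂ) ε⁻¹)ᶜ ∩ t' = ∅ → (Vᶜ ∩ (t ∩ t')).Nonempty := by
      intro t t' ht ht' hc hn' hO hO'
      have hcR : ∀ s : Set ℂ, IsClosed s → IsClosed (e₁ '' (Vᶜ ∩ s ∩ closedBall 0 (ε⁻¹ + 1))) := fun s hs =>
        (((isCompact_closedBall _ _).inter_left (hV.isClosed_compl.inter hs)).image hT.emb₁.continuous).isClosed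
      have hA : IsClosed (e₁ '' (Vᶜ ∩ t ∩ closedBall 0 (ε⁻¹ + 1)) ∪ e₂ '' closedBall 0 (ε⁻¹ + 1)⁻¹) :=
        (hcR t ht).union ((isCompact_closedBall _ _).image hT.emb₂.continuous).isClosed
      have hcov : closure U₂ ⊆ (e₁ '' (Vᶜ ∩ t ∩ closedBall 0 (ε⁻¹ + 1)) ∪ e₂ '' closedBall 0 (ε⁻¹ + 1)⁻¹) ∪
          e₁ '' (Vᶜ ∩ t' ∩ closedBall 0 (ε⁻¹ + 1)) := fun x hx => by
        rcases eq_or_ne x (e₂ 0) with rfl | hx0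
        · exact .inl (.inr ⟨0, by simp only [mem_closedBall_zero_iff, norm_zero]; positivity, rfl⟩)
        obtain ⟨w, rfl⟩ := hT.exists_eq hx0
        have hw : w ∈ Vᶜ := by rw [← hun] at hx; exact hx
        rcases le_or_gt ‖w‖ (ε⁻¹ + 1) with h | h
        · rcases hc hw with h' | h'
          exacts [.inl (.inl ⟨w, ⟨⟨hw, h'⟩, mem_closedBall_zero_iff.2 h⟩, rfl⟩), .inr ⟨w, ⟨⟨hw, h'⟩, mem_closedBall_zero_iff.2 h⟩, rfl⟩]
        · refine .inl (.inr ⟨w⁻¹, ?_, by rw [hT.inv _ (inv_ne_zero (norm_pos_iff.1 (lt_trans (by positivity) h))), inv_inv]⟩)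
          rw [mem_closedBall_zero_iff, norm_inv]
          exact inv_anti₀ (by positivity) h.le
      have ⟨w', hw', hwt'⟩ := hn'
      have hw'R : w' ∈ closedBall (0 : ℂ) (ε⁻¹ + 1) := by
        by_contra h
        exact (eq_empty_iff_forall_notMem.1 hO') w' ⟨fun h' => h (closedBall_subset_closedBall (by linarith) h'), hwt'⟩
      obtain ⟨x, -, hx, w, ⟨⟨hw, hwt⟩, -⟩, rfl⟩ := isPreconnected_closed_iff.1 hp₂.closure _ _ hA (hcR t' ht') hcov
        ⟨e₂ 0, subset_closure h2, .inr ⟨0, by simp only [mem_closedBall_zero_iff, norm_zero]; positivity, rfl⟩⟩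
        ⟨e₁ w', by rw [← hun]; exact hw', ⟨w', ⟨⟨hw', hwt'⟩, hw'R⟩, rfl⟩⟩
      refine ⟨w, hw, ?_, hwt⟩
      rcases hx with ⟨v, hv, e⟩ | ⟨v, hv, e⟩
      · rw [← hT.emb₁.injective e]; exact hv.1.2
      · rcases eq_or_ne v 0 with rfl | hv0
        · exact absurd e.symm (hT.ne₂ w)
        · rw [hT.inv _ hv0] at e
          rw [← hT.emb₁.injective e]
          refine hO fun h => ?_
          rw [mem_closedBall_zero_iff, norm_inv] at h
          have := mem_closedBall_zero_iff.1 hv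
          have h3 := (inv_le_inv₀ (norm_pos_iff.2 hv0) hε).1 h
          have : (ε⁻¹ + 1)⁻¹ < ε := inv_lt_of_inv_lt₀ hε (by linarith)
          linarith
    rw [isPreconnected_closed_iff]
    intro t t' ht ht' hc hn hn'
    by_contra hcon
    have hOV : (closedBall (0 : ℂ) ε⁻¹)ᶜ ⊆ Vᶜ := fun w hw hwV =>
      hd.le_bot ⟨hwV, hbd w (not_le.1 fun h => hw (mem_closedBall_zero_iff.2 h))⟩
    have hpre := isPreconnected_compl_closedBall_zero (inv_pos.2 hε).le
    by_cases h : ((closedBall (0 : ℂ) ε⁻¹)ᶜ ∩ t').Nonempty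
    · by_cases h' : ((closedBall (0 : ℂ) ε⁻¹)ᶜ ∩ t).Nonempty
      · exact hcon ((isPreconnected_closed_iff.1 hpre t t' ht ht' (hOV.trans hc) h' h).mono (inter_subset_inter_left _ hOV))
      · refine hcon ?_
        rw [inter_comm t t']
        refine key t' t ht' ht (by rwa [union_comm]) hn (fun w hw => ?_) (not_nonempty_iff_eq_empty.1 h')
        exact (hc (hOV hw)).resolve_left fun h1 => h' ⟨w, hw, h1⟩
    · exact hcon (key t t' ht ht' hc hn' (fun w hw => (hc (hOV hw)).resolve_right fun h1 => h ⟨w, hw, h1⟩)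
        (not_nonempty_iff_eq_empty.1 h))
  have ⟨ψ, φ, hR⟩ := exists_riemannMap hV (hp₁.preimage_of_isOpenMap hT.emb₁.injective hT.emb₁.isOpenMap hsub) h1 hVR hreg hVc
  have ⟨A, hA, hper, hAe⟩ := hR.exists_lowMap
  have hM := hR.discModel hV hVR hT.emb₁ (Function.leftInverse_invFun hT.emb₁.injective)
  rw [him] at hM
  refine ⟨_, _, A, ψ, ⟨hM, hA, hper, fun v hv => by rw [hAe v hv]; rfl, congrArg e₁ hR.zero⟩, hR.diff, fun z hz hz0 => ?_, fun _ _ => rfl⟩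
  have h1 : HasDerivAt ψ 0 z := by
    have := (hR.diff.differentiableAt (isOpen_ball.mem_nhds hz)).hasDerivAt
    rwa [hz0] at this
  have h3 := (hR.diff_inv _ (hR.maps hz)).hasDerivWithinAt.comp z (h1.hasDerivWithinAt (s := 𝔻)) hR.maps
  have h5 := (((hasDerivAt_id z).hasDerivWithinAt (s := 𝔻)).congr (fun w hw => hR.left_inv w hw) (hR.left_inv z hz))
  have h6 := (isOpen_ball.uniqueDiffWithinAt hz).eq_deriv _ h5 h3
  simp at h6

lemma exists_plane_homeo {ρ : ℝ} (hc : ‖c‖ < ρ) : ∃ M : ℂ ≃ₜ ℂ, M c = 0 ∧ ∀ z, ρ ≤ ‖z‖ → M z = z := by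
  have hρ := (norm_nonneg c).trans_lt hc
  set N : ℂ → ℂ := fun z => z + ((max 0 (1 - ‖z‖ / ρ) : ℝ) : ℂ) * c with hN
  obtain ⟨k, hkc⟩ : ∃ k : NNReal, (k : ℝ) = ‖c‖ / ρ := ⟨NNReal.mk (‖c‖ / ρ) (by positivity), rfl⟩
  have happ : ApproximatesLinearOn N ((ContinuousLinearEquiv.refl ℝ ℂ : ℂ ≃L[ℝ] ℂ) : ℂ →L[ℝ] ℂ) univ k := by
    refine ApproximatesLinearOn.approximatesLinearOn_iff_lipschitzOnWith.2 (LipschitzOnWith.of_dist_le_mul fun x _ y _ => ?_)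
    rw [dist_eq_norm, hkc]
    have h1 : N x - x - (N y - y) = ((max 0 (1 - ‖x‖ / ρ) - max 0 (1 - ‖y‖ / ρ) : ℝ) : ℂ) * c := by
      simp only [hN]; push_cast; ring
    change ‖N x - x - (N y - y)‖ ≤ _
    rw [h1, norm_mul, Complex.norm_real, Real.norm_eq_abs]
    have h2 : |max 0 (1 - ‖x‖ / ρ) - max 0 (1 - ‖y‖ / ρ)| ≤ dist x y / ρ := by
      refine (abs_max_sub_max_le_max 0 (1 - ‖x‖ / ρ) 0 (1 - ‖y‖ / ρ)).trans (max_le (by simp; positivity) ?_)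
      rw [show 1 - ‖x‖ / ρ - (1 - ‖y‖ / ρ) = (‖y‖ - ‖x‖) / ρ by ring, abs_div, abs_of_pos hρ, dist_comm, dist_eq_norm]
      gcongr
      exact abs_norm_sub_norm_le _ _
    calc _ ≤ dist x y / ρ * ‖c‖ := by gcongr
      _ = _ := by ring
  have hlt : k < ‖((ContinuousLinearEquiv.refl ℝ ℂ).symm : ℂ →L[ℝ] ℂ)‖₊⁻¹ := by
    have : ‖((ContinuousLinearEquiv.refl ℝ ℂ).symm : ℂ →L[ℝ] ℂ)‖₊ = 1 := NNReal.eq (ContinuousLinearMap.norm_id (𝕜 := ℝ) (E := ℂ))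
    rw [this, inv_one]; exact NNReal.coe_lt_coe.1 (by rw [hkc, NNReal.coe_one]; exact (div_lt_one hρ).2 hc)
  set T := happ.toHomeomorph N (.inr hlt)
  have hT : ∀ z, T z = N z := fun _ => rfl
  refine ⟨T.symm, T.symm_apply_eq.2 ?_, fun z hz => T.symm_apply_eq.2 ?_⟩
  · rw [hT]; simp [hN]
  · rw [hT, hN]
    simp [max_eq_left (by have := (one_le_div hρ).2 hz; linarith : 1 - ‖z‖ / ρ ≤ 0)]

/-- A compactly supported homeomorphism of the disc is transported to the sphere. -/
lemma DiscModel.exists_transport (h : DiscModel U G H)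
    {c : CDisc} (hc : ‖(c : ℂ)‖ < 1) : ∃ (b : X ≃ₜ X) (μ : CDisc ≃ₜ CDisc), (∀ x ∉ U, b x = x) ∧
      (∀ z : CDisc, ‖z.1‖ = 1 → μ z = z) ∧ (∀ z, ‖(μ z : ℂ)‖ < 1 ↔ ‖z.1‖ < 1) ∧ (μ c : ℂ) = 0 ∧
      ∀ z : CDisc, ‖z.1‖ < 1 → b (G z) = G (μ z) := by
  classical
  have ⟨ρ, hcρ, hρ⟩ := exists_between hc
  have ⟨M, hMc, hM⟩ := exists_plane_homeo hcρ
  have hMs : ∀ z, ρ ≤ ‖z‖ → M.symm z = z := fun z hz => M.symm_apply_eq.2 (hM z hz).symm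
  have hlt : ∀ {M : ℂ ≃ₜ ℂ}, (∀ z, ρ ≤ ‖z‖ → M z = z) → ∀ z, ‖z‖ < 1 → ‖M z‖ < 1 := fun {M} hM z hz => by
    rcases lt_or_ge ‖M z‖ ρ with h1 | h1
    · exact h1.trans hρ
    · rwa [M.injective (hM _ h1)]
  have hiff : ∀ z, ‖M z‖ < 1 ↔ ‖z‖ < 1 := fun z => ⟨fun h1 => by simpa using hlt hMs _ h1, hlt hM z⟩
  have hle : ∀ z, z ∈ 𝔻bar ↔ M z ∈ 𝔻bar := fun z => by
    simp only [mem_closedBall_zero_iff]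
    rcases lt_or_ge ‖z‖ 1 with h1 | h1
    · exact ⟨fun _ => (hlt hM z h1).le, fun _ => h1.le⟩
    · rw [hM z (hρ.le.trans h1)]
  set B : (ℂ ≃ₜ ℂ) → X → X := fun M x => if x ∈ U then G (M (H x)) else x with hB
  have hBc : ∀ {M : ℂ ≃ₜ ℂ}, (∀ z, ρ ≤ ‖z‖ → M z = z) → Continuous (B M) := fun {M} hM => by
    refine continuous_iff_continuousAt.2 fun x => ?_
    by_cases hx : x ∈ U
    · have h1 : ContinuousOn (fun x => G (M (H x))) U := h.cont.comp (M.continuous.comp_continuousOn h.cont_inv) fun x hx =>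
        mem_ball_zero_iff.2 (hlt hM _ (mem_ball_zero_iff.1 (h.maps_inv hx)))
      refine (h1.continuousAt (h.isOpen.mem_nhds hx)).congr ?_
      filter_upwards [h.isOpen.mem_nhds hx] with y hy
      simp only [hB, if_pos hy]
    · have hK := (isCompact_closedBall _ _).image_of_continuousOn (h.cont.mono (closedBall_subset_ball hρ))
      refine continuousAt_id.congr ?_
      filter_upwards [hK.isClosed.isOpen_compl.mem_nhds (by rintro ⟨z, hz, rfl⟩; exact hx (h.maps (closedBall_subset_ball hρ hz)))] with y hy
      by_cases hyU : y ∈ U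
      · simp only [hB, if_pos hyU, hM _ (not_lt.1 fun h1 => hy ⟨H y, mem_closedBall_zero_iff.2 h1.le, h.right_inv y hyU⟩), h.right_inv y hyU, id]
      · simp only [hB, if_neg hyU, id]
  have hBi : ∀ {M : ℂ ≃ₜ ℂ}, (∀ z, ρ ≤ ‖z‖ → M z = z) → ∀ x, B M.symm (B M x) = x := fun {M} hM x => by
    by_cases hx : x ∈ U
    · have h1 := mem_ball_zero_iff.2 (hlt hM _ (mem_ball_zero_iff.1 (h.maps_inv hx)))
      simp only [hB, if_pos hx, if_pos (h.maps h1), h.left_inv _ h1, M.symm_apply_apply, h.right_inv x hx]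
    · simp only [hB, if_neg hx]
  refine ⟨⟨⟨B M, B M.symm, hBi hM, hBi hMs⟩, hBc hM, hBc hMs⟩, M.subtype hle, fun x hx => if_neg hx,
    fun z hz => Subtype.ext (hM _ (by rw [hz]; exact hρ.le)), fun z => hiff z, hMc, fun z hz => ?_⟩
  have hz' := mem_ball_zero_iff.2 hz
  change B M (G z) = G (M z)
  simp only [hB, if_pos (h.maps hz'), h.left_inv _ hz']

/-- The disc homeomorphism induced by an extension to the prime ends. -/
lemma DiscModel.exists_conj (h : DiscModel U G H) {J : CDisc ≃ₜ PrimeEndComp U}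
    (hJ : ∀ (z : CDisc) (hz : ‖z.1‖ < 1), J z = pePt U ⟨G z, h.maps (mem_ball_zero_iff.2 hz)⟩)
    (hJ1 : ∀ z : CDisc, ‖z.1‖ = 1 → ∃ p, J z = peEnd U p) (hf : f '' U = U)
    {F : PrimeEndComp U ≃ₜ PrimeEndComp U} (hF : IsPEExtension f U F) :
    ∃ Ψ : CDisc ≃ₜ CDisc, (∀ z, J (Ψ z) = F (J z)) ∧ (∀ z, ‖(Ψ z).1‖ < 1 ↔ ‖z.1‖ < 1) ∧
      ∀ z : CDisc, ‖z.1‖ < 1 → G (Ψ z) = f (G z) := by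
  have hΨ : ∀ z, J ((J.trans (F.trans J.symm)) z) = F (J z) := fun z => J.apply_symm_apply _
  have hfU : ∀ x ∈ U, f x ∈ U := fun x hx => hf ▸ mem_image_of_mem f hx
  have h1 : ∀ z : CDisc, ¬ ‖z.1‖ < 1 → ∃ p, J z = peEnd U p := fun z hz => hJ1 z (le_antisymm z.norm_le (not_lt.1 hz))
  have key : ∀ z : CDisc, ‖z.1‖ < 1 → ‖((J.trans (F.trans J.symm)) z : ℂ)‖ < 1 ∧ G ((J.trans (F.trans J.symm)) z) = f (G z) :=
    fun z hz => by
      have h2 := hΨ z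
      rw [hJ z hz, hF _ (h.maps (mem_ball_zero_iff.2 hz)) (hfU _ (h.maps (mem_ball_zero_iff.2 hz)))] at h2
      by_cases h3 : ‖((J.trans (F.trans J.symm)) z : ℂ)‖ < 1
      · rw [hJ _ h3] at h2
        exact ⟨h3, congrArg Subtype.val (Sum.inl.inj h2)⟩
      · have ⟨p, hp⟩ := h1 _ h3
        rw [hp] at h2; exact absurd h2 Sum.inr_ne_inl
  refine ⟨J.trans (F.trans J.symm), hΨ, fun z => ⟨fun hz => ?_, fun hz => (key z hz).1⟩, fun z hz => (key z hz).2⟩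
  by_contra h3
  obtain ⟨x, hx, hxy⟩ : G ((J.trans (F.trans J.symm)) z) ∈ f '' U := hf.symm ▸ (h.maps (mem_ball_zero_iff.2 hz))
  have h4 := hΨ z
  rw [hJ _ hz] at h4
  have ⟨p, hp⟩ := h1 z h3
  have h6 := F.injective (by rw [hF x hx (hfU x hx), ← h4]; simp only [hxy] : F (pePt U ⟨x, hx⟩) = F (J z))
  rw [hp] at h6
  exact Sum.inl_ne_inr h6

/-- Modifying the map away from the frontier makes the disc homeomorphism fix the centre. -/
lemma DiscModel.exists_discMap (h : DiscModel U G H) {Ψ : CDisc ≃ₜ CDisc} (hΨ : ∀ z, ‖(Ψ z).1‖ < 1 ↔ ‖z.1‖ < 1)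
    (hG : ∀ z : CDisc, ‖z.1‖ < 1 → G (Ψ z) = f (G z)) :
    ∃ (b : X ≃ₜ X) (Φ : CDisc ≃ₜ CDisc), (∀ x ∉ U, b x = x) ∧ (∀ x, b x ∈ U ↔ x ∈ U) ∧
      (∀ z : CDisc, ‖z.1‖ = 1 → Φ z = Ψ z) ∧ ∀ f' : X ≃ₜ X, (∀ x ∈ U, f' x = b (f x)) → DiscMap G f' Φ := by
  have ⟨b, μ, hb, hμ1, hμ, hμ0, hbG⟩ := h.exists_transport (c := Ψ ⟨0, by simp⟩) ((hΨ _).2 (by simp))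
  refine ⟨b, Ψ.trans μ, hb, fun x => ⟨fun hx => ?_, fun hx => ?_⟩, fun z hz => hμ1 _ ?_, fun f' hf' => ⟨fun z => (hμ _).trans (hΨ z), fun z hz => ?_, fun z hz => ?_⟩⟩
  · by_contra hxU; rw [hb x hxU] at hx; exact hxU hx
  · by_contra hbx; exact hbx (by rwa [b.injective (hb _ hbx)])
  · exact le_antisymm (CDisc.norm_le _) (not_lt.1 fun h1 => by have := (hΨ z).1 h1; linarith)
  · rw [hf' _ (h.maps (mem_ball_zero_iff.2 hz)), ← hG z hz, hbG _ ((hΨ z).2 hz)]; rfl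
  · rw [show z = ⟨0, by simp⟩ from Subtype.ext hz]; exact hμ0

/-- A circle map on the boundary of the disc, read in a circle coordinate on the prime ends. -/
lemma exists_circle_coord {X : Type*} [TopologicalSpace X] {U : Set X} [T2Space (PrimeEndComp U)] {J : CDisc ≃ₜ PrimeEndComp U}
    (hJ : ∀ z : CDisc, ‖z.1‖ < 1 → ∃ x, J z = pePt U x) (hJ1 : ∀ z : CDisc, ‖z.1‖ = 1 → ∃ p, J z = peEnd U p) :
    ∃ ψ : ↥(PrimeEndCircle U) ≃ₜ 𝕋, ∀ (p : PrimeEnd U) (x : ℝ),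
      ψ ⟨peEnd U p, ⟨p, rfl⟩⟩ = (x : 𝕋) ↔ J (lowDisc x) = peEnd U p := by
  have n1 : ∀ x : ℝ, ‖(lowDisc x : ℂ)‖ = 1 := fun x => by rw [lowDisc_coe (by simp)]; exact norm_ee_eq.2 (by simp)
  set C : ℝ → ↥(PrimeEndCircle U) := fun x => ⟨J (lowDisc x), by obtain ⟨p, hp⟩ := hJ1 _ (n1 x); exact ⟨p, hp.symm⟩⟩ with hC
  have hCc : Continuous C := (J.continuous.comp (continuous_lowDisc.comp continuous_ofReal)).subtype_mk _
  have hCi : ∀ x y, C x = C y ↔ ∃ k : ℤ, y = x + k := fun x y => by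
    rw [hC, Subtype.mk.injEq, J.injective.eq_iff, Subtype.ext_iff, lowDisc_coe (by simp), lowDisc_coe (by simp), ee_eq_iff]
    exact exists_congr fun k => by norm_cast
  have hbij : Function.Bijective (show Function.Periodic C 1 from fun x => ((hCi _ _).2 ⟨1, by simp⟩).symm).lift := by
    constructor
    · intro a b hab
      induction a using QuotientAddGroup.induction_on with | H x => ?_
      induction b using QuotientAddGroup.induction_on with | H y => ?_
      obtain ⟨k, rfl⟩ := (hCi x y).1 hab
      exact (coe_add_intCast x k).symm
    · rintro ⟨q, p, rfl⟩
      have ⟨z, hz⟩ := J.surjective (peEnd U p)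
      have hz1 : ‖z.1‖ = 1 := by
        by_contra h
        have ⟨x, hx⟩ := hJ z (lt_of_le_of_ne z.norm_le h)
        rw [hz] at hx; exact Sum.inr_ne_inl hx
      have ⟨v, hv⟩ := exists_ee (z := z) (norm_ne_zero_iff.1 (by rw [hz1]; exact one_ne_zero))
      have hv0 := norm_ee_eq.1 (by rw [hv, hz1])
      refine ⟨((v.re : ℝ) : 𝕋), Subtype.ext ?_⟩
      change J (lowDisc v.re) = peEnd U p
      rw [show ((v.re : ℝ) : ℂ) = v from Complex.ext rfl (by simp [hv0]), lowDisc_eq hv0.le hv, hz]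
  set T : 𝕋 ≃ₜ ↥(PrimeEndCircle U) :=
    Continuous.homeoOfEquivCompactToT2 (f := Equiv.ofBijective _ hbij) (continuous_coinduced_dom.2 hCc)
  refine ⟨T.symm, fun p x => ?_⟩
  rw [T.symm_apply_eq, Subtype.ext_iff, eq_comm]
  rfl

/-- The lift reflected through the origin. -/
lemma CircleDeg1Lift.exists_reflect (g : CircleDeg1Lift) : ∃ g' : CircleDeg1Lift, (∀ x, g' x = -g (-x)) ∧
    g'.translationNumber = -g.translationNumber := by
  set g' : CircleDeg1Lift := ⟨⟨fun x => -g (-x), fun x y h => neg_le_neg (g.monotone (neg_le_neg h))⟩, fun x => by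
    have := g.map_sub_int (-x) 1
    push_cast at this
    change -g (-(x + 1)) = -g (-x) + 1
    rw [neg_add', this]; ring⟩ with hg'
  have h : ∀ x, g' x = -g (-x) := fun _ => rfl
  have hit : ∀ n : ℕ, ∀ x, (g' ^ n) x = -(g ^ n) (-x) := fun n => by
    induction n with
    | zero => simp
    | succ n ih => intro x; rw [pow_succ, CircleDeg1Lift.mul_apply, ih, h, neg_neg, pow_succ, CircleDeg1Lift.mul_apply]
  refine ⟨g', h, CircleDeg1Lift.translationNumber_eq_of_tendsto₀ _ ?_⟩
  refine g.tendsto_translation_number₀.neg.congr fun n => ?_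
  rw [← CircleDeg1Lift.coe_pow, hit]
  simp [neg_div]

lemma addOrderOf_eq_zero_of_not_rational {α : 𝕋} (h : ¬ IsRationalAC α) : addOrderOf α = 0 := by
  rw [addOrderOf_eq_zero_iff]
  contrapose! h
  induction α using QuotientAddGroup.induction_on with | H a => ?_
  have ⟨q, hq⟩ := AddCircle.isOfFinAddOrder_iff_exists_rat_eq_div.1 h
  exact ⟨q, by rw [hq, div_one]⟩

/-- Walker's conjecture on cobasin boundaries. -/
theorem walker_conjecture (f : SphereTwo ≃ₜ SphereTwo) (hor : IsOrientationPreserving f)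
    (K : Set SphereTwo) (hKcomp : IsCompact K) (hKconn : IsConnected K)
    (hKnt : K.Nontrivial)
    (U₁ U₂ : Set SphereTwo) (hcomps : HasTwoComps Kᶜ U₁ U₂)
    (hinv1 : ⇑f '' U₁ = U₁) (hinv2 : ⇑f '' U₂ = U₂)
    (hbd1 : frontier U₁ = K) (hbd2 : frontier U₂ = K)
    (F₁ : PrimeEndComp U₁ ≃ₜ PrimeEndComp U₁) (hF₁ : IsPEExtension f U₁ F₁)
    (φ : ↥(PrimeEndCircle U₁) ≃ₜ AddCircle (1 : ℝ))
    (α : AddCircle (1 : ℝ)) (hαirr : ¬IsRationalAC α)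
    (hconj : ∀ p : PrimeEnd U₁, ∃ p' : PrimeEnd U₁, F₁ (peEnd U₁ p) = peEnd U₁ p' ∧
      φ ⟨peEnd U₁ p', ⟨p', rfl⟩⟩ = φ ⟨peEnd U₁ p, ⟨p, rfl⟩⟩ + α) :
    ∀ F₂ : PrimeEndComp U₂ ≃ₜ PrimeEndComp U₂, IsPEExtension f U₂ F₂ →
      ∃ (ψ : ↥(PrimeEndCircle U₂) ≃ₜ AddCircle (1 : ℝ)) (G : CircleDeg1Lift), StrictMono ⇑G ∧ Continuous ⇑G ∧
        (∀ (p : PrimeEnd U₂) (x : ℝ), ψ ⟨peEnd U₂ p, ⟨p, rfl⟩⟩ = ((x : ℝ) : AddCircle (1 : ℝ)) →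
          ∃ p' : PrimeEnd U₂, F₂ (peEnd U₂ p) = peEnd U₂ p' ∧
            ψ ⟨peEnd U₂ p', ⟨p', rfl⟩⟩ = ((G x : ℝ) : AddCircle (1 : ℝ))) ∧
        ((G.translationNumber : ℝ) : AddCircle (1 : ℝ)) = α := by
  intro F₂ hF₂
  have := ChartedSpace.locallyConnectedSpace (EuclideanSpace ℝ (Fin 2)) SphereTwo
  have ⟨hU₁, hU₂, hne, hor'⟩ := hcomps
  have ho₁ := hU₁.isOpen hKcomp.isClosed.isOpen_compl
  have ho₂ := hU₂.isOpen hKcomp.isClosed.isOpen_compl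
  have hp₁ := hU₁.isPreconnected
  have hp₂ := hU₂.isPreconnected
  have ⟨p, hp⟩ := hU₁.nonempty
  have ⟨q, hq⟩ := hU₂.nonempty
  have hd : Disjoint U₁ U₂ := by
    refine disjoint_iff_inter_eq_empty.2 (not_nonempty_iff_eq_empty.1 fun hn => hne ?_)
    exact Subset.antisymm (hU₂.subset_of_preconnected hp₁ hU₁.subset hn)
      (hU₁.subset_of_preconnected hp₂ hU₂.subset (by rwa [inter_comm]))
  have hun : ∀ x ∉ K, x ∈ U₁ ∨ x ∈ U₂ := fun x hx =>
    (hor' x hx).imp (fun h => by rw [← h]; exact mem_connectedComponentIn hx) fun h => by rw [← h]; exact mem_connectedComponentIn hx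
  have hun₁ : U₁ᶜ = closure U₂ := by
    rw [closure_eq_self_union_frontier, hbd2]
    refine Subset.antisymm (fun x hx => ?_) (union_subset (fun x hx hx' => disjoint_left.1 hd hx' hx) fun x hx hx' => hU₁.subset hx' hx)
    by_contra hc
    exact (hun x fun h => hc (Or.inr h)).elim hx fun h => hc (Or.inl h)
  have hun₂ : U₂ᶜ = closure U₁ := by
    rw [closure_eq_self_union_frontier, hbd1]
    refine Subset.antisymm (fun x hx => ?_) (union_subset (fun x hx hx' => disjoint_left.1 hd hx hx') fun x hx hx' => hU₂.subset hx' hx)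
    by_contra hc
    exact (hun x fun h => hc (Or.inr h)).elim (fun h => hc (Or.inl h)) hx
  obtain ⟨e₁, e₂, hT, rfl, rfl⟩ := exists_twoCharts (p := p) (q := q) fun e => disjoint_left.1 hd hp (e ▸ hq)
  have ⟨G₁, H₁, A₁, ψ, h₁, hψd, hψ0, hGψ⟩ := hT.exists_side ho₁ ho₂ hp₁ hp₂ hd hun₁ hp hq
  have ⟨G₂, H₂, A₂, _, h₂, _⟩ := hT.symm.exists_side ho₂ ho₁ hp₂ hp₁ hd.symm hun₂ hq hp
  have hc₂ : U₂ᶜ.Nonempty := ⟨_, fun h => disjoint_left.1 hd hp h⟩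
  have ⟨J₁, hJ₁, hJ₁'⟩ := h₁.model.exists_homeo (⟨_, fun h => disjoint_left.1 hd h hq⟩)
  have ⟨J₂, hJ₂, hJ₂'⟩ := h₂.model.exists_homeo hc₂
  have ⟨Ψ₁, hΨ₁, hΨ₁n, hΨ₁G⟩ := h₁.model.exists_conj hJ₁ hJ₁' hinv1 hF₁
  have ⟨Ψ₂, hΨ₂, hΨ₂n, hΨ₂G⟩ := h₂.model.exists_conj hJ₂ hJ₂' hinv2 hF₂
  have ⟨b₁, Φ₁, hb₁, _, hΦ₁, hb₁f⟩ := h₁.model.exists_discMap hΨ₁n hΨ₁G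
  have ⟨b₂, Φ₂, hb₂, hb₂U, hΦ₂, hb₂f⟩ := h₂.model.exists_discMap hΨ₂n hΨ₂G
  have hf₁ := hb₁f (f.trans (b₂.trans b₁)) fun x hx => congrArg b₁
    (hb₂ _ fun h => disjoint_left.1 hd (hinv1 ▸ mem_image_of_mem f hx) h)
  have hf₂ := hb₂f (f.trans (b₂.trans b₁)) fun x hx =>
    hb₁ _ fun h => disjoint_left.1 hd h ((hb₂U _).2 (hinv2 ▸ mem_image_of_mem f hx))
  classical
  have hmem : ∀ z : CDisc, ‖z.1‖ = 1 → J₁ z ∈ PrimeEndCircle U₁ := fun z hz => by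
    have ⟨r, hr⟩ := hJ₁' z hz; exact ⟨r, hr.symm⟩
  set θ : CDisc → AddCircle (1 : ℝ) := fun z => if h : ‖z.1‖ = 1 then φ ⟨J₁ z, hmem z h⟩ else 0
  have hθe : ∀ (z : CDisc) (h : ‖z.1‖ = 1), θ z = φ ⟨J₁ z, hmem z h⟩ := fun z h => dif_pos h
  have hθ : ContinuousOn θ {z | ‖z.1‖ = 1} := by
    rw [continuousOn_iff_continuous_domRestrict]
    refine (φ.continuous.comp ((J₁.continuous.comp continuous_subtype_val).subtype_mk fun z => hmem z.1 z.2)).congr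
      fun z => (hθe z.1 z.2).symm
  have hθi : InjOn θ {z | ‖z.1‖ = 1} := fun z hz w hw e => by
    rw [hθe z hz, hθe w hw] at e
    exact J₁.injective (congrArg Subtype.val (φ.injective e))
  have ⟨g, hgm, hgc, hgΦ, hgτ⟩ := exists_opposite_circle_lift hT h₁ h₂ hψd hψ0 hGψ hd (hbd1.trans hbd2.symm) hf₁ hf₂ hθ hθi
    (addOrderOf_eq_zero_of_not_rational hαirr) fun z hz => by
      have ⟨r, hr⟩ := hJ₁' z hz
      have ⟨r', hr', hφ⟩ := hconj r
      rw [hθe _ (hf₁.norm_eq hz), hθe z hz]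
      have e' : (⟨J₁ z, hmem z hz⟩ : ↥(PrimeEndCircle U₁)) = ⟨peEnd U₁ r, ⟨r, rfl⟩⟩ := Subtype.ext hr
      rw [e', ← hφ]
      exact congrArg φ (Subtype.ext (by rw [hΦ₁ z hz, hΨ₁, hr, hr'] : J₁ (Φ₁ z) = peEnd U₁ r'))
  have := h₂.model.t2Space_primeEndComp hc₂
  have ⟨χ, hχ⟩ := exists_circle_coord (fun z hz => ⟨_, hJ₂ z hz⟩) hJ₂'
  have key : ∀ (r : PrimeEnd U₂) (x : ℝ), χ ⟨peEnd U₂ r, ⟨r, rfl⟩⟩ = (x : AddCircle (1 : ℝ)) →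
      ∃ r', F₂ (peEnd U₂ r) = peEnd U₂ r' ∧ χ ⟨peEnd U₂ r', ⟨r', rfl⟩⟩ = (g x : AddCircle (1 : ℝ)) := fun r x hx => by
    have n1 : ∀ y : ℝ, ‖(lowDisc y : ℂ)‖ = 1 := fun y => by rw [lowDisc_coe (by simp)]; exact norm_ee_eq.2 (by simp)
    have ⟨r', hr'⟩ := hJ₂' _ (n1 (g x))
    exact ⟨r', by rw [← (hχ r x).1 hx, ← hΨ₂, ← hΦ₂ _ (n1 x), hgΦ, hr'], (hχ _ _).2 hr'⟩
  rcases hgτ with hτ | hτ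
  · exact ⟨χ, g, hgm, hgc, key, hτ⟩
  have ⟨g', hg', hτ'⟩ := g.exists_reflect
  refine ⟨χ.trans (Homeomorph.neg _), g', fun x y h => ?_, ?_, fun r x hx => ?_, ?_⟩
  · rw [hg', hg']; exact neg_lt_neg (hgm (neg_lt_neg h))
  · rw [show ⇑g' = fun x => -g (-x) from funext hg']; fun_prop
  · have ⟨r', h1, h2⟩ := key r (-x) (by rw [AddCircle.coe_neg]; exact neg_eq_iff_eq_neg.1 hx)
    refine ⟨r', h1, ?_⟩
    rw [hg', AddCircle.coe_neg, ← h2]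
    rfl
  · rw [hτ', AddCircle.coe_neg, hτ, neg_neg]

end
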